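/- For any convex polytope P ⊆ ℝ^d, any face F of P, and any framework Φ_P for P, g_2(P,F) = dim_ℝ (S(Φ_P)/S(Φ_N)), where Φ_N is the subframework of Φ_P consisting of all vertices and edges of Φ_P contained in N(P,F), and S(Φ_N) is embedded in S(Φ_P) by extension by zero. -/

import Mathlib

open Polynomial
open scoped Classical

noncomputable section

/-- `P ⊆ ℝ^d` is a (convex) polytope: the convex hull of a finite set of points. -/
def IsPolytope {d : ℕ} (P : Set (Fin d → ℝ)) : Prop :=
  ∃ S : Finset (Fin d → ℝ), P = convexHull ℝ (S : Set (Fin d → ℝ))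

/-- `F` is a face of `P`: the empty set, `P` itself, or the intersection of `P`
with a supporting hyperplane. -/
def IsFace {d : ℕ} (P F : Set (Fin d → ℝ)) : Prop :=
  F = ∅ ∨ F = P ∨ ∃ (f : (Fin d → ℝ) →ₗ[ℝ] ℝ) (c : ℝ),
    (∀ x ∈ P, f x ≤ c) ∧ F = {x ∈ P | f x = c}

/-- Affine dimension of a subset of `ℝ^d`, with `pdim ∅ = -1`. -/
def pdim {d : ℕ} (P : Set (Fin d → ℝ)) : ℤ :=
  if P = ∅ then -1 else (Module.finrank ℝ (affineSpan ℝ P).direction : ℤ)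

/-- The pair of functions `g`, `h` satisfies the defining recursion of the
`g`- and `h`-polynomials of polytopes. -/
def IsGH {d : ℕ} (g h : Set (Fin d → ℝ) → Polynomial ℤ) : Prop :=
  g ∅ = 1 ∧
  (∀ P : Set (Fin d → ℝ), IsPolytope P →
      h P = ∑ᶠ F ∈ {F : Set (Fin d → ℝ) | IsFace P F ∧ F ≠ P},
        (X - 1 : Polynomial ℤ) ^ (pdim P - pdim F - 1).toNat * g F) ∧
  (∀ P : Set (Fin d → ℝ), IsPolytope P → P ≠ ∅ →
      (g P).coeff 0 = (h P).coeff 0 ∧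
      (∀ i : ℕ, 0 < i → 2 * (i : ℤ) ≤ pdim P →
        (g P).coeff i = (h P).coeff i - (h P).coeff (i - 1)) ∧
      (∀ i : ℕ, 0 < i → ¬(2 * (i : ℤ) ≤ pdim P) → (g P).coeff i = 0))

/-- `Q` is (a combinatorial model of) the quotient polytope `P/E`, with `ψ` an
explicit isomorphism from the interval `[E, P]` in the face poset of `P` to the
face poset of `Q`. -/
def IsQuotientPair {d : ℕ} (P E Q : Set (Fin d → ℝ))
    (ψ : Set (Fin d → ℝ) → Set (Fin d → ℝ)) : Prop :=
  IsPolytope Q ∧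
  Set.BijOn ψ {G : Set (Fin d → ℝ) | IsFace P G ∧ E ⊆ G} {G : Set (Fin d → ℝ) | IsFace Q G} ∧
  ∀ G₁ ∈ {G : Set (Fin d → ℝ) | IsFace P G ∧ E ⊆ G},
    ∀ G₂ ∈ {G : Set (Fin d → ℝ) | IsFace P G ∧ E ⊆ G}, (G₁ ⊆ G₂ ↔ ψ G₁ ⊆ ψ G₂)

/-- The family `gr` of relative `g`-polynomials satisfies the defining relation
`∑_{F ≤ E ≤ P} g(E,F) g(P/E) = g(P)` (where `g(P/P) = 1`, the quotient by `P`
itself being the empty polytope). -/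
def IsRelG {d : ℕ} (g : Set (Fin d → ℝ) → Polynomial ℤ)
    (gr : Set (Fin d → ℝ) → Set (Fin d → ℝ) → Polynomial ℤ) : Prop :=
  ∀ (P F : Set (Fin d → ℝ)) (Q : Set (Fin d → ℝ) → Set (Fin d → ℝ))
    (ψ : Set (Fin d → ℝ) → Set (Fin d → ℝ) → Set (Fin d → ℝ)),
    IsPolytope P → IsFace P F →
    (∀ E, IsFace P E → F ⊆ E → IsQuotientPair P E (Q E) (ψ E)) →
    (∑ᶠ E ∈ {E : Set (Fin d → ℝ) | IsFace P E ∧ F ⊆ E}, gr E F * g (Q E)) = g P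

/-- A rational polytope: the convex hull of finitely many points with rational
coordinates. -/
def IsRationalPolytope {d : ℕ} (P : Set (Fin d → ℝ)) : Prop :=
  ∃ S : Finset (Fin d → ℝ), (∀ v ∈ S, ∀ i : Fin d, ∃ q : ℚ, v i = (q : ℝ)) ∧
    P = convexHull ℝ (S : Set (Fin d → ℝ))

/-- For a fixed `v`, the map `w ↦ {v, w}` is injective. -/
lemma pair_left_injective {α : Type*} (v : α) :
    Function.Injective (fun w => ({v, w} : Set α)) := by
  intro w w' h
  simp only [Set.ext_iff, Set.mem_insert_iff, Set.mem_singleton_iff] at h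
  rcases (h w).mp (Or.inr rfl) with h1 | h1
  · rcases (h w').mpr (Or.inr rfl) with h2 | h2
    · rw [h1, h2]
    · exact h2.symm
  · exact h1

/-- The space of stresses of the framework with edge set `Ed` (edges are two-element
sets of points of `ℝ^d`): assignments of a scalar to each edge such that the total
force at each vertex vanishes.  This is the kernel of the map
`α : ℝ^E → ℝ^V ⊗ ℝ^d`, `α(1_e) = 1_{v₁} ⊗ (v₁ − v₂) + 1_{v₂} ⊗ (v₂ − v₁)`. -/
def Stress {d : ℕ} (Ed : Set (Set (Fin d → ℝ))) : Submodule ℝ (Set (Fin d → ℝ) → ℝ) where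
  carrier := {s | (Function.support s).Finite ∧ Function.support s ⊆ Ed ∧
    ∀ v : Fin d → ℝ, (∑ᶠ w : Fin d → ℝ, s {v, w} • (v - w)) = 0}
  zero_mem' := ⟨by simp, by simp, by simp⟩
  add_mem' := by
    rintro s t ⟨hs1, hs2, hs3⟩ ⟨ht1, ht2, ht3⟩
    have hsupp : Function.support (s + t) ⊆ Function.support s ∪ Function.support t :=
      Function.support_add s t
    refine ⟨(hs1.union ht1).subset hsupp, hsupp.trans (Set.union_subset hs2 ht2), ?_⟩
    intro v
    have hfs : (Function.support fun w => s {v, w} • (v - w)).Finite := by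
      refine Set.Finite.subset (hs1.preimage (Set.injOn_of_injective (pair_left_injective v))) ?_
      intro w hw
      simp only [Function.mem_support] at hw
      simp only [Set.mem_preimage, Function.mem_support]
      intro h0; exact hw (by rw [h0, zero_smul])
    have hft : (Function.support fun w => t {v, w} • (v - w)).Finite := by
      refine Set.Finite.subset (ht1.preimage (Set.injOn_of_injective (pair_left_injective v))) ?_
      intro w hw
      simp only [Function.mem_support] at hw
      simp only [Set.mem_preimage, Function.mem_support]
      intro h0; exact hw (by rw [h0, zero_smul])
    have : (∑ᶠ w : Fin d → ℝ, (s + t) {v, w} • (v - w)) =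
        ∑ᶠ w : Fin d → ℝ, (s {v, w} • (v - w) + t {v, w} • (v - w)) := by
      congr 1; funext w; simp [add_smul]
    rw [this, finsum_add_distrib hfs hft, hs3 v, ht3 v, add_zero]
  smul_mem' := by
    intro c s ⟨hs1, hs2, hs3⟩
    have hsupp : Function.support (c • s) ⊆ Function.support s := by
      intro x hx
      simp only [Function.mem_support, Pi.smul_apply, smul_eq_mul] at hx ⊢
      intro h0; exact hx (by rw [h0, mul_zero])
    refine ⟨hs1.subset hsupp, hsupp.trans hs2, ?_⟩
    intro v
    have : (∑ᶠ w : Fin d → ℝ, (c • s) {v, w} • (v - w)) =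
        c • ∑ᶠ w : Fin d → ℝ, s {v, w} • (v - w) := by
      rw [smul_finsum]
      congr 1; funext w; simp [smul_smul]
    rw [this, hs3 v, smul_zero]

/-- The edges in `Ed` contained in `G` triangulate the two-dimensional polytope `G`. -/
def Triangulates {d : ℕ} (Ed : Set (Set (Fin d → ℝ))) (G : Set (Fin d → ℝ)) : Prop :=
  ∃ T : Finset (Finset (Fin d → ℝ)),
    (∀ t ∈ T, t.card = 3 ∧
      AffineIndependent ℝ (fun x : ↥(t : Set (Fin d → ℝ)) => (x : Fin d → ℝ)) ∧
      convexHull ℝ (t : Set (Fin d → ℝ)) ⊆ G ∧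
      ∀ v ∈ t, ∀ w ∈ t, v ≠ w → ({v, w} : Set (Fin d → ℝ)) ∈ Ed) ∧
    (⋃ t ∈ T, convexHull ℝ (t : Set (Fin d → ℝ))) = G ∧
    (∀ t₁ ∈ T, ∀ t₂ ∈ T, convexHull ℝ (t₁ : Set (Fin d → ℝ)) ∩ convexHull ℝ (t₂ : Set (Fin d → ℝ)) =
      convexHull ℝ ((t₁ : Set (Fin d → ℝ)) ∩ (t₂ : Set (Fin d → ℝ)))) ∧
    (∀ e ∈ Ed, e ⊆ G → ∃ t ∈ T, e ⊆ (t : Set (Fin d → ℝ)))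

/-- `Ed` is the edge set of a framework `Φ_P` for the polytope `P`: its edges are the
edges of `P` together with additional segments between vertices of `P`, each lying in
a `2`-face, so that every `2`-face of `P` is triangulated. -/
def IsFrameworkFor {d : ℕ} (P : Set (Fin d → ℝ)) (Ed : Set (Set (Fin d → ℝ))) : Prop :=
  Ed.Finite ∧
  (∀ e ∈ Ed, ∃ v w : Fin d → ℝ, v ≠ w ∧ e = {v, w} ∧ IsFace P {v} ∧ IsFace P {w} ∧
    (IsFace P (segment ℝ v w) ∨
      ∃ G, IsFace P G ∧ pdim G = 2 ∧ segment ℝ v w ⊆ G)) ∧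
  (∀ G, IsFace P G → pdim G = 1 →
    ∃ v w : Fin d → ℝ, G = segment ℝ v w ∧ ({v, w} : Set (Fin d → ℝ)) ∈ Ed) ∧
  (∀ G, IsFace P G → pdim G = 2 → Triangulates Ed G)

/-- `N(P,F)`: the union of all facets of `P` containing the face `F`. -/
def NPF {d : ℕ} (P F : Set (Fin d → ℝ)) : Set (Fin d → ℝ) :=
  ⋃₀ {G : Set (Fin d → ℝ) | IsFace P G ∧ pdim G = pdim P - 1 ∧ F ⊆ G}

section PartA
set_option linter.unusedSectionVars false
variable {ι W W' : Type*} [DecidableEq ι] [AddCommGroup W] [Module ℝ W] [AddCommGroup W'] [Module ℝ W']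

/-- `T` is a face of the vector configuration `(p i)_{i ∈ S}`. -/
def Fc (p : ι → W) (S T : Finset ι) : Prop :=
  T ⊆ S ∧ ∃ f : W →ₗ[ℝ] ℝ, (∀ i ∈ S, 0 ≤ f (p i)) ∧ ∀ i ∈ S, (f (p i) = 0 ↔ i ∈ T)

/-- The configuration is pointed. -/
def PosC (p : ι → W) (S : Finset ι) : Prop := ∃ f : W →ₗ[ℝ] ℝ, ∀ i ∈ S, 0 < f (p i)

/-- Span of a subconfiguration. -/
def sp (p : ι → W) (T : Finset ι) : Submodule ℝ W := Submodule.span ℝ (p '' (T : Set ι))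

/-- Rank of a subconfiguration. -/
def rk (p : ι → W) (T : Finset ι) : ℕ := Module.finrank ℝ (sp p T)

instance sp_fd (p : ι → W) (T : Finset ι) : FiniteDimensional ℝ (sp p T) :=
  FiniteDimensional.span_of_finite ℝ (T.finite_toSet.image p)

lemma mem_sp {p : ι → W} {T : Finset ι} {i : ι} (h : i ∈ T) : p i ∈ sp p T :=
  Submodule.subset_span ⟨i, h, rfl⟩

lemma sp_mono {p : ι → W} {T U : Finset ι} (h : T ⊆ U) : sp p T ≤ sp p U :=
  Submodule.span_mono (Set.image_mono (by exact_mod_cast h))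

lemma sp_union {p : ι → W} {T U : Finset ι} : sp p (T ∪ U) = sp p T ⊔ sp p U := by
  unfold sp; rw [Finset.coe_union, Set.image_union, Submodule.span_union]

lemma sp_le {p : ι → W} {T : Finset ι} {K : Submodule ℝ W} : sp p T ≤ K ↔ ∀ i ∈ T, p i ∈ K := by
  unfold sp; rw [Submodule.span_le]
  constructor
  · intro h i hi; exact h ⟨i, hi, rfl⟩
  · rintro h _ ⟨i, hi, rfl⟩; exact h i hi

lemma zero_on_sp {p : ι → W} {T : Finset ι} {f : W →ₗ[ℝ] ℝ} (h : ∀ i ∈ T, f (p i) = 0)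
    {x : W} (hx : x ∈ sp p T) : f x = 0 := by
  have : sp p T ≤ LinearMap.ker f := sp_le.2 (fun i hi => by simpa using h i hi)
  simpa using this hx

lemma eq_on_sp {p : ι → W} {T : Finset ι} {f g : W →ₗ[ℝ] W'} (h : ∀ i ∈ T, f (p i) = g (p i))
    {x : W} (hx : x ∈ sp p T) : f x = g x := by
  have : sp p T ≤ LinearMap.ker (f - g) := sp_le.2 (fun i hi => by simp [h i hi])
  have := this hx
  simpa [sub_eq_zero] using this

lemma rk_mono {p : ι → W} {T U : Finset ι} (h : T ⊆ U) : rk p T ≤ rk p U :=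
  Submodule.finrank_mono (sp_mono h)

lemma rk_empty (p : ι → W) : rk p ∅ = 0 := by
  unfold rk sp; rw [Finset.coe_empty, Set.image_empty, Submodule.span_empty]; exact finrank_bot ℝ W

lemma Fc.refl (p : ι → W) (S : Finset ι) : Fc p S S :=
  ⟨Finset.Subset.refl _, 0, by simp, by simp⟩

lemma Fc.empty {p : ι → W} {S : Finset ι} (h : PosC p S) : Fc p S ∅ := by
  obtain ⟨f, hf⟩ := h
  exact ⟨by simp, f, fun i hi => (hf i hi).le, fun i hi => by simp [(hf i hi).ne']⟩

lemma Fc.sub {p : ι → W} {S T : Finset ι} (h : Fc p S T) : T ⊆ S := h.1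

lemma Fc.inter {p : ι → W} {S T U : Finset ι} (hT : Fc p S T) (hU : Fc p S U) : Fc p S (T ∩ U) := by
  obtain ⟨hTS, f, hf, hf'⟩ := hT
  obtain ⟨hUS, g, hg, hg'⟩ := hU
  refine ⟨Finset.inter_subset_left.trans hTS, f + g, fun i hi => ?_, fun i hi => ?_⟩
  · simpa using add_nonneg (hf i hi) (hg i hi)
  · rw [Finset.mem_inter, ← hf' i hi, ← hg' i hi, LinearMap.add_apply]
    have := hf i hi; have := hg i hi
    constructor
    · intro h; constructor <;> linarith
    · rintro ⟨h1, h2⟩; linarith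

lemma PosC.mono {p : ι → W} {S T : Finset ι} (h : PosC p S) (hT : T ⊆ S) : PosC p T := by
  obtain ⟨f, hf⟩ := h; exact ⟨f, fun i hi => hf i (hT hi)⟩

lemma Fc.restrict {p : ι → W} {S T U : Finset ι} (hU : Fc p S U) (hT : T ⊆ S) : Fc p T (U ∩ T) := by
  obtain ⟨hUS, g, hg, hg'⟩ := hU
  refine ⟨Finset.inter_subset_right, g, fun i hi => hg i (hT hi), fun i hi => ?_⟩
  rw [hg' i (hT hi)]; simp [hi]

lemma Fc.restrict' {p : ι → W} {S T U : Finset ι} (hU : Fc p S U) (hT : T ⊆ S) (hUT : U ⊆ T) :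
    Fc p T U := by
  have := hU.restrict hT
  rwa [Finset.inter_eq_left.2 hUT] at this

/-- uniform domination on a finite set -/
lemma exists_big (S : Finset ι) (a b : ι → ℝ) (hb : ∀ i ∈ S, 0 ≤ b i) :
    ∃ N : ℝ, 0 < N ∧ ∀ i ∈ S, 0 < b i → 0 < a i + N * b i := by
  induction S using Finset.induction_on with
  | empty => exact ⟨1, by norm_num, by simp⟩
  | insert j S hj ih =>
    obtain ⟨N, hN, h⟩ := ih (fun i hi => hb i (Finset.mem_insert_of_mem hi))
    by_cases hbj : 0 < b j
    · refine ⟨N + (|a j| + 1) / b j, by positivity, fun i hi hbi => ?_⟩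
      rcases Finset.mem_insert.1 hi with rfl | hi
      · have : (|a i| + 1) / b i * b i = |a i| + 1 := by field_simp
        have h2 := neg_abs_le (a i)
        have h3 : 0 < N * b i := by positivity
        nlinarith
      · have h1 := h i hi hbi
        have : 0 ≤ (|a j| + 1) / b j * b i := by positivity
        nlinarith
    · refine ⟨N, hN, fun i hi hbi => ?_⟩
      rcases Finset.mem_insert.1 hi with rfl | hi
      · exact absurd hbi hbj
      · exact h i hi hbi

lemma Fc.trans {p : ι → W} {S T U : Finset ι} (hT : Fc p S T) (hU : Fc p T U) : Fc p S U := by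
  obtain ⟨hTS, f, hf, hf'⟩ := hT
  obtain ⟨hUT, g, hg, hg'⟩ := hU
  obtain ⟨N, hN, h⟩ := exists_big S (fun i => g (p i)) (fun i => f (p i)) hf
  have key : ∀ i ∈ S, 0 ≤ (g + N • f) (p i) ∧ ((g + N • f) (p i) = 0 ↔ i ∈ U) := by
    intro i hi
    by_cases hiT : i ∈ T
    · have h0 := (hf' i hi).2 hiT
      simp only [LinearMap.add_apply, LinearMap.smul_apply, h0, smul_zero, add_zero]
      exact ⟨hg i hiT, hg' i hiT⟩
    · have h0 : 0 < f (p i) := lt_of_le_of_ne (hf i hi) (fun h => hiT ((hf' i hi).1 h.symm))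
      have h1 := h i hi h0
      simp only [LinearMap.add_apply, LinearMap.smul_apply, smul_eq_mul]
      refine ⟨h1.le, ?_⟩
      constructor
      · intro h2; exact absurd h2 h1.ne'
      · intro h2; exact absurd (hUT h2) hiT
  exact ⟨hUT.trans hTS, g + N • f, fun i hi => (key i hi).1, fun i hi => (key i hi).2⟩

lemma Fc.mem_of_sp {p : ι → W} {S T : Finset ι} (hT : Fc p S T) {i : ι} (hi : i ∈ S)
    (h : p i ∈ sp p T) : i ∈ T := by
  obtain ⟨hTS, f, hf, hf'⟩ := hT
  exact (hf' i hi).1 (zero_on_sp (fun j hj => (hf' j (hTS hj)).2 hj) h)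

lemma Fc.eq_of_rk {p : ι → W} {S T U : Finset ι} (hU : Fc p S U) (hT : T ⊆ S) (hUT : U ⊆ T)
    (h : rk p T ≤ rk p U) : U = T := by
  have : sp p U = sp p T := Submodule.eq_of_le_of_finrank_le (sp_mono hUT) h
  apply Finset.Subset.antisymm hUT
  intro i hi
  exact hU.mem_of_sp (hT hi) (this ▸ mem_sp hi)

lemma Fc.rk_lt {p : ι → W} {S T U : Finset ι} (hU : Fc p S U) (hT : T ⊆ S) (hUT : U ⊆ T)
    (h : U ≠ T) : rk p U < rk p T := by
  by_contra h'
  exact h (hU.eq_of_rk hT hUT (not_lt.1 h'))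

/-- Two faces with the same span coincide. -/
lemma Fc.subset_of_sp {p : ι → W} {S T U : Finset ι} (hU : Fc p S U) (hT : T ⊆ S)
    (h : sp p T ≤ sp p U) : T ⊆ U := fun _ hi => hU.mem_of_sp (hT hi) (h (mem_sp hi))

/-- Faces under an injective linear map. -/
lemma fc_comp {p : ι → W} {S T : Finset ι} (L : W →ₗ[ℝ] W') (hL : Function.Injective L) :
    Fc (fun i => L (p i)) S T ↔ Fc p S T := by
  constructor
  · rintro ⟨h, f, h1, h2⟩
    exact ⟨h, f ∘ₗ L, h1, h2⟩
  · rintro ⟨h, f, h1, h2⟩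
    obtain ⟨M, hM⟩ := L.exists_leftInverse_of_injective (LinearMap.ker_eq_bot.2 hL)
    have e : ∀ x, M (L x) = x := fun x => LinearMap.congr_fun hM x
    exact ⟨h, f ∘ₗ M, by simpa [e] using h1, by simpa [e] using h2⟩

lemma pos_comp {p : ι → W} {S : Finset ι} (L : W →ₗ[ℝ] W') (hL : Function.Injective L) :
    PosC (fun i => L (p i)) S ↔ PosC p S := by
  constructor
  · rintro ⟨f, h1⟩
    exact ⟨f ∘ₗ L, h1⟩
  · rintro ⟨f, h1⟩
    obtain ⟨M, hM⟩ := L.exists_leftInverse_of_injective (LinearMap.ker_eq_bot.2 hL)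
    have e : ∀ x, M (L x) = x := fun x => LinearMap.congr_fun hM x
    exact ⟨f ∘ₗ M, by simpa [e] using h1⟩

lemma sp_comp {p : ι → W} {T : Finset ι} (L : W →ₗ[ℝ] W') :
    sp (fun i => L (p i)) T = (sp p T).map L := by
  unfold sp; rw [Submodule.map_span, ← Set.image_comp]; rfl

lemma rk_comp {p : ι → W} {T : Finset ι} (L : W →ₗ[ℝ] W') (hL : Function.Injective L) :
    rk (fun i => L (p i)) T = rk p T := by
  unfold rk; rw [sp_comp]
  exact (Submodule.equivMapOfInjective L hL _).finrank_eq.symm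

/-- Faces under positive rescaling (and congruence). -/
lemma fc_scale {p q : ι → W} {S T : Finset ι} (c : ι → ℝ) (hc : ∀ i ∈ S, 0 < c i)
    (h : ∀ i ∈ S, q i = c i • p i) : Fc q S T ↔ Fc p S T := by
  unfold Fc
  refine and_congr_right fun _ => exists_congr fun f => and_congr ?_ ?_
  · refine forall₂_congr fun i hi => ?_
    rw [h i hi, map_smul, smul_eq_mul, mul_nonneg_iff_of_pos_left (hc i hi)]
  · refine forall₂_congr fun i hi => ?_
    rw [h i hi, map_smul, smul_eq_mul, mul_eq_zero, or_iff_right (hc i hi).ne']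

lemma sp_scale {p q : ι → W} {T : Finset ι} (c : ι → ℝ) (hc : ∀ i ∈ T, 0 < c i)
    (h : ∀ i ∈ T, q i = c i • p i) : sp q T = sp p T := by
  apply le_antisymm
  · rw [sp_le]; intro i hi; rw [h i hi]; exact Submodule.smul_mem _ _ (mem_sp hi)
  · rw [sp_le]; intro i hi
    have : p i = (c i)⁻¹ • q i := by rw [h i hi, smul_smul, inv_mul_cancel₀ (hc i hi).ne', one_smul]
    rw [this]; exact Submodule.smul_mem _ _ (mem_sp hi)

lemma rk_scale {p q : ι → W} {T : Finset ι} (c : ι → ℝ) (hc : ∀ i ∈ T, 0 < c i)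
    (h : ∀ i ∈ T, q i = c i • p i) : rk q T = rk p T := by
  unfold rk; rw [sp_scale c hc h]

lemma fc_congr {p q : ι → W} {S T : Finset ι} (h : ∀ i ∈ S, q i = p i) : Fc q S T ↔ Fc p S T :=
  fc_scale (fun _ => 1) (by simp) (by simpa using h)

/-- The quotient configuration. -/
def Qp (p : ι → W) (T : Finset ι) : ι → W ⧸ sp p T := fun i => (sp p T).mkQ (p i)

lemma fc_quot {p : ι → W} {S T U : Finset ι} (hT : Fc p S T) (hU : U ⊆ S \ T) :
    Fc (Qp p T) (S \ T) U ↔ Fc p S (T ∪ U) := by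
  have hTS := hT.1
  constructor
  · rintro ⟨h, f, h1, h2⟩
    refine ⟨Finset.union_subset hTS (h.trans Finset.sdiff_subset), f ∘ₗ (sp p T).mkQ, ?_, ?_⟩
    · intro i hi
      by_cases hiT : i ∈ T
      · have : (sp p T).mkQ (p i) = 0 := by simpa using mem_sp hiT
        simp only [LinearMap.comp_apply, this, map_zero, le_refl]
      · exact h1 i (by simp [hi, hiT])
    · intro i hi
      by_cases hiT : i ∈ T
      · have : (sp p T).mkQ (p i) = 0 := by simpa using mem_sp hiT
        simp only [LinearMap.comp_apply, this, map_zero, true_iff]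
        simp [hiT]
      · have := h2 i (by simp [hi, hiT])
        simp only [LinearMap.comp_apply]
        rw [show (sp p T).mkQ (p i) = Qp p T i from rfl, this]; simp [hiT]
  · rintro ⟨h, f, h1, h2⟩
    have hk : sp p T ≤ LinearMap.ker f := sp_le.2 fun i hi => by
      simpa using (h2 i (hTS hi)).2 (by simp [hi])
    refine ⟨hU, (sp p T).liftQ f hk, ?_, ?_⟩
    · intro i hi
      have := h1 i (Finset.sdiff_subset hi)
      simpa [Qp] using this
    · intro i hi
      have h3 := h2 i (Finset.sdiff_subset hi)
      have : (sp p T).liftQ f hk (Qp p T i) = f (p i) := by simp [Qp]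
      rw [this, h3]
      have hiT := (Finset.mem_sdiff.1 hi).2
      simp [hiT]

lemma sp_quot (p : ι → W) (T U : Finset ι) : sp (Qp p T) U = (sp p U).map (sp p T).mkQ :=
  sp_comp (p := p) (T := U) (sp p T).mkQ

lemma rk_quot (p : ι → W) (T U : Finset ι) : rk (Qp p T) U + rk p T = rk p (T ∪ U) := by
  unfold rk
  rw [sp_quot, sp_union]
  have h1 : (sp p U).map (sp p T).mkQ = (sp p T ⊔ sp p U).map (sp p T).mkQ := by
    rw [Submodule.map_sup]
    have : (sp p T).map (sp p T).mkQ = ⊥ := by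
      rw [eq_bot_iff, Submodule.map_le_iff_le_comap, Submodule.comap_bot, Submodule.ker_mkQ]
    rw [this, bot_sup_eq]
  rw [h1]
  set A := sp p T ⊔ sp p U with hA
  have hTA : sp p T ≤ A := le_sup_left
  have := LinearMap.finrank_range_add_finrank_ker ((sp p T).mkQ.domRestrict A)
  rw [LinearMap.range_domRestrict, LinearMap.ker_domRestrict, Submodule.ker_mkQ] at this
  rw [← this]
  congr 1
  exact (Submodule.comapSubtypeEquivOfLe hTA).finrank_eq.symm

lemma pos_quot {p : ι → W} {S T : Finset ι} (hT : Fc p S T) : PosC (Qp p T) (S \ T) := by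
  obtain ⟨hTS, f, h1, h2⟩ := hT
  have hk : sp p T ≤ LinearMap.ker f := sp_le.2 fun i hi => by
      simpa using (h2 i (hTS hi)).2 (by simp [hi])
  refine ⟨(sp p T).liftQ f hk, fun i hi => ?_⟩
  have hi' := Finset.mem_sdiff.1 hi
  have : (sp p T).liftQ f hk (Qp p T i) = f (p i) := by simp [Qp]
  rw [this]
  exact lt_of_le_of_ne (h1 i hi'.1) (fun h => hi'.2 ((h2 i hi'.1).1 h.symm))

/-- argmin faces -/
lemma exists_argmin {p : ι → W} {S : Finset ι} (f0 : W →ₗ[ℝ] ℝ) (h0 : ∀ i ∈ S, 0 < f0 (p i))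
    (g : W →ₗ[ℝ] ℝ) (hS : S.Nonempty) :
    ∃ (c : ℝ) (T : Finset ι), T.Nonempty ∧ Fc p S T ∧ (∀ i ∈ S, c * f0 (p i) ≤ g (p i)) ∧
      ∀ i ∈ S, (i ∈ T ↔ g (p i) = c * f0 (p i)) := by
  obtain ⟨j, hj, hmin⟩ := S.exists_min_image (fun i => g (p i) / f0 (p i)) hS
  set c := g (p j) / f0 (p j) with hc
  have hle : ∀ i ∈ S, c * f0 (p i) ≤ g (p i) := fun i hi => by
    have := hmin i hi
    rwa [le_div_iff₀ (h0 i hi)] at this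
  refine ⟨c, S.filter (fun i => g (p i) = c * f0 (p i)), ⟨j, ?_⟩, ⟨Finset.filter_subset _ _, g - c • f0, ?_, ?_⟩, hle, ?_⟩
  · simp only [Finset.mem_filter, hj, true_and, hc]
    have := (h0 j hj).ne'
    field_simp
  · intro i hi; simpa using hle i hi
  · intro i hi; simp [hi, sub_eq_zero]
  · intro i hi; simp [hi]

lemma rk_pos_of_mem {p : ι → W} {S : Finset ι} (hP : PosC p S) {T : Finset ι} (hT : T ⊆ S)
    (h : T.Nonempty) : 0 < rk p T := by
  obtain ⟨i, hi⟩ := h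
  have := (Fc.empty hP).rk_lt hT (Finset.empty_subset T) (by rintro rfl; simp at hi)
  omega

/-- Every nonempty pointed configuration has a rank one face. -/
lemma exists_atom {p : ι → W} {S : Finset ι} (hP : PosC p S) (hS : S.Nonempty) :
    ∃ T, Fc p S T ∧ T.Nonempty ∧ rk p T = 1 := by
  obtain ⟨T, hT, hmin⟩ := (S.powerset.filter (fun T => Fc p S T ∧ T.Nonempty)).exists_min_image
    Finset.card ⟨S, by simp [Fc.refl, hS]⟩
  simp only [Finset.mem_filter, Finset.mem_powerset, and_imp] at hT hmin
  obtain ⟨hTS, hTf, hTn⟩ := hT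
  refine ⟨T, hTf, hTn, ?_⟩
  obtain ⟨f0, hf0⟩ := hP
  have hf0T : ∀ i ∈ T, 0 < f0 (p i) := fun i hi => hf0 i (hTS hi)
  obtain ⟨i, hi⟩ := hTn
  have key : ∀ j ∈ T, p j ∈ Submodule.span ℝ {p i} := by
    intro j hj
    by_contra hcon
    obtain ⟨g, hg1, hg2⟩ := Submodule.exists_le_ker_of_notMem hcon
    obtain ⟨c, U, hUn, hU, hUle, hUm⟩ := exists_argmin f0 hf0T g ⟨i, hi⟩
    have hUS := hTf.trans hU
    have hc := hmin U hUS.1 hUS hUn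
    have hUT : U = T := Finset.eq_of_subset_of_card_le hU.1 hc
    have hgi : g (p i) = 0 := by
      have := hg2 (Submodule.mem_span_singleton_self (p i)); simpa using this
    have h1 := (hUm i hi).1 (hUT ▸ hi)
    have h2 := (hUm j hj).1 (hUT ▸ hj)
    rw [hgi] at h1
    have : c = 0 := by
      rcases mul_eq_zero.1 h1.symm with h | h
      · exact h
      · exact absurd h (hf0T i hi).ne'
    rw [this, zero_mul] at h2
    exact hg1 h2
  have : sp p T = Submodule.span ℝ {p i} := by
    apply le_antisymm
    · exact sp_le.2 key
    · rw [Submodule.span_singleton_le_iff_mem]; exact mem_sp hi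
  unfold rk; rw [this]
  apply finrank_span_singleton
  intro h; have := hf0T i hi; rw [h] at this; simp at this

/-- atoms generate -/
lemma nonneg_of_atoms {p : ι → W} {S : Finset ι} (hP : PosC p S) (g : W →ₗ[ℝ] ℝ)
    (h : ∀ T, Fc p S T → rk p T = 1 → ∃ i ∈ T, 0 ≤ g (p i)) : ∀ i ∈ S, 0 ≤ g (p i) := by
  intro i hi
  have hP' := hP
  obtain ⟨f0, hf0⟩ := hP
  obtain ⟨c, U, hUn, hU, hUle, hUm⟩ := exists_argmin f0 hf0 g ⟨i, hi⟩
  obtain ⟨T, hT, hTn, hT1⟩ := exists_atom (hP'.mono hU.1) hUn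
  obtain ⟨j, hj, hjp⟩ := h T (hU.trans hT) hT1
  have hjS := hU.1 (hT.1 hj)
  have h1 := (hUm j hjS).1 (hT.1 hj)
  have h2 := hUle i hi
  have h3 := hf0 i hi
  have h4 := hf0 j hjS
  have : 0 ≤ c := by
    by_contra hc
    push Not at hc
    nlinarith
  nlinarith

lemma zero_of_atoms {p : ι → W} {S : Finset ι} (hP : PosC p S) (g : W →ₗ[ℝ] ℝ)
    (h : ∀ T, Fc p S T → rk p T = 1 → ∃ i ∈ T, g (p i) = 0) : ∀ i ∈ S, g (p i) = 0 := by
  intro i hi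
  have h1 := nonneg_of_atoms hP g (fun T hT h1 => by
    obtain ⟨j, hj, e⟩ := h T hT h1; exact ⟨j, hj, e.ge⟩) i hi
  have h2 := nonneg_of_atoms hP (-g) (fun T hT h1 => by
    obtain ⟨j, hj, e⟩ := h T hT h1; exact ⟨j, hj, by simp [e]⟩) i hi
  simp at h2; linarith

/-- covers exist -/
lemma exists_cover {p : ι → W} {S T : Finset ι} (hT : Fc p S T) (hne : T ≠ S) :
    ∃ R, Fc p S R ∧ T ⊆ R ∧ rk p R = rk p T + 1 := by
  have hn : (S \ T).Nonempty := by
    rw [Finset.sdiff_nonempty]; intro h; exact hne (Finset.Subset.antisymm hT.1 h)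
  obtain ⟨U, hU, hUn, hU1⟩ := exists_atom (pos_quot hT) hn
  refine ⟨T ∪ U, (fc_quot hT hU.1).1 hU, Finset.subset_union_left, ?_⟩
  have := rk_quot p T U; omega

/-- A functional vanishing on all covers of a proper face vanishes. -/
lemma zero_of_covers {p : ι → W} {S T : Finset ι} (hT : Fc p S T) (g : W →ₗ[ℝ] ℝ)
    (h0 : ∀ i ∈ T, g (p i) = 0)
    (h : ∀ R, Fc p S R → T ⊆ R → rk p R = rk p T + 1 → ∃ i ∈ R, i ∉ T ∧ g (p i) = 0) :
    ∀ i ∈ S, g (p i) = 0 := by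
  intro i hi
  by_cases hiT : i ∈ T
  · exact h0 i hiT
  have hk : sp p T ≤ LinearMap.ker g := sp_le.2 fun i hi => by simpa using h0 i hi
  have := zero_of_atoms (pos_quot hT) ((sp p T).liftQ g hk) (fun U hU hU1 => by
    have h1 := rk_quot p T U
    obtain ⟨j, hj, hjT, hj0⟩ := h (T ∪ U) ((fc_quot hT hU.1).1 hU) Finset.subset_union_left (by omega)
    refine ⟨j, by simpa [hjT] using hj, by simpa [Qp] using hj0⟩) i (by simp [hi, hiT])
  simpa [Qp] using this

/-- faces of every intermediate rank above T -/
lemma exists_face_rank {p : ι → W} {S T : Finset ι} (hT : Fc p S T) {r : ℕ} (h1 : rk p T ≤ r)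
    (h2 : r ≤ rk p S) : ∃ R, Fc p S R ∧ T ⊆ R ∧ rk p R = r := by
  induction r, h1 using Nat.le_induction with
  | base => exact ⟨T, hT, Finset.Subset.refl _, rfl⟩
  | succ r hr ih =>
    obtain ⟨R, hR, hTR, hRr⟩ := ih (by omega)
    obtain ⟨R', hR', hRR', h⟩ := exists_cover hR (by rintro rfl; omega)
    exact ⟨R', hR', hTR.trans hRR', by omega⟩

end PartA

section PartB
set_option linter.unusedSectionVars false
universe u
variable {ι : Type*} [DecidableEq ι] {W : Type u} [AddCommGroup W] [Module ℝ W]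

/-- The finset of faces of a configuration. -/
def faces (p : ι → W) (S : Finset ι) : Finset (Finset ι) := S.powerset.filter (fun T => Fc p S T)

lemma mem_faces {p : ι → W} {S T : Finset ι} : T ∈ faces p S ↔ Fc p S T := by
  simp only [faces, Finset.mem_filter, Finset.mem_powerset, and_iff_right_iff_imp]
  exact fun h => h.1

lemma sum_quot {M : Type*} [AddCommMonoid M] {p : ι → W} {S T : Finset ι} (hT : Fc p S T)
    (φ : Finset ι → M) :
    ∑ X ∈ (faces p S).filter (fun X => T ⊆ X), φ X
      = ∑ U ∈ faces (Qp p T) (S \ T), φ (T ∪ U) := by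
  symm
  refine Finset.sum_bij' (fun U _ => T ∪ U) (fun X _ => X \ T) ?_ ?_ ?_ ?_ ?_
  · intro U hU
    rw [mem_faces] at hU
    simp [mem_faces, (fc_quot hT hU.1).1 hU, Finset.subset_union_left]
  · intro X hX
    simp only [Finset.mem_filter, mem_faces] at hX ⊢
    have h1 : X \ T ⊆ S \ T := Finset.sdiff_subset_sdiff hX.1.1 (Finset.Subset.refl _)
    rw [fc_quot hT h1, Finset.union_sdiff_of_subset hX.2]
    exact hX.1
  · intro U hU
    rw [mem_faces] at hU
    have : Disjoint U T := Finset.disjoint_of_subset_left hU.1 Finset.sdiff_disjoint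
    simp [Finset.union_sdiff_left, Finset.sdiff_eq_self_of_disjoint this]
  · intro X hX
    simp only [Finset.mem_filter, mem_faces] at hX
    exact Finset.union_sdiff_of_subset hX.2
  · intro U hU; rfl

lemma atom_eq {p : ι → W} {S R R' : Finset ι} (hP : PosC p S) (hR : Fc p S R) (hR' : Fc p S R')
    (h1 : rk p R = 1) (h1' : rk p R' = 1) {i : ι} (hi : i ∈ R) (hi' : i ∈ R') : R = R' := by
  have hI := hR.inter hR'
  have hn : 0 < rk p (R ∩ R') := rk_pos_of_mem hP hI.1 ⟨i, by simp [hi, hi']⟩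
  have e1 := hI.eq_of_rk hR.1 Finset.inter_subset_left (by omega)
  have e2 := hI.eq_of_rk hR'.1 Finset.inter_subset_right (by omega)
  rw [← e1]; exact e2

lemma atom_parallel {p : ι → W} {R : Finset ι} (h1 : rk p R = 1) (f g : W →ₗ[ℝ] ℝ) {i j : ι}
    (hi : i ∈ R) (hj : j ∈ R) : f (p i) * g (p j) = f (p j) * g (p i) := by
  by_cases h0 : p i = 0
  · simp [h0]
  have : sp p R = Submodule.span ℝ {p i} := by
    symm
    apply Submodule.eq_of_le_of_finrank_le
    · rw [Submodule.span_singleton_le_iff_mem]; exact mem_sp hi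
    · rw [finrank_span_singleton h0]; exact h1.le
  have hj' : p j ∈ Submodule.span ℝ {p i} := this ▸ mem_sp hj
  obtain ⟨c, hc⟩ := Submodule.mem_span_singleton.1 hj'
  rw [← hc]; simp; ring

lemma exists_generic {p : ι → W} {S : Finset ι} (f0 : W →ₗ[ℝ] ℝ) (h0 : ∀ i ∈ S, 0 < f0 (p i))
    (f : W →ₗ[ℝ] ℝ) : ∃ f' : W →ₗ[ℝ] ℝ, (∀ i ∈ S, (f' (p i) < 0 ↔ f (p i) < 0)) ∧
      ∀ i ∈ S, ∀ j ∈ S, f' (p i) * f0 (p j) = f' (p j) * f0 (p i) →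
        f0 (p j) • p i = f0 (p i) • p j := by
  let J := {x : S × S // f0 (p x.2) • p x.1 ≠ f0 (p x.1) • p x.2}
  obtain ⟨g, hg⟩ := Module.exists_dual_forall_apply_ne_zero (K := ℝ) (M := W) (ι := J)
    (fun x => f0 (p x.1.2) • p x.1.1 - f0 (p x.1.1) • p x.1.2) (fun x => sub_ne_zero.2 x.2)
  obtain ⟨N, hN, hbig⟩ := exists_big S (fun i => g (p i)) (fun i => f0 (p i)) (fun i hi => (h0 i hi).le)
  set g' : W →ₗ[ℝ] ℝ := g + N • f0 with hg'
  have hpos : ∀ i ∈ S, 0 < g' (p i) := fun i hi => by simpa [hg'] using hbig i hi (h0 i hi)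
  have ev1 : ∀ i ∈ S, ∀ᶠ ε : ℝ in nhdsWithin 0 (Set.Ioi 0),
      (f (p i) + ε * g' (p i) < 0 ↔ f (p i) < 0) := by
    intro i hi
    by_cases hf : f (p i) < 0
    · have hc : Filter.Tendsto (fun ε : ℝ => f (p i) + ε * g' (p i)) (nhds 0) (nhds (f (p i) + 0 * g' (p i))) :=
        (continuous_const.add (continuous_id.mul continuous_const)).tendsto 0
      rw [zero_mul, add_zero] at hc
      have := (hc.eventually (gt_mem_nhds hf)).filter_mono (nhdsWithin_le_nhds (s := Set.Ioi 0))
      filter_upwards [this] with ε hε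
      simp [hf, hε]
    · filter_upwards [self_mem_nhdsWithin] with ε hε
      have h2 : 0 < ε * g' (p i) := mul_pos hε (hpos i hi)
      constructor
      · intro h; linarith
      · intro h; exact absurd h hf
  have ev2 : ∀ i ∈ S, ∀ j ∈ S, ∀ᶠ ε : ℝ in nhdsWithin 0 (Set.Ioi 0),
      ((f (p i) + ε * g' (p i)) * f0 (p j) = (f (p j) + ε * g' (p j)) * f0 (p i) →
        f0 (p j) • p i = f0 (p i) • p j) := by
    intro i hi j hj
    by_cases hne : f0 (p j) • p i = f0 (p i) • p j
    · exact Filter.Eventually.of_forall fun _ _ => hne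
    · have hgg := hg ⟨(⟨i, hi⟩, ⟨j, hj⟩), hne⟩
      set b := g' (p i) * f0 (p j) - g' (p j) * f0 (p i) with hb
      have hb0 : b ≠ 0 := by
        intro h; apply hgg
        simp only [hb, hg', LinearMap.add_apply, LinearMap.smul_apply, smul_eq_mul] at h
        simp only [map_sub, map_smul, smul_eq_mul]; linarith
      set a := f (p i) * f0 (p j) - f (p j) * f0 (p i) with ha
      have : ∀ᶠ ε : ℝ in nhdsWithin 0 (Set.Ioi 0), a + ε * b ≠ 0 := by
        by_cases ha0 : a = 0
        · filter_upwards [self_mem_nhdsWithin] with ε hε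
          rw [ha0, zero_add]; exact mul_ne_zero (ne_of_gt hε) hb0
        · have hc : Filter.Tendsto (fun ε : ℝ => a + ε * b) (nhds 0) (nhds (a + 0 * b)) :=
            (continuous_const.add (continuous_id.mul continuous_const)).tendsto 0
          rw [zero_mul, add_zero] at hc
          exact (hc.eventually_ne ha0).filter_mono nhdsWithin_le_nhds
      filter_upwards [this] with ε hε h
      exact absurd (by rw [ha, hb]; linarith) hε
  have e1 := (Filter.eventually_all_finset S).2 ev1
  have e2 := (Filter.eventually_all_finset S).2 (fun i hi => (Filter.eventually_all_finset S).2 (ev2 i hi))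
  obtain ⟨ε, h1, h2⟩ := (e1.and e2).exists
  refine ⟨f + ε • g', ?_, ?_⟩
  · intro i hi; simpa using h1 i hi
  · intro i hi j hj; simpa using h2 i hi j hj

lemma class_rank_one {p : ι → W} {R : Finset ι} (f0 : W →ₗ[ℝ] ℝ) (h0 : ∀ i ∈ R, 0 < f0 (p i))
    (hn : R.Nonempty) (h : ∀ i ∈ R, ∀ j ∈ R, f0 (p j) • p i = f0 (p i) • p j) : rk p R = 1 := by
  obtain ⟨i, hi⟩ := hn
  have : sp p R = Submodule.span ℝ {p i} := by
    apply le_antisymm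
    · rw [sp_le]; intro j hj
      have e : p j = ((f0 (p i))⁻¹ * f0 (p j)) • p i := by
        rw [mul_smul, h i hi j hj, smul_smul, inv_mul_cancel₀ (h0 i hi).ne', one_smul]
      rw [e]; exact Submodule.smul_mem _ _ (Submodule.mem_span_singleton_self _)
    · rw [Submodule.span_singleton_le_iff_mem]; exact mem_sp hi
  unfold rk; rw [this]
  apply finrank_span_singleton
  intro h'; have := h0 i hi; rw [h'] at this; simp at this

/-- Euler type relation for the part of the face complex in an open half-space. -/
theorem euler_neg (n : ℕ) : ∀ {W : Type u} [AddCommGroup W] [Module ℝ W] (p : ι → W) (S : Finset ι),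
    S.card ≤ n → PosC p S → ∀ f : W →ₗ[ℝ] ℝ,
    ∑ T ∈ (faces p S).filter (fun T => ∀ i ∈ T, f (p i) < 0), (-1 : ℤ) ^ (rk p T)
      = if (∃ i ∈ S, f (p i) < 0) then 0 else 1 := by
  induction n with
  | zero =>
    intro W _ _ p S hS hP f
    have : S = ∅ := by simpa using hS
    subst this
    have : (faces p ∅).filter (fun T => ∀ i ∈ T, f (p i) < 0) = {∅} := by
      ext T
      simp only [Finset.mem_filter, mem_faces, Finset.mem_singleton]
      constructor
      · rintro ⟨h, _⟩; simpa using h.1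
      · rintro rfl; exact ⟨Fc.refl _ _, by simp⟩
    rw [this]; simp [rk_empty]
  | succ n ih =>
    intro W _ _ p S hS hP f
    by_cases hex : ∃ i ∈ S, f (p i) < 0
    swap
    · rw [if_neg hex]
      have : (faces p S).filter (fun T => ∀ i ∈ T, f (p i) < 0) = {∅} := by
        ext T
        simp only [Finset.mem_filter, mem_faces, Finset.mem_singleton]
        constructor
        · rintro ⟨h, h2⟩
          rw [Finset.eq_empty_iff_forall_notMem]
          intro i hi; exact hex ⟨i, h.1 hi, h2 i hi⟩
        · rintro rfl; exact ⟨Fc.empty hP, by simp⟩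
      rw [this]; simp [rk_empty]
    rw [if_pos hex]
    have hP0 := hP
    obtain ⟨f0, h0⟩ := hP0
    obtain ⟨f', hf'1, hf'2⟩ := exists_generic f0 h0 f
    have hset : (faces p S).filter (fun T => ∀ i ∈ T, f (p i) < 0) =
        (faces p S).filter (fun T => ∀ i ∈ T, f' (p i) < 0) := by
      apply Finset.filter_congr
      intro T hT
      exact forall₂_congr fun i hi => (hf'1 i ((mem_faces.1 hT).1 hi)).symm
    rw [hset]
    replace hex : ∃ i ∈ S, f' (p i) < 0 := by
      obtain ⟨i, hi, h⟩ := hex; exact ⟨i, hi, (hf'1 i hi).2 h⟩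
    clear hset hf'1 f
    rename_i f
    set 𝓕 := (faces p S).filter (fun T => ∀ i ∈ T, f' (p i) < 0) with h𝓕
    set 𝓡 := 𝓕.filter (fun R => rk p R = 1) with h𝓡
    have memF : ∀ T, T ∈ 𝓕 ↔ Fc p S T ∧ ∀ i ∈ T, f' (p i) < 0 := by
      intro T; simp [h𝓕, mem_faces]
    have memR : ∀ T, T ∈ 𝓡 ↔ Fc p S T ∧ (∀ i ∈ T, f' (p i) < 0) ∧ rk p T = 1 := by
      intro T; simp [h𝓡, memF, and_assoc]
    have atom_ne : ∀ R, rk p R = 1 → R.Nonempty := by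
      intro R hR
      rw [Finset.nonempty_iff_ne_empty]; rintro rfl; rw [rk_empty] at hR; omega
    -- the relation: R is the top class of T
    let C : Finset ι → Finset ι → Prop := fun R T =>
      R ⊆ T ∧ ∀ r ∈ R, ∀ i ∈ T, i ∉ R → f' (p i) * f0 (p r) < f' (p r) * f0 (p i)
    have uniq : ∀ T ∈ 𝓕.filter (fun T => T.Nonempty), ∃! R, R ∈ 𝓡 ∧ C R T := by
      intro T hT
      rw [Finset.mem_filter, memF] at hT
      obtain ⟨⟨hTf, hTn⟩, hne⟩ := hT
      obtain ⟨c, R, hRn, hR, hRle, hRm⟩ := exists_argmin f0 (fun i hi => h0 i (hTf.1 hi)) (-f') hne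
      have hRS := hTf.trans hR
      have hR1 : rk p R = 1 := by
        apply class_rank_one f0 (fun i hi => h0 i (hRS.1 hi)) hRn
        intro i hi j hj
        apply hf'2 i (hRS.1 hi) j (hRS.1 hj)
        have e1 := (hRm i (hR.1 hi)).1 hi
        have e2 := (hRm j (hR.1 hj)).1 hj
        simp only [LinearMap.neg_apply] at e1 e2
        have e1' : f' (p i) = -(c * f0 (p i)) := by linarith
        have e2' : f' (p j) = -(c * f0 (p j)) := by linarith
        rw [e1', e2']; ring
      refine ⟨R, ⟨(memR R).2 ⟨hRS, fun i hi => hTn i (hR.1 hi), hR1⟩, hR.1, ?_⟩, ?_⟩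
      · intro r hr i hi hiR
        have e1 := (hRm r (hR.1 hr)).1 hr
        have e2 := hRle i hi
        have e3 : (-f') (p i) ≠ c * f0 (p i) := fun h => hiR ((hRm i hi).2 h)
        have e4 := lt_of_le_of_ne e2 e3.symm
        simp only [LinearMap.neg_apply] at e1 e4
        have e1' : f' (p r) = -(c * f0 (p r)) := by linarith
        rw [e1']
        have := h0 r (hRS.1 hr)
        nlinarith
      · rintro R' ⟨hR', hC, hC'⟩
        rw [memR] at hR'
        obtain ⟨r', hr'⟩ := atom_ne R' hR'.2.2
        by_cases hr'R : r' ∈ R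
        · exact atom_eq hP hR'.1 hRS hR'.2.2 hR1 hr' hr'R
        · obtain ⟨r, hr⟩ := hRn
          have e1 := (hRm r (hR.1 hr)).1 hr
          have e2 := hRle r' (hC hr')
          by_cases hrR' : r ∈ R'
          · exact atom_eq hP hR'.1 hRS hR'.2.2 hR1 hrR' hr
          · have e5 := hC' r' hr' r (hR.1 hr) hrR'
            simp only [LinearMap.neg_apply] at e1 e2
            have e1' : f' (p r) = -(c * f0 (p r)) := by linarith
            rw [e1'] at e5
            have := h0 r (hRS.1 hr)
            nlinarith
    -- inner sums
    have inner : ∀ R ∈ 𝓡, ∑ T ∈ 𝓕.filter (fun T => T.Nonempty ∧ C R T), (-1 : ℤ) ^ (rk p T)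
        = if (∀ r ∈ R, ∀ i ∈ S, i ∉ R → f' (p r) * f0 (p i) ≤ f' (p i) * f0 (p r)) then -1 else 0 := by
      intro R hR
      rw [memR] at hR
      obtain ⟨hRf, hRneg, hR1⟩ := hR
      obtain ⟨r, hr⟩ := atom_ne R hR1
      have hr0 := h0 r (hRf.1 hr)
      have hRr : ∀ s ∈ R, ∃ a : ℝ, 0 < a ∧ f' (p s) = a * f' (p r) ∧ f0 (p s) = a * f0 (p r) := by
        intro s hs
        have hs0 := h0 s (hRf.1 hs)
        refine ⟨f0 (p s) / f0 (p r), by positivity, ?_, by field_simp⟩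
        have := atom_parallel hR1 f' f0 hs hr
        field_simp; linarith
      set φ : W →ₗ[ℝ] ℝ := f0 (p r) • f' - f' (p r) • f0 with hφ
      have hφR : ∀ s ∈ R, φ (p s) = 0 := by
        intro s hs
        obtain ⟨a, ha, e1, e2⟩ := hRr s hs
        simp only [hφ, LinearMap.sub_apply, LinearMap.smul_apply, smul_eq_mul, e1, e2]; ring
      have hk : sp p R ≤ LinearMap.ker φ := sp_le.2 fun i hi => by simpa using hφR i hi
      have hIH := ih (Qp p R) (S \ R) (by
        have h1 : (S \ R).card < S.card := Finset.card_lt_card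
          ⟨Finset.sdiff_subset, fun h => by
            have := h (hRf.1 hr); simp [hr] at this⟩
        omega) (pos_quot hRf) ((sp p R).liftQ φ hk)
      have hl : ∀ i, (sp p R).liftQ φ hk (Qp p R i) = φ (p i) := fun i => by simp [Qp]
      simp only [hl] at hIH
      have e1 : 𝓕.filter (fun T => T.Nonempty ∧ C R T) =
          ((faces p S).filter (fun X => R ⊆ X)).filter (fun X => ∀ i ∈ X \ R, φ (p i) < 0) := by
        ext T
        simp only [Finset.mem_filter, memF, mem_faces]
        constructor
        · rintro ⟨⟨h1, h2⟩, h3, h4, h5⟩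
          refine ⟨⟨h1, h4⟩, fun i hi => ?_⟩
          rw [Finset.mem_sdiff] at hi
          have := h5 r hr i hi.1 hi.2
          simp only [hφ, LinearMap.sub_apply, LinearMap.smul_apply, smul_eq_mul]; linarith
        · rintro ⟨⟨h1, h2⟩, h3⟩
          have h3' : ∀ i ∈ T, i ∉ R → f' (p i) * f0 (p r) < f' (p r) * f0 (p i) := by
            intro i hi hiR
            have := h3 i (by simp [hi, hiR])
            simp only [hφ, LinearMap.sub_apply, LinearMap.smul_apply, smul_eq_mul] at this; linarith
          refine ⟨⟨h1, fun i hi => ?_⟩, ⟨r, h2 hr⟩, h2, ?_⟩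
          · by_cases hiR : i ∈ R
            · exact hRneg i hiR
            · have a1 := h3' i hi hiR
              have a2 := hRneg r hr
              have a3 := h0 i (h1.1 hi)
              by_contra hc
              push Not at hc
              nlinarith [mul_nonneg hc hr0.le, mul_pos_of_neg_of_neg a2 (neg_lt_zero.2 a3)]
          · intro s hs i hi hiR
            obtain ⟨a, ha, e1, e2⟩ := hRr s hs
            rw [e1, e2]
            have := h3' i hi hiR
            nlinarith
      rw [e1, Finset.sum_filter, sum_quot hRf (fun X => if (∀ i ∈ X \ R, φ (p i) < 0) then (-1 : ℤ) ^ rk p X else 0)]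
      have e2 : ∀ U ∈ faces (Qp p R) (S \ R),
          (if (∀ i ∈ (R ∪ U) \ R, φ (p i) < 0) then (-1 : ℤ) ^ rk p (R ∪ U) else 0)
          = - (if (∀ i ∈ U, φ (p i) < 0) then (-1 : ℤ) ^ rk (Qp p R) U else 0) := by
        intro U hU
        rw [mem_faces] at hU
        have hd : Disjoint U R := Finset.disjoint_of_subset_left hU.1 Finset.sdiff_disjoint
        have : (R ∪ U) \ R = U := by
          simp [Finset.union_sdiff_left, Finset.sdiff_eq_self_of_disjoint hd]
        rw [this, ← rk_quot, hR1, pow_succ]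
        split_ifs <;> simp
      rw [Finset.sum_congr rfl e2, Finset.sum_neg_distrib, ← Finset.sum_filter, hIH]
      have e3 : (∃ i ∈ S \ R, φ (p i) < 0) ↔ ¬ (∀ r ∈ R, ∀ i ∈ S, i ∉ R → f' (p r) * f0 (p i) ≤ f' (p i) * f0 (p r)) := by
        constructor
        · rintro ⟨i, hi, h⟩ hall
          rw [Finset.mem_sdiff] at hi
          have := hall r hr i hi.1 hi.2
          simp only [hφ, LinearMap.sub_apply, LinearMap.smul_apply, smul_eq_mul] at h; linarith
        · intro h
          push Not at h
          obtain ⟨s, hs, i, hi, hiR, hlt⟩ := h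
          refine ⟨i, by simp [hi, hiR], ?_⟩
          obtain ⟨a, ha, e1, e2⟩ := hRr s hs
          rw [e1, e2] at hlt
          simp only [hφ, LinearMap.sub_apply, LinearMap.smul_apply, smul_eq_mul]
          by_contra hc; push Not at hc
          nlinarith [mul_nonneg ha.le hc]
      by_cases hA : (∀ r ∈ R, ∀ i ∈ S, i ∉ R → f' (p r) * f0 (p i) ≤ f' (p i) * f0 (p r))
      · rw [if_neg (by rw [e3]; exact not_not.2 hA), if_pos hA]
      · rw [if_pos (e3.2 hA), if_neg hA]; simp
    -- the unique minimum
    have hmin : ∃ R₀ ∈ 𝓡, ∀ R ∈ 𝓡,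
        ((∀ r ∈ R, ∀ i ∈ S, i ∉ R → f' (p r) * f0 (p i) ≤ f' (p i) * f0 (p r)) ↔ R = R₀) := by
      obtain ⟨i0, hi0, hneg⟩ := hex
      obtain ⟨c, R, hRn, hR, hRle, hRm⟩ := exists_argmin f0 h0 f' ⟨i0, hi0⟩
      have hc : c < 0 := by
        have := hRle i0 hi0; have := h0 i0 hi0
        by_contra hc; push Not at hc
        nlinarith [mul_nonneg hc this.le]
      have hR1 : rk p R = 1 := by
        apply class_rank_one f0 (fun i hi => h0 i (hR.1 hi)) hRn
        intro i hi j hj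
        apply hf'2 i (hR.1 hi) j (hR.1 hj)
        rw [(hRm i (hR.1 hi)).1 hi, (hRm j (hR.1 hj)).1 hj]; ring
      refine ⟨R, (memR R).2 ⟨hR, fun i hi => ?_, hR1⟩, ?_⟩
      · rw [(hRm i (hR.1 hi)).1 hi]; have := h0 i (hR.1 hi); nlinarith
      · intro R' hR'
        rw [memR] at hR'
        constructor
        · intro hall
          obtain ⟨r', hr'⟩ := atom_ne R' hR'.2.2
          obtain ⟨r, hr⟩ := hRn
          by_cases hrR' : r ∈ R'
          · exact atom_eq hP hR'.1 hR hR'.2.2 hR1 hrR' hr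
          · have h1 := hall r' hr' r (hR.1 hr) hrR'
            have h2 := hRle r' (hR'.1.1 hr')
            rw [(hRm r (hR.1 hr)).1 hr] at h1
            have h3 := h0 r (hR.1 hr)
            have h4 : f' (p r') = c * f0 (p r') := by
              apply le_antisymm _ h2
              have : f' (p r') * f0 (p r) ≤ (c * f0 (p r')) * f0 (p r) := by linarith
              exact le_of_mul_le_mul_right this h3
            exact atom_eq hP hR'.1 hR hR'.2.2 hR1 hr' ((hRm r' (hR'.1.1 hr')).2 h4)
        · rintro rfl r hr i hi _
          have h2 := hRle i hi
          rw [(hRm r (hR.1 hr)).1 hr]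
          have := h0 r (hR.1 hr)
          nlinarith
    -- assemble
    have hsplit : ∑ T ∈ 𝓕, (-1 : ℤ) ^ (rk p T) =
        ∑ T ∈ 𝓕.filter (fun T => T.Nonempty), (-1 : ℤ) ^ (rk p T) + 1 := by
      rw [← Finset.sum_filter_add_sum_filter_not 𝓕 (fun T => T.Nonempty)]
      congr 1
      have : 𝓕.filter (fun T => ¬ T.Nonempty) = {∅} := by
        ext T
        simp only [Finset.mem_filter, memF, Finset.mem_singleton, Finset.not_nonempty_iff_eq_empty]
        constructor
        · exact fun h => h.2
        · rintro rfl; exact ⟨⟨Fc.empty hP, by simp⟩, rfl⟩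
      rw [this]; simp [rk_empty]
    have hdouble : ∑ T ∈ 𝓕.filter (fun T => T.Nonempty), (-1 : ℤ) ^ (rk p T) =
        ∑ R ∈ 𝓡, ∑ T ∈ 𝓕.filter (fun T => T.Nonempty ∧ C R T), (-1 : ℤ) ^ (rk p T) := by
      have : ∀ R ∈ 𝓡, ∑ T ∈ 𝓕.filter (fun T => T.Nonempty ∧ C R T), (-1 : ℤ) ^ (rk p T) =
          ∑ T ∈ 𝓕.filter (fun T => T.Nonempty), if C R T then (-1 : ℤ) ^ (rk p T) else 0 := by
        intro R _
        rw [← Finset.sum_filter]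
        apply Finset.sum_congr _ (fun _ _ => rfl)
        ext T; simp only [Finset.mem_filter]; tauto
      rw [Finset.sum_congr rfl this, Finset.sum_comm]
      refine Finset.sum_congr rfl fun T hT => ?_
      obtain ⟨R, ⟨hR1, hR2⟩, hR3⟩ := uniq T hT
      rw [Finset.sum_eq_single R]
      · rw [if_pos hR2]
      · intro R' hR' hne
        rw [if_neg]; intro hC; exact hne (hR3 R' ⟨hR', hC⟩)
      · intro h; exact absurd hR1 h
    rw [hsplit, hdouble, Finset.sum_congr rfl inner]
    obtain ⟨R₀, hR₀, hR₀'⟩ := hmin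
    rw [Finset.sum_eq_single R₀]
    · rw [if_pos ((hR₀' R₀ hR₀).2 rfl)]; norm_num
    · intro R hR hne
      rw [if_neg]; intro h; exact hne ((hR₀' R hR).1 h)
    · intro h; exact absurd hR₀ h

theorem euler_full (p : ι → W) (S : Finset ι) (hP : PosC p S) (hS : S.Nonempty) :
    ∑ T ∈ faces p S, (-1 : ℤ) ^ (rk p T) = 0 := by
  obtain ⟨f0, h0⟩ := id hP
  have := euler_neg S.card p S le_rfl hP (-f0)
  obtain ⟨i, hi⟩ := hS
  rw [if_pos ⟨i, hi, by simpa using h0 i hi⟩] at this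
  rw [← this]
  apply Finset.sum_congr _ (fun _ _ => rfl)
  rw [Finset.filter_true_of_mem]
  intro T hT j hj
  simpa using h0 j ((mem_faces.1 hT).1 hj)

/-- Interval version. -/
theorem euler_interval (p : ι → W) (S Z : Finset ι) (hZ : Fc p S Z) (hne : Z ≠ S) :
    ∑ T ∈ (faces p S).filter (fun T => Z ⊆ T), (-1 : ℤ) ^ (rk p T) = 0 := by
  rw [sum_quot hZ]
  have hn : (S \ Z).Nonempty := by
    rw [Finset.sdiff_nonempty]; intro h; exact hne (Finset.Subset.antisymm hZ.1 h)
  have := euler_full (Qp p Z) (S \ Z) (pos_quot hZ) hn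
  have e : ∀ U ∈ faces (Qp p Z) (S \ Z), (-1 : ℤ) ^ rk p (Z ∪ U) = (-1) ^ rk p Z * (-1) ^ rk (Qp p Z) U := by
    intro U _; rw [← rk_quot, pow_add, mul_comm]
  rw [Finset.sum_congr rfl e, ← Finset.mul_sum, this, mul_zero]

end PartB

section PartC
set_option linter.unusedSectionVars false
variable {ι : Type*} [DecidableEq ι] {W : Type*} [AddCommGroup W] [Module ℝ W]

/-- The `g`,`h` recursion on the faces of a configuration. -/
structure GHc (p : ι → W) (S : Finset ι) (G H : Finset ι → ℤ[X]) : Prop where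
  empty : G ∅ = 1
  hh : ∀ T ∈ faces p S, H T = ∑ U ∈ (faces p T).filter (fun U => U ≠ T),
    (X - 1 : ℤ[X]) ^ (rk p T - rk p U - 1) * G U
  g0 : ∀ T ∈ faces p S, T.Nonempty → (G T).coeff 0 = (H T).coeff 0
  g1 : ∀ T ∈ faces p S, T.Nonempty → ∀ i, 0 < i → 2 * i + 1 ≤ rk p T →
    (G T).coeff i = (H T).coeff i - (H T).coeff (i - 1)
  g2 : ∀ T ∈ faces p S, T.Nonempty → ∀ i, 0 < i → ¬ (2 * i + 1 ≤ rk p T) → (G T).coeff i = 0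

lemma faces_trans {p : ι → W} {S T U : Finset ι} (hT : T ∈ faces p S) (hU : U ∈ faces p T) :
    U ∈ faces p S := mem_faces.2 ((mem_faces.1 hT).trans (mem_faces.1 hU))

lemma GHc.sub {p : ι → W} {S T : Finset ι} {G H : Finset ι → ℤ[X]} (h : GHc p S G H)
    (hT : T ∈ faces p S) : GHc p T G H where
  empty := h.empty
  hh U hU := h.hh U (faces_trans hT hU)
  g0 U hU := h.g0 U (faces_trans hT hU)
  g1 U hU := h.g1 U (faces_trans hT hU)
  g2 U hU := h.g2 U (faces_trans hT hU)

lemma reflect_sum' {α : Type*} (s : Finset α) (f : α → ℤ[X]) (N : ℕ) :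
    reflect N (∑ i ∈ s, f i) = ∑ i ∈ s, reflect N (f i) := by
  induction s using Finset.induction_on with
  | empty => simp
  | insert a s ha ih => rw [Finset.sum_insert ha, Finset.sum_insert ha, reflect_add, ih]

lemma natDegree_X_sub_one_pow (k : ℕ) : natDegree ((X - 1 : ℤ[X]) ^ k) ≤ k := by
  refine natDegree_pow_le.trans ?_
  have : natDegree (X - 1 : ℤ[X]) ≤ 1 := by
    have := natDegree_X_sub_C_le (1 : ℤ); simpa using this
  nlinarith

lemma reflect_X_sub_one_pow (k : ℕ) : reflect k ((X - 1 : ℤ[X]) ^ k) = (1 - X) ^ k := by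
  induction k with
  | zero => simp [reflect_one]
  | succ k ih =>
    rw [pow_succ, reflect_mul _ _ (natDegree_X_sub_one_pow k) (by simpa using natDegree_X_sub_one_pow 1), ih,
      pow_succ]
    congr 1
    rw [reflect_sub, reflect_one, reflect_one_X]; simp

lemma GHc.natDegree_le {p : ι → W} {S T : Finset ι} {G H : Finset ι → ℤ[X]} (h : GHc p S G H)
    (hT : T ∈ faces p S) (hP : PosC p S) : natDegree (G T) ≤ rk p T := by
  rcases T.eq_empty_or_nonempty with rfl | hn
  · rw [h.empty]; simp
  · rw [natDegree_le_iff_coeff_eq_zero]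
    intro i hi
    exact h.g2 T hT hn i (by omega) (by omega)

lemma sign_aux (r u v : ℕ) (h1 : u + 1 ≤ r) (h2 : v ≤ u) (g : ℤ[X]) :
    (1 - X : ℤ[X]) ^ (r - u - 1) * ((X - 1 : ℤ[X]) ^ (u - v) * g) =
      (-1) ^ (r + 1) * ((-1 : ℤ[X]) ^ u) * ((X - 1 : ℤ[X]) ^ (r - v - 1) * g) := by
  obtain ⟨a, rfl⟩ := Nat.exists_eq_add_of_le h2
  obtain ⟨b, rfl⟩ := Nat.exists_eq_add_of_le h1
  have e1 : v + a + 1 + b - (v + a) - 1 = b := by omega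
  have e2 : v + a - v = a := by omega
  have e3 : v + a + 1 + b - v - 1 = b + a := by omega
  rw [e1, e2, e3]
  have a1 : (1 - X : ℤ[X]) ^ b = (-1) ^ b * (X - 1) ^ b := by
    rw [← mul_pow]; congr 1; ring
  have a3 : (-1 : ℤ[X]) ^ (v + a + 1 + b + 1) * (-1 : ℤ[X]) ^ (v + a) = (-1) ^ b := by
    rw [← pow_add]
    have : v + a + 1 + b + 1 + (v + a) = b + 2 * (v + a + 1) := by ring
    rw [this, pow_add, pow_mul]; simp
  rw [a1, a3, pow_add]; ring

set_option maxHeartbeats 1000000 in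
/-- Kazhdan-Lusztig-Stanley identity. -/
theorem GHc.kls {p : ι → W} {G H : Finset ι → ℤ[X]} (n : ℕ) : ∀ S : Finset ι, S.card ≤ n → PosC p S →
    GHc p S G H →
    ∑ U ∈ faces p S, (X - 1 : ℤ[X]) ^ (rk p S - rk p U) * G U = reflect (rk p S) (G S) := by
  induction n with
  | zero =>
    intro S hS hP h
    obtain rfl : S = ∅ := by simpa using hS
    have : faces p (∅ : Finset ι) = {∅} := by
      ext T; rw [mem_faces]
      constructor
      · intro h; simpa using h.1
      · intro h; rw [Finset.mem_singleton] at h; subst h; exact Fc.refl _ _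
    rw [this]; simp [h.empty, rk_empty, reflect_one]
  | succ n ih =>
    intro S hS hP h
    rcases S.eq_empty_or_nonempty with rfl | hn
    · have : faces p (∅ : Finset ι) = {∅} := by
        ext T; rw [mem_faces]
        constructor
        · intro h; simpa using h.1
        · intro h; rw [Finset.mem_singleton] at h; subst h; exact Fc.refl _ _
      rw [this]; simp [h.empty, rk_empty, reflect_one]
    have hSS : S ∈ faces p S := mem_faces.2 (Fc.refl _ _)
    have hr : 0 < rk p S := rk_pos_of_mem hP (Finset.Subset.refl _) hn
    set r := rk p S with hrdef
    have hlt : ∀ U ∈ (faces p S).filter (fun U => U ≠ S), rk p U + 1 ≤ r := by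
      intro U hU
      simp only [Finset.mem_filter, mem_faces] at hU
      exact hU.1.rk_lt (Finset.Subset.refl _) hU.1.1 hU.2
    have ih' : ∀ U ∈ (faces p S).filter (fun U => U ≠ S),
        ∑ V ∈ faces p U, (X - 1 : ℤ[X]) ^ (rk p U - rk p V) * G V = reflect (rk p U) (G U) := by
      intro U hU
      simp only [Finset.mem_filter] at hU
      have hU' := mem_faces.1 hU.1
      refine ih U ?_ (hP.mono hU'.1) (h.sub hU.1)
      have := Finset.card_lt_card (Finset.ssubset_iff_subset_ne.2 ⟨hU'.1, hU.2⟩)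
      omega
    -- palindromicity of H
    have pal : reflect (r - 1) (H S) = H S := by
      have e1 : reflect (r-1) (H S) = ∑ U ∈ (faces p S).filter (fun U => U ≠ S),
          ∑ V ∈ faces p U, (1 - X : ℤ[X]) ^ (r - rk p U - 1) * ((X - 1 : ℤ[X]) ^ (rk p U - rk p V) * G V) := by
        rw [h.hh S hSS, reflect_sum']
        refine Finset.sum_congr rfl fun U hU => ?_
        rw [← Finset.mul_sum, ih' U hU]
        have hU2 := hlt U hU
        have : r - 1 = (r - rk p U - 1) + rk p U := by omega
        rw [this, reflect_mul _ _ (natDegree_X_sub_one_pow _)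
          (h.natDegree_le (Finset.mem_filter.1 hU).1 hP), reflect_X_sub_one_pow]
      have e2 : ∀ U ∈ (faces p S).filter (fun U => U ≠ S),
          ∑ V ∈ faces p U, (1 - X : ℤ[X]) ^ (r - rk p U - 1) * ((X - 1 : ℤ[X]) ^ (rk p U - rk p V) * G V)
          = ∑ V ∈ (faces p S).filter (fun U => U ≠ S), if V ⊆ U then
            (-1) ^ (r + 1) * ((-1 : ℤ[X]) ^ (rk p U)) * ((X - 1 : ℤ[X]) ^ (r - rk p V - 1) * G V) else 0 := by
        intro U hU
        have hU2 := hlt U hU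
        have hU1 := mem_faces.1 (Finset.mem_filter.1 hU).1
        rw [← Finset.sum_filter]
        refine Finset.sum_congr ?_ ?_
        · ext V
          simp only [Finset.mem_filter, mem_faces]
          constructor
          · intro hV
            refine ⟨⟨hU1.trans hV, ?_⟩, hV.1⟩
            rintro rfl
            exact (Finset.mem_filter.1 hU).2 (Finset.Subset.antisymm hU1.1 hV.1)
          · rintro ⟨⟨h1, h2⟩, h3⟩
            exact h1.restrict' hU1.1 h3
        · intro V hV
          have hVU : rk p V ≤ rk p U := rk_mono (Finset.mem_filter.1 hV).2
          exact sign_aux r _ _ hU2 hVU _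
      rw [e1, Finset.sum_congr rfl e2, Finset.sum_comm, h.hh S hSS]
      refine Finset.sum_congr rfl fun V hV => ?_
      have hV1 := Finset.mem_filter.1 hV
      rw [← Finset.sum_filter, ← Finset.sum_mul, ← Finset.mul_sum]
      have eu := euler_interval p S V (mem_faces.1 hV1.1) hV1.2
      have : ∑ U ∈ ((faces p S).filter (fun U => U ≠ S)).filter (fun U => V ⊆ U), (-1 : ℤ) ^ rk p U =
          - (-1) ^ r := by
        rw [← Finset.sum_filter_add_sum_filter_not _ (fun U => U ≠ S)] at eu
        have e3 : ((faces p S).filter (fun U => V ⊆ U)).filter (fun U => ¬ U ≠ S) = {S} := by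
          ext U; simp only [Finset.mem_filter, Finset.mem_singleton, not_not]
          constructor
          · exact fun h => h.2
          · rintro rfl; exact ⟨⟨hSS, (mem_faces.1 hV1.1).1⟩, rfl⟩
        rw [e3, Finset.sum_singleton] at eu
        have e4 : ((faces p S).filter (fun U => U ≠ S)).filter (fun U => V ⊆ U) =
          ((faces p S).filter (fun U => V ⊆ U)).filter (fun U => U ≠ S) := Finset.filter_comm _ _ _
        rw [e4]; linarith
      have this' := congrArg (Int.castRingHom ℤ[X]) this
      rw [map_sum] at this'
      simp only [map_pow, map_neg, map_one] at this'
      rw [this']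
      have : (-1 : ℤ[X]) ^ (r + 1) * -(-1) ^ r = 1 := by
        have : (-1 : ℤ[X]) ^ (r + 1) * -(-1) ^ r = ((-1) ^ r) ^ 2 := by ring
        rw [this, ← pow_mul, mul_comm, pow_mul]; simp
      rw [this, one_mul]
    have hdeg : ∀ i, r ≤ i → (H S).coeff i = 0 := by
      intro i hi
      have : natDegree (H S) ≤ r - 1 := by
        rw [h.hh S hSS]
        apply natDegree_sum_le_of_forall_le
        intro U hU
        refine natDegree_mul_le.trans ?_
        have h1 := natDegree_X_sub_one_pow (r - rk p U - 1)
        have h2 := h.natDegree_le (Finset.mem_filter.1 hU).1 hP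
        have := hlt U hU
        rw [← hrdef]
        omega
      exact coeff_eq_zero_of_natDegree_lt (by omega)
    have hpal : ∀ i, i ≤ r - 1 → (H S).coeff (r - 1 - i) = (H S).coeff i := by
      intro i hi
      conv_rhs => rw [← pal]
      rw [coeff_reflect, revAt_le hi]
    have hf : ∑ U ∈ faces p S, (X - 1 : ℤ[X]) ^ (r - rk p U) * G U = (X - 1) * H S + G S := by
      rw [← Finset.sum_filter_add_sum_filter_not _ (fun U => U ≠ S)]
      congr 1
      · rw [h.hh S hSS, Finset.mul_sum]
        refine Finset.sum_congr rfl fun U hU => ?_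
        have := hlt U hU
        have e : r - rk p U = (r - rk p U - 1) + 1 := by omega
        rw [e, pow_succ]; simp only [Nat.add_sub_cancel]; ring
      · have e3 : (faces p S).filter (fun U => ¬ U ≠ S) = {S} := by
          ext U; simp only [Finset.mem_filter, Finset.mem_singleton, not_not]
          constructor
          · exact fun h => h.2
          · rintro rfl; exact ⟨hSS, rfl⟩
        rw [e3]; simp [hrdef]
    rw [hf]
    ext i
    rw [coeff_reflect]
    have key : ((X - 1) * H S + G S).coeff i =
        (if i = 0 then 0 else (H S).coeff (i - 1)) - (H S).coeff i + (G S).coeff i := by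
      rw [sub_mul, coeff_add, coeff_sub, one_mul]
      rcases i with _ | i
      · simp
      · simp [coeff_X_mul]
    rw [key]
    have c0 := h.g0 S hSS hn
    have c1 := h.g1 S hSS hn
    have c2 := h.g2 S hSS hn
    rw [← hrdef] at c1 c2
    by_cases hir : r < i
    · rw [revAt_eq_self_of_lt hir, if_neg (by omega), hdeg _ (by omega), hdeg _ (by omega), c2 i (by omega) (by omega)]
      simp
    · rw [revAt_le (by omega)]
      by_cases hi0 : i = 0
      · subst hi0
        rw [if_pos rfl, c0, Nat.sub_zero, c2 r hr (by omega)]; ring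
      rw [if_neg hi0]
      by_cases h2 : 2 * i + 1 ≤ r
      · rw [c1 i (by omega) h2, c2 (r - i) (by omega) (by omega)]; ring
      · rw [c2 i (by omega) h2]
        by_cases hri : i = r
        · rw [hri, Nat.sub_self, c0, hdeg r le_rfl, ← hpal (r-1) le_rfl]; simp
        by_cases h3 : 2 * i = r
        · rw [c2 (r - i) (by omega) (by omega)]
          have := hpal (i - 1) (by omega)
          have e : r - 1 - (i - 1) = i := by omega
          rw [e] at this; rw [this]; ring
        · rw [c1 (r - i) (by omega) (by omega)]
          have a := hpal (i - 1) (by omega)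
          have b := hpal i (by omega)
          have e : r - 1 - (i - 1) = r - i := by omega
          have e' : r - 1 - i = r - i - 1 := by omega
          rw [e] at a; rw [e'] at b; rw [a, b]; ring

theorem GHc.kls' {p : ι → W} {G H : Finset ι → ℤ[X]} {S : Finset ι} (hP : PosC p S) (h : GHc p S G H) :
    G S = ∑ U ∈ faces p S, (1 - X : ℤ[X]) ^ (rk p S - rk p U) * reflect (rk p U) (G U) := by
  have := congrArg (reflect (rk p S)) (GHc.kls S.card S le_rfl hP h)
  rw [reflect_sum'] at this
  rw [reflect_reflect] at this
  rw [← this]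
  refine Finset.sum_congr rfl fun U hU => ?_
  have hU' : rk p U ≤ rk p S := rk_mono (mem_faces.1 hU).1
  have e : rk p S = (rk p S - rk p U) + rk p U := by omega
  conv_lhs => arg 1; rw [e]
  rw [reflect_mul _ _ (natDegree_X_sub_one_pow _) (h.natDegree_le hU hP), reflect_X_sub_one_pow]

/-- number of faces of rank `k`. -/
def fcount (p : ι → W) (S : Finset ι) (k : ℕ) : ℕ := ((faces p S).filter (fun T => rk p T = k)).card

lemma one_sub_X_pow_coeff (n : ℕ) : ((1 - X : ℤ[X]) ^ n).coeff 0 = 1 ∧ ((1 - X : ℤ[X]) ^ n).coeff 1 = - n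
    ∧ ((1 - X : ℤ[X]) ^ n).coeff 2 = (n.choose 2 : ℤ) := by
  induction n with
  | zero => simp [coeff_one]
  | succ n ih =>
    obtain ⟨a, b, c⟩ := ih
    have : ((1 - X : ℤ[X]) ^ (n+1)) = (1 - X) ^ n - (1 - X) ^ n * X := by ring
    rw [this]
    refine ⟨?_, ?_, ?_⟩
    · simp [a]
    · rw [coeff_sub, show (1:ℕ) = 0 + 1 from rfl, coeff_mul_X, a]; simp [b]; ring
    · rw [coeff_sub, show (2:ℕ) = 1 + 1 from rfl, coeff_mul_X, b]; simp [c, Nat.choose_succ_succ]; ring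

lemma coeff_two_mul (a b : ℤ[X]) : (a * b).coeff 2 = a.coeff 0 * b.coeff 2 + a.coeff 1 * b.coeff 1 + a.coeff 2 * b.coeff 0 := by
  rw [coeff_mul, Finset.Nat.antidiagonal_succ, Finset.sum_cons, Finset.Nat.antidiagonal_succ]
  simp; ring

lemma coeff_one_mul' (a b : ℤ[X]) : (a * b).coeff 1 = a.coeff 0 * b.coeff 1 + a.coeff 1 * b.coeff 0 := by
  rw [coeff_mul, Finset.Nat.antidiagonal_succ]
  simp

theorem GHc.coeff0 {p : ι → W} {G H : Finset ι → ℤ[X]} {S : Finset ι} (hP : PosC p S) (h : GHc p S G H) :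
    (G S).coeff 0 = 1 := by
  rw [h.kls' hP, finsetSum_coeff, Finset.sum_eq_single ∅]
  · simp [rk_empty, h.empty, reflect_one, (one_sub_X_pow_coeff _).1]
  · intro U hU hne
    have hn := Finset.nonempty_iff_ne_empty.2 hne
    have := rk_pos_of_mem hP (mem_faces.1 hU).1 hn
    rw [mul_coeff_zero, coeff_reflect, revAt_le (by omega), h.g2 U hU hn _ (by omega) (by omega), mul_zero]
  · intro hh; exact absurd (mem_faces.2 (Fc.empty hP)) hh

/-- coefficients of the reflected g polynomial -/
lemma GHc.refl_coeff {p : ι → W} {G H : Finset ι → ℤ[X]} {S U : Finset ι} (hP : PosC p S) (h : GHc p S G H)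
    (hU : U ∈ faces p S) :
    (reflect (rk p U) (G U)).coeff 0 = (if rk p U = 0 then 1 else 0) ∧
    (reflect (rk p U) (G U)).coeff 1 = (if rk p U = 1 then 1 else 0) ∧
    (reflect (rk p U) (G U)).coeff 2 = (if rk p U = 2 then 1 else 0) + (if rk p U = 3 then (G U).coeff 1 else 0) := by
  rcases U.eq_empty_or_nonempty with rfl | hn
  · simp [rk_empty, h.empty, reflect_one, coeff_one]
  have hr := rk_pos_of_mem hP (mem_faces.1 hU).1 hn
  have c2 := h.g2 U hU hn
  have c0 := (h.sub hU).coeff0 (hP.mono (mem_faces.1 hU).1)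
  refine ⟨?_, ?_, ?_⟩
  · rw [coeff_reflect, revAt_le (by omega), c2 _ (by omega) (by omega), if_neg (by omega)]
  · rw [coeff_reflect, revAt_le (by omega)]
    by_cases h1 : rk p U = 1
    · rw [if_pos h1, h1, Nat.sub_self, c0]
    · rw [if_neg h1, c2 _ (by omega) (by omega)]
  · rw [coeff_reflect]
    by_cases h1 : rk p U = 1
    · rw [if_neg (by omega), if_neg (by omega), h1, revAt_eq_self_of_lt (by omega), c2 2 (by omega) (by omega)]; simp
    rw [revAt_le (by omega)]
    by_cases h2 : rk p U = 2
    · rw [if_pos h2, h2, Nat.sub_self, c0]; simp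
    by_cases h3 : rk p U = 3
    · rw [if_pos h3, h3]; simp
    · rw [if_neg h2, if_neg h3, c2 _ (by omega) (by omega)]; simp

theorem GHc.coeff1 {p : ι → W} {G H : Finset ι → ℤ[X]} {S : Finset ι} (hP : PosC p S) (h : GHc p S G H) :
    (G S).coeff 1 = (fcount p S 1 : ℤ) - rk p S := by
  rw [h.kls' hP, finsetSum_coeff]
  have : ∀ U ∈ faces p S, ((1 - X : ℤ[X]) ^ (rk p S - rk p U) * reflect (rk p U) (G U)).coeff 1 =
      (if rk p U = 1 then 1 else 0) - (rk p S : ℤ) * (if U = ∅ then 1 else 0) := by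
    intro U hU
    obtain ⟨a, b, c⟩ := h.refl_coeff hP hU
    obtain ⟨a', b', c'⟩ := one_sub_X_pow_coeff (rk p S - rk p U)
    rw [coeff_one_mul', a, b, a', b']
    rcases U.eq_empty_or_nonempty with rfl | hn
    · simp [rk_empty]
    · have hr := rk_pos_of_mem hP (mem_faces.1 hU).1 hn
      rw [if_neg hr.ne', if_neg (Finset.nonempty_iff_ne_empty.1 hn)]; ring
  rw [Finset.sum_congr rfl this, Finset.sum_sub_distrib, ← Finset.mul_sum]
  rw [Finset.sum_ite_eq' , if_pos (mem_faces.2 (Fc.empty hP)), mul_one, fcount, Finset.card_filter]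
  push_cast; rfl

theorem GHc.coeff2 {p : ι → W} {G H : Finset ι → ℤ[X]} {S : Finset ι} (hP : PosC p S) (h : GHc p S G H) :
    (G S).coeff 2 = ((rk p S).choose 2 : ℤ) - (rk p S - 1) * (fcount p S 1 : ℤ) + fcount p S 2
      + ∑ U ∈ (faces p S).filter (fun U => rk p U = 3), ((fcount p U 1 : ℤ) - 3) := by
  rw [h.kls' hP, finsetSum_coeff]
  have : ∀ U ∈ faces p S, ((1 - X : ℤ[X]) ^ (rk p S - rk p U) * reflect (rk p U) (G U)).coeff 2 =
      ((rk p S).choose 2 : ℤ) * (if U = ∅ then 1 else 0) - (rk p S - 1) * (if rk p U = 1 then 1 else 0)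
      + (if rk p U = 2 then 1 else 0) + if rk p U = 3 then ((fcount p U 1 : ℤ) - 3) else 0 := by
    intro U hU
    obtain ⟨a, b, c⟩ := h.refl_coeff hP hU
    obtain ⟨a', b', c'⟩ := one_sub_X_pow_coeff (rk p S - rk p U)
    have hU' : rk p U ≤ rk p S := rk_mono (mem_faces.1 hU).1
    rw [coeff_two_mul, a, b, c, a', b', c', (h.sub hU).coeff1 (hP.mono (mem_faces.1 hU).1)]
    rcases U.eq_empty_or_nonempty with rfl | hn
    · simp [rk_empty]
    · have hr := rk_pos_of_mem hP (mem_faces.1 hU).1 hn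
      rw [if_neg hr.ne', if_neg (Finset.nonempty_iff_ne_empty.1 hn)]
      by_cases h1 : rk p U = 1
      · rw [h1] at hU'; simp [h1, Nat.cast_sub hU']
      by_cases h3 : rk p U = 3
      · simp [h3]
      · simp [h1, h3]
  rw [Finset.sum_congr rfl this, Finset.sum_add_distrib, Finset.sum_add_distrib, Finset.sum_sub_distrib,
    ← Finset.mul_sum, ← Finset.mul_sum, Finset.sum_ite_eq' , if_pos (mem_faces.2 (Fc.empty hP)), mul_one,
    Finset.sum_filter, fcount, fcount, Finset.card_filter, Finset.card_filter]
  push_cast; rfl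

end PartC

section PartD
set_option linter.unusedSectionVars false
variable {ι : Type*} [DecidableEq ι] {W : Type*} [AddCommGroup W] [Module ℝ W]

/-- membership in a span tested by functionals -/
lemma mem_of_functionals {K : Submodule ℝ W} {x : W}
    (h : ∀ g : W →ₗ[ℝ] ℝ, (∀ y ∈ K, g y = 0) → g x = 0) : x ∈ K := by
  by_contra hx
  obtain ⟨f, hf, hK⟩ := Submodule.exists_le_ker_of_notMem hx
  exact hf (h f (fun y hy => by simpa using hK hy))

lemma reps_sp {p : ι → W} {S N : Finset ι} (hP : PosC p S) (hN : N ⊆ S)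
    (h : ∀ R, Fc p S R → rk p R = 1 → (R ∩ N).Nonempty) : sp p N = sp p S := by
  apply le_antisymm (sp_mono hN)
  rw [sp_le]
  intro i hi
  apply mem_of_functionals
  intro g hg
  refine zero_of_atoms hP g ?_ i hi
  intro R hR h1
  obtain ⟨j, hj⟩ := h R hR h1
  rw [Finset.mem_inter] at hj
  exact ⟨j, hj.1, hg _ (mem_sp hj.2)⟩

lemma reps_face_sp {p : ι → W} {S N U : Finset ι} (hP : PosC p S)
    (h : ∀ R, Fc p S R → rk p R = 1 → (R ∩ N).Nonempty) (hU : Fc p S U) : sp p (U ∩ N) = sp p U := by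
  apply reps_sp (hP.mono hU.1) Finset.inter_subset_left
  intro R hR h1
  obtain ⟨j, hj⟩ := h R (hU.trans hR) h1
  rw [Finset.mem_inter] at hj
  exact ⟨j, by simp [hj.1, hj.2, hR.1 hj.1]⟩

lemma reps_face {p : ι → W} {S N U : Finset ι} (hP : PosC p S) (hN : N ⊆ S)
    (h : ∀ R, Fc p S R → rk p R = 1 → (R ∩ N).Nonempty) (hU : Fc p N U) :
    ∃ U', Fc p S U' ∧ U = U' ∩ N := by
  obtain ⟨hUN, f, h1, h2⟩ := hU
  have h3 := nonneg_of_atoms hP f (fun R hR hr => by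
    obtain ⟨j, hj⟩ := h R hR hr
    rw [Finset.mem_inter] at hj
    exact ⟨j, hj.1, h1 j hj.2⟩)
  refine ⟨S.filter (fun i => f (p i) = 0), ⟨Finset.filter_subset _ _, f, h3, fun i hi => by simp [hi]⟩, ?_⟩
  ext i
  simp only [Finset.mem_inter, Finset.mem_filter]
  constructor
  · intro hi; exact ⟨⟨hN (hUN hi), (h2 i (hUN hi)).2 hi⟩, hUN hi⟩
  · rintro ⟨⟨_, h4⟩, h5⟩; exact (h2 i h5).1 h4

/-- Convex position. -/
def Cvx (p : ι → W) (S : Finset ι) : Prop := PosC p S ∧ ∀ v ∈ S, Fc p S {v}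

lemma Cvx.mono {p : ι → W} {S T : Finset ι} (h : Cvx p S) (hT : T ⊆ S) : Cvx p T :=
  ⟨h.1.mono hT, fun v hv => (h.2 v (hT hv)).restrict' hT (by simpa using hv)⟩

lemma PosC.ne_zero {p : ι → W} {S : Finset ι} (h : PosC p S) {v : ι} (hv : v ∈ S) : p v ≠ 0 := by
  obtain ⟨f, hf⟩ := h
  intro h0; have := hf v hv; rw [h0] at this; simp at this

lemma rk_singleton {p : ι → W} {v : ι} (h : p v ≠ 0) : rk p {v} = 1 := by
  unfold rk sp; rw [Finset.coe_singleton, Set.image_singleton]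
  exact finrank_span_singleton h

lemma sp_singleton {p : ι → W} {v : ι} : sp p {v} = Submodule.span ℝ {p v} := by
  unfold sp; simp

lemma Cvx.eq_singleton {p : ι → W} {S T : Finset ι} (h : Cvx p S) (hT : T ⊆ S) (h1 : rk p T = 1) {v : ι}
    (hv : v ∈ T) : T = {v} := by
  have h2 := (h.mono hT).2 v hv
  refine (h2.eq_of_rk (Finset.Subset.refl _) h2.1 ?_).symm
  rw [h1, rk_singleton (h.1.ne_zero (hT hv))]

lemma nonempty_of_rk {p : ι → W} {T : Finset ι} (h : 0 < rk p T) : T.Nonempty := by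
  rw [Finset.nonempty_iff_ne_empty]; rintro rfl; rw [rk_empty] at h; omega

lemma Cvx.fcount_one {p : ι → W} {S : Finset ι} (h : Cvx p S) : fcount p S 1 = S.card := by
  unfold fcount
  symm
  refine Finset.card_bij (fun v _ => {v}) ?_ ?_ ?_
  · intro v hv; simp [mem_faces, h.2 v hv, rk_singleton (h.1.ne_zero hv)]
  · intro a _ b _ hab; simpa using hab
  · intro T hT
    simp only [Finset.mem_filter, mem_faces] at hT
    obtain ⟨v, hv⟩ := nonempty_of_rk (p := p) (T := T) (by omega)
    exact ⟨v, hT.1.1 hv, (h.eq_singleton hT.1.1 hT.2 hv).symm⟩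

lemma euler_rank (p : ι → W) (S : Finset ι) (hP : PosC p S) (hr : 0 < rk p S) :
    ∑ j ∈ Finset.range (rk p S + 1), (-1 : ℤ) ^ j * fcount p S j = 0 := by
  have := euler_full p S hP (nonempty_of_rk hr)
  rw [← Finset.sum_fiberwise_of_maps_to (t := Finset.range (rk p S + 1)) (g := fun T => rk p T)] at this
  · rw [← this]
    refine Finset.sum_congr rfl fun j _ => ?_
    rw [Finset.sum_congr rfl (g := fun _ => (-1 : ℤ) ^ j)]
    · rw [Finset.sum_const, fcount]; simp [mul_comm]
    · intro T hT; rw [(Finset.mem_filter.1 hT).2]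
  · intro T hT
    rw [Finset.mem_range]
    have := rk_mono (p := p) (mem_faces.1 hT).1
    omega

lemma fcount_zero {p : ι → W} {S : Finset ι} (hP : PosC p S) : fcount p S 0 = 1 := by
  unfold fcount
  rw [Finset.card_eq_one]
  refine ⟨∅, ?_⟩
  ext T
  simp only [Finset.mem_filter, mem_faces, Finset.mem_singleton]
  constructor
  · rintro ⟨h, h0⟩
    by_contra hne
    have := rk_pos_of_mem hP h.1 (Finset.nonempty_iff_ne_empty.2 hne)
    omega
  · rintro rfl; exact ⟨Fc.empty hP, rk_empty p⟩

lemma fcount_top {p : ι → W} {S : Finset ι} : fcount p S (rk p S) = 1 := by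
  unfold fcount
  rw [Finset.card_eq_one]
  refine ⟨S, ?_⟩
  ext T
  simp only [Finset.mem_filter, mem_faces, Finset.mem_singleton]
  constructor
  · rintro ⟨h, h0⟩
    exact h.eq_of_rk (Finset.Subset.refl _) h.1 h0.ge
  · rintro rfl; exact ⟨Fc.refl _ _, rfl⟩

lemma fcount_rank2 {p : ι → W} {S : Finset ι} (hP : PosC p S) (hr : rk p S = 2) : fcount p S 1 = 2 := by
  have := euler_rank p S hP (by omega)
  have h0 := fcount_zero hP
  have h1 := fcount_top (p := p) (S := S)
  rw [hr] at this h1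
  simp only [Finset.sum_range_succ, Finset.sum_range_zero, h0, h1] at this
  push_cast at this; omega

lemma fcount_rank3 {p : ι → W} {S : Finset ι} (hP : PosC p S) (hr : rk p S = 3) :
    fcount p S 2 = fcount p S 1 := by
  have := euler_rank p S hP (by omega)
  have h0 := fcount_zero hP
  have h1 := fcount_top (p := p) (S := S)
  rw [hr] at this h1
  simp only [Finset.sum_range_succ, Finset.sum_range_zero, h0, h1] at this
  push_cast at this; omega

lemma fcount_rank4 {p : ι → W} {S : Finset ι} (hP : PosC p S) (hr : rk p S = 4) :
    fcount p S 2 + 2 = fcount p S 1 + fcount p S 3 := by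
  have := euler_rank p S hP (by omega)
  have h0 := fcount_zero hP
  have h1 := fcount_top (p := p) (S := S)
  rw [hr] at this h1
  simp only [Finset.sum_range_succ, Finset.sum_range_zero, h0, h1] at this
  push_cast at this; omega

lemma Cvx.card_rank2 {p : ι → W} {S T : Finset ι} (h : Cvx p S) (hT : T ⊆ S) (hr : rk p T = 2) :
    T.card = 2 := by
  rw [← (h.mono hT).fcount_one, fcount_rank2 (h.mono hT).1 hr]

lemma Cvx.three_le {p : ι → W} {S T : Finset ι} (h : Cvx p S) (hT : T ⊆ S) (h3 : 3 ≤ T.card) :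
    3 ≤ rk p T := by
  by_contra hlt
  have hn : T.Nonempty := Finset.card_pos.1 (by omega)
  have := rk_pos_of_mem h.1 hT hn
  have : rk p T = 1 ∨ rk p T = 2 := by omega
  rcases this with h1 | h1
  · obtain ⟨v, hv⟩ := hn
    have := h.eq_singleton hT h1 hv
    rw [this] at h3; simp at h3
  · have := h.card_rank2 hT h1; omega

lemma rk_le_card (p : ι → W) (T : Finset ι) : rk p T ≤ T.card := by
  unfold rk sp
  have := finrank_span_finset_le_card (R := ℝ) (T.image p)
  rw [Finset.coe_image] at this
  exact this.trans Finset.card_image_le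

lemma Cvx.rk_pair {p : ι → W} {S : Finset ι} (h : Cvx p S) {v w : ι} (hv : v ∈ S) (hw : w ∈ S) (hne : v ≠ w) :
    rk p {v, w} = 2 := by
  have hsub : ({v, w} : Finset ι) ⊆ S := by
    intro x hx; simp at hx; rcases hx with rfl | rfl <;> assumption
  have h1 := rk_le_card p {v, w}
  have h2 := rk_pos_of_mem h.1 hsub ⟨v, by simp⟩
  have h3 : rk p {v, w} ≠ 1 := by
    intro h4
    have := h.eq_singleton hsub h4 (v := v) (by simp)
    have : w ∈ ({v} : Finset ι) := by rw [← this]; simp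
    simp at this; exact hne this.symm
  have := Finset.card_le_two (a := v) (b := w)
  omega

/-- The covers of a face -/
def covers (p : ι → W) (S Z : Finset ι) : Finset (Finset ι) :=
  (faces p S).filter (fun T => Z ⊆ T ∧ rk p T = rk p Z + 1)

lemma mem_covers {p : ι → W} {S Z T : Finset ι} : T ∈ covers p S Z ↔ Fc p S T ∧ Z ⊆ T ∧ rk p T = rk p Z + 1 := by
  simp [covers, mem_faces]

lemma card_quot {p : ι → W} {S T : Finset ι} (hT : Fc p S T) (k : ℕ) :
    ((faces p S).filter (fun X => T ⊆ X ∧ rk p X = rk p T + k)).card = fcount (Qp p T) (S \ T) k := by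
  have := sum_quot hT (fun X => if rk p X = rk p T + k then 1 else 0)
  rw [← Finset.sum_filter, Finset.filter_filter, ← Finset.card_eq_sum_ones] at this
  rw [this, fcount, Finset.card_filter]
  refine Finset.sum_congr rfl fun U _ => ?_
  have := rk_quot p T U
  congr 1
  simp only [eq_iff_iff]
  omega

lemma rk_quot_all {p : ι → W} {S T : Finset ι} (hT : T ⊆ S) : rk (Qp p T) (S \ T) + rk p T = rk p S := by
  rw [rk_quot, Finset.union_sdiff_of_subset hT]

lemma diamond {p : ι → W} {S Z : Finset ι} (hZ : Fc p S Z) (hr : rk p S = rk p Z + 2) :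
    (covers p S Z).card = 2 := by
  unfold covers
  rw [card_quot hZ 1]
  apply fcount_rank2 (pos_quot hZ)
  have := rk_quot_all (p := p) hZ.1
  omega

/-- neighbours -/
def Nb (p : ι → W) (S : Finset ι) (v : ι) : Finset ι := S.filter (fun w => w ≠ v ∧ Fc p S {v, w})

lemma mem_Nb {p : ι → W} {S : Finset ι} {v w : ι} : w ∈ Nb p S v ↔ w ≠ v ∧ Fc p S {v, w} := by
  simp only [Nb, Finset.mem_filter]
  constructor
  · exact fun h => h.2
  · intro h; exact ⟨h.2.1 (by simp), h⟩

lemma Nb_sub {p : ι → W} {S : Finset ι} {v : ι} : Nb p S v ⊆ S := Finset.filter_subset _ _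

lemma Nb_symm {p : ι → W} {S : Finset ι} {v w : ι} : w ∈ Nb p S v ↔ v ∈ Nb p S w := by
  rw [mem_Nb, mem_Nb, Finset.pair_comm, ne_comm]

lemma Nb_face {p : ι → W} {S G : Finset ι} (hG : Fc p S G) {v : ι} (hv : v ∈ G) :
    Nb p G v = Nb p S v ∩ G := by
  ext w
  simp only [Finset.mem_inter, mem_Nb]
  constructor
  · rintro ⟨h1, h2⟩; exact ⟨⟨h1, hG.trans h2⟩, h2.1 (by simp)⟩
  · rintro ⟨⟨h1, h2⟩, h3⟩
    refine ⟨h1, h2.restrict' hG.1 ?_⟩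
    intro x hx; simp at hx; rcases hx with rfl | rfl <;> assumption

lemma Cvx.cover_singleton {p : ι → W} {S T : Finset ι} (h : Cvx p S) {v : ι} (hv : v ∈ S) :
    T ∈ covers p S {v} ↔ ∃ w ∈ Nb p S v, T = {v, w} := by
  rw [mem_covers, rk_singleton (h.1.ne_zero hv)]
  constructor
  · rintro ⟨hT, h1, h2⟩
    have hc := h.card_rank2 hT.1 h2
    have hvT : v ∈ T := h1 (by simp)
    have : (T.erase v).card = 1 := by rw [Finset.card_erase_of_mem hvT, hc]
    obtain ⟨w, hw⟩ := Finset.card_eq_one.1 this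
    have hTe : T = {v, w} := by rw [← Finset.insert_erase hvT, hw]
    refine ⟨w, ?_, hTe⟩
    rw [mem_Nb, ← hTe]
    refine ⟨?_, hT⟩
    have : w ∈ T.erase v := by rw [hw]; simp
    exact Finset.ne_of_mem_erase this
  · rintro ⟨w, hw, rfl⟩
    have := mem_Nb.1 hw
    exact ⟨this.2, by simp, h.rk_pair hv (Nb_sub hw) (Ne.symm this.1)⟩

lemma Cvx.card_covers_singleton {p : ι → W} {S : Finset ι} (h : Cvx p S) {v : ι} (hv : v ∈ S) :
    (covers p S {v}).card = (Nb p S v).card := by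
  symm
  refine Finset.card_bij (fun w _ => {v, w}) ?_ ?_ ?_
  · intro w hw; exact (h.cover_singleton hv).2 ⟨w, hw, rfl⟩
  · intro a ha b hb hab
    have : a ∈ ({v, b} : Finset ι) := by rw [← hab]; simp
    simp [(mem_Nb.1 ha).1] at this; exact this
  · intro T hT
    obtain ⟨w, hw, e⟩ := (h.cover_singleton hv).1 hT
    exact ⟨w, hw, e.symm⟩

lemma Cvx.polygon_Nb {p : ι → W} {S : Finset ι} (h : Cvx p S) (hr : rk p S = 3) {v : ι} (hv : v ∈ S) :
    (Nb p S v).card = 2 := by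
  rw [← h.card_covers_singleton hv]
  exact diamond (h.2 v hv) (by rw [rk_singleton (h.1.ne_zero hv), hr])

/-- atoms of the vertex quotient contain neighbours -/
lemma Cvx.quot_reps {p : ι → W} {S : Finset ι} (h : Cvx p S) {v : ι} (hv : v ∈ S) :
    ∀ R, Fc (Qp p {v}) (S \ {v}) R → rk (Qp p {v}) R = 1 → ∃ w ∈ Nb p S v, R = {w} := by
  intro R hR h1
  have h2 := rk_quot p {v} R
  have h3 := (fc_quot (h.2 v hv) hR.1).1 hR
  obtain ⟨w, hw, e⟩ := (h.cover_singleton (T := {v} ∪ R) hv).1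
    (mem_covers.2 ⟨h3, Finset.subset_union_left, by omega⟩)
  refine ⟨w, hw, ?_⟩
  have hvR : v ∉ R := fun hv' => by have := hR.1 hv'; simp at this
  ext x
  have : x ∈ {v} ∪ R ↔ x ∈ ({v, w} : Finset ι) := by rw [e]
  simp only [Finset.mem_union, Finset.mem_singleton, Finset.mem_insert] at this ⊢
  have hwv := (mem_Nb.1 hw).1
  constructor
  · intro hx
    rcases this.1 (Or.inr hx) with rfl | h
    · exact absurd hx hvR
    · exact h
  · rintro rfl
    rcases this.2 (Or.inr rfl) with h | h
    · exact absurd h hwv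
    · exact h

lemma Nb_sub_sdiff {p : ι → W} {S : Finset ι} {v : ι} : Nb p S v ⊆ S \ {v} := by
  intro w hw; simp [Nb_sub hw, (mem_Nb.1 hw).1]

/-- The vertex figure is in convex position -/
lemma Cvx.quot_cvx {p : ι → W} {S : Finset ι} (h : Cvx p S) {v : ι} (hv : v ∈ S) :
    Cvx (Qp p {v}) (Nb p S v) := by
  have hP := pos_quot (h.2 v hv)
  refine ⟨hP.mono Nb_sub_sdiff, fun w hw => ?_⟩
  refine Fc.restrict' (S := S \ {v}) ?_ Nb_sub_sdiff (by simpa using hw)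
  rw [fc_quot (h.2 v hv) (by simpa using Nb_sub_sdiff hw)]
  exact (mem_Nb.1 hw).2

lemma Cvx.quot_meets {p : ι → W} {S : Finset ι} (h : Cvx p S) {v : ι} (hv : v ∈ S) :
    ∀ R, Fc (Qp p {v}) (S \ {v}) R → rk (Qp p {v}) R = 1 → (R ∩ Nb p S v).Nonempty := by
  intro R hR h1
  obtain ⟨w, hw, rfl⟩ := h.quot_reps hv R hR h1
  exact ⟨w, by simp [hw]⟩

/-- Faces of the vertex figure -/
lemma Cvx.quot_face {p : ι → W} {S U : Finset ι} (h : Cvx p S) {v : ι} (hv : v ∈ S)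
    (hU : Fc (Qp p {v}) (Nb p S v) U) : ∃ G, Fc p S G ∧ v ∈ G ∧ U = G ∩ Nb p S v := by
  obtain ⟨U', h1, h2⟩ := reps_face (pos_quot (h.2 v hv)) Nb_sub_sdiff (h.quot_meets hv) hU
  refine ⟨{v} ∪ U', (fc_quot (h.2 v hv) h1.1).1 h1, by simp, ?_⟩
  rw [h2]
  ext x
  simp only [Finset.mem_inter, Finset.mem_union, Finset.mem_singleton]
  constructor
  · rintro ⟨a, b⟩; exact ⟨Or.inr a, b⟩
  · rintro ⟨rfl | a, b⟩
    · exact absurd rfl (mem_Nb.1 b).1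
    · exact ⟨a, b⟩

lemma Cvx.quot_face' {p : ι → W} {S G : Finset ι} (h : Cvx p S) {v : ι} (hv : v ∈ G)
    (hG : Fc p S G) : Fc (Qp p {v}) (Nb p S v) (G ∩ Nb p S v) ∧
      rk (Qp p {v}) (G ∩ Nb p S v) + 1 = rk p G := by
  have hvS := hG.1 hv
  have e : {v} ∪ (G \ {v}) = G := Finset.union_sdiff_of_subset (by simpa using hv)
  have h1 : Fc (Qp p {v}) (S \ {v}) (G \ {v}) := by
    rw [fc_quot (h.2 v hvS) (Finset.sdiff_subset_sdiff hG.1 (Finset.Subset.refl _)), e]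
    exact hG
  have e2 : G \ {v} ∩ Nb p S v = G ∩ Nb p S v := by
    ext x
    simp only [Finset.mem_inter, Finset.mem_sdiff, Finset.mem_singleton]
    constructor
    · rintro ⟨⟨a, _⟩, b⟩; exact ⟨a, b⟩
    · rintro ⟨a, b⟩; exact ⟨⟨a, (mem_Nb.1 b).1⟩, b⟩
  have h2 := h1.restrict (Nb_sub_sdiff (p := p) (S := S) (v := v))
  rw [e2] at h2
  refine ⟨h2, ?_⟩
  have h3 := reps_face_sp (pos_quot (h.2 v hvS)) (h.quot_meets hvS) h1
  rw [e2] at h3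
  have h4 : rk (Qp p {v}) (G ∩ Nb p S v) = rk (Qp p {v}) (G \ {v}) := by unfold rk; rw [h3]
  have h5 := rk_quot p {v} (G \ {v})
  rw [e, rk_singleton (h.1.ne_zero hvS)] at h5
  omega

/-- a functional vanishing at v, nonneg on neighbours, is nonneg -/
lemma Cvx.nonneg_of_Nb {p : ι → W} {S : Finset ι} (h : Cvx p S) {v : ι} (hv : v ∈ S) (f : W →ₗ[ℝ] ℝ)
    (h0 : f (p v) = 0) (h1 : ∀ w ∈ Nb p S v, 0 ≤ f (p w)) : ∀ w ∈ S, 0 ≤ f (p w) := by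
  have hk : sp p {v} ≤ LinearMap.ker f := sp_le.2 (by simpa using h0)
  have := nonneg_of_atoms (pos_quot (h.2 v hv)) ((sp p {v}).liftQ f hk) (fun R hR hr => by
    obtain ⟨w, hw, rfl⟩ := h.quot_reps hv R hR hr
    exact ⟨w, by simp, by simpa [Qp] using h1 w hw⟩)
  intro w hw
  by_cases hwv : w = v
  · rw [hwv, h0]
  · simpa [Qp] using this w (by simp [hw, hwv])

lemma Cvx.sp_Nb {p : ι → W} {S : Finset ι} (h : Cvx p S) {v : ι} (hv : v ∈ S) :
    sp p (insert v (Nb p S v)) = sp p S := by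
  apply le_antisymm (sp_mono (Finset.insert_subset hv Nb_sub))
  rw [sp_le]; intro i hi
  apply mem_of_functionals
  intro g hg
  have h0 : g (p v) = 0 := hg _ (mem_sp (Finset.mem_insert_self _ _))
  have h1 : ∀ w ∈ Nb p S v, g (p w) = 0 := fun w hw => hg _ (mem_sp (Finset.mem_insert_of_mem hw))
  have a := h.nonneg_of_Nb hv g h0 (fun w hw => (h1 w hw).ge) i hi
  have b := h.nonneg_of_Nb hv (-g) (by simp [h0]) (fun w hw => by simp [h1 w hw]) i hi
  simp at b; linarith

/-- Connectivity of the graph -/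
lemma Cvx.conn {p : ι → W} {S : Finset ι} (h : Cvx p S) {v0 : ι} (hv0 : v0 ∈ S) (Q : ι → Prop) (h0 : Q v0)
    (step : ∀ v ∈ S, ∀ w ∈ Nb p S v, Q w → Q v) : ∀ v ∈ S, Q v := by
  by_contra hcon
  push Not at hcon
  obtain ⟨f0, hf0⟩ := id h.1
  obtain ⟨-, g, hg, hg0⟩ := h.2 v0 hv0
  obtain ⟨v, hv, hmin⟩ := (S.filter (fun v => ¬ Q v)).exists_min_image (fun i => g (p i) / f0 (p i))
    (by obtain ⟨v, hv, hq⟩ := hcon; exact ⟨v, by simp [hv, hq]⟩)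
  rw [Finset.mem_filter] at hv
  have hnb : ∀ w ∈ Nb p S v, ¬ Q w := fun w hw hq => hv.2 (step v hv.1 w hw hq)
  set c := g (p v) / f0 (p v) with hc
  have hfv := hf0 v hv.1
  have hcpos : 0 < c := by
    apply div_pos _ hfv
    rcases (hg v hv.1).lt_or_eq with h' | h'
    · exact h'
    · exfalso
      have := (hg0 v hv.1).1 h'.symm
      rw [Finset.mem_singleton] at this
      rw [this] at hv; exact hv.2 h0
  have := h.nonneg_of_Nb hv.1 (g - c • f0) (by simp [hc]; field_simp; simp) (fun w hw => by
    have h1 := hmin w (by simp [Nb_sub hw, hnb w hw])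
    have h2 := hf0 w (Nb_sub hw)
    rw [le_div_iff₀ h2] at h1
    simp; linarith) v0 hv0
  have h3 := (hg0 v0 hv0).2 (by simp)
  have h4 := hf0 v0 hv0
  simp [h3] at this
  nlinarith

end PartD

section PartE1
set_option linter.unusedSectionVars false
variable {ι : Type*} [DecidableEq ι] {W : Type*} [AddCommGroup W] [Module ℝ W]

lemma faces_sub {p : ι → W} {S G : Finset ι} (hG : Fc p S G) :
    faces p G = (faces p S).filter (fun T => T ⊆ G) := by
  ext T; simp only [mem_faces, Finset.mem_filter]
  exact ⟨fun h => ⟨hG.trans h, h.1⟩, fun h => h.1.restrict' hG.1 h.2⟩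

/-- the faces of rank k -/
def fk (p : ι → W) (S : Finset ι) (k : ℕ) : Finset (Finset ι) := (faces p S).filter (fun T => rk p T = k)

lemma mem_fk {p : ι → W} {S T : Finset ι} {k : ℕ} : T ∈ fk p S k ↔ Fc p S T ∧ rk p T = k := by
  simp [fk, mem_faces]

lemma fk_card {p : ι → W} {S : Finset ι} {k : ℕ} : (fk p S k).card = fcount p S k := rfl

lemma fk_sub {p : ι → W} {S G : Finset ι} (hG : Fc p S G) (k : ℕ) :
    fk p G k = (fk p S k).filter (fun T => T ⊆ G) := by
  unfold fk; rw [faces_sub hG, Finset.filter_comm]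

lemma Cvx.rank4_sum {p : ι → W} {S : Finset ι} (h : Cvx p S) (hr : rk p S = 4) :
    ∑ G ∈ fk p S 3, ((G.card : ℤ) - 2) = 2 * S.card - 4 := by
  have h1 : ∑ G ∈ fk p S 3, G.card = 2 * fcount p S 2 := by
    have : ∀ G ∈ fk p S 3, G.card = ∑ e ∈ fk p S 2, if e ⊆ G then 1 else 0 := by
      intro G hG
      rw [mem_fk] at hG
      rw [← (h.mono hG.1.1).fcount_one, ← fcount_rank3 (h.mono hG.1.1).1 hG.2, ← fk_card, fk_sub hG.1,
        Finset.card_filter]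
    rw [Finset.sum_congr rfl this, Finset.sum_comm, ← fk_card, mul_comm, ← smul_eq_mul, ← Finset.sum_const]
    refine Finset.sum_congr rfl fun e he => ?_
    rw [mem_fk] at he
    rw [← Finset.card_filter, ← diamond (p := p) (S := S) he.1 (by omega)]
    congr 1
    ext G; simp only [Finset.mem_filter, mem_fk, mem_covers]
    constructor
    · rintro ⟨⟨a, b⟩, c⟩; exact ⟨a, c, by omega⟩
    · rintro ⟨a, b, c⟩; exact ⟨⟨a, by omega⟩, b⟩
  have h2 := fcount_rank4 h.1 hr
  rw [h.fcount_one] at h2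
  rw [Finset.sum_sub_distrib, Finset.sum_const, fk_card]
  have h1' : ∑ G ∈ fk p S 3, (G.card : ℤ) = 2 * fcount p S 2 := by exact_mod_cast h1
  rw [h1']
  simp only [nsmul_eq_mul]
  omega

/-- Sign changes of a functional around a polygon. -/
lemma polygon_sign {p : ι → W} {S : Finset ι} (h : Cvx p S) (hr : rk p S = 3) (f : W →ₗ[ℝ] ℝ) :
    ((fk p S 2).filter (fun e => (e.filter (fun w => f (p w) < 0)).card = 1)).card ≤ 2 := by
  set neg := S.filter (fun w => f (p w) < 0) with hneg
  have hcard : ∀ e ∈ fk p S 2, e.card = 2 := fun e he =>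
    h.card_rank2 (mem_fk.1 he).1.1 (mem_fk.1 he).2
  have hsub : ∀ e ∈ fk p S 2, e ⊆ neg ↔ (e.filter (fun w => f (p w) < 0)).card = 2 := by
    intro e he
    have h1 := hcard e he
    constructor
    · intro hs
      rw [Finset.filter_true_of_mem, h1]
      intro w hw; exact (Finset.mem_filter.1 (hs hw)).2
    · intro hs w hw
      have : e.filter (fun w => f (p w) < 0) = e :=
        Finset.eq_of_subset_of_card_le (Finset.filter_subset _ _) (by omega)
      rw [← this] at hw
      exact Finset.mem_filter.2 ⟨(mem_fk.1 he).1.1 (Finset.mem_filter.1 hw).1, (Finset.mem_filter.1 hw).2⟩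
  -- double count
  have dc : ∑ e ∈ fk p S 2, (e.filter (fun w => f (p w) < 0)).card = 2 * neg.card := by
    have : ∀ e ∈ fk p S 2, (e.filter (fun w => f (p w) < 0)).card =
        ∑ w ∈ neg, if w ∈ e then 1 else 0 := by
      intro e he
      rw [← Finset.card_filter]
      congr 1
      ext w; simp only [hneg, Finset.mem_filter]
      constructor
      · rintro ⟨a, b⟩; exact ⟨⟨(mem_fk.1 he).1.1 a, b⟩, a⟩
      · rintro ⟨⟨_, b⟩, a⟩; exact ⟨a, b⟩
    rw [Finset.sum_congr rfl this, Finset.sum_comm, mul_comm, ← smul_eq_mul, ← Finset.sum_const]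
    refine Finset.sum_congr rfl fun w hw => ?_
    have hwS := (Finset.mem_filter.1 hw).1
    have r1 := rk_singleton (h.1.ne_zero hwS)
    rw [← Finset.card_filter]
    refine Eq.trans ?_ (diamond (p := p) (S := S) (h.2 w hwS) (by rw [r1, hr]))
    congr 1
    ext G; simp only [Finset.mem_filter, mem_fk, mem_covers, r1, Finset.singleton_subset_iff]
    tauto
  have dc2 : ∑ e ∈ fk p S 2, (e.filter (fun w => f (p w) < 0)).card =
      ((fk p S 2).filter (fun e => (e.filter (fun w => f (p w) < 0)).card = 1)).card
      + 2 * ((fk p S 2).filter (fun e => e ⊆ neg)).card := by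
    rw [Finset.card_filter, Finset.card_filter, Finset.mul_sum, ← Finset.sum_add_distrib]
    refine Finset.sum_congr rfl fun e he => ?_
    have h1 := hsub e he
    have h2 := hcard e he
    have h3 := Finset.card_filter_le e (fun w => f (p w) < 0)
    rw [h2] at h3
    by_cases hs : e ⊆ neg
    · rw [h1.1 hs, if_neg (by omega), if_pos hs]; norm_num
    · rw [if_neg hs]
      have : (e.filter (fun w => f (p w) < 0)).card ≠ 2 := fun hh => hs (h1.2 hh)
      split_ifs <;> omega
  by_cases hall : S ⊆ neg
  · have e1 : (fk p S 2).filter (fun e => e ⊆ neg) = fk p S 2 :=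
      Finset.filter_true_of_mem fun e he => (mem_fk.1 he).1.1.trans hall
    have e2 : neg = S := Finset.Subset.antisymm (Finset.filter_subset _ _) hall
    rw [e1, fk_card, fcount_rank3 h.1 hr, h.fcount_one] at dc2
    rw [e2] at dc
    omega
  · have eu := euler_neg S.card p S le_rfl h.1 f
    have e0 : ∑ T ∈ (faces p S).filter (fun T => ∀ i ∈ T, f (p i) < 0), (-1 : ℤ) ^ rk p T =
        1 - neg.card + ((fk p S 2).filter (fun e => e ⊆ neg)).card := by
      have c1 : (neg.card : ℤ) = ((fk p S 1).filter (fun e => e ⊆ neg)).card := by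
        congr 1
        refine Finset.card_bij (fun v _ => {v}) ?_ ?_ ?_
        · intro v hv
          have hvS := (Finset.mem_filter.1 hv).1
          rw [Finset.mem_filter, mem_fk]
          exact ⟨⟨h.2 v hvS, rk_singleton (h.1.ne_zero hvS)⟩, by simpa using hv⟩
        · intro a _ b _ hab; simpa using hab
        · intro T hT
          simp only [Finset.mem_filter, mem_fk] at hT
          obtain ⟨v, hv⟩ := nonempty_of_rk (p := p) (T := T) (by omega)
          exact ⟨v, hT.2 hv, (h.eq_singleton hT.1.1.1 hT.1.2 hv).symm⟩
      have c0 : (1 : ℤ) = (fk p S 0).card := by rw [fk_card, fcount_zero h.1]; rfl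
      have c0' : (1 : ℤ) - ((fk p S 1).filter (fun e => e ⊆ neg)).card + ((fk p S 2).filter (fun e => e ⊆ neg)).card =
        (fk p S 0).card - ((fk p S 1).filter (fun e => e ⊆ neg)).card + ((fk p S 2).filter (fun e => e ⊆ neg)).card := by
        rw [← c0]
      rw [c1, c0']
      simp only [fk, Finset.filter_filter, Finset.card_filter]
      push_cast
      rw [Finset.sum_filter, ← Finset.sum_sub_distrib, ← Finset.sum_add_distrib]
      refine Finset.sum_congr rfl fun T hT => ?_
      have hT' := mem_faces.1 hT
      have hsub' : (∀ i ∈ T, f (p i) < 0) ↔ T ⊆ neg := by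
        constructor
        · intro hh i hi; exact Finset.mem_filter.2 ⟨hT'.1 hi, hh i hi⟩
        · intro hh i hi; exact (Finset.mem_filter.1 (hh hi)).2
      have hr3 : rk p T ≤ 3 := by rw [← hr]; exact rk_mono hT'.1
      by_cases hs : T ⊆ neg
      · rw [if_pos (hsub'.2 hs)]
        have : rk p T ≠ 3 := by
          intro h3
          have := hT'.eq_of_rk (Finset.Subset.refl _) hT'.1 (by omega)
          rw [this] at hs; exact hall hs
        have : rk p T = 0 ∨ rk p T = 1 ∨ rk p T = 2 := by omega
        rcases this with h1 | h1 | h1 <;> simp [h1, hs]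
      · rw [if_neg (fun hh => hs (hsub'.1 hh))]
        have : rk p T ≠ 0 := by
          intro h0
          have : T = ∅ := by
            by_contra hne
            have := rk_pos_of_mem h.1 hT'.1 (Finset.nonempty_iff_ne_empty.2 hne)
            omega
          rw [this] at hs; simp at hs
        simp [hs, this]
    rw [e0] at eu
    split_ifs at eu <;> omega

/-- A functional vanishing on a facet is proportional to the exposing functional. -/
lemma prop_of_facet {p : ι → W} {S G : Finset ι} (hG : Fc p S G) (hr : rk p S = rk p G + 1) (lam f : W →ₗ[ℝ] ℝ)
    (hl : ∀ i ∈ S, lam (p i) = 0 ↔ i ∈ G) (hf : ∀ i ∈ G, f (p i) = 0) :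
    ∃ c : ℝ, ∀ i ∈ S, f (p i) = c * lam (p i) := by
  have hne : ∃ i ∈ S, i ∉ G := by
    by_contra hcon
    push Not at hcon
    have : G = S := Finset.Subset.antisymm hG.1 hcon
    rw [this] at hr; omega
  obtain ⟨j, hj, hjG⟩ := hne
  have hlj : lam (p j) ≠ 0 := fun h => hjG ((hl j hj).1 h)
  refine ⟨f (p j) / lam (p j), ?_⟩
  have hsp : sp p (insert j G) = sp p S := by
    apply Submodule.eq_of_le_of_finrank_le (sp_mono (Finset.insert_subset hj hG.1))
    have hlt : sp p G < sp p (insert j G) := by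
      apply lt_of_le_of_ne (sp_mono (Finset.subset_insert _ _))
      intro h
      apply hjG
      apply hG.mem_of_sp hj
      rw [h]; exact mem_sp (by simp)
    have := Submodule.finrank_lt_finrank_of_lt hlt
    unfold rk at hr
    omega
  intro i hi
  have hz : ∀ k ∈ insert j G, (f - (f (p j) / lam (p j)) • lam) (p k) = 0 := by
    intro k hk
    rw [Finset.mem_insert] at hk
    rcases hk with rfl | hk
    · simp; field_simp; simp
    · simp [hf k hk, (hl k (hG.1 hk)).2 hk]
  have := zero_on_sp hz (hsp ▸ mem_sp hi)
  simp at this; linarith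

/-- Local sign count at a vertex of a rank 4 configuration. -/
lemma vertex_sign {p : ι → W} {S : Finset ι} (h : Cvx p S) (hr : rk p S = 4) {v : ι} (hv : v ∈ S)
    (f : W →ₗ[ℝ] ℝ) (h0 : f (p v) = 0) :
    ((fk p S 3).filter (fun G => v ∈ G ∧ ((Nb p G v).filter (fun w => f (p w) < 0)).card = 1)).card ≤ 2 := by
  have hk : sp p {v} ≤ LinearMap.ker f := sp_le.2 (by simpa using h0)
  have hq := h.quot_cvx hv
  have hr' : rk (Qp p {v}) (Nb p S v) = 3 := by
    have := (h.quot_face' hv (Fc.refl p S)).2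
    rw [Finset.inter_eq_right.2 Nb_sub] at this; omega
  refine le_trans ?_ (polygon_sign hq hr' ((sp p {v}).liftQ f hk))
  apply Finset.card_le_card_of_injOn (fun G => G ∩ Nb p S v)
  · intro G hG
    simp only [Finset.coe_filter, Set.mem_ofPred_eq, mem_fk] at hG ⊢
    have h1 := h.quot_face' hG.2.1 hG.1.1
    refine ⟨⟨h1.1, by omega⟩, ?_⟩
    have h2 := hG.2.2
    rw [Nb_face hG.1.1 hG.2.1, Finset.inter_comm] at h2
    rw [← h2]; congr 1
  · intro G hG G' hG' he
    simp only [Finset.coe_filter, Set.mem_ofPred_eq, mem_fk] at hG hG' he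
    have e1 := (h.mono hG.1.1.1).sp_Nb hG.2.1
    have e2 := (h.mono hG'.1.1.1).sp_Nb hG'.2.1
    rw [Nb_face hG.1.1 hG.2.1, Finset.inter_comm, he] at e1
    rw [Nb_face hG'.1.1 hG'.2.1, Finset.inter_comm, e1] at e2
    exact Finset.Subset.antisymm (hG'.1.1.subset_of_sp hG.1.1.1 e2.le) (hG.1.1.subset_of_sp hG'.1.1.1 e2.ge)

end PartE1

section PartE2
set_option linter.unusedSectionVars false
variable {ι : Type*} [DecidableEq ι] {W : Type*} [AddCommGroup W] [Module ℝ W]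

/-- Number of neighbours where a functional is negative -/
def cng (p : ι → W) (G : Finset ι) (v : ι) (f : W →ₗ[ℝ] ℝ) : ℕ :=
  ((Nb p G v).filter (fun w => f (p w) < 0)).card

lemma bil_zero {p : ι → W} {D : Finset ι} (A : W →ₗ[ℝ] W →ₗ[ℝ] ℝ)
    (h : ∀ v ∈ D, ∀ w ∈ D, A (p v) (p w) = 0) {x y : W} (hx : x ∈ sp p D) (hy : y ∈ sp p D) : A x y = 0 := by
  have h1 : ∀ v ∈ D, A (p v) y = 0 := fun v hv => zero_on_sp (f := A (p v)) (h v hv) hy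
  exact zero_on_sp (f := A.flip y) (by simpa using h1) hx

lemma face_aux {p : ι → W} {G : Finset ι} (h : Cvx p G) (hr : rk p G = 3) (A : W →ₗ[ℝ] W →ₗ[ℝ] ℝ)
    (hA : A.IsAlt) (hne : ∃ v ∈ G, ∃ w ∈ G, A (p v) (p w) ≠ 0) :
    ∑ v ∈ G, (if cng p G v (A (p v)) = 0 then (if cng p G v (-A (p v)) = 2 then 2 else 1) else 0) ≤ 2 := by
  have hpos : ∀ v ∈ G, cng p G v (A (p v)) = 0 → ∀ w ∈ G, 0 ≤ A (p v) (p w) := by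
    intro v hv h0
    apply h.nonneg_of_Nb hv _ (hA _)
    intro w hw
    by_contra hlt
    rw [cng, Finset.card_eq_zero] at h0
    have : w ∈ (Nb p G v).filter (fun w => A (p v) (p w) < 0) := Finset.mem_filter.2 ⟨hw, not_le.1 hlt⟩
    rw [h0] at this; simp at this
  set D := G.filter (fun v => cng p G v (A (p v)) = 0) with hD
  have hDG : D ⊆ G := Finset.filter_subset _ _
  have horth : ∀ v ∈ D, ∀ w ∈ D, A (p v) (p w) = 0 := by
    intro v hv w hw
    rw [hD, Finset.mem_filter] at hv hw
    have h1 := hpos v hv.1 hv.2 w hw.1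
    have h2 := hpos w hw.1 hw.2 v hv.1
    have h3 := hA.neg (p v) (p w)
    linarith
  have hD2 : D.card ≤ 2 := by
    by_contra hlt
    have h3 := h.three_le hDG (by omega)
    have hsp : sp p D = sp p G := Submodule.eq_of_le_of_finrank_le (sp_mono hDG) (by unfold rk at h3 hr; omega)
    obtain ⟨v, hv, w, hw, hvw⟩ := hne
    exact hvw (bil_zero A horth (hsp ▸ mem_sp hv) (hsp ▸ mem_sp hw))
  rw [← Finset.sum_filter, ← hD]
  by_cases hex : ∃ v ∈ D, cng p G v (-A (p v)) = 2
  · obtain ⟨v, hv, hv2⟩ := hex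
    have hvG := hDG hv
    have hv0 := (Finset.mem_filter.1 hv).2
    have hall : ∀ w ∈ Nb p G v, 0 < A (p v) (p w) := by
      have : (Nb p G v).filter (fun w => (-A (p v)) (p w) < 0) = Nb p G v := by
        apply Finset.eq_of_subset_of_card_le (Finset.filter_subset _ _)
        rw [h.polygon_Nb hr hvG]; exact hv2.ge
      intro w hw
      rw [← this, Finset.mem_filter] at hw
      simpa using hw.2
    have hDv : D = {v} := by
      apply Finset.eq_singleton_iff_unique_mem.2 ⟨hv, ?_⟩
      intro b hb
      by_contra hbv
      set Z := G.filter (fun w => A (p v) (p w) = 0) with hZ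
      have hZf : Fc p G Z := ⟨Finset.filter_subset _ _, A (p v), hpos v hvG hv0, fun i hi => by
        simp [hZ, hi]⟩
      have hvZ : v ∈ Z := by simp [hZ, hvG, hA (p v)]
      have hbZ : b ∈ Z := by simp [hZ, hDG hb, horth v hv b hb]
      have hvb : ({v, b} : Finset ι) ⊆ Z := by
        intro x hx; simp only [Finset.mem_insert, Finset.mem_singleton] at hx; rcases hx with rfl | rfl <;> assumption
      have hr2 := rk_mono (p := p) hvb
      rw [h.rk_pair hvG (hDG hb) (Ne.symm hbv)] at hr2
      have hr3 := rk_mono (p := p) hZf.1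
      have : rk p Z = 2 ∨ rk p Z = 3 := by omega
      rcases this with h2 | h3
      · have hc := h.card_rank2 hZf.1 h2
        have e : {v, b} = Z := Finset.eq_of_subset_of_card_le hvb (by
          rw [hc, Finset.card_pair (Ne.symm hbv)])
        have : b ∈ Nb p G v := mem_Nb.2 ⟨hbv, by rw [e]; exact hZf⟩
        have := hall b this
        rw [horth v hv b hb] at this; exact lt_irrefl _ this
      · have e := hZf.eq_of_rk (Finset.Subset.refl _) hZf.1 (by omega)
        have : (Nb p G v).Nonempty := Finset.card_pos.1 (by rw [h.polygon_Nb hr hvG]; norm_num)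
        obtain ⟨w, hw⟩ := this
        have h1 := hall w hw
        have h2 : w ∈ Z := by rw [e]; exact Nb_sub hw
        rw [(Finset.mem_filter.1 h2).2] at h1; exact lt_irrefl _ h1
    rw [hDv, Finset.sum_singleton, if_pos hv2]
  · push Not at hex
    rw [Finset.sum_congr rfl (g := fun _ => 1) (fun v hv => if_neg (hex v hv))]
    simpa using hD2

lemma face_count {p : ι → W} {G : Finset ι} (h : Cvx p G) (hr : rk p G = 3) (A : W →ₗ[ℝ] W →ₗ[ℝ] ℝ)
    (hA : A.IsAlt) (hne : ∃ v ∈ G, ∃ w ∈ G, A (p v) (p w) ≠ 0) :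
    2 * G.card ≤ ∑ v ∈ G, ((if cng p G v (A (p v)) = 1 then 1 else 0) +
      (if cng p G v (-A (p v)) = 1 then 1 else 0)) + 4 := by
  have h1 := face_aux h hr A hA hne
  have h2 := face_aux h hr (-A) (fun x => by simp [hA x]) (by
    obtain ⟨v, hv, w, hw, hvw⟩ := hne; exact ⟨v, hv, w, hw, by simpa using hvw⟩)
  simp only [LinearMap.neg_apply, neg_neg] at h2
  have h3 : 2 * G.card = ∑ v ∈ G, 2 := by simp [mul_comm]
  have h4 : ∑ v ∈ G, 2 ≤ ∑ v ∈ G, (((if cng p G v (A (p v)) = 1 then 1 else 0) +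
      (if cng p G v (-A (p v)) = 1 then 1 else 0)) +
      ((if cng p G v (A (p v)) = 0 then (if cng p G v (-A (p v)) = 2 then 2 else 1) else 0) +
      (if cng p G v (-A (p v)) = 0 then (if cng p G v (A (p v)) = 2 then 2 else 1) else 0))) := by
    refine Finset.sum_le_sum fun v hv => ?_
    have hle : cng p G v (A (p v)) + cng p G v (-A (p v)) ≤ 2 := by
      rw [← h.polygon_Nb hr hv, cng, cng, ← Finset.card_union_of_disjoint]
      · exact Finset.card_le_card (Finset.union_subset (Finset.filter_subset _ _) (Finset.filter_subset _ _))
      · rw [Finset.disjoint_filter]; intro w _ h1; simp; linarith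
    split_ifs <;> omega
  rw [Finset.sum_add_distrib, Finset.sum_add_distrib (f := fun v => (if cng p G v (A (p v)) = 0 then (if cng p G v (-A (p v)) = 2 then 2 else 1) else 0))] at h4
  omega

/-- A separating functional from a vertex outside can be rotated to a facet. -/
lemma exists_bad_facet {p : ι → W} {S Z : Finset ι} (h : Cvx p S) (hZ : Z ⊆ S) (hr : rk p S = 4) (hrZ : rk p Z = 4)
    {x : ι} (hx : x ∈ S) (hxZ : x ∉ Z) :
    ∃ (f : W →ₗ[ℝ] ℝ) (T : Finset ι), Fc p Z T ∧ rk p T = 3 ∧ (∀ i ∈ Z, 0 ≤ f (p i)) ∧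
      (∀ i ∈ Z, f (p i) = 0 ↔ i ∈ T) ∧ f (p x) < 0 := by
  have hsp : sp p Z = sp p S := Submodule.eq_of_le_of_finrank_le (sp_mono hZ) (by unfold rk at hr hrZ; omega)
  -- candidate set
  set C := (faces p Z).filter (fun T => ∃ f : W →ₗ[ℝ] ℝ, (∀ i ∈ Z, 0 ≤ f (p i)) ∧
      (∀ i ∈ Z, f (p i) = 0 ↔ i ∈ T) ∧ f (p x) < 0) with hC
  have hCn : C.Nonempty := by
    obtain ⟨f0, hf0⟩ := h.1
    obtain ⟨-, g, hg, hg0⟩ := h.2 x hx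
    obtain ⟨N, hN, hb⟩ := exists_big Z (fun i => - f0 (p i)) (fun i => g (p i)) (fun i hi => hg i (hZ hi))
    have hpos : ∀ i ∈ Z, 0 < (N • g - f0) (p i) := by
      intro i hi
      have : 0 < g (p i) := by
        refine lt_of_le_of_ne (hg i (hZ hi)) (fun e => ?_)
        have := (hg0 i (hZ hi)).1 e.symm
        simp at this; subst this; exact hxZ hi
      have := hb i hi this
      simp; linarith
    refine ⟨∅, ?_⟩
    rw [hC, Finset.mem_filter, mem_faces]
    refine ⟨Fc.empty (h.1.mono hZ), N • g - f0, fun i hi => (hpos i hi).le, fun i hi => ?_, ?_⟩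
    · simpa using (hpos i hi).ne'
    · have := (hg0 x hx).2 (by simp)
      simp [this, hf0 x hx]
  obtain ⟨T, hT, hmax⟩ := C.exists_max_image (rk p) hCn
  rw [hC, Finset.mem_filter, mem_faces] at hT
  obtain ⟨hTf, f, hf, hf0, hfx⟩ := hT
  refine ⟨f, T, hTf, ?_, hf, hf0, hfx⟩
  have hle : rk p T ≤ 4 := by rw [← hrZ]; exact rk_mono hTf.1
  have h4 : rk p T ≠ 4 := by
    intro h4
    have e := hTf.eq_of_rk (Finset.Subset.refl _) hTf.1 (by omega)
    have : f (p x) = 0 := zero_on_sp (T := Z) (fun i hi => (hf0 i hi).2 (e ▸ hi)) (hsp ▸ mem_sp hx)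
    linarith
  by_contra h3
  -- rotate
  have hins : rk p (insert x T) < 4 := by
    have h1 := rk_quot p T {x}
    have h2 := rk_le_card (Qp p T) {x}
    rw [Finset.union_comm] at h1
    rw [Finset.insert_eq]; simp at h2; omega
  have hz : ∃ z ∈ Z, p z ∉ sp p (insert x T) := by
    by_contra hcon
    push Not at hcon
    have := Submodule.finrank_mono (sp_le.2 hcon)
    unfold rk at hins hrZ; omega
  obtain ⟨z, hzZ, hz⟩ := hz
  obtain ⟨k', hk', hker⟩ := Submodule.exists_le_ker_of_notMem hz
  obtain ⟨k, hk, hkT⟩ : ∃ k : W →ₗ[ℝ] ℝ, k (p z) < 0 ∧ ∀ i ∈ insert x T, k (p i) = 0 := by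
    have h0 : ∀ i ∈ insert x T, k' (p i) = 0 := fun i hi => by simpa using hker (mem_sp hi)
    rcases lt_or_gt_of_ne hk' with h1 | h1
    · exact ⟨k', h1, h0⟩
    · exact ⟨-k', by simpa using h1, fun i hi => by simp [h0 i hi]⟩
  obtain ⟨m, hm, hmin⟩ := (Z.filter (fun i => k (p i) < 0)).exists_min_image (fun i => f (p i) / (- k (p i)))
    ⟨z, by simp [hzZ, hk]⟩
  rw [Finset.mem_filter] at hm
  set t := f (p m) / (- k (p m)) with ht
  have ht0 : 0 ≤ t := div_nonneg (hf m hm.1) (by linarith)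
  have hnn : ∀ i ∈ Z, 0 ≤ (f + t • k) (p i) := by
    intro i hi
    simp only [LinearMap.add_apply, LinearMap.smul_apply, smul_eq_mul]
    rcases lt_or_ge (k (p i)) 0 with h1 | h1
    · have := hmin i (by simp [hi, h1])
      rw [le_div_iff₀ (by linarith)] at this
      linarith
    · have := hf i hi; positivity
  have hm0 : (f + t • k) (p m) = 0 := by
    have : k (p m) ≠ 0 := hm.2.ne
    simp [ht]; field_simp; ring
  have hmT : m ∉ T := fun hmT => by
    have := hkT m (Finset.mem_insert_of_mem hmT); linarith [hm.2]
  set T' := Z.filter (fun i => (f + t • k) (p i) = 0) with hT'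
  have hT'f : Fc p Z T' := ⟨Finset.filter_subset _ _, f + t • k, hnn, fun i hi => by simp [hT', hi]⟩
  have hTT' : T ⊆ T' := by
    intro i hi
    rw [hT', Finset.mem_filter]
    refine ⟨hTf.1 hi, ?_⟩
    simp [(hf0 i (hTf.1 hi)).2 hi, hkT i (Finset.mem_insert_of_mem hi)]
  have hmT' : m ∈ T' := by rw [hT', Finset.mem_filter]; exact ⟨hm.1, hm0⟩
  have hlt := hTf.rk_lt hT'f.1 hTT' (fun e => hmT (e ▸ hmT'))
  have := hmax T' (by
    rw [hC, Finset.mem_filter, mem_faces]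
    refine ⟨hT'f, f + t • k, hnn, fun i hi => by simp [hT', hi], ?_⟩
    simp [hkT x (Finset.mem_insert_self _ _), hfx])
  omega

lemma Zlem {p : ι → W} {S Z : Finset ι} (h : Cvx p S) (hr : rk p S = 4) (hZ : Z ⊆ S) (hrZ : 3 ≤ rk p Z)
    (hne : Z ≠ S) :
    ∑ G ∈ (fk p S 3).filter (fun G => 3 ≤ (G ∩ Z).card), (((G ∩ Z).card : ℤ) - 2) < 2 * Z.card - 4 := by
  have hZc := rk_le_card p Z
  have hZ4 : rk p Z ≤ 4 := by rw [← hr]; exact rk_mono hZ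
  have hface : ∀ G ∈ (fk p S 3).filter (fun G => 3 ≤ (G ∩ Z).card), Fc p S G ∧ rk p G = 3 ∧ rk p (G ∩ Z) = 3 ∧
      sp p (G ∩ Z) = sp p G := by
    intro G hG
    rw [Finset.mem_filter, mem_fk] at hG
    have h3 := h.three_le (Finset.inter_subset_left.trans hG.1.1.1) hG.2
    have h4 := rk_mono (p := p) (Finset.inter_subset_left : G ∩ Z ⊆ G)
    refine ⟨hG.1.1, hG.1.2, by omega, Submodule.eq_of_le_of_finrank_le (sp_mono Finset.inter_subset_left) ?_⟩
    have := hG.1.2; unfold rk at *; omega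
  have hinj : Set.InjOn (fun G => G ∩ Z) ((fk p S 3).filter (fun G => 3 ≤ (G ∩ Z).card) : Set (Finset ι)) := by
    intro G hG G' hG' e
    have h1 := hface G hG
    have h2 := hface G' hG'
    have e' : G ∩ Z = G' ∩ Z := e
    have : sp p G = sp p G' := by rw [← h1.2.2.2, ← h2.2.2.2, e']
    exact Finset.Subset.antisymm (h2.1.subset_of_sp h1.1.1 this.le) (h1.1.subset_of_sp h2.1.1 this.ge)
  rcases (by omega : rk p Z = 3 ∨ rk p Z = 4) with h3 | h4
  · have hcard : ((fk p S 3).filter (fun G => 3 ≤ (G ∩ Z).card)).card ≤ 1 := by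
      rw [Finset.card_le_one]
      intro G hG G' hG'
      have h1 := hface G hG
      have h2 := hface G' hG'
      have e1 : sp p (G ∩ Z) = sp p Z := Submodule.eq_of_le_of_finrank_le (sp_mono Finset.inter_subset_right) (by
        have := h1.2.2.1; unfold rk at *; omega)
      have e2 : sp p (G' ∩ Z) = sp p Z := Submodule.eq_of_le_of_finrank_le (sp_mono Finset.inter_subset_right) (by
        have := h2.2.2.1; unfold rk at *; omega)
      have : sp p G = sp p G' := by rw [← h1.2.2.2, ← h2.2.2.2, e1, e2]
      exact Finset.Subset.antisymm (h2.1.subset_of_sp h1.1.1 this.le) (h1.1.subset_of_sp h2.1.1 this.ge)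
    have : ∑ G ∈ (fk p S 3).filter (fun G => 3 ≤ (G ∩ Z).card), (((G ∩ Z).card : ℤ) - 2) ≤
        ((fk p S 3).filter (fun G => 3 ≤ (G ∩ Z).card)).card • ((Z.card : ℤ) - 2) := by
      apply Finset.sum_le_card_nsmul
      intro G _
      have := Finset.card_le_card (Finset.inter_subset_right : G ∩ Z ⊆ Z); omega
    rw [nsmul_eq_mul] at this
    have h5 : (((fk p S 3).filter (fun G => 3 ≤ (G ∩ Z).card)).card : ℤ) ≤ 1 := by exact_mod_cast hcard
    nlinarith
  · rw [← (h.mono hZ).rank4_sum h4, ← Finset.sum_image (f := fun T : Finset ι => (T.card : ℤ) - 2) hinj]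
    obtain ⟨x, hx, hxZ⟩ : ∃ x ∈ S, x ∉ Z := by
      by_contra hcon; push Not at hcon; exact hne (Finset.Subset.antisymm hZ hcon)
    obtain ⟨f, T, hT, hT3, hf, hf0, hfx⟩ := exists_bad_facet h hZ hr h4 hx hxZ
    apply Finset.sum_lt_sum_of_subset (i := T)
    · intro U hU
      rw [Finset.mem_image] at hU
      obtain ⟨G, hG, rfl⟩ := hU
      have h1 := hface G hG
      exact mem_fk.2 ⟨h1.1.restrict hZ, h1.2.2.1⟩
    · exact mem_fk.2 ⟨hT, hT3⟩
    · intro hcon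
      rw [Finset.mem_image] at hcon
      obtain ⟨G, hG, rfl⟩ := hcon
      have h1 := hface G hG
      obtain ⟨-, lam, hl, hl0⟩ := h1.1
      obtain ⟨c, hc⟩ := prop_of_facet hT (by omega) f lam hf0 (fun i hi => by
        rw [Finset.mem_inter] at hi; exact (hl0 i (hZ hi.2)).2 hi.1)
      have hsp : sp p Z = sp p S := Submodule.eq_of_le_of_finrank_le (sp_mono hZ) (by unfold rk at hr h4; omega)
      have hall : ∀ i ∈ S, lam (p i) = c * f (p i) := by
        intro i hi
        have := eq_on_sp (f := lam) (g := c • f) (T := Z) (fun j hj => by simpa using hc j hj) (hsp ▸ mem_sp hi)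
        simpa using this
      obtain ⟨j, hj, hjT⟩ : ∃ j ∈ Z, j ∉ G ∩ Z := by
        by_contra hcon; push Not at hcon
        have := Finset.Subset.antisymm hT.1 hcon
        rw [this] at hT3; omega
      have hjf : 0 < f (p j) := lt_of_le_of_ne (hf j hj) (fun e => hjT ((hf0 j hj).1 e.symm))
      have hlj : 0 ≤ c * f (p j) := by rw [← hall j (hZ hj)]; exact hl j (hZ hj)
      have hc0 : 0 ≤ c := by
        by_contra hlt; push Not at hlt; nlinarith
      have hlx : 0 ≤ c * f (p x) := by rw [← hall x hx]; exact hl x hx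
      have hc00 : c = 0 := by
        by_contra hne
        have : 0 < c := lt_of_le_of_ne hc0 (Ne.symm hne)
        nlinarith
      have : G = S := Finset.Subset.antisymm h1.1.1 (fun i hi => (hl0 i hi).1 (by rw [hall i hi, hc00, zero_mul]))
      rw [this] at h1; omega
    · have := rk_le_card p T
      have : (3 : ℤ) ≤ T.card := by exact_mod_cast (by omega : 3 ≤ T.card)
      linarith
    · intro U hU _
      have h1 := (mem_fk.1 hU).2
      have := rk_le_card p U
      have : (3 : ℤ) ≤ U.card := by exact_mod_cast (by omega : 3 ≤ U.card)
      linarith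

end PartE2

section PartE3
set_option linter.unusedSectionVars false
variable {ι : Type*} [DecidableEq ι] {W : Type*} [AddCommGroup W] [Module ℝ W]

/-- The motion `u` agrees with a trivial motion on `T`. -/
def AltOn (p : ι → W) (u : ι → W →ₗ[ℝ] ℝ) (T : Finset ι) : Prop :=
  ∃ A : W →ₗ[ℝ] W →ₗ[ℝ] ℝ, A.IsAlt ∧ ∀ v ∈ T, ∀ w ∈ T, u v (p w) = A (p v) (p w)

lemma AltOn.mono {p : ι → W} {u : ι → W →ₗ[ℝ] ℝ} {S T : Finset ι} (h : AltOn p u S) (hT : T ⊆ S) : AltOn p u T := by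
  obtain ⟨A, hA, h⟩ := h
  exact ⟨A, hA, fun v hv w hw => h v (hT hv) w (hT hw)⟩

lemma AltOn.sub {p : ι → W} {u : ι → W →ₗ[ℝ] ℝ} {T : Finset ι} (h : AltOn p u T) {B : W →ₗ[ℝ] W →ₗ[ℝ] ℝ} (hB : B.IsAlt) :
    AltOn p (fun v => u v - B (p v)) T := by
  obtain ⟨A, hA, h⟩ := h
  exact ⟨A - B, fun x => by simp [hA x, hB x], fun v hv w hw => by simp [h v hv w hw]⟩

lemma AltOn.add {p : ι → W} {u : ι → W →ₗ[ℝ] ℝ} {T : Finset ι} {B : W →ₗ[ℝ] W →ₗ[ℝ] ℝ} (hB : B.IsAlt)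
    (h : AltOn p (fun v => u v - B (p v)) T) : AltOn p u T := by
  obtain ⟨A, hA, h⟩ := h
  refine ⟨A + B, fun x => by simp [hA x, hB x], fun v hv w hw => ?_⟩
  have := h v hv w hw
  simp at this ⊢; linarith

/-- wedge of two functionals -/
def wedge (a b : W →ₗ[ℝ] ℝ) : W →ₗ[ℝ] W →ₗ[ℝ] ℝ := a.smulRight b - b.smulRight a

lemma wedge_apply (a b : W →ₗ[ℝ] ℝ) (x y : W) : wedge a b x y = a x * b y - b x * a y := by simp [wedge]

lemma wedge_alt (a b : W →ₗ[ℝ] ℝ) : (wedge a b).IsAlt := fun x => by rw [wedge_apply]; ring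

lemma R4_aux {p : ι → W} {S : Finset ι} (h : Cvx p S) (hr : rk p S = 4) (u : ι → W →ₗ[ℝ] ℝ)
    (hu : ∀ G ∈ fk p S 3, AltOn p u G)
    (hZ : 3 ≤ rk p (S.filter (fun v => ∀ w ∈ S, u v (p w) = 0))) :
    ∀ v ∈ S, ∀ w ∈ S, u v (p w) = 0 := by
  set Z := S.filter (fun v => ∀ w ∈ S, u v (p w) = 0) with hZd
  have hZS : Z ⊆ S := Finset.filter_subset _ _
  by_contra hcon
  have hne : Z ≠ S := by
    intro e
    apply hcon
    intro v hv
    rw [← e] at hv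
    exact (Finset.mem_filter.1 hv).2
  have hZl := Zlem h hr hZS hZ hne
  set Null : Finset ι → Prop := fun G => ∀ v ∈ G, ∀ w ∈ G, u v (p w) = 0 with hNull
  have hu0 : ∀ v ∈ S, u v (p v) = 0 := by
    intro v hv
    obtain ⟨G, hG, hvG, hG3⟩ := exists_face_rank (r := 3) (h.2 v hv) (by rw [rk_singleton (h.1.ne_zero hv)]; omega) (by omega)
    obtain ⟨A, hA, hA'⟩ := hu G (mem_fk.2 ⟨hG, hG3⟩)
    have hvG' : v ∈ G := hvG (by simp)
    rw [hA' v hvG' v hvG']; exact hA _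
  set t : ι → Finset ι → ℕ := fun v G => (if cng p G v (u v) = 1 then 1 else 0) +
      (if cng p G v (-u v) = 1 then 1 else 0) with ht
  have hG : ∀ G ∈ (fk p S 3).filter (fun G => ¬ Null G), 2 * G.card ≤ ∑ v ∈ G, t v G + 4 := by
    intro G hG
    rw [Finset.mem_filter] at hG
    obtain ⟨A, hA, hA'⟩ := hu G hG.1
    have hGf := mem_fk.1 hG.1
    have hnn := hG.2
    simp only [hNull] at hnn
    push Not at hnn
    obtain ⟨v, hv, w, hw, hvw⟩ := hnn
    have := face_count (h.mono hGf.1.1) hGf.2 A hA ⟨v, hv, w, hw, by rwa [← hA' v hv w hw]⟩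
    refine this.trans (le_of_eq ?_)
    congr 1
    refine Finset.sum_congr rfl fun v hv => ?_
    have e1 : cng p G v (A (p v)) = cng p G v (u v) := by
      unfold cng; congr 1
      refine Finset.filter_congr fun w hw => ?_
      rw [hA' v hv w (Nb_sub hw)]
    have e2 : cng p G v (-A (p v)) = cng p G v (-u v) := by
      unfold cng; congr 1
      refine Finset.filter_congr fun w hw => ?_
      rw [LinearMap.neg_apply, LinearMap.neg_apply, hA' v hv w (Nb_sub hw)]
    rw [e1, e2]
  have hv : ∀ v ∈ S, v ∉ Z → ∑ G ∈ (fk p S 3).filter (fun G => ¬ Null G), (if v ∈ G then t v G else 0)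
      + 2 * ((fk p S 3).filter (fun G => Null G ∧ v ∈ G)).card ≤ 4 := by
    intro v hvS hvZ
    have hle : ∑ G ∈ (fk p S 3).filter (fun G => ¬ Null G), (if v ∈ G then t v G else 0) ≤
        ((fk p S 3).filter (fun G => v ∈ G ∧ cng p G v (u v) = 1)).card +
        ((fk p S 3).filter (fun G => v ∈ G ∧ cng p G v (-u v) = 1)).card := by
      rw [Finset.card_filter, Finset.card_filter, ← Finset.sum_add_distrib]
      refine (Finset.sum_le_sum_of_subset (Finset.filter_subset _ _)).trans ?_
      refine Finset.sum_le_sum fun G _ => ?_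
      by_cases hvG : v ∈ G <;> simp [hvG, ht]
    have hn1 := vertex_sign h hr hvS (u v) (hu0 v hvS)
    have hn2 := vertex_sign h hr hvS (-u v) (by simp [hu0 v hvS])
    have hnull : ((fk p S 3).filter (fun G => Null G ∧ v ∈ G)).card ≤ 1 := by
      rw [Finset.card_le_one]
      intro G hG G' hG'
      rw [Finset.mem_filter, mem_fk] at hG hG'
      by_contra hGG
      apply hvZ
      rw [hZd, Finset.mem_filter]
      refine ⟨hvS, fun w hw => ?_⟩
      obtain ⟨-, lam, hl, hl0⟩ := id hG.1.1
      obtain ⟨c, hc⟩ := prop_of_facet hG.1.1 (by omega) lam (u v) hl0 (fun i hi => hG.2.1 v hG.2.2 i hi)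
      have : ∃ j ∈ G', j ∉ G := by
        by_contra hcon; push Not at hcon
        exact hGG (hG'.1.1.eq_of_rk hG.1.1.1 hcon (by omega)).symm
      obtain ⟨j, hj, hjG⟩ := this
      have h1 := hc j (hG'.1.1.1 hj)
      rw [hG'.2.1 v hG'.2.2 j hj] at h1
      have h2 : lam (p j) ≠ 0 := fun e => hjG ((hl0 j (hG'.1.1.1 hj)).1 e)
      have h3 : c = 0 := by
        rcases mul_eq_zero.1 h1.symm with h3 | h3
        · exact h3
        · exact absurd h3 h2
      rw [hc w hw, h3, zero_mul]
    by_cases hz : ((fk p S 3).filter (fun G => Null G ∧ v ∈ G)).card = 0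
    · rw [hz]
      have : ∀ f : W →ₗ[ℝ] ℝ, ∀ G, ((Nb p G v).filter (fun w => f (p w) < 0)).card = cng p G v f := fun f G => rfl
      simp only [this] at hn1 hn2
      omega
    · have h1 : ((fk p S 3).filter (fun G => Null G ∧ v ∈ G)).card = 1 := by omega
      obtain ⟨G0, hG0⟩ := Finset.card_pos.1 (by omega : 0 < ((fk p S 3).filter (fun G => Null G ∧ v ∈ G)).card)
      rw [Finset.mem_filter, mem_fk] at hG0
      obtain ⟨-, lam, hl, hl0⟩ := id hG0.1.1
      obtain ⟨c, hc⟩ := prop_of_facet hG0.1.1 (by omega) lam (u v) hl0 (fun i hi => hG0.2.1 v hG0.2.2 i hi)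
      have this' : ∀ f : W →ₗ[ℝ] ℝ, ∀ G, ((Nb p G v).filter (fun w => f (p w) < 0)).card = cng p G v f := fun f G => rfl
      simp only [this'] at hn1 hn2
      have hzero : ∀ f : W →ₗ[ℝ] ℝ, (∀ w ∈ S, 0 ≤ f (p w)) →
          ((fk p S 3).filter (fun G => v ∈ G ∧ cng p G v f = 1)).card = 0 := by
        intro f hf
        rw [Finset.card_eq_zero, Finset.filter_eq_empty_iff]
        rintro G hG ⟨hvG, h1⟩
        have : cng p G v f = 0 := by
          unfold cng
          rw [Finset.card_eq_zero, Finset.filter_eq_empty_iff]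
          intro w hw
          rw [not_lt]
          exact hf w ((mem_fk.1 hG).1.1 (Nb_sub hw))
        omega
      rcases le_total 0 c with hc0 | hc0
      · have := hzero (u v) (fun w hw => by rw [hc w hw]; exact mul_nonneg hc0 (hl w hw))
        omega
      · have := hzero (-u v) (fun w hw => by
          rw [LinearMap.neg_apply, hc w hw]; nlinarith [mul_nonneg (neg_nonneg.2 hc0) (hl w hw)])
        omega
  have hvZ : ∀ v ∈ Z, ∀ G ∈ fk p S 3, v ∈ G → t v G = 0 := by
    intro v hv G hG hvG
    have h0 := (Finset.mem_filter.1 hv).2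
    have e1 : cng p G v (u v) = 0 := by
      unfold cng; rw [Finset.card_eq_zero, Finset.filter_eq_empty_iff]
      intro w hw; rw [h0 w ((mem_fk.1 hG).1.1 (Nb_sub hw))]; simp
    have e2 : cng p G v (-u v) = 0 := by
      unfold cng; rw [Finset.card_eq_zero, Finset.filter_eq_empty_iff]
      intro w hw; rw [LinearMap.neg_apply, h0 w ((mem_fk.1 hG).1.1 (Nb_sub hw))]; simp
    simp [ht, e1, e2]
  -- combine
  have hsum1 : ∑ G ∈ (fk p S 3).filter (fun G => ¬ Null G), ∑ v ∈ G, t v G =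
      ∑ v ∈ S \ Z, ∑ G ∈ (fk p S 3).filter (fun G => ¬ Null G), (if v ∈ G then t v G else 0) := by
    rw [Finset.sum_comm]
    refine Finset.sum_congr rfl fun G hG => ?_
    have hG' := (Finset.mem_filter.1 hG).1
    rw [← Finset.sum_filter]
    symm
    apply Finset.sum_subset
    · intro v hv; exact (Finset.mem_filter.1 hv).2
    · intro v hvG hv
      apply hvZ v _ G hG' hvG
      by_contra hvZ
      exact hv (Finset.mem_filter.2 ⟨Finset.mem_sdiff.2 ⟨(mem_fk.1 hG').1.1 hvG, hvZ⟩, hvG⟩)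
  have hsum2 : ∑ v ∈ S \ Z, ((fk p S 3).filter (fun G => Null G ∧ v ∈ G)).card =
      ∑ G ∈ (fk p S 3).filter Null, (G \ Z).card := by
    have : ∀ v ∈ S \ Z, ((fk p S 3).filter (fun G => Null G ∧ v ∈ G)).card =
        ∑ G ∈ (fk p S 3).filter Null, if v ∈ G then 1 else 0 := by
      intro v _
      rw [← Finset.card_filter, Finset.filter_filter]
    rw [Finset.sum_congr rfl this, Finset.sum_comm]
    refine Finset.sum_congr rfl fun G hG => ?_
    rw [← Finset.card_filter]
    congr 1
    ext v
    have := (mem_fk.1 (Finset.mem_filter.1 hG).1).1.1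
    simp only [Finset.mem_filter, Finset.mem_sdiff]
    constructor
    · rintro ⟨⟨a, b⟩, c⟩; exact ⟨c, b⟩
    · rintro ⟨a, b⟩; exact ⟨⟨this a, b⟩, a⟩
  have hsum3 : ∑ v ∈ S \ Z, (∑ G ∈ (fk p S 3).filter (fun G => ¬ Null G), (if v ∈ G then t v G else 0)
      + 2 * ((fk p S 3).filter (fun G => Null G ∧ v ∈ G)).card) ≤ ∑ v ∈ S \ Z, 4 :=
    Finset.sum_le_sum fun v hv' => by
      rw [Finset.mem_sdiff] at hv'; exact hv v hv'.1 hv'.2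
  rw [Finset.sum_add_distrib, ← Finset.mul_sum, ← hsum1, hsum2, Finset.sum_const, smul_eq_mul] at hsum3
  have hsum4 := Finset.sum_le_sum hG
  rw [Finset.sum_add_distrib] at hsum4
  have h4 := h.rank4_sum hr
  rw [← Finset.sum_filter_add_sum_filter_not _ Null] at h4
  have hsum4' : ∑ G ∈ (fk p S 3).filter (fun G => ¬ Null G), ((2 : ℤ) * (G.card - 2)) ≤
      ∑ G ∈ (fk p S 3).filter (fun G => ¬ Null G), ∑ v ∈ G, (t v G : ℤ) := by
    refine Finset.sum_le_sum fun G hG' => ?_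
    have := hG G hG'
    have : (2 : ℤ) * G.card ≤ ∑ v ∈ G, (t v G : ℤ) + 4 := by exact_mod_cast this
    linarith
  rw [← Finset.mul_sum] at hsum4'
  have hsum3' : ∑ G ∈ (fk p S 3).filter (fun G => ¬ Null G), ∑ v ∈ G, (t v G : ℤ) +
      2 * ∑ G ∈ (fk p S 3).filter Null, ((G \ Z).card : ℤ) ≤ (S \ Z).card * 4 := by exact_mod_cast hsum3
  have hcardSZ : ((S \ Z).card : ℤ) = S.card - Z.card := by
    rw [Finset.card_sdiff_of_subset hZS]
    have := Finset.card_le_card hZS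
    push_cast [this]; ring
  have hsplit : ∑ G ∈ (fk p S 3).filter Null, ((G.card : ℤ) - 2) =
      ∑ G ∈ (fk p S 3).filter Null, (((G ∩ Z).card : ℤ) - 2) + ∑ G ∈ (fk p S 3).filter Null, ((G \ Z).card : ℤ) := by
    rw [← Finset.sum_add_distrib]
    refine Finset.sum_congr rfl fun G _ => ?_
    have : (G.card : ℤ) = (G ∩ Z).card + (G \ Z).card := by exact_mod_cast (Finset.card_inter_add_card_sdiff G Z).symm
    linarith
  have hfin : ∑ G ∈ (fk p S 3).filter Null, (((G ∩ Z).card : ℤ) - 2) ≤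
      ∑ G ∈ (fk p S 3).filter (fun G => 3 ≤ (G ∩ Z).card), (((G ∩ Z).card : ℤ) - 2) := by
    rw [Finset.sum_filter, Finset.sum_filter]
    refine Finset.sum_le_sum fun G _ => ?_
    by_cases h3 : 3 ≤ (G ∩ Z).card
    · rw [if_pos h3]
      have : (3 : ℤ) ≤ (G ∩ Z).card := by exact_mod_cast h3
      split_ifs <;> linarith
    · rw [if_neg h3]
      have : ((G ∩ Z).card : ℤ) ≤ 2 := by exact_mod_cast (by omega : (G ∩ Z).card ≤ 2)
      split_ifs <;> linarith
  linarith

/-- functional with prescribed values on a linearly independent set -/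
lemma exists_functional {b : Set W} (hb : LinearIndependent ℝ ((↑) : b → W)) (c : W → ℝ) :
    ∃ f : W →ₗ[ℝ] ℝ, ∀ x ∈ b, f x = c x := by
  replace hb : LinearIndepOn ℝ id b := hb
  refine ⟨(Module.Basis.extend hb).constr ℝ (fun x => c x), fun x hx => ?_⟩
  have := (Module.Basis.extend hb).constr_basis ℝ (fun x => c x) ⟨x, Module.Basis.subset_extend hb hx⟩
  rwa [Module.Basis.extend_apply_self] at this

lemma R4 {p : ι → W} {S : Finset ι} (h : Cvx p S) (hr : rk p S = 4) (u : ι → W →ₗ[ℝ] ℝ)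
    (hu : ∀ G ∈ fk p S 3, AltOn p u G) : AltOn p u S := by
  obtain ⟨G, hG, -, hG3⟩ := exists_face_rank (r := 3) (Fc.empty h.1) (by rw [rk_empty]; omega) (by omega)
  obtain ⟨A, hA, hA'⟩ := hu G (mem_fk.2 ⟨hG, hG3⟩)
  obtain ⟨-, lam, hl, hl0⟩ := id hG
  have hc : ∀ v ∈ G, ∃ c : ℝ, ∀ i ∈ S, (u v - A (p v)) (p i) = c * lam (p i) := by
    intro v hv
    exact prop_of_facet hG (by omega) lam _ hl0 (fun i hi => by simp [hA' v hv i hi])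
  choose! c hc using hc
  obtain ⟨b, hb, hbs, hbl⟩ := exists_linearIndependent ℝ (p '' (G : Set ι))
  have hinj : Set.InjOn p (G : Set ι) := by
    intro v hv w hw e
    by_contra hne
    have h2 := h.rk_pair (hG.1 hv) (hG.1 hw) hne
    have h1 := rk_singleton (h.1.ne_zero (hG.1 hv))
    have : sp p {v, w} = sp p {v} := by unfold sp; simp [Set.image_pair, e]
    unfold rk at h1 h2; rw [this] at h2; omega
  obtain ⟨γ, hγ⟩ := exists_functional hbl (fun x => if hx : ∃ v ∈ G, p v = x then c hx.choose else 0)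
  have hγ' : ∀ v ∈ G, p v ∈ b → γ (p v) = c v := by
    intro v hv hb'
    rw [hγ _ hb']
    have hx : ∃ w ∈ G, p w = p v := ⟨v, hv, rfl⟩
    rw [dif_pos hx]
    rw [hinj hx.choose_spec.1 hv hx.choose_spec.2]
  apply AltOn.add hA
  apply AltOn.add (wedge_alt γ lam)
  refine ⟨0, fun x => by simp, ?_⟩
  have := R4_aux h hr (fun v => u v - A (p v) - wedge γ lam (p v)) (fun G hG => ((hu G hG).sub hA).sub (wedge_alt _ _)) ?_
  · simpa using this
  · rw [← hG3]
    apply Submodule.finrank_mono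
    unfold sp
    rw [← hbs]
    apply Submodule.span_le.2
    intro x hx
    obtain ⟨v, hv, rfl⟩ := hb hx
    apply Submodule.subset_span
    refine ⟨v, ?_, rfl⟩
    rw [Finset.mem_coe, Finset.mem_filter]
    refine ⟨hG.1 hv, fun w hw => ?_⟩
    have h1 := hc v hv w hw
    have h2 : lam (p v) = 0 := (hl0 v (hG.1 hv)).2 hv
    rw [LinearMap.sub_apply, h1, wedge_apply, hγ' v hv hx, h2]; ring

end PartE3

section PartE4
set_option linter.unusedSectionVars false
universe uu
variable {ι : Type*} [DecidableEq ι]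

/-- local form at a vertex -/
lemma R_local (n : ℕ) {W : Type uu} [AddCommGroup W] [Module ℝ W]
    (IH : ∀ (W' : Type uu) [AddCommGroup W'] [Module ℝ W'] (p : ι → W') (S : Finset ι) (u : ι → W' →ₗ[ℝ] ℝ),
      Cvx p S → rk p S < n → (∀ G, Fc p S G → rk p G ≤ 3 → AltOn p u G) → AltOn p u S)
    {p : ι → W} {S : Finset ι} (u : ι → W →ₗ[ℝ] ℝ) (h : Cvx p S) (hr : rk p S = n) (h5 : 5 ≤ n)
    (hu : ∀ G, Fc p S G → rk p G < n → AltOn p u G) {v : ι} (hv : v ∈ S) :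
    ∃ A : W →ₗ[ℝ] W →ₗ[ℝ] ℝ, A.IsAlt ∧ ∀ w ∈ insert v (Nb p S v), ∀ y ∈ sp p S, u w y = A (p w) y := by
  obtain ⟨α, hα⟩ : ∃ α : W →ₗ[ℝ] ℝ, α (p v) = 1 := by
    obtain ⟨f, hf⟩ := h.1
    refine ⟨(f (p v))⁻¹ • f, ?_⟩
    have := (hf v hv).ne'
    simp [this]
  have hvv : u v (p v) = 0 := by
    obtain ⟨A, hA, hA'⟩ := hu {v} (h.2 v hv) (by rw [rk_singleton (h.1.ne_zero hv)]; omega)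
    rw [hA' v (by simp) v (by simp)]; exact hA _
  have hvw : ∀ w ∈ Nb p S v, u w (p v) + u v (p w) = 0 := by
    intro w hw
    have hw' := mem_Nb.1 hw
    obtain ⟨A, hA, hA'⟩ := hu {v, w} hw'.2 (by rw [h.rk_pair hv (Nb_sub hw) hw'.1.symm]; omega)
    rw [hA' v (by simp) w (by simp), hA' w (by simp) v (by simp), ← hA.neg (p w) (p v)]; ring
  set B := wedge α (u v) with hB
  set u' : ι → W →ₗ[ℝ] ℝ := fun w => u w - B (p w) with hu'
  have hBv : ∀ y, B (p v) y = u v y := by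
    intro y; rw [hB, wedge_apply, hα, hvv]; ring
  have hu'w : ∀ w ∈ Nb p S v, u' w (p v) = 0 := by
    intro w hw
    have := hvw w hw
    simp only [hu', LinearMap.sub_apply, hB, wedge_apply, hvv, hα]; linarith
  have hker : ∀ w ∈ Nb p S v, sp p {v} ≤ LinearMap.ker (u' w) := fun w hw => sp_le.2 (by simpa using hu'w w hw)
  set u'' : ι → (W ⧸ sp p {v}) →ₗ[ℝ] ℝ := fun w => if hk : sp p {v} ≤ LinearMap.ker (u' w) then (sp p {v}).liftQ (u' w) hk else 0 with hu''
  have hu''w : ∀ w ∈ Nb p S v, ∀ x, u'' w ((sp p {v}).mkQ x) = u' w x := by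
    intro w hw x
    simp only [hu'', dif_pos (hker w hw)]; simp
  have hsec : sp p {v} ≤ LinearMap.ker (LinearMap.id - α.smulRight (p v)) := sp_le.2 (by
    intro i hi; simp at hi; subst hi; simp [hα])
  have hqr := (h.quot_face' hv (Fc.refl p S)).2
  rw [Finset.inter_eq_right.2 Nb_sub] at hqr
  obtain ⟨A'', hA'', hA''w⟩ := IH _ (Qp p {v}) (Nb p S v) u'' (h.quot_cvx hv) (by omega) (by
    intro U hU hU3
    obtain ⟨G, hG, hvG, rfl⟩ := h.quot_face hv hU
    have hGr := (h.quot_face' hvG hG).2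
    obtain ⟨A, hA, hA'⟩ := hu G hG (by omega)
    set s := (sp p {v}).liftQ (LinearMap.id - α.smulRight (p v)) hsec with hs
    have hAs : ∀ w, s (Qp p {v} w) = p w - α (p w) • p v := by
      intro w; simp [hs, Qp]
    refine ⟨(A - B).compl₁₂ s s, fun x => by simp [hA (s x), wedge_alt _ _ (s x), hB], ?_⟩
    intro w hw x hx
    rw [Finset.mem_inter] at hw hx
    have e1 : u'' w (Qp p {v} x) = u' w (p x) := hu''w w hw.2 _
    rw [e1, LinearMap.compl₁₂_apply, hAs, hAs]
    have e2 : ∀ y ∈ G, (A - B) (p v) (p y) = 0 := by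
      intro y hy
      rw [LinearMap.sub_apply, LinearMap.sub_apply, hBv, ← hA' v hvG y hy, sub_self]
    have e3 : ∀ y ∈ G, (A - B) (p y) (p v) = 0 := by
      intro y hy
      have h1 := hA.neg (p v) (p y)
      have h2 := (wedge_alt α (u v)).neg (p v) (p y)
      have h3 := e2 y hy
      simp only [LinearMap.sub_apply, hB] at h3 ⊢
      linarith
    simp only [map_sub, map_smul, LinearMap.sub_apply (f := (A - B) (p w)), LinearMap.sub_apply (f := A - B), LinearMap.sub_apply, LinearMap.smul_apply, smul_eq_mul]
    have e4 := e2 x hx.1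
    have e5 := e3 w hw.1
    have e6 := e2 v hvG
    simp only [LinearMap.sub_apply] at e4 e5 e6
    simp only [hu', LinearMap.sub_apply]
    rw [hA' w hw.1 x hx.1, e4, e5, e6]; ring)
  refine ⟨A''.compl₁₂ (sp p {v}).mkQ (sp p {v}).mkQ + B, fun x => by simp [hA'' _, wedge_alt _ _ x, hB], ?_⟩
  have hmk : (sp p {v}).mkQ (p v) = 0 := by
    simpa using (mem_sp (p := p) (by simp) : p v ∈ sp p {v})
  intro w hw y hy
  rw [Finset.mem_insert] at hw
  rcases hw with rfl | hw
  · rw [LinearMap.add_apply, LinearMap.add_apply, hBv, LinearMap.compl₁₂_apply, hmk]; simp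
  · rw [← h.sp_Nb hv] at hy
    refine eq_on_sp (g := (A''.compl₁₂ (sp p {v}).mkQ (sp p {v}).mkQ + B) (p w)) ?_ hy
    intro i hi
    rw [Finset.mem_insert] at hi
    rw [LinearMap.add_apply, LinearMap.add_apply, LinearMap.compl₁₂_apply]
    rcases hi with rfl | hi
    · rw [hmk, map_zero, zero_add]
      have := hu'w w hw
      simp only [hu', LinearMap.sub_apply] at this; linarith
    · have h1 : u'' w ((sp p {v}).mkQ (p i)) = A'' ((sp p {v}).mkQ (p w)) ((sp p {v}).mkQ (p i)) := hA''w w hw i hi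
      rw [← h1, hu''w w hw]; simp [hu']

theorem rigid (n : ℕ) : ∀ (W : Type uu) [AddCommGroup W] [Module ℝ W] (p : ι → W) (S : Finset ι) (u : ι → W →ₗ[ℝ] ℝ),
      Cvx p S → rk p S < n → (∀ G, Fc p S G → rk p G ≤ 3 → AltOn p u G) → AltOn p u S := by
  induction n with
  | zero => intro W _ _ p S u _ h; omega
  | succ n ih =>
    intro W _ _ p S u h hlt hu
    rcases Nat.lt_or_ge (rk p S) n with hn | hn
    · exact ih W p S u h hn hu
    have hr : rk p S = n := by omega
    by_cases h3 : n ≤ 3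
    · exact hu S (Fc.refl _ _) (by omega)
    by_cases h4 : n = 4
    · exact R4 h (by omega) u (fun G hG => hu G (mem_fk.1 hG).1 (mem_fk.1 hG).2.le)
    have hu' : ∀ G, Fc p S G → rk p G < n → AltOn p u G := fun G hG hG' =>
      ih W p G u (h.mono hG.1) hG' (fun E hE hE3 => hu E (hG.trans hE) hE3)
    have hloc := fun v (hv : v ∈ S) => R_local n ih u h hr (by omega) hu' hv
    choose! A hA hAu using hloc
    -- agreement on faces
    have hface : ∀ G, Fc p S G → rk p G < n → ∀ v ∈ G, ∀ v' ∈ G, ∀ x ∈ G, ∀ y ∈ G,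
        (A v - A v') (p x) (p y) = 0 := by
      intro G hG hGn
      obtain ⟨C, hC, hC'⟩ := hu' G hG hGn
      have : ∀ v ∈ G, ∀ x ∈ G, ∀ y ∈ G, A v (p x) (p y) = C (p x) (p y) := by
        intro v hv x hx y hy
        have hsp := (h.mono hG.1).sp_Nb hv
        refine eq_on_sp (p := p) (T := insert v (Nb p G v)) (f := (A v).flip (p y)) (g := C.flip (p y)) ?_ (hsp ▸ mem_sp hx)
        intro i hi
        have hiG : i ∈ G := by
          rw [Finset.mem_insert] at hi; rcases hi with rfl | hi
          · exact hv
          · exact Nb_sub hi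
        have hi' : i ∈ insert v (Nb p S v) := by
          rw [Nb_face hG hv] at hi
          exact Finset.insert_subset_insert _ Finset.inter_subset_left hi
        rw [LinearMap.flip_apply, LinearMap.flip_apply, ← hAu v (hG.1 hv) i hi' _ (mem_sp (hG.1 hy)), hC' i hiG y hy]
      intro v hv v' hv' x hx y hy
      rw [LinearMap.sub_apply, LinearMap.sub_apply, this v hv x hx y hy, this v' hv' x hx y hy, sub_self]
    obtain ⟨v0, hv0⟩ := nonempty_of_rk (p := p) (T := S) (by omega)
    have hconn := h.conn hv0 (fun v => ∀ x ∈ S, ∀ y ∈ S, A v (p x) (p y) = A v0 (p x) (p y)) (by intros; rfl) (by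
      intro v hv w hw hq x hx y hy
      rw [← hq x hx y hy, ← sub_eq_zero]
      have hw' := mem_Nb.1 hw
      have hr2 := h.rk_pair hv (Nb_sub hw) hw'.1.symm
      -- D (p i) = 0 on S for i in a rank-3 face containing the edge
      have h1 : ∀ G, Fc p S G → {v, w} ⊆ G → rk p G = 3 → ∀ i ∈ G, ∀ y ∈ S, (A v - A w) (p i) (p y) = 0 := by
        intro G hG hvG hG3 i hi
        have hvG' : v ∈ G := hvG (by simp)
        have hwG' : w ∈ G := hvG (by simp)
        apply zero_of_covers hG
        · intro j hj; exact hface G hG (by omega) v hvG' w hwG' i hi j hj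
        · intro R hR hGR hRr
          have : ∃ j ∈ R, j ∉ G := by
            by_contra hcon; push Not at hcon
            have := rk_mono (p := p) (T := R) (U := G) hcon; omega
          obtain ⟨j, hj, hjG⟩ := this
          exact ⟨j, hj, hjG, hface R hR (by omega) v (hGR hvG') w (hGR hwG') i (hGR hi) j hj⟩
      have h2 : ∀ x ∈ S, (A v - A w).flip (p y) (p x) = 0 := by
        apply zero_of_covers hw'.2
        · intro i hi
          obtain ⟨G, hG, hsub, hG3⟩ := exists_face_rank (r := 3) hw'.2 (by omega) (by omega)
          exact h1 G hG hsub hG3 i (hsub hi) y hy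
        · intro R hR hsub hRr
          have : ∃ j ∈ R, j ∉ ({v, w} : Finset ι) := by
            by_contra hcon; push Not at hcon
            have := rk_mono (p := p) (T := R) (U := {v, w}) hcon; omega
          obtain ⟨j, hj, hjG⟩ := this
          exact ⟨j, hj, hjG, h1 R hR hsub (by omega) j hj y hy⟩
      simpa using h2 x hx)
    refine ⟨A v0, hA v0 hv0, fun v hv w hw => ?_⟩
    rw [← hconn v hv v hv w hw, hAu v hv v (by simp) _ (mem_sp hw)]

/-- Whiteley's theorem -/
theorem rigidity {W : Type uu} [AddCommGroup W] [Module ℝ W] {p : ι → W} {S : Finset ι} (u : ι → W →ₗ[ℝ] ℝ)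
    (h : Cvx p S) (hu : ∀ G, Fc p S G → rk p G ≤ 3 → AltOn p u G) : AltOn p u S :=
  rigid (rk p S + 1) W p S u h (by omega) hu

end PartE4

section PartG1
set_option linter.unusedSectionVars false
variable {ι : Type*} [DecidableEq ι] {W : Type*} [AddCommGroup W] [Module ℝ W]

/-- Extension by zero of a function on a finset. -/
def exS {M : Type*} [AddCommGroup M] [Module ℝ M] {κ : Type*} (S : Finset κ) : (↥S → M) →ₗ[ℝ] (κ → M) where
  toFun u i := if h : i ∈ S then u ⟨i, h⟩ else 0
  map_add' u v := by ext i; by_cases h : i ∈ S <;> simp [h]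
  map_smul' c u := by ext i; by_cases h : i ∈ S <;> simp [h]

lemma exS_mem {M : Type*} [AddCommGroup M] [Module ℝ M] {κ : Type*} {S : Finset κ} (u : ↥S → M) {i : κ} (h : i ∈ S) :
    exS S u i = u ⟨i, h⟩ := by simp [exS, h]

lemma exS_coe {M : Type*} [AddCommGroup M] [Module ℝ M] {κ : Type*} {S : Finset κ} (u : ↥S → M) (i : ↥S) :
    exS S u i = u i := by simp [exS]

lemma exS_not {M : Type*} [AddCommGroup M] [Module ℝ M] {κ : Type*} {S : Finset κ} (u : ↥S → M) {i : κ} (h : i ∉ S) :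
    exS S u i = 0 := by simp [exS, h]

lemma exS_restrict {M : Type*} [AddCommGroup M] [Module ℝ M] {κ : Type*} {S : Finset κ} (u : κ → M) {i : κ} (h : i ∈ S) :
    exS S (fun j : ↥S => u j) i = u i := by simp [exS, h]

/-- The stress map of a framework of vectors. -/
def TT (p : ι → W) (S : Finset ι) (Ed : Finset (Finset ι)) : ((↥Ed → ℝ) × (↥S → ℝ)) →ₗ[ℝ] (↥S → W) where
  toFun x v := x.2 v • p v + ∑ w : ↥S, exS Ed x.1 {v.1, w.1} • p w
  map_add' x y := by
    ext v
    simp only [Prod.fst_add, Prod.snd_add, map_add, Pi.add_apply, add_smul, Finset.sum_add_distrib]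
    abel
  map_smul' c x := by
    ext v
    simp only [Prod.smul_fst, Prod.smul_snd, map_smul, Pi.smul_apply, smul_eq_mul, mul_smul, RingHom.id_apply,
      smul_add, Finset.smul_sum]

lemma TT_apply (p : ι → W) (S : Finset ι) (Ed : Finset (Finset ι)) (x) (v : ↥S) :
    TT p S Ed x v = x.2 v • p v + ∑ w : ↥S, exS Ed x.1 {v.1, w.1} • p w := rfl

/-- Motions of a framework of vectors. -/
def MotS (p : ι → W) (S : Finset ι) (Ed : Finset (Finset ι)) : Submodule ℝ (↥S → (W →ₗ[ℝ] ℝ)) where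
  carrier := {u | (∀ v : ↥S, u v (p v) = 0) ∧ ∀ v w : ↥S, ({v.1, w.1} : Finset ι) ∈ Ed → u v (p w) + u w (p v) = 0}
  zero_mem' := by simp
  add_mem' := by
    rintro u u' ⟨h1, h2⟩ ⟨h3, h4⟩
    refine ⟨fun v => by simp [h1, h3], fun v w h => ?_⟩
    have := h2 v w h; have := h4 v w h
    simp only [Pi.add_apply, LinearMap.add_apply]; linarith
  smul_mem' := by
    rintro c u ⟨h1, h2⟩
    refine ⟨fun v => by simp [h1], fun v w h => ?_⟩
    have := h2 v w h
    simp only [Pi.smul_apply, LinearMap.smul_apply, ← smul_add, this, smul_zero]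

lemma mem_MotS {p : ι → W} {S : Finset ι} {Ed : Finset (Finset ι)} {u : ↥S → (W →ₗ[ℝ] ℝ)} :
    u ∈ MotS p S Ed ↔ (∀ v : ↥S, u v (p v) = 0) ∧
      ∀ v w : ↥S, ({v.1, w.1} : Finset ι) ∈ Ed → u v (p w) + u w (p v) = 0 := Iff.rfl

lemma pair_eq_pair {a b v w : ι} (h : ({v, w} : Finset ι) = {a, b}) (_hab : a ≠ b) :
    (v = a ∧ w = b) ∨ (v = b ∧ w = a) := by
  have hv : v ∈ ({a, b} : Finset ι) := h ▸ (by simp)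
  have hw : w ∈ ({a, b} : Finset ι) := h ▸ (by simp)
  have ha : a ∈ ({v, w} : Finset ι) := h ▸ (by simp)
  have hb : b ∈ ({v, w} : Finset ι) := h ▸ (by simp)
  simp only [Finset.mem_insert, Finset.mem_singleton] at *
  grind

lemma mot_dual (p : ι → W) (S : Finset ι) (Ed : Finset (Finset ι)) (hEd : ∀ e ∈ Ed, e.card = 2 ∧ e ⊆ S)
    (u : ↥S → (W →ₗ[ℝ] ℝ)) :
    u ∈ MotS p S Ed ↔ ∀ x, ∑ v : ↥S, u v (TT p S Ed x v) = 0 := by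
  rw [mem_MotS]
  constructor
  · rintro ⟨h1, h2⟩ x
    simp only [TT_apply, map_add, map_smul, h1, mul_zero, zero_add, map_sum, smul_eq_mul]
    have hsw : ∑ v : ↥S, ∑ w : ↥S, exS Ed x.1 {v.1, w.1} * u v (p w) =
        ∑ v : ↥S, ∑ w : ↥S, exS Ed x.1 {v.1, w.1} * u w (p v) := by
      rw [Finset.sum_comm]
      refine Finset.sum_congr rfl fun v _ => Finset.sum_congr rfl fun w _ => ?_
      rw [Finset.pair_comm]
    have hz : ∑ v : ↥S, ∑ w : ↥S, exS Ed x.1 {v.1, w.1} * u v (p w) +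
        ∑ v : ↥S, ∑ w : ↥S, exS Ed x.1 {v.1, w.1} * u w (p v) = 0 := by
      rw [← Finset.sum_add_distrib]
      refine Finset.sum_eq_zero fun v _ => ?_
      rw [← Finset.sum_add_distrib]
      refine Finset.sum_eq_zero fun w _ => ?_
      by_cases h : ({v.1, w.1} : Finset ι) ∈ Ed
      · rw [← mul_add, h2 v w h, mul_zero]
      · rw [exS_not _ h]; simp
    linarith
  · intro h
    constructor
    · intro a
      have := h (0, Pi.single a 1)
      simp only [TT_apply, map_zero, Pi.zero_apply, zero_smul, Finset.sum_const_zero, add_zero, map_smul] at this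
      rw [Finset.sum_eq_single a] at this
      · simpa using this
      · intro b _ hb; simp [hb]
      · simp
    · intro a b hab
      have hne : a ≠ b := by
        rintro rfl
        have := (hEd _ hab).1
        simp at this
      have hne' : a.1 ≠ b.1 := fun h => hne (Subtype.ext h)
      have := h (Pi.single ⟨_, hab⟩ 1, 0)
      have hex : ∀ v w : ↥S, exS Ed (Pi.single (⟨{a.1, b.1}, hab⟩ : ↥Ed) (1:ℝ)) {v.1, w.1} =
          (if v = a ∧ w = b then 1 else 0) + (if v = b ∧ w = a then 1 else 0) := by
        intro v w
        by_cases h1 : v = a ∧ w = b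
        · obtain ⟨rfl, rfl⟩ := h1
          rw [exS_mem _ hab]; simp [hne]
        · by_cases h2 : v = b ∧ w = a
          · obtain ⟨rfl, rfl⟩ := h2
            have : ({v.1, w.1} : Finset ι) = {w.1, v.1} := Finset.pair_comm _ _
            rw [this, exS_mem _ hab]; simp [hne, hne.symm]
          · rw [if_neg h1, if_neg h2, add_zero]
            by_cases hm : ({v.1, w.1} : Finset ι) ∈ Ed
            · rw [exS_mem _ hm, Pi.single_eq_of_ne]
              intro h3
              rcases pair_eq_pair (congrArg Subtype.val h3) hne' with h4 | h4
              · exact h1 ⟨Subtype.ext h4.1, Subtype.ext h4.2⟩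
              · exact h2 ⟨Subtype.ext h4.1, Subtype.ext h4.2⟩
            · rw [exS_not _ hm]
      simp only [TT_apply, Pi.zero_apply, zero_smul, zero_add, hex, map_sum, map_smul, smul_eq_mul, add_mul,
        Finset.sum_add_distrib] at this
      have e1 : ∑ v : ↥S, ∑ w : ↥S, (if v = a ∧ w = b then (1:ℝ) else 0) * u v (p w) = u a (p b) := by
        rw [Finset.sum_eq_single a, Finset.sum_eq_single b] <;> simp +contextual
      have e2 : ∑ v : ↥S, ∑ w : ↥S, (if v = b ∧ w = a then (1:ℝ) else 0) * u v (p w) = u b (p a) := by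
        rw [Finset.sum_eq_single b, Finset.sum_eq_single a] <;> simp +contextual
      rw [e1, e2] at this
      exact this

theorem stress_dim [FiniteDimensional ℝ W] (p : ι → W) (S : Finset ι) (Ed : Finset (Finset ι))
    (hEd : ∀ e ∈ Ed, e.card = 2 ∧ e ⊆ S) :
    Module.finrank ℝ (LinearMap.ker (TT p S Ed)) + S.card * Module.finrank ℝ W =
      Ed.card + S.card + Module.finrank ℝ (MotS p S Ed) := by
  have h1 := LinearMap.finrank_range_add_finrank_ker (TT p S Ed)
  have h2 := LinearMap.finrank_range_add_finrank_ker (TT p S Ed).dualMap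
  rw [LinearMap.finrank_range_dualMap_eq_finrank_range] at h2
  have e := LinearMap.lsum ℝ (fun _ : ↥S => W) ℝ (M := ℝ)
  have h3 : Module.finrank ℝ (LinearMap.ker (TT p S Ed).dualMap) = Module.finrank ℝ (MotS p S Ed) := by
    have hc : MotS p S Ed = (LinearMap.ker (TT p S Ed).dualMap).comap
        (LinearMap.lsum ℝ (fun _ : ↥S => W) ℝ (M := ℝ)).toLinearMap := by
      ext u
      rw [mot_dual p S Ed hEd, Submodule.mem_comap, LinearMap.mem_ker, LinearMap.ext_iff]
      refine forall_congr' fun x => ?_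
      simp [LinearMap.dualMap_apply]
    rw [hc]
    exact (LinearEquiv.finrank_eq (LinearEquiv.ofSubmodule' (LinearMap.lsum ℝ (fun _ : ↥S => W) ℝ (M := ℝ)) _)).symm
  rw [h3, Subspace.dual_finrank_eq] at h2
  simp only [Module.finrank_prod, Module.finrank_pi, Module.finrank_pi_fintype, Finset.sum_const, Fintype.card_coe,
    Finset.card_univ, smul_eq_mul] at h1 h2
  omega

/-- Injective linear maps do not change stresses. -/
lemma ker_TT_comp {W' : Type*} [AddCommGroup W'] [Module ℝ W'] (p : ι → W) (S : Finset ι) (Ed : Finset (Finset ι))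
    (L : W →ₗ[ℝ] W') (hL : Function.Injective L) :
    LinearMap.ker (TT (fun i => L (p i)) S Ed) = LinearMap.ker (TT p S Ed) := by
  ext x
  simp only [LinearMap.mem_ker, funext_iff, TT_apply, Pi.zero_apply]
  refine forall_congr' fun v => ?_
  rw [← map_zero L, ← hL.eq_iff]
  simp [map_sum]

end PartG1

section PartG2
set_option linter.unusedSectionVars false
variable {ι : Type*} [DecidableEq ι] {W : Type*} [AddCommGroup W] [Module ℝ W]

lemma ext_rel {V : Type*} [AddCommGroup V] [Module ℝ V] (p : ι → W) (T : Finset ι) (u : ι → V)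
    (h : ∀ c : ι → ℝ, ∑ v ∈ T, c v • p v = 0 → ∑ v ∈ T, c v • u v = 0) :
    ∃ L : W →ₗ[ℝ] V, ∀ v ∈ T, L (p v) = u v := by
  let L0 : (ι → ℝ) →ₗ[ℝ] W := ∑ v ∈ T, (LinearMap.proj v).smulRight (p v)
  let U0 : (ι → ℝ) →ₗ[ℝ] V := ∑ v ∈ T, (LinearMap.proj v).smulRight (u v)
  have hL0 : ∀ c, L0 c = ∑ v ∈ T, c v • p v := fun c => by simp [L0]
  have hU0 : ∀ c, U0 c = ∑ v ∈ T, c v • u v := fun c => by simp [U0]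
  have hk : LinearMap.ker L0 ≤ LinearMap.ker U0 := fun c hc => by
    rw [LinearMap.mem_ker, hU0]; exact h c (by rw [← hL0]; exact hc)
  obtain ⟨L, hL⟩ := LinearMap.exists_extend (((LinearMap.ker L0).liftQ U0 hk) ∘ₗ
    (L0.quotKerEquivRange.symm : LinearMap.range L0 →ₗ[ℝ] _))
  refine ⟨L, fun v hv => ?_⟩
  have h1 : L0 (Pi.single v 1) = p v := by
    rw [hL0, Finset.sum_eq_single v] <;> simp +contextual [hv]
  have h2 : U0 (Pi.single v 1) = u v := by
    rw [hU0, Finset.sum_eq_single v] <;> simp +contextual [hv]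
  have h3 := LinearMap.congr_fun hL ⟨L0 (Pi.single v 1), LinearMap.mem_range_self _ _⟩
  have h4 : L0.quotKerEquivRange.symm ⟨L0 (Pi.single v 1), LinearMap.mem_range_self _ _⟩ =
      (LinearMap.ker L0).mkQ (Pi.single v 1) := by
    rw [LinearEquiv.symm_apply_eq]; rfl
  simp only [LinearMap.comp_apply, Submodule.subtype_apply, LinearEquiv.coe_coe] at h3
  rw [h4, h1] at h3
  rw [h3, ← h2]; simp

lemma anti_of_alt {A : W →ₗ[ℝ] W →ₗ[ℝ] ℝ} (h : A.IsAlt) (x y : W) : A x y = - A y x := by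
  rw [h.neg]

/-- Projection onto the span of a subconfiguration. -/
lemma exists_proj (K : Submodule ℝ W) : ∃ π : W →ₗ[ℝ] W, (∀ x, π x ∈ K) ∧ ∀ x ∈ K, π x = x := by
  obtain ⟨g, hg⟩ := LinearMap.exists_leftInverse_of_injective K.subtype K.ker_subtype
  refine ⟨K.subtype ∘ₗ g, fun x => by simp, fun x hx => ?_⟩
  have := LinearMap.congr_fun hg ⟨x, hx⟩
  simpa using congrArg Subtype.val this

lemma altOn_of_rel {p : ι → W} {u : ι → W →ₗ[ℝ] ℝ} {T : Finset ι}
    (h1 : ∀ v ∈ T, ∀ w ∈ T, u v (p w) = - u w (p v))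
    (h2 : ∀ c : ι → ℝ, ∑ v ∈ T, c v • p v = 0 → ∀ w ∈ T, ∑ v ∈ T, c v * u v (p w) = 0) : AltOn p u T := by
  obtain ⟨π, hπ, hπ'⟩ := exists_proj (sp p T)
  obtain ⟨β, hβ⟩ := ext_rel p T (fun v => u v ∘ₗ π) (fun c hc => by
    ext x
    have : (∑ v ∈ T, c v • u v) (π x) = 0 := by
      refine zero_on_sp (p := p) (T := T) (fun w hw => ?_) (hπ x)
      simpa using h2 c hc w hw
    simpa using this)
  have hb : ∀ v ∈ T, ∀ w ∈ T, β (p v) (p w) = u v (p w) := fun v hv w hw => by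
    rw [hβ v hv, LinearMap.comp_apply, hπ' _ (mem_sp hw)]
  have hanti : ∀ x ∈ sp p T, ∀ y ∈ sp p T, β x y + β y x = 0 := by
    intro x hx y hy
    have step : ∀ w ∈ T, β x (p w) + β (p w) x = 0 := by
      intro w hw
      have := zero_on_sp (p := p) (T := T) (f := β.flip (p w) + β (p w)) (fun v hv => by
        simp only [LinearMap.add_apply, LinearMap.flip_apply, hb v hv w hw, hb w hw v hv, h1 v hv w hw]; ring) hx
      simpa using this
    have := zero_on_sp (p := p) (T := T) (f := β x + β.flip x) (fun w hw => by simpa using step w hw) hy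
    simpa using this
  refine ⟨β.compl₁₂ π π, fun x => ?_, fun v hv w hw => ?_⟩
  · have := hanti _ (hπ x) _ (hπ x)
    simp only [LinearMap.compl₁₂_apply]; linarith
  · simp only [LinearMap.compl₁₂_apply, hπ' _ (mem_sp hv), hπ' _ (mem_sp hw), hb v hv w hw]

lemma AltOn.anti {p : ι → W} {u : ι → W →ₗ[ℝ] ℝ} {T : Finset ι} (h : AltOn p u T) {v w : ι} (hv : v ∈ T) (hw : w ∈ T) :
    u v (p w) = - u w (p v) := by
  obtain ⟨A, hA, h⟩ := h
  rw [h v hv w hw, h w hw v hv, anti_of_alt hA]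

lemma AltOn.rel {p : ι → W} {u : ι → W →ₗ[ℝ] ℝ} {T : Finset ι} (h : AltOn p u T) (c : ι → ℝ)
    (hc : ∑ v ∈ T, c v • p v = 0) {w : ι} (hw : w ∈ T) : ∑ v ∈ T, c v * u v (p w) = 0 := by
  obtain ⟨A, hA, h⟩ := h
  have : A (∑ v ∈ T, c v • p v) (p w) = 0 := by rw [hc]; simp
  rw [map_sum, LinearMap.sum_apply] at this
  rw [← this]
  refine Finset.sum_congr rfl fun v hv => ?_
  simp [h v hv w hw]

lemma AltOn.add' {p : ι → W} {u u' : ι → W →ₗ[ℝ] ℝ} {T : Finset ι} (h : AltOn p u T) (h' : AltOn p u' T) :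
    AltOn p (u + u') T := by
  obtain ⟨A, hA, h⟩ := h
  obtain ⟨B, hB, h'⟩ := h'
  exact ⟨A + B, fun x => by simp [hA x, hB x], fun v hv w hw => by simp [h v hv w hw, h' v hv w hw]⟩

lemma AltOn.smul' {p : ι → W} {u : ι → W →ₗ[ℝ] ℝ} {T : Finset ι} (h : AltOn p u T) (c : ℝ) :
    AltOn p (c • u) T := by
  obtain ⟨A, hA, h⟩ := h
  exact ⟨c • A, fun x => by simp [hA x], fun v hv w hw => by simp [h v hv w hw]⟩

lemma AltOn.zero' {p : ι → W} {T : Finset ι} : AltOn p 0 T :=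
  ⟨0, fun x => by simp, fun v hv w hw => by simp⟩

lemma AltOn.congr {p : ι → W} {u u' : ι → W →ₗ[ℝ] ℝ} {T : Finset ι} (h : AltOn p u T)
    (e : ∀ v ∈ T, ∀ w ∈ T, u' v (p w) = u v (p w)) : AltOn p u' T := by
  obtain ⟨A, hA, h⟩ := h
  exact ⟨A, hA, fun v hv w hw => by rw [e v hv w hw, h v hv w hw]⟩

variable (W) in
/-- Alternating bilinear forms. -/
def AltW : Submodule ℝ (W →ₗ[ℝ] W →ₗ[ℝ] ℝ) where
  carrier := {A | A.IsAlt}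
  zero_mem' := fun x => by simp
  add_mem' := fun {A B} hA hB x => by
    have := hA x; have := hB x
    simp_all
  smul_mem' := fun c A hA x => by
    have := hA x
    simp_all

lemma mem_AltW {A : W →ₗ[ℝ] W →ₗ[ℝ] ℝ} : A ∈ AltW W ↔ A.IsAlt := Iff.rfl

/-- Trivial motions. -/
def altMap (p : ι → W) (S : Finset ι) : (W →ₗ[ℝ] W →ₗ[ℝ] ℝ) →ₗ[ℝ] (↥S → (W →ₗ[ℝ] ℝ)) where
  toFun A v := A (p v)
  map_add' A B := by ext; simp
  map_smul' c A := by ext; simp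

lemma altMap_apply (p : ι → W) (S : Finset ι) (A) (v : ↥S) : altMap p S A v = A (p v) := rfl

lemma altMap_inj {p : ι → W} {S : Finset ι} (hS : sp p S = ⊤) : Function.Injective (altMap p S) := by
  intro A B h
  apply LinearMap.ext
  intro x
  refine eq_on_sp (p := p) (T := S) (fun i hi => ?_) (by rw [hS]; trivial)
  exact congrFun h ⟨i, hi⟩

lemma finrank_map_inj {V V' : Type*} [AddCommMonoid V] [Module ℝ V] [AddCommMonoid V'] [Module ℝ V']
    (f : V →ₗ[ℝ] V') (hf : Function.Injective f) (X : Submodule ℝ V) :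
    Module.finrank ℝ (X.map f) = Module.finrank ℝ X :=
  (Submodule.equivMapOfInjective f hf X).finrank_eq.symm

lemma finrank_alt_image {p : ι → W} {S : Finset ι} (hS : sp p S = ⊤) (X : Submodule ℝ (W →ₗ[ℝ] W →ₗ[ℝ] ℝ)) :
    Module.finrank ℝ (X.map (altMap p S)) = Module.finrank ℝ X := by
  have := finrank_map_inj (altMap p S) (altMap_inj hS) X
  exact this

/-- If all motions are trivial. -/
lemma motS_eq_alt {p : ι → W} {S : Finset ι} {Ed : Finset (Finset ι)} (hS : sp p S = ⊤)
    (h : ∀ u ∈ MotS p S Ed, AltOn p (exS S u) S) : MotS p S Ed = (AltW W).map (altMap p S) := by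
  ext u
  rw [Submodule.mem_map]
  constructor
  · intro hu
    obtain ⟨A, hA, hu⟩ := h u hu
    refine ⟨A, hA, ?_⟩
    funext v
    apply LinearMap.ext
    intro x
    refine eq_on_sp (p := p) (T := S) (fun i hi => ?_) (by rw [hS]; trivial)
    have := hu v v.2 i hi
    rw [exS_coe] at this
    exact this.symm
  · rintro ⟨A, hA, rfl⟩
    refine mem_MotS.2 ⟨fun v => hA (p v), fun v w _ => ?_⟩
    have := anti_of_alt hA (p v) (p w)
    simp only [altMap_apply]; linarith

theorem finrank_AltW [FiniteDimensional ℝ W] : Module.finrank ℝ (AltW W) = (Module.finrank ℝ W).choose 2 := by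
  let b := Module.finBasis ℝ W
  set r := Module.finrank ℝ W with hr
  have hsp : sp b Finset.univ = ⊤ := by
    unfold sp; rw [Finset.coe_univ, Set.image_univ, b.span_eq]
  let Ed : Finset (Finset (Fin r)) := Finset.powersetCard 2 Finset.univ
  have hEd : ∀ e ∈ Ed, e.card = 2 ∧ e ⊆ Finset.univ := fun e he => by
    simp only [Ed, Finset.mem_powersetCard] at he; exact ⟨he.2, he.1⟩
  have hpair : ∀ v w : Fin r, v ≠ w → ({v, w} : Finset (Fin r)) ∈ Ed := fun v w h => by
    simp only [Ed, Finset.mem_powersetCard]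
    exact ⟨Finset.subset_univ _, Finset.card_pair h⟩
  have h1 := stress_dim b Finset.univ Ed hEd
  have hker : LinearMap.ker (TT b Finset.univ Ed) = ⊥ := by
    rw [Submodule.eq_bot_iff]
    rintro ⟨s, σ⟩ hx
    rw [LinearMap.mem_ker] at hx
    have key : ∀ v w : ↥(Finset.univ : Finset (Fin r)),
        (if w = v then σ v else 0) + exS Ed s {v.1, w.1} = 0 := by
      intro v w
      have h2 := congrFun hx v
      have h3 := congrArg (fun x => b.repr x w) h2
      simp only [TT_apply, map_add, map_smul, map_sum, Module.Basis.repr_self, Pi.zero_apply, map_zero,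
        Finsupp.coe_add, Pi.add_apply, Finsupp.single_apply, smul_eq_mul,
        Finsupp.coe_finsetSum, Finset.sum_apply, Finsupp.coe_zero, Finsupp.coe_smul, Pi.smul_apply] at h3
      rw [Finset.sum_eq_single w] at h3
      · refine Eq.trans ?_ h3
        congr 1
        · by_cases hvw : w = v
          · simp [hvw]
          · have : ¬ (v.1 = w.1) := fun h => hvw (Subtype.ext h.symm)
            simp [hvw, this]
        · simp
      · intro i _ hi
        have : ¬ (i.1 = w.1) := fun h => hi (Subtype.ext h)
        simp [this]
      · simp
    have hσ : σ = 0 := by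
      funext v
      have := key v v
      rw [if_pos rfl, exS_not] at this
      · simpa using this
      · intro h; have := (hEd _ h).1; simp at this
    have hs : s = 0 := by
      funext e
      obtain ⟨v, w, hvw, he⟩ := Finset.card_eq_two.1 (hEd e e.2).1
      have := key ⟨v, by simp⟩ ⟨w, by simp⟩
      rw [hσ] at this
      simp only [Pi.zero_apply, ite_self, zero_add] at this
      rw [exS_mem s (by rw [← he]; exact e.2)] at this
      refine Eq.trans ?_ this
      congr 1
      exact Subtype.ext he
    rw [hσ, hs]; rfl
  have hmot := motS_eq_alt (p := b) (S := Finset.univ) (Ed := Ed) hsp (fun u hu => by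
    apply altOn_of_rel
    · intro v _ w _
      by_cases hvw : v = w
      · subst hvw
        rw [exS_mem u (Finset.mem_univ v), hu.1 ⟨v, Finset.mem_univ v⟩]; simp
      · have := hu.2 ⟨v, Finset.mem_univ v⟩ ⟨w, Finset.mem_univ w⟩ (hpair v w hvw)
        rw [exS_mem u (Finset.mem_univ v), exS_mem u (Finset.mem_univ w)]
        simp only at this; linarith
    · intro c hc w _
      have := Fintype.linearIndependent_iff.1 b.linearIndependent c hc
      simp [this])
  rw [hker, hmot, finrank_alt_image hsp] at h1
  simp only [finrank_bot, Finset.card_univ, Fintype.card_fin, Ed, Finset.card_powersetCard] at h1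
  rw [← hr] at h1
  have h2 : r.choose 2 * 2 = r * (r - 1) := by
    rw [Nat.choose_two_right, Nat.div_mul_cancel (Nat.even_mul_pred_self r).two_dvd]
  rcases r with _ | r
  · simp at *; omega
  · simp only [Nat.add_sub_cancel] at h2
    have : (r+1)*(r+1) = (r+1)*r + (r+1) := by ring
    omega

end PartG2

section PartG3
set_option linter.unusedSectionVars false
variable {ι : Type*} [DecidableEq ι] {W : Type*} [AddCommGroup W] [Module ℝ W]

/-- Smallest face containing `A`. -/
def jn (p : ι → W) (S A : Finset ι) : Finset ι := S.filter (fun i => ∀ G, Fc p S G → A ⊆ G → i ∈ G)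

lemma jn_fc (p : ι → W) (S A : Finset ι) (hA : A ⊆ S) : Fc p S (jn p S A) := by
  have hne : ((faces p S).filter (fun G => A ⊆ G)).Nonempty := ⟨S, by simp [mem_faces, Fc.refl, hA]⟩
  obtain ⟨G, hG, hmin⟩ := Finset.exists_min_image _ Finset.card hne
  rw [Finset.mem_filter, mem_faces] at hG
  have : jn p S A = G := by
    ext i
    simp only [jn, Finset.mem_filter]
    constructor
    · rintro ⟨_, h⟩; exact h G hG.1 hG.2
    · intro hi
      refine ⟨hG.1.1 hi, fun G' hG' hA' => ?_⟩
      have h1 := hmin (G ∩ G') (by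
        rw [Finset.mem_filter, mem_faces]; exact ⟨hG.1.inter hG', Finset.subset_inter hG.2 hA'⟩)
      have h2 := Finset.eq_of_subset_of_card_le Finset.inter_subset_left h1
      rw [← h2] at hi
      exact (Finset.mem_inter.1 hi).2
  rw [this]; exact hG.1

lemma sub_jn {p : ι → W} {S A : Finset ι} (hA : A ⊆ S) : A ⊆ jn p S A := fun i hi => by
  simp only [jn, Finset.mem_filter]
  exact ⟨hA hi, fun G _ h => h hi⟩

lemma jn_sub {p : ι → W} {S A G : Finset ι} (hG : Fc p S G) (hA : A ⊆ G) : jn p S A ⊆ G := fun i hi => by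
  simp only [jn, Finset.mem_filter] at hi
  exact hi.2 G hG hA

lemma jn_eq_self {p : ι → W} {S G : Finset ι} (hG : Fc p S G) : jn p S G = G :=
  (jn_sub hG (Finset.Subset.refl _)).antisymm (sub_jn hG.1)

/-- Motions of the part of a framework in proper faces containing `F`. -/
def MotN (p : ι → W) (S F : Finset ι) : Submodule ℝ (↥S → (W →ₗ[ℝ] ℝ)) where
  carrier := {u | (∀ v : ↥S, u v (p v) = 0) ∧ ∀ G, Fc p S G → F ⊆ G → G ≠ S → AltOn p (exS S u) G}
  zero_mem' := ⟨by simp, fun G _ _ _ => by rw [map_zero]; exact AltOn.zero'⟩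
  add_mem' := by
    rintro u u' ⟨h1, h2⟩ ⟨h3, h4⟩
    refine ⟨fun v => by simp [h1, h3], fun G a b c => ?_⟩
    rw [map_add]; exact (h2 G a b c).add' (h4 G a b c)
  smul_mem' := by
    rintro c u ⟨h1, h2⟩
    refine ⟨fun v => by simp [h1], fun G a b d => ?_⟩
    rw [map_smul]; exact (h2 G a b d).smul' c

lemma mem_MotN {p : ι → W} {S F : Finset ι} {u : ↥S → (W →ₗ[ℝ] ℝ)} : u ∈ MotN p S F ↔
    (∀ v : ↥S, u v (p v) = 0) ∧ ∀ G, Fc p S G → F ⊆ G → G ≠ S → AltOn p (exS S u) G := Iff.rfl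

/-- Motions vanishing on `F`. -/
def Mot0 (p : ι → W) (S F : Finset ι) : Submodule ℝ (↥S → (W →ₗ[ℝ] ℝ)) where
  carrier := {u | u ∈ MotN p S F ∧ ∀ v : ↥S, v.1 ∈ F → u v = 0}
  zero_mem' := ⟨Submodule.zero_mem _, by simp⟩
  add_mem' := by
    rintro u u' ⟨h1, h2⟩ ⟨h3, h4⟩
    exact ⟨Submodule.add_mem _ h1 h3, fun v hv => by simp [h2 v hv, h4 v hv]⟩
  smul_mem' := by
    rintro c u ⟨h1, h2⟩
    exact ⟨Submodule.smul_mem _ c h1, fun v hv => by simp [h2 v hv]⟩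

lemma mem_Mot0 {p : ι → W} {S F : Finset ι} {u : ↥S → (W →ₗ[ℝ] ℝ)} : u ∈ Mot0 p S F ↔
    u ∈ MotN p S F ∧ ∀ v : ↥S, v.1 ∈ F → u v = 0 := Iff.rfl

/-- Local motions at `v`. -/
def ZZ (p : ι → W) (S F : Finset ι) (v : ι) : Submodule ℝ (W →ₗ[ℝ] ℝ) where
  carrier := {f | f (p v) = 0 ∧ ∀ G, Fc p S G → F ⊆ G → G ≠ S → v ∈ G → ∀ w ∈ G, f (p w) = 0}
  zero_mem' := by simp
  add_mem' := by
    rintro f f' ⟨h1, h2⟩ ⟨h3, h4⟩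
    exact ⟨by simp [h1, h3], fun G a b c d w e => by simp [h2 G a b c d w e, h4 G a b c d w e]⟩
  smul_mem' := by
    rintro c f ⟨h1, h2⟩
    exact ⟨by simp [h1], fun G a b c d w e => by simp [h2 G a b c d w e]⟩

lemma mem_ZZ {p : ι → W} {S F : Finset ι} {v : ι} {f : W →ₗ[ℝ] ℝ} : f ∈ ZZ p S F v ↔
    f (p v) = 0 ∧ ∀ G, Fc p S G → F ⊆ G → G ≠ S → v ∈ G → ∀ w ∈ G, f (p w) = 0 := Iff.rfl

/-- A functional vanishing on proper faces above a face of corank at least two vanishes. -/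
lemma zero_of_proper {p : ι → W} {S F : Finset ι} (hS : sp p S = ⊤) (hF : Fc p S F) (hr : rk p F + 2 ≤ rk p S)
    (f : W →ₗ[ℝ] ℝ) (h : ∀ G, Fc p S G → F ⊆ G → G ≠ S → ∀ w ∈ G, f (p w) = 0) : f = 0 := by
  have h0 : ∀ i ∈ S, f (p i) = 0 := by
    apply zero_of_covers hF f
    · exact h F hF (Finset.Subset.refl _) (by rintro rfl; omega)
    · intro R hR hFR hk
      obtain ⟨i, hi, hiF⟩ : ∃ i ∈ R, i ∉ F := by
        by_contra hcon
        push Not at hcon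
        have : R = F := Finset.Subset.antisymm hcon hFR
        rw [this] at hk; omega
      exact ⟨i, hi, hiF, h R hR hFR (by rintro rfl; omega) i hi⟩
  apply LinearMap.ext
  intro x
  exact zero_on_sp (p := p) (T := S) h0 (by rw [hS]; trivial)

lemma rk_full {p : ι → W} {S : Finset ι} (hS : sp p S = ⊤) : rk p S = Module.finrank ℝ W := by
  unfold rk; rw [hS]; exact finrank_top ℝ W

/-- annihilator dimension -/
lemma finrank_ann [FiniteDimensional ℝ W] (p : ι → W) (T : Finset ι) (X : Submodule ℝ (W →ₗ[ℝ] ℝ))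
    (hX : ∀ f, f ∈ X ↔ ∀ i ∈ T, f (p i) = 0) : Module.finrank ℝ X + rk p T = Module.finrank ℝ W := by
  have : X = (sp p T).dualAnnihilator := by
    ext f
    rw [hX, Submodule.mem_dualAnnihilator]
    exact ⟨fun h w hw => zero_on_sp h hw, fun h i hi => h _ (mem_sp hi)⟩
  rw [this, add_comm]
  exact Subspace.finrank_add_finrank_dualAnnihilator_eq _

/-- dimension of the local motion space -/
def zz (p : ι → W) (S F : Finset ι) (v : ι) : ℕ :=
  if jn p S (F ∪ {v}) = S then rk p S - 1 else if rk p (jn p S (F ∪ {v})) + 1 = rk p S then 1 else 0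

lemma finrank_ZZ [FiniteDimensional ℝ W] {p : ι → W} {S F : Finset ι} (hP : PosC p S) (hS : sp p S = ⊤) (hF : Fc p S F)
    {v : ι} (hv : v ∈ S) : Module.finrank ℝ (ZZ p S F v) = zz p S F v := by
  have hsub : F ∪ {v} ⊆ S := Finset.union_subset hF.1 (by simpa using hv)
  have hJ := jn_fc p S _ hsub
  have hFJ : F ⊆ jn p S (F ∪ {v}) := Finset.subset_union_left.trans (sub_jn hsub)
  have hvJ : v ∈ jn p S (F ∪ {v}) := sub_jn hsub (by simp)
  have hr := rk_full hS
  unfold zz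
  split_ifs with h1 h2
  · have := finrank_ann p {v} (ZZ p S F v) (fun f => by
      rw [mem_ZZ]
      constructor
      · rintro ⟨h, _⟩; simpa using h
      · intro h
        refine ⟨by simpa using h, fun G hG hFG hne hvG => ?_⟩
        exfalso
        apply hne
        apply hG.1.antisymm
        rw [← h1]
        exact jn_sub hG (Finset.union_subset hFG (by simpa using hvG)))
    rw [rk_singleton (hP.ne_zero hv)] at this
    omega
  · have := finrank_ann p (jn p S (F ∪ {v})) (ZZ p S F v) (fun f => by
      rw [mem_ZZ]
      constructor
      · rintro ⟨_, h⟩; exact h _ hJ hFJ h1 hvJ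
      · intro h
        refine ⟨h v hvJ, fun G hG hFG hne hvG => ?_⟩
        have hsb := jn_sub hG (Finset.union_subset hFG (by simpa using hvG) : F ∪ {v} ⊆ G)
        have hlt := hG.rk_lt (Finset.Subset.refl S) hG.1 hne
        have := hJ.eq_of_rk hG.1 hsb (by omega)
        rw [this] at h
        exact h)
    omega
  · have : ZZ p S F v = ⊥ := by
      rw [Submodule.eq_bot_iff]
      intro f hf
      have hlt := hJ.rk_lt (Finset.Subset.refl S) hJ.1 h1
      exact zero_of_proper hS hJ (by omega) f (fun G hG hJG hne => hf.2 G hG (hFJ.trans hJG) hne (hJG hvJ))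
    rw [this, finrank_bot]

end PartG3

section PartG4
set_option linter.unusedSectionVars false
variable {ι : Type*} [DecidableEq ι] {W : Type*} [AddCommGroup W] [Module ℝ W]

lemma finrank_pi_sub {κ : Type*} [Fintype κ] {V : Type*} [AddCommGroup V] [Module ℝ V] [FiniteDimensional ℝ V]
    (Z : κ → Submodule ℝ V) :
    Module.finrank ℝ (Submodule.pi Set.univ Z) = ∑ i, Module.finrank ℝ (Z i) := by
  rw [← Module.finrank_pi_fintype ℝ (M := fun i => ↥(Z i))]
  refine LinearEquiv.finrank_eq
    { toFun := fun u i => ⟨u.1 i, u.2 i trivial⟩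
      invFun := fun u => ⟨fun i => (u i).1, fun i _ => (u i).2⟩
      map_add' := fun u v => rfl
      map_smul' := fun c u => rfl
      left_inv := fun u => rfl
      right_inv := fun u => rfl }

lemma dual_ext {p : ι → W} {S : Finset ι} (hS : sp p S = ⊤) {f g : W →ₗ[ℝ] ℝ} (h : ∀ i ∈ S, f (p i) = g (p i)) :
    f = g := by
  apply LinearMap.ext
  intro x
  exact eq_on_sp (p := p) (T := S) h (by rw [hS]; trivial)

lemma altMap_mem {p : ι → W} {S F : Finset ι} {A : W →ₗ[ℝ] W →ₗ[ℝ] ℝ} (hA : A.IsAlt) : altMap p S A ∈ MotN p S F := by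
  refine mem_MotN.2 ⟨fun v => hA (p v), fun G hG _ _ => ⟨A, hA, fun v hv w hw => ?_⟩⟩
  rw [exS_mem _ (hG.1 hv)]; rfl

lemma mot_restrict {p : ι → W} {S F : Finset ι} (hS : sp p S = ⊤) (hF : Fc p S F) (hr : rk p F + 2 ≤ rk p S)
    {u : ↥S → (W →ₗ[ℝ] ℝ)} (hu : u ∈ MotN p S F) :
    ∃ A : W →ₗ[ℝ] W →ₗ[ℝ] ℝ, A.IsAlt ∧ ∀ v : ↥S, v.1 ∈ F → u v = A (p v) := by
  obtain ⟨π, hπ, hπ'⟩ := exists_proj (sp p F)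
  obtain ⟨β, hβ⟩ := ext_rel p F (exS S u) (fun c hc => by
    apply zero_of_proper hS hF hr
    intro G hG hFG hne w hw
    obtain ⟨A, hA, h⟩ := hu.2 G hG hFG hne
    have h1 : A (∑ v ∈ F, c v • p v) (p w) = 0 := by rw [hc]; simp
    rw [map_sum, LinearMap.sum_apply] at h1
    rw [LinearMap.sum_apply, ← h1]
    refine Finset.sum_congr rfl fun v hv => ?_
    simp [h v (hFG hv) w hw])
  have hanti : ∀ x ∈ sp p F, ∀ y ∈ sp p F, β x y + β y x = 0 := by
    have hAF := hu.2 F hF (Finset.Subset.refl _) (by rintro rfl; omega)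
    intro x hx y hy
    have step : ∀ w ∈ F, β x (p w) + β (p w) x = 0 := by
      intro w hw
      have := zero_on_sp (p := p) (T := F) (f := β.flip (p w) + β (p w)) (fun v hv => by
        have := hAF.anti hv hw
        simp only [LinearMap.add_apply, LinearMap.flip_apply, hβ v hv, hβ w hw, this]; ring) hx
      simpa using this
    have := zero_on_sp (p := p) (T := F) (f := β x + β.flip x) (fun w hw => by simpa using step w hw) hy
    simpa using this
  refine ⟨β ∘ₗ π - (β ∘ₗ π).flip - β.compl₁₂ π π, fun x => ?_, fun v hv => ?_⟩
  · have := hanti _ (hπ x) _ (hπ x)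
    simp only [LinearMap.sub_apply, LinearMap.comp_apply, LinearMap.flip_apply, LinearMap.compl₁₂_apply]
    linarith
  · ext y
    have h1 := hanti _ (hπ y) _ (mem_sp hv)
    have h2 := hβ v hv
    rw [exS_coe] at h2
    simp only [LinearMap.sub_apply, LinearMap.comp_apply, LinearMap.flip_apply, LinearMap.compl₁₂_apply,
      hπ' _ (mem_sp hv), ← h2] at *
    linarith

/-- pull back of alternating forms -/
def pullB {V V' : Type*} [AddCommGroup V] [Module ℝ V] [AddCommGroup V'] [Module ℝ V'] (q : V →ₗ[ℝ] V') :
    (V' →ₗ[ℝ] V' →ₗ[ℝ] ℝ) →ₗ[ℝ] (V →ₗ[ℝ] V →ₗ[ℝ] ℝ) where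
  toFun A := A.compl₁₂ q q
  map_add' A B := by ext; simp
  map_smul' c A := by ext; simp

lemma pullB_apply {V V' : Type*} [AddCommGroup V] [Module ℝ V] [AddCommGroup V'] [Module ℝ V'] (q : V →ₗ[ℝ] V')
    (A) (x y : V) : pullB q A x y = A (q x) (q y) := rfl

/-- descend an alternating form -/
lemma exists_descend (K : Submodule ℝ W) (A : W →ₗ[ℝ] W →ₗ[ℝ] ℝ) (hA : A.IsAlt) (h : ∀ x ∈ K, A x = 0) :
    ∃ B : (W ⧸ K) →ₗ[ℝ] (W ⧸ K) →ₗ[ℝ] ℝ, B.IsAlt ∧ pullB K.mkQ B = A := by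
  have h' : ∀ x, ∀ y ∈ K, A x y = 0 := fun x y hy => by rw [anti_of_alt hA, h y hy]; simp
  obtain ⟨s, hs⟩ := LinearMap.exists_rightInverse_of_surjective K.mkQ K.range_mkQ
  have hs' : ∀ x, x - s (K.mkQ x) ∈ K := fun x => by
    apply (Submodule.Quotient.eq K).1
    exact (LinearMap.congr_fun hs (K.mkQ x)).symm
  refine ⟨A.compl₁₂ s s, fun x => hA _, ?_⟩
  ext x y
  rw [pullB_apply, LinearMap.compl₁₂_apply]
  have h1 := h _ (hs' x)
  have h2 := h' x _ (hs' y)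
  rw [map_sub, sub_eq_zero] at h1 h2
  rw [← h1, ← h2]

lemma finrank_MotN [FiniteDimensional ℝ W] {p : ι → W} {S F : Finset ι} (hS : sp p S = ⊤) (hF : Fc p S F)
    (hr : rk p F + 2 ≤ rk p S) :
    Module.finrank ℝ (MotN p S F) + (rk p S - rk p F).choose 2 = (rk p S).choose 2 + Module.finrank ℝ (Mot0 p S F) := by
  have h1 : MotN p S F = (AltW W).map (altMap p S) ⊔ Mot0 p S F := by
    apply le_antisymm
    · intro u hu
      obtain ⟨A, hA, h⟩ := mot_restrict hS hF hr hu
      refine Submodule.mem_sup.2 ⟨altMap p S A, Submodule.mem_map_of_mem hA, u - altMap p S A, ?_, by simp⟩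
      refine ⟨Submodule.sub_mem _ hu (altMap_mem hA), fun v hv => ?_⟩
      rw [Pi.sub_apply, h v hv, altMap_apply, sub_self]
    · apply sup_le
      · rintro _ ⟨A, hA, rfl⟩
        exact altMap_mem hA
      · exact fun u hu => hu.1
  have h2 : (AltW W).map (altMap p S) ⊓ Mot0 p S F =
      ((AltW (W ⧸ sp p F)).map (pullB (sp p F).mkQ)).map (altMap p S) := by
    ext u
    constructor
    · rintro ⟨⟨A, hA, rfl⟩, h⟩
      obtain ⟨B, hB, hBA⟩ := exists_descend (sp p F) A hA (fun x hx => by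
        have := eq_on_sp (p := p) (T := F) (f := A) (g := 0) (fun i hi => h.2 ⟨i, hF.1 hi⟩ hi) hx
        simpa using this)
      exact ⟨A, ⟨B, hB, hBA⟩, rfl⟩
    · rintro ⟨_, ⟨B, hB, rfl⟩, rfl⟩
      have hA : (pullB (sp p F).mkQ B).IsAlt := fun x => hB _
      refine ⟨⟨_, hA, rfl⟩, altMap_mem hA, fun v hv => ?_⟩
      ext y
      have : (sp p F).mkQ (p v) = 0 := by simpa using mem_sp hv
      rw [altMap_apply, pullB_apply, this]; simp
  have h3 := Submodule.finrank_sup_add_finrank_inf_eq ((AltW W).map (altMap p S)) (Mot0 p S F)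
  rw [← h1, h2, finrank_alt_image hS, finrank_alt_image hS, finrank_AltW, finrank_map_inj, finrank_AltW,
    ← rk_full hS] at h3
  · have h4 := Submodule.finrank_quotient_add_finrank (sp p F)
    have h5 := rk_full hS
    have : Module.finrank ℝ (W ⧸ sp p F) = rk p S - rk p F := by unfold rk at *; omega
    rw [this] at h3
    exact h3
  · intro B B' h
    ext x y
    exact LinearMap.congr_fun₂ h x y

/-- product of local motions -/
def PiZ (p : ι → W) (S F : Finset ι) : Submodule ℝ (↥S → (W →ₗ[ℝ] ℝ)) :=
  Submodule.pi Set.univ (fun v : ↥S => ZZ p S F v)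

lemma mem_PiZ {p : ι → W} {S F : Finset ι} {u : ↥S → (W →ₗ[ℝ] ℝ)} : u ∈ PiZ p S F ↔ ∀ v : ↥S, u v ∈ ZZ p S F v := by
  simp [PiZ, Submodule.mem_pi]

lemma finrank_PiZ [FiniteDimensional ℝ W] {p : ι → W} {S F : Finset ι} (hP : PosC p S) (hS : sp p S = ⊤) (hF : Fc p S F) :
    Module.finrank ℝ (PiZ p S F) = ∑ v ∈ S, zz p S F v := by
  unfold PiZ
  rw [finrank_pi_sub, ← Finset.sum_coe_sort S]
  exact Finset.sum_congr rfl fun v _ => finrank_ZZ hP hS hF v.2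

lemma PiZ_le {p : ι → W} {S F : Finset ι} (hS : sp p S = ⊤) (hF : Fc p S F) (hr : rk p F + 2 ≤ rk p S) :
    PiZ p S F ≤ Mot0 p S F := by
  intro u hu
  rw [mem_PiZ] at hu
  refine ⟨⟨fun v => (hu v).1, fun G hG hFG hne => ⟨0, fun x => by simp, fun v hv w hw => ?_⟩⟩, fun v hv => ?_⟩
  · rw [exS_mem _ (hG.1 hv), (hu ⟨v, hG.1 hv⟩).2 G hG hFG hne hv w hw]; simp
  · exact zero_of_proper hS hF hr _ (fun G hG hFG hne w hw => (hu v).2 G hG hFG hne (hFG hv) w hw)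

lemma Mot0_two {p : ι → W} {S F : Finset ι} (hS : sp p S = ⊤) (hF : Fc p S F)
    (hr : rk p S = rk p F + 2) : Mot0 p S F = PiZ p S F := by
  apply le_antisymm _ (PiZ_le hS hF (by omega))
  intro u hu
  rw [mem_PiZ]
  refine fun v => ⟨hu.1.1 v, fun G hG hFG hne hvG w hw => ?_⟩
  by_cases hvF : v.1 ∈ F
  · rw [hu.2 v hvF]; rfl
  obtain ⟨A, hA, h⟩ := hu.1.2 G hG hFG hne
  have h1 := h v hvG w hw
  rw [exS_coe] at h1
  rw [h1]
  -- `p w` is in the span of `F` and `v`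
  have hrG : rk p G = rk p F + 1 := by
    have := hG.rk_lt (Finset.Subset.refl S) hG.1 hne
    have := hF.rk_lt hG.1 hFG (by rintro rfl; exact hvF hvG)
    omega
  have hsub : F ∪ {v.1} ⊆ G := Finset.union_subset hFG (by simpa using hvG)
  have hsp : sp p (F ∪ {v.1}) = sp p G := by
    apply Submodule.eq_of_le_of_finrank_le (sp_mono hsub)
    have : rk p F < rk p (F ∪ {v.1}) := hF.rk_lt (hsub.trans hG.1) Finset.subset_union_left (by
      intro h; apply hvF; rw [h]; simp)
    change rk p G ≤ rk p (F ∪ {v.1})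
    omega
  have hz : ∀ i ∈ F ∪ {v.1}, A (p v) (p i) = 0 := by
    intro i hi
    rcases Finset.mem_union.1 hi with hi | hi
    · have h2 := h i (hFG hi) v hvG
      rw [exS_mem _ (hF.1 hi), hu.2 ⟨i, hF.1 hi⟩ hi] at h2
      rw [anti_of_alt hA, ← h2]; simp
    · rw [Finset.mem_singleton.1 hi]; exact hA _
  exact zero_on_sp hz (by rw [hsp]; exact mem_sp hw)

end PartG4

section PartG5
set_option linter.unusedSectionVars false
variable {ι : Type*} [DecidableEq ι] {W : Type*} [AddCommGroup W] [Module ℝ W]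

lemma sp_exists {p : ι → W} {T : Finset ι} {x : W} (h : x ∈ sp p T) : ∃ b : ι → ℝ, ∑ i ∈ T, b i • p i = x := by
  unfold sp at h
  rw [Submodule.mem_span_image_finset_iff_exists_fun] at h
  obtain ⟨c, hc⟩ := h
  refine ⟨exS T c, ?_⟩
  rw [← hc, ← Finset.sum_coe_sort]
  exact Finset.sum_congr rfl fun i _ => by rw [exS_coe]

lemma exists_reps {p : ι → W} {S : Finset ι} (hP : PosC p S) :
    ∃ M ⊆ S, Cvx p M ∧ (∀ R, Fc p S R → rk p R = 1 → (R ∩ M).Nonempty) ∧ M.card = fcount p S 1 ∧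
      ∀ v ∈ M, ∃ R, Fc p S R ∧ rk p R = 1 ∧ v ∈ R := by
  have hex : ∀ R : ↥(fk p S 1), ∃ v : ι, v ∈ R.1 := fun R => by
    have h := mem_fk.1 R.2
    exact nonempty_of_rk (p := p) (T := R) (by omega)
  choose c hc using hex
  have huniq : ∀ R R' : ↥(fk p S 1), c R' ∈ R.1 → R' = R := fun R R' h => by
    have h1 := mem_fk.1 R.2
    have h2 := mem_fk.1 R'.2
    exact Subtype.ext (atom_eq hP h2.1 h1.1 h2.2 h1.2 (hc R') h)
  have hsub : (Finset.univ.image c) ⊆ S := by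
    intro v hv
    obtain ⟨R, hR, rfl⟩ := Finset.mem_image.1 hv
    exact (mem_fk.1 R.2).1.1 (hc R)
  refine ⟨Finset.univ.image c, hsub, ⟨hP.mono hsub, ?_⟩, ?_, ?_, ?_⟩
  · intro v hv
    obtain ⟨R, hR, rfl⟩ := Finset.mem_image.1 hv
    have h1 := (mem_fk.1 R.2).1.restrict hsub
    have : R.1 ∩ Finset.univ.image c = {c R} := by
      ext x
      simp only [Finset.mem_inter, Finset.mem_image, Finset.mem_univ, true_and, Finset.mem_singleton]
      constructor
      · rintro ⟨hx, R', rfl⟩; rw [huniq R R' hx]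
      · rintro rfl; exact ⟨hc R, R, rfl⟩
    rwa [this] at h1
  · intro R hR h1
    have hm : R ∈ fk p S 1 := mem_fk.2 ⟨hR, h1⟩
    exact ⟨c ⟨R, hm⟩, Finset.mem_inter.2 ⟨hc ⟨R, hm⟩, Finset.mem_image_of_mem _ (Finset.mem_univ _)⟩⟩
  · rw [Finset.card_image_of_injective, Finset.card_univ, Fintype.card_coe]
    · rfl
    · intro R R' h
      exact huniq R' R (h ▸ hc R')
  · intro v hv
    obtain ⟨R, hR, rfl⟩ := Finset.mem_image.1 hv
    exact ⟨R, (mem_fk.1 R.2).1, (mem_fk.1 R.2).2, hc R⟩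

/-- Restriction of a family to a subset. -/
def resM (S M : Finset ι) (hM : M ⊆ S) (V : Type*) [AddCommGroup V] [Module ℝ V] : (↥S → V) →ₗ[ℝ] (↥M → V) where
  toFun u v := u ⟨v, hM v.2⟩
  map_add' _ _ := rfl
  map_smul' _ _ := rfl

/-- Pull back of functionals along the quotient. -/
def pullD (M : Finset ι) (K : Submodule ℝ W) : (↥M → ((W ⧸ K) →ₗ[ℝ] ℝ)) →ₗ[ℝ] (↥M → (W →ₗ[ℝ] ℝ)) where
  toFun u v := u v ∘ₗ K.mkQ
  map_add' _ _ := rfl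
  map_smul' _ _ := rfl

lemma reps_span {p : ι → W} {S F M G : Finset ι} (hF : Fc p S F)
    (hrep : ∀ R, Fc (Qp p F) (S \ F) R → rk (Qp p F) R = 1 → (R ∩ M).Nonempty) (hG : Fc p S G) (hFG : F ⊆ G) :
    sp p (F ∪ (G ∩ M)) = sp p G := by
  have e : F ∪ (G \ F) = G := Finset.union_sdiff_of_subset hFG
  have h1 : Fc (Qp p F) (S \ F) (G \ F) := by
    rw [fc_quot hF (Finset.sdiff_subset_sdiff hG.1 (Finset.Subset.refl _)), e]; exact hG
  have h2 := reps_face_sp (pos_quot hF) hrep h1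
  have h3 : rk (Qp p F) (G \ F ∩ M) = rk (Qp p F) (G \ F) := by unfold rk; rw [h2]
  have h4 := rk_quot p F (G \ F ∩ M)
  have h5 := rk_quot p F (G \ F)
  have e2 : F ∪ (G \ F ∩ M) ⊆ F ∪ (G ∩ M) :=
    Finset.union_subset_union (Finset.Subset.refl _) (Finset.inter_subset_inter Finset.sdiff_subset (Finset.Subset.refl _))
  rw [e] at h5
  apply Submodule.eq_of_le_of_finrank_le (sp_mono (Finset.union_subset hFG Finset.inter_subset_left))
  change rk p G ≤ rk p (F ∪ (G ∩ M))
  have := rk_mono (p := p) e2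
  omega

lemma reps_spanQ {p : ι → W} {S F M G : Finset ι} (hF : Fc p S F)
    (hrep : ∀ R, Fc (Qp p F) (S \ F) R → rk (Qp p F) R = 1 → (R ∩ M).Nonempty) (hG : Fc p S G) (hFG : F ⊆ G)
    {w : ι} (hw : w ∈ G) : Qp p F w ∈ sp (Qp p F) (G ∩ M) := by
  have h1 : p w ∈ sp p (F ∪ (G ∩ M)) := by rw [reps_span hF hrep hG hFG]; exact mem_sp hw
  rw [sp_union] at h1
  obtain ⟨a, ha, b, hb, hab⟩ := Submodule.mem_sup.1 h1
  rw [sp_quot]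
  refine ⟨b, hb, ?_⟩
  have : (sp p F).mkQ a = 0 := by simpa using ha
  rw [Qp, ← hab, map_add, this, zero_add]

lemma finrank_split {V V' : Type*} [AddCommGroup V] [Module ℝ V] [FiniteDimensional ℝ V] [AddCommGroup V'] [Module ℝ V']
    (X : Submodule ℝ V) (φ : V →ₗ[ℝ] V') :
    Module.finrank ℝ X = Module.finrank ℝ (X ⊓ LinearMap.ker φ : Submodule ℝ V) + Module.finrank ℝ (X.map φ) := by
  have h1 := LinearMap.finrank_range_add_finrank_ker (φ.domRestrict X)
  rw [LinearMap.range_domRestrict, LinearMap.ker_domRestrict] at h1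
  have h2 := finrank_map_inj X.subtype (Submodule.injective_subtype _) ((LinearMap.ker φ).comap X.subtype)
  rw [Submodule.map_comap_subtype] at h2
  omega

lemma Mot0_ker [FiniteDimensional ℝ W] {p : ι → W} {S F M : Finset ι} (hS : sp p S = ⊤) (hF : Fc p S F)
    (hr : rk p F + 3 ≤ rk p S) (hM : M ⊆ S \ F) (hMS : M ⊆ S)
    (hrep : ∀ R, Fc (Qp p F) (S \ F) R → rk (Qp p F) R = 1 → (R ∩ M).Nonempty)
    (hat : ∀ v ∈ M, ∃ R, Fc (Qp p F) (S \ F) R ∧ rk (Qp p F) R = 1 ∧ v ∈ R) :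
    Mot0 p S F ⊓ LinearMap.ker (resM S M hMS (W →ₗ[ℝ] ℝ)) = PiZ p S F := by
  have hMF : ∀ v ∈ M, v ∉ F := fun v hv => (Finset.mem_sdiff.1 (hM hv)).2
  have hcov : ∀ v ∈ M, ∃ G, Fc p S G ∧ F ⊆ G ∧ v ∈ G ∧ rk p G = rk p F + 1 := by
    intro v hv
    obtain ⟨R, hR, h1, hvR⟩ := hat v hv
    refine ⟨F ∪ R, (fc_quot hF hR.1).1 hR, Finset.subset_union_left, by simp [hvR], ?_⟩
    have := rk_quot p F R; omega
  ext u
  constructor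
  · rintro ⟨hu, hk⟩
    rw [mem_PiZ]
    refine fun v => ⟨hu.1.1 v, fun G hG hFG hne hvG w hw => ?_⟩
    obtain ⟨A, hA, h⟩ := hu.1.2 G hG hFG hne
    have h2 := h v hvG w hw
    rw [exS_coe] at h2
    rw [h2]
    have h3 : ∀ i ∈ F ∪ (G ∩ M), A.flip (p w) (p i) = 0 := by
      intro i hi
      rw [LinearMap.flip_apply]
      rcases Finset.mem_union.1 hi with hi | hi
      · rw [← h i (hFG hi) w hw, exS_mem _ (hF.1 hi), hu.2 ⟨i, hF.1 hi⟩ hi]; rfl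
      · rw [Finset.mem_inter] at hi
        rw [← h i hi.1 w hw, exS_mem _ (hMS hi.2)]
        have := congrFun hk ⟨i, hi.2⟩
        change u ⟨i, hMS hi.2⟩ = 0 at this
        rw [this]; rfl
    exact zero_on_sp h3 (by rw [reps_span hF hrep hG hFG]; exact mem_sp hvG)
  · intro hu
    refine ⟨PiZ_le hS hF (by omega) hu, ?_⟩
    rw [SetLike.mem_coe, LinearMap.mem_ker]
    funext v
    change u ⟨v, hMS v.2⟩ = 0
    obtain ⟨R, hR, hFR, hvR, hrR⟩ := hcov v v.2
    rw [mem_PiZ] at hu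
    exact zero_of_proper hS hR (by omega) _ (fun G hG hRG hne w hw =>
      (hu ⟨v, hMS v.2⟩).2 G hG (hFR.trans hRG) hne (hRG hvR) w hw)

lemma Mot0_ran [FiniteDimensional ℝ W] {p : ι → W} {S F M : Finset ι} (hS : sp p S = ⊤) (hF : Fc p S F)
    (hr : rk p F + 3 ≤ rk p S) (hM : M ⊆ S \ F) (hMS : M ⊆ S)
    (hrep : ∀ R, Fc (Qp p F) (S \ F) R → rk (Qp p F) R = 1 → (R ∩ M).Nonempty)
    (hat : ∀ v ∈ M, ∃ R, Fc (Qp p F) (S \ F) R ∧ rk (Qp p F) R = 1 ∧ v ∈ R) :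
    (Mot0 p S F).map (resM S M hMS (W →ₗ[ℝ] ℝ)) = (MotN (Qp p F) M ∅).map (pullD M (sp p F)) := by
  have hMF : ∀ v ∈ M, v ∉ F := fun v hv => (Finset.mem_sdiff.1 (hM hv)).2
  have hcov : ∀ v ∈ M, ∃ G, Fc p S G ∧ F ⊆ G ∧ v ∈ G ∧ rk p G = rk p F + 1 := by
    intro v hv
    obtain ⟨R, hR, h1, hvR⟩ := hat v hv
    refine ⟨F ∪ R, (fc_quot hF hR.1).1 hR, Finset.subset_union_left, by simp [hvR], ?_⟩
    have := rk_quot p F R; omega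
  ext f
  constructor
  · rintro ⟨u, hu, rfl⟩
    have hz : ∀ v : ↥M, sp p F ≤ LinearMap.ker (u ⟨v, hMS v.2⟩) := by
      intro v
      obtain ⟨R, hR, hFR, hvR, hrR⟩ := hcov v v.2
      rw [sp_le]
      intro i hi
      have h2 := (hu.1.2 R hR hFR (by rintro rfl; omega)).anti hvR (hFR hi)
      rw [exS_mem _ (hMS v.2), exS_mem _ (hF.1 hi), hu.2 ⟨i, hF.1 hi⟩ hi] at h2
      rw [LinearMap.mem_ker, h2]; simp
    refine ⟨fun v => (sp p F).liftQ _ (hz v), ?_, ?_⟩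
    · refine ⟨fun v => ?_, fun U hU _ hne => ?_⟩
      · simpa [Qp] using hu.1.1 ⟨v, hMS v.2⟩
      · obtain ⟨U', hU', hUU⟩ := reps_face (pos_quot hF) hM hrep hU
        have hG := (fc_quot hF hU'.1).1 hU'
        have hGne : F ∪ U' ≠ S := by
          intro h
          apply hne
          apply hU.1.antisymm
          intro v hv
          rw [hUU]
          have h2 : v ∈ F ∪ U' := h ▸ hMS hv
          rcases Finset.mem_union.1 h2 with h2 | h2
          · exact absurd h2 (hMF v hv)
          · exact Finset.mem_inter.2 ⟨h2, hv⟩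
        have hA := hu.1.2 _ hG Finset.subset_union_left hGne
        have hUG : U ⊆ F ∪ U' := by rw [hUU]; exact Finset.inter_subset_left.trans Finset.subset_union_right
        have hval : ∀ v ∈ U, ∀ w, exS M (fun v : ↥M => (sp p F).liftQ _ (hz v)) v (Qp p F w) = exS S u v (p w) := by
          intro v hv w
          rw [exS_mem _ (hU.1 hv), exS_mem _ (hMS (hU.1 hv))]; simp [Qp]
        apply altOn_of_rel
        · intro v hv w hw
          rw [hval v hv, hval w hw]
          exact hA.anti (hUG hv) (hUG hw)
        · intro c hc w hw
          -- lift the relation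
          obtain ⟨A, hA', hAA⟩ := hA
          have hmem : ∑ v ∈ U, c v • p v ∈ sp p F := by
            rw [← Submodule.ker_mkQ (sp p F), LinearMap.mem_ker, map_sum, ← hc]
            simp [Qp]
          have h0 : A.flip (p w) (∑ v ∈ U, c v • p v) = 0 := by
            refine zero_on_sp (fun i hi => ?_) hmem
            rw [LinearMap.flip_apply, ← hAA i (Finset.mem_union_left _ hi) w (hUG hw), exS_mem _ (hF.1 hi),
              hu.2 ⟨i, hF.1 hi⟩ hi]; rfl
          rw [map_sum] at h0
          rw [← h0]
          refine Finset.sum_congr rfl fun v hv => ?_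
          rw [hval v hv, hAA v (hUG hv) w (hUG hw)]; simp
    · funext v
      ext x
      simp [pullD, resM]
  · rintro ⟨t, ht, rfl⟩
    have hprop : ∀ G, Fc p S G → F ⊆ G → G ≠ S → Fc (Qp p F) M (G ∩ M) ∧ G ∩ M ≠ M := by
      intro G hG hFG hne
      have e : F ∪ (G \ F) = G := Finset.union_sdiff_of_subset hFG
      have h1 : Fc (Qp p F) (S \ F) (G \ F) := by
        rw [fc_quot hF (Finset.sdiff_subset_sdiff hG.1 (Finset.Subset.refl _)), e]; exact hG
      have h2 := h1.restrict hM
      have e2 : G \ F ∩ M = G ∩ M := by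
        ext x
        simp only [Finset.mem_inter, Finset.mem_sdiff]
        constructor
        · rintro ⟨⟨a, _⟩, b⟩; exact ⟨a, b⟩
        · rintro ⟨a, b⟩; exact ⟨⟨a, hMF x b⟩, b⟩
      refine ⟨e2 ▸ h2, fun h => hne ?_⟩
      apply hG.1.antisymm
      apply hG.subset_of_sp (Finset.Subset.refl _)
      have h3 := reps_span hF hrep (Fc.refl p S) hF.1
      rw [← h3, ← reps_span hF hrep hG hFG, h, Finset.inter_eq_right.2 hMS]
    have hex : ∀ v : ↥S, ∃ f : W →ₗ[ℝ] ℝ, (∀ h : v.1 ∈ M, f = t ⟨v, h⟩ ∘ₗ (sp p F).mkQ) ∧ (v.1 ∈ F → f = 0) ∧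
        f (p v) = 0 ∧ ∀ G, Fc p S G → F ⊆ G → v.1 ∈ G → ∀ A : (W ⧸ sp p F) →ₗ[ℝ] (W ⧸ sp p F) →ₗ[ℝ] ℝ, G ≠ S →
          A.IsAlt → (∀ x ∈ G ∩ M, ∀ y ∈ G ∩ M, exS M t x (Qp p F y) = A (Qp p F x) (Qp p F y)) →
          ∀ w ∈ G, f (p w) = A (Qp p F v) (Qp p F w) := by
      intro v
      have hext : ∀ G, Fc p S G → F ⊆ G → ∀ A : (W ⧸ sp p F) →ₗ[ℝ] (W ⧸ sp p F) →ₗ[ℝ] ℝ,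
          (∀ x ∈ G ∩ M, ∀ y ∈ G ∩ M, exS M t x (Qp p F y) = A (Qp p F x) (Qp p F y)) →
          ∀ x ∈ G ∩ M, ∀ w ∈ G, exS M t x (Qp p F w) = A (Qp p F x) (Qp p F w) := by
        intro G hG hFG A h x hx w hw
        exact eq_on_sp (h x hx) (reps_spanQ hF hrep hG hFG hw)
      by_cases hvF : v.1 ∈ F
      · refine ⟨0, fun h => absurd hvF (hMF _ h), fun _ => rfl, rfl, fun G hG hFG hvG A hne hA h w hw => ?_⟩
        have : Qp p F v = 0 := by simpa [Qp] using mem_sp hvF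
        rw [this]; simp
      by_cases hvM : v.1 ∈ M
      · refine ⟨t ⟨v, hvM⟩ ∘ₗ (sp p F).mkQ, fun _ => rfl, fun h => absurd h hvF, ht.1 ⟨v, hvM⟩,
          fun G hG hFG hvG A hne hA h w hw => ?_⟩
        have := hext G hG hFG A h v (Finset.mem_inter.2 ⟨hvG, hvM⟩) w hw
        rw [exS_mem _ hvM] at this
        exact this
      by_cases hJ : jn p S (F ∪ {v.1}) = S
      · refine ⟨0, fun h => absurd h hvM, fun h => absurd h hvF, rfl, fun G hG hFG hvG A hne hA h w hw => ?_⟩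
        exfalso
        apply hne
        apply hG.1.antisymm
        rw [← hJ]
        exact jn_sub hG (Finset.union_subset hFG (by simpa using hvG))
      · have hsub : F ∪ {v.1} ⊆ S := Finset.union_subset hF.1 (by simp)
        have hJf := jn_fc p S _ hsub
        have hFJ : F ⊆ jn p S (F ∪ {v.1}) := Finset.subset_union_left.trans (sub_jn hsub)
        have hvJ : v.1 ∈ jn p S (F ∪ {v.1}) := sub_jn hsub (by simp)
        have h2 := reps_spanQ hF hrep hJf hFJ hvJ
        obtain ⟨b, hb⟩ : ∃ b : ι → ℝ, ∑ x ∈ jn p S (F ∪ {v.1}) ∩ M, b x • Qp p F x = Qp p F v := by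
          exact sp_exists h2
        have hval : ∀ G, Fc p S G → F ⊆ G → v.1 ∈ G → ∀ A : (W ⧸ sp p F) →ₗ[ℝ] (W ⧸ sp p F) →ₗ[ℝ] ℝ,
          (∀ x ∈ G ∩ M, ∀ y ∈ G ∩ M, exS M t x (Qp p F y) = A (Qp p F x) (Qp p F y)) →
          ∀ w ∈ G, ((∑ x ∈ jn p S (F ∪ {v.1}) ∩ M, b x • exS M t x) ∘ₗ (sp p F).mkQ) (p w) =
            A (Qp p F v) (Qp p F w) := by
          intro G hG hFG hvG A h w hw
          rw [← hb, map_sum, LinearMap.sum_apply, LinearMap.comp_apply, LinearMap.sum_apply]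
          refine Finset.sum_congr rfl fun x hx => ?_
          have hx' : x ∈ G ∩ M := by
            rw [Finset.mem_inter] at hx ⊢
            exact ⟨jn_sub hG (Finset.union_subset hFG (by simpa using hvG)) hx.1, hx.2⟩
          have := hext G hG hFG A h x hx' w hw
          simp only [LinearMap.smul_apply, map_smul]
          rw [← this]; rfl
        refine ⟨(∑ x ∈ jn p S (F ∪ {v.1}) ∩ M, b x • exS M t x) ∘ₗ (sp p F).mkQ, fun h => absurd h hvM,
          fun h => absurd h hvF, ?_, fun G hG hFG hvG A hne hA h w hw => hval G hG hFG hvG A h w hw⟩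
        obtain ⟨h3, h4⟩ := hprop _ hJf hFJ hJ
        obtain ⟨A, hA, h⟩ := ht.2 _ h3 (Finset.empty_subset _) h4
        rw [hval _ hJf hFJ hvJ A h v hvJ]
        exact hA _
    choose u hu1 hu2 hu3 hu4 using hex
    have hu : u ∈ Mot0 p S F := by
      refine ⟨⟨hu3, fun G hG hFG hne => ?_⟩, hu2⟩
      obtain ⟨h3, h4⟩ := hprop G hG hFG hne
      obtain ⟨A, hA, h⟩ := ht.2 _ h3 (Finset.empty_subset _) h4
      refine ⟨pullB (sp p F).mkQ A, fun x => hA _, fun v hv w hw => ?_⟩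
      rw [exS_mem _ (hG.1 hv)]
      exact hu4 ⟨v, hG.1 hv⟩ G hG hFG hv A hne hA h w hw
    refine ⟨u, hu, ?_⟩
    funext v
    exact hu1 ⟨v, hMS v.2⟩ v.2

theorem finrank_Mot0 [FiniteDimensional ℝ W] {p : ι → W} {S F M : Finset ι} (hS : sp p S = ⊤) (hF : Fc p S F)
    (hr : rk p F + 3 ≤ rk p S) (hM : M ⊆ S \ F)
    (hrep : ∀ R, Fc (Qp p F) (S \ F) R → rk (Qp p F) R = 1 → (R ∩ M).Nonempty)
    (hat : ∀ v ∈ M, ∃ R, Fc (Qp p F) (S \ F) R ∧ rk (Qp p F) R = 1 ∧ v ∈ R) :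
    Module.finrank ℝ (Mot0 p S F) = Module.finrank ℝ (PiZ p S F) + Module.finrank ℝ (MotN (Qp p F) M ∅) := by
  have hMS : M ⊆ S := hM.trans Finset.sdiff_subset
  have h1 := finrank_split (Mot0 p S F) (resM S M hMS (W →ₗ[ℝ] ℝ))
  rw [Mot0_ker hS hF hr hM hMS hrep hat, Mot0_ran hS hF hr hM hMS hrep hat, finrank_map_inj] at h1
  · exact h1
  · intro f g h
    funext v
    ext x
    exact LinearMap.congr_fun (congrFun h v) x

end PartG5

section PartG6
set_option linter.unusedSectionVars false
variable {ι : Type*} [DecidableEq ι] {W : Type*} [AddCommGroup W] [Module ℝ W]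

lemma indep_of_rk {p : ι → W} {T : Finset ι} (h : rk p T = T.card) (c : ι → ℝ) (hc : ∑ i ∈ T, c i • p i = 0) :
    ∀ i ∈ T, c i = 0 := by
  have hli : LinearIndependent ℝ (fun i : ↥T => p i) := by
    rw [linearIndependent_iff_card_eq_finrank_span]
    rw [Fintype.card_coe, ← h]
    have e : (Set.range fun i : ↥T => p i) = p '' (T : Set ι) := by ext x; simp
    unfold rk sp Set.finrank
    rw [e]
  rw [Fintype.linearIndependent_iff] at hli
  intro i hi
  exact hli (fun i => c i) (by rw [← hc, Finset.sum_coe_sort T (fun i => c i • p i)]) ⟨i, hi⟩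

lemma altOn_indep {p : ι → W} {u : ι → W →ₗ[ℝ] ℝ} {T : Finset ι} (h : rk p T = T.card)
    (h1 : ∀ v ∈ T, ∀ w ∈ T, u v (p w) = - u w (p v)) : AltOn p u T := by
  refine altOn_of_rel h1 fun c hc w hw => Finset.sum_eq_zero fun v hv => ?_
  rw [indep_of_rk h c hc v hv, zero_mul]

lemma mem_alt_of_altOn {p : ι → W} {S : Finset ι} (hS : sp p S = ⊤) {u : ↥S → (W →ₗ[ℝ] ℝ)} (h : AltOn p (exS S u) S) :
    u ∈ (AltW W).map (altMap p S) := by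
  obtain ⟨A, hA, hu⟩ := h
  refine ⟨A, hA, ?_⟩
  funext v
  refine dual_ext hS fun i hi => ?_
  rw [altMap_apply, ← hu v v.2 i hi, exS_coe]

lemma finrank_MotN_empty_four [FiniteDimensional ℝ W] {p : ι → W} {S : Finset ι} (h : Cvx p S) (hS : sp p S = ⊤)
    (hr : 4 ≤ rk p S) : Module.finrank ℝ (MotN p S ∅) = (rk p S).choose 2 := by
  have : MotN p S ∅ = (AltW W).map (altMap p S) := by
    ext u
    constructor
    · intro hu
      apply mem_alt_of_altOn hS
      refine rigidity _ h fun G hG hr' => hu.2 G hG (Finset.empty_subset _) ?_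
      rintro rfl; omega
    · rintro ⟨A, hA, rfl⟩
      exact altMap_mem hA
  rw [this, finrank_alt_image hS, finrank_AltW, rk_full hS]

/-- pairs in a rank two face -/
lemma Cvx.edge_pair {p : ι → W} {S G : Finset ι} (h : Cvx p S) (hG : G ∈ fk p S 2) {v w : ι} (hne : v ≠ w)
    (hv : v ∈ G) (hw : w ∈ G) : G = {v, w} := by
  have h1 := mem_fk.1 hG
  have hc := h.card_rank2 h1.1.1 h1.2
  symm
  apply Finset.eq_of_subset_of_card_le
  · intro x hx; simp at hx; rcases hx with rfl | rfl <;> assumption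
  · rw [hc, Finset.card_pair hne]

lemma Cvx.pair_fk {p : ι → W} {S : Finset ι} (h : Cvx p S) {v w : ι} (hv : v ∈ S) :
    ({v, w} : Finset ι) ∈ fk p S 2 ↔ w ∈ Nb p S v := by
  rw [mem_fk, mem_Nb]
  constructor
  · rintro ⟨h1, h2⟩
    refine ⟨?_, h1⟩
    rintro rfl
    rw [Finset.pair_eq_singleton, rk_singleton (h.1.ne_zero hv)] at h2
    omega
  · rintro ⟨h1, h2⟩
    exact ⟨h2, h.rk_pair hv (h2.1 (by simp)) h1.symm⟩

lemma polygon_no_stress {p : ι → W} {S : Finset ι} (h : Cvx p S) (hr : rk p S = 3) :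
    LinearMap.ker (TT p S (fk p S 2)) = ⊥ := by
  rw [LinearMap.ker_eq_bot']
  intro x hx
  have key : ∀ v : ↥S, x.2 v = 0 ∧ ∀ w ∈ Nb p S v, exS (fk p S 2) x.1 {v.1, w} = 0 := by
    intro v
    have h1 : TT p S (fk p S 2) x v = 0 := by rw [hx]; rfl
    rw [TT_apply] at h1
    have hvN : v.1 ∉ Nb p S v := fun hh => (mem_Nb.1 hh).1 rfl
    have h2 : ∑ w : ↥S, exS (fk p S 2) x.1 {v.1, w.1} • p w = ∑ w ∈ Nb p S v, exS (fk p S 2) x.1 {v.1, w} • p w := by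
      rw [Finset.sum_coe_sort S (fun w => exS (fk p S 2) x.1 {v.1, w} • p w)]
      symm
      apply Finset.sum_subset Nb_sub
      intro w hw hn
      rw [exS_not, zero_smul]
      rwa [h.pair_fk v.2]
    have hrk : rk p (insert v.1 (Nb p S v)) = (insert v.1 (Nb p S v)).card := by
      rw [Finset.card_insert_of_notMem hvN, h.polygon_Nb hr v.2]
      unfold rk; rw [h.sp_Nb v.2]; exact hr
    have h3 := indep_of_rk hrk (fun w => if w = v.1 then x.2 v else exS (fk p S 2) x.1 {v.1, w}) (by
      rw [Finset.sum_insert hvN, if_pos rfl]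
      rw [h2] at h1
      rw [← h1]
      congr 1
      refine Finset.sum_congr rfl fun w hw => ?_
      rw [if_neg (mem_Nb.1 hw).1])
    refine ⟨by simpa using h3 v (Finset.mem_insert_self _ _), fun w hw => ?_⟩
    have := h3 w (Finset.mem_insert_of_mem hw)
    rwa [if_neg (mem_Nb.1 hw).1] at this
  ext e
  · have he := mem_fk.1 e.2
    have hc := h.card_rank2 he.1.1 he.2
    obtain ⟨v, w, hne, hvw⟩ := Finset.card_eq_two.1 hc
    have hv : v ∈ S := he.1.1 (by rw [hvw]; simp)
    have h1 := (key ⟨v, hv⟩).2 w ((h.pair_fk hv).1 (hvw ▸ e.2))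
    rw [← exS_coe x.1 e, hvw]
    exact h1
  · exact (key e).1

lemma MotN_three_eq {p : ι → W} {S : Finset ι} (h : Cvx p S) (hr : rk p S = 3) :
    MotN p S ∅ = MotS p S (fk p S 2) := by
  ext u
  constructor
  · intro hu
    refine ⟨hu.1, fun v w hvw => ?_⟩
    have h1 := mem_fk.1 hvw
    have h2 := (hu.2 _ h1.1 (Finset.empty_subset _) (by rintro h3; rw [h3] at h1; omega)).anti
      (show v.1 ∈ ({v.1, w.1} : Finset ι) by simp) (show w.1 ∈ ({v.1, w.1} : Finset ι) by simp)
    rw [exS_coe, exS_coe] at h2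
    linarith
  · intro hu
    refine ⟨hu.1, fun G hG _ hne => ?_⟩
    have hlt := hG.rk_lt (Finset.Subset.refl _) hG.1 hne
    have hcard : rk p G = G.card := by
      have h1 := rk_le_card p G
      by_contra hn
      rcases (by omega : rk p G = 0 ∨ rk p G = 1 ∨ rk p G = 2) with h0 | h0 | h0
      · have : ¬ G.Nonempty := fun hh => by have := rk_pos_of_mem h.1 hG.1 hh; omega
        rw [Finset.not_nonempty_iff_eq_empty] at this
        subst this; simp at hn; omega
      · have := (h.mono hG.1).fcount_one
        have h2 := fcount_top (p := p) (S := G)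
        rw [h0] at h2; omega
      · have := h.card_rank2 hG.1 h0; omega
    apply altOn_indep hcard
    intro v hv w hw
    rw [exS_mem _ (hG.1 hv), exS_mem _ (hG.1 hw)]
    by_cases hvw : v = w
    · subst hvw
      rw [hu.1 ⟨v, hG.1 hv⟩]; simp
    · have h2 : 2 ≤ rk p G := by
        rw [← h.rk_pair (hG.1 hv) (hG.1 hw) hvw]
        exact rk_mono (by intro x hx; simp at hx; rcases hx with rfl | rfl <;> assumption)
      have hG2 : G ∈ fk p S 2 := mem_fk.2 ⟨hG, by omega⟩
      have := hu.2 ⟨v, hG.1 hv⟩ ⟨w, hG.1 hw⟩ (by rw [← h.edge_pair hG2 hvw hv hw]; exact hG2)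
      linarith

lemma finrank_MotN_empty_three [FiniteDimensional ℝ W] {p : ι → W} {S : Finset ι} (h : Cvx p S) (hS : sp p S = ⊤)
    (hr : rk p S = 3) : Module.finrank ℝ (MotN p S ∅) = S.card := by
  have h1 := stress_dim p S (fk p S 2) (fun e he => by
    have he' := mem_fk.1 he
    exact ⟨h.card_rank2 he'.1.1 he'.2, he'.1.1⟩)
  rw [polygon_no_stress h hr, finrank_bot, ← MotN_three_eq h hr, fk_card, fcount_rank3 h.1 hr, h.fcount_one, ← rk_full hS, hr] at h1
  omega

end PartG6

section PartG7
set_option linter.unusedSectionVars false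
variable {ι : Type*} [DecidableEq ι] {W : Type*} [AddCommGroup W] [Module ℝ W]

/-- A framework of a configuration of vectors: edges in low rank faces, all rank two faces, and
rank three faces are minimally rigid. -/
structure Fr (p : ι → W) (S : Finset ι) (Ed : Finset (Finset ι)) : Prop where
  pair : ∀ e ∈ Ed, e.card = 2 ∧ ∃ G, Fc p S G ∧ rk p G ≤ 3 ∧ e ⊆ G
  edge : fk p S 2 ⊆ Ed
  cnt : ∀ G ∈ fk p S 3, (Ed.filter (fun e => e ⊆ G)).card + 3 = 2 * G.card
  rig : ∀ G ∈ fk p S 3, ∀ u : ι → W →ₗ[ℝ] ℝ, (∀ v ∈ G, u v (p v) = 0) →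
    (∀ v ∈ G, ∀ w ∈ G, ({v, w} : Finset ι) ∈ Ed → u v (p w) + u w (p v) = 0) → AltOn p u G

lemma Fr.sub {p : ι → W} {S G : Finset ι} {Ed : Finset (Finset ι)} (h : Fr p S Ed) (hG : Fc p S G) :
    Fr p G (Ed.filter (fun e => e ⊆ G)) where
  pair := by
    intro e he
    rw [Finset.mem_filter] at he
    obtain ⟨h1, H, hH, hr, heH⟩ := h.pair e he.1
    refine ⟨h1, H ∩ G, hH.restrict hG.1, (rk_mono Finset.inter_subset_left).trans hr, Finset.subset_inter heH he.2⟩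
  edge := by
    intro e he
    have h1 := mem_fk.1 he
    rw [Finset.mem_filter]
    exact ⟨h.edge (mem_fk.2 ⟨hG.trans h1.1, h1.2⟩), h1.1.1⟩
  cnt := by
    intro H hH
    have h1 := mem_fk.1 hH
    rw [← h.cnt H (mem_fk.2 ⟨hG.trans h1.1, h1.2⟩), Finset.filter_filter]
    congr 2
    ext e
    simp only [Finset.mem_filter]
    exact ⟨fun hh => ⟨hh.1, hh.2.2⟩, fun hh => ⟨hh.1, hh.2.trans h1.1.1, hh.2⟩⟩
  rig := by
    intro H hH u hu0 hu
    have h1 := mem_fk.1 hH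
    refine h.rig H (mem_fk.2 ⟨hG.trans h1.1, h1.2⟩) u hu0 fun v hv w hw hvw => hu v hv w hw ?_
    rw [Finset.mem_filter]
    exact ⟨hvw, by intro x hx; simp at hx; rcases hx with rfl | rfl <;> exact h1.1.1 (by assumption)⟩

lemma Fr.altOn_low {p : ι → W} {S : Finset ι} {Ed : Finset (Finset ι)} (h : Fr p S Ed) (hC : Cvx p S)
    (u : ι → W →ₗ[ℝ] ℝ) {G : Finset ι} (hG : Fc p S G) (hr : rk p G ≤ 3) (hu0 : ∀ v ∈ G, u v (p v) = 0)
    (hu : ∀ v ∈ G, ∀ w ∈ G, ({v, w} : Finset ι) ∈ Ed → u v (p w) + u w (p v) = 0) : AltOn p u G := by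
  by_cases h3 : rk p G = 3
  · exact h.rig G (mem_fk.2 ⟨hG, h3⟩) u hu0 hu
  have hcard : rk p G = G.card := by
    have h1 := rk_le_card p G
    by_contra hn
    rcases (by omega : rk p G = 0 ∨ rk p G = 1 ∨ rk p G = 2) with h0 | h0 | h0
    · have : ¬ G.Nonempty := fun hh => by have := rk_pos_of_mem hC.1 hG.1 hh; omega
      rw [Finset.not_nonempty_iff_eq_empty] at this
      subst this; simp at hn; omega
    · have := (hC.mono hG.1).fcount_one
      have h2 := fcount_top (p := p) (S := G)
      rw [h0] at h2; omega
    · have := hC.card_rank2 hG.1 h0; omega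
  apply altOn_indep hcard
  intro v hv w hw
  by_cases hvw : v = w
  · subst hvw
    rw [hu0 v hv]; simp
  · have h2 : 2 ≤ rk p G := by
      rw [← hC.rk_pair (hG.1 hv) (hG.1 hw) hvw]
      exact rk_mono (by intro x hx; simp at hx; rcases hx with rfl | rfl <;> assumption)
    have hG2 : G ∈ fk p S 2 := mem_fk.2 ⟨hG, by omega⟩
    have := hu v hv w hw (by rw [← hC.edge_pair hG2 hvw hv hw]; exact h.edge hG2)
    linarith

lemma Fr.altOn {p : ι → W} {S : Finset ι} {Ed : Finset (Finset ι)} (h : Fr p S Ed) (hC : Cvx p S)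
    (u : ι → W →ₗ[ℝ] ℝ) {G : Finset ι} (hG : Fc p S G) (hu0 : ∀ v ∈ G, u v (p v) = 0)
    (hu : ∀ v ∈ G, ∀ w ∈ G, ({v, w} : Finset ι) ∈ Ed → u v (p w) + u w (p v) = 0) : AltOn p u G := by
  refine rigidity u (hC.mono hG.1) fun H hH hr => ?_
  exact h.altOn_low hC u (hG.trans hH) hr (fun v hv => hu0 v (hH.1 hv))
    (fun v hv w hw => hu v (hH.1 hv) w (hH.1 hw))

lemma Fr.edge_sub {p : ι → W} {S : Finset ι} {Ed : Finset (Finset ι)} (h : Fr p S Ed) :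
    ∀ e ∈ Ed, e.card = 2 ∧ e ⊆ S := fun e he => by
  obtain ⟨h1, G, hG, _, h2⟩ := h.pair e he
  exact ⟨h1, h2.trans hG.1⟩

/-- The edges of the framework in proper faces containing `F`. -/
def EdN (p : ι → W) (S F : Finset ι) (Ed : Finset (Finset ι)) : Finset (Finset ι) :=
  Ed.filter (fun e => jn p S (F ∪ e) ≠ S)

lemma jn_ne_iff {p : ι → W} {S A : Finset ι} (hA : A ⊆ S) : jn p S A ≠ S ↔ ∃ G, Fc p S G ∧ G ≠ S ∧ A ⊆ G := by
  constructor
  · intro h; exact ⟨_, jn_fc p S A hA, h, sub_jn hA⟩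
  · rintro ⟨G, hG, hne, hAG⟩ h
    exact hne (hG.1.antisymm (h ▸ jn_sub hG hAG))

lemma Fr.MotS_EdN {p : ι → W} {S F : Finset ι} {Ed : Finset (Finset ι)} (h : Fr p S Ed) (hC : Cvx p S)
    (hF : Fc p S F) : MotS p S (EdN p S F Ed) = MotN p S F := by
  ext u
  constructor
  · intro hu
    refine ⟨hu.1, fun G hG hFG hne => ?_⟩
    refine h.altOn hC _ hG (fun v hv => ?_) (fun v hv w hw hvw => ?_)
    · rw [exS_mem _ (hG.1 hv)]; exact hu.1 _
    · rw [exS_mem _ (hG.1 hv), exS_mem _ (hG.1 hw)]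
      refine hu.2 ⟨v, hG.1 hv⟩ ⟨w, hG.1 hw⟩ ?_
      have hs : ({v, w} : Finset ι) ⊆ G := by
        intro x hx; simp at hx; rcases hx with rfl | rfl <;> assumption
      rw [EdN, Finset.mem_filter, jn_ne_iff (Finset.union_subset hF.1 (hs.trans hG.1))]
      exact ⟨hvw, G, hG, hne, Finset.union_subset hFG hs⟩
  · intro hu
    refine ⟨hu.1, fun v w hvw => ?_⟩
    have hs : ({v.1, w.1} : Finset ι) ⊆ S := by
      intro x hx; simp at hx; rcases hx with rfl | rfl <;> simp
    rw [EdN, Finset.mem_filter, jn_ne_iff (Finset.union_subset hF.1 hs)] at hvw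
    obtain ⟨_, G, hG, hne, hG'⟩ := hvw
    have := (hu.2 G hG (Finset.subset_union_left.trans hG') hne).anti
      (Finset.subset_union_right.trans hG' (show v.1 ∈ _ by simp)) (Finset.subset_union_right.trans hG' (show w.1 ∈ _ by simp))
    rw [exS_coe, exS_coe] at this
    linarith

lemma Fr.stress_top [FiniteDimensional ℝ W] {p : ι → W} {S : Finset ι} {Ed : Finset (Finset ι)} (h : Fr p S Ed) (hC : Cvx p S)
    (hS : sp p S = ⊤) :
    Module.finrank ℝ (LinearMap.ker (TT p S Ed)) + S.card * rk p S = Ed.card + S.card + (rk p S).choose 2 := by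
  have h1 := stress_dim p S Ed h.edge_sub
  rw [motS_eq_alt hS, finrank_alt_image hS, finrank_AltW, ← rk_full hS] at h1
  · exact h1
  · intro u hu
    refine h.altOn hC _ (Fc.refl p S) (fun v hv => ?_) (fun v hv w hw hvw => ?_)
    · rw [exS_mem _ hv]; exact hu.1 _
    · rw [exS_mem _ hv, exS_mem _ hw]; exact hu.2 ⟨v, hv⟩ ⟨w, hw⟩ hvw

/-- The correction term. -/
def kap (p : ι → W) (S F : Finset ι) : ℤ :=
  if rk p S = rk p F then (rk p S).choose 2 else if rk p S = rk p F + 1 then rk p F else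
  if rk p S = rk p F + 2 then 1 else if rk p S = rk p F + 3 then 3 - (covers p S F).card else 0

lemma stress_diff_top [FiniteDimensional ℝ W] {p : ι → W} {S F : Finset ι} {Ed : Finset (Finset ι)} (h : Fr p S Ed) (hC : Cvx p S)
    (hS : sp p S = ⊤) (hF : Fc p S F) (hr : rk p F + 2 ≤ rk p S) :
    (Module.finrank ℝ (LinearMap.ker (TT p S Ed)) : ℤ) - Module.finrank ℝ (LinearMap.ker (TT p S (EdN p S F Ed))) =
      (Ed.card : ℤ) - (EdN p S F Ed).card - ∑ v ∈ S, (zz p S F v : ℤ) + kap p S F := by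
  have h1 := h.stress_top hC hS
  have h2 := stress_dim p S (EdN p S F Ed) (fun e he => h.edge_sub e (Finset.mem_filter.1 he).1)
  rw [h.MotS_EdN hC hF, ← rk_full hS] at h2
  have h3 := finrank_MotN hS hF hr
  have h4 := finrank_PiZ hC.1 hS hF
  have h5 : (Module.finrank ℝ (Mot0 p S F) : ℤ) = ∑ v ∈ S, (zz p S F v : ℤ) + (rk p S - rk p F).choose 2 - kap p S F := by
    by_cases hm : rk p S = rk p F + 2
    · rw [Mot0_two hS hF hm, h4]
      have : rk p S - rk p F = 2 := by omega
      rw [this, kap, if_neg (by omega), if_neg (by omega), if_pos hm]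
      simp
    · obtain ⟨M, hM, hMC, hrep, hcard, hat⟩ := exists_reps (pos_quot hF)
      rw [finrank_Mot0 hS hF (by omega) hM hrep hat, h4]
      have hQ : rk (Qp p F) (S \ F) + rk p F = rk p S := rk_quot_all hF.1
      have hspQ : sp (Qp p F) (S \ F) = ⊤ := by
        rw [sp_quot, Submodule.map_mkQ_eq_top, ← sp_union, Finset.union_sdiff_of_subset hF.1, hS]
      have hspM : sp (Qp p F) M = ⊤ := by
        rw [← hspQ]; exact reps_sp (pos_quot hF) hM hrep
      have hrM : rk (Qp p F) M + rk p F = rk p S := by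
        rw [← hQ]; unfold rk; rw [hspM, hspQ]
      rw [kap, if_neg (by omega), if_neg (by omega), if_neg hm]
      by_cases hm3 : rk p S = rk p F + 3
      · rw [finrank_MotN_empty_three hMC hspM (by omega), if_pos hm3, hcard, ← card_quot hF]
        have : rk p S - rk p F = 3 := by omega
        rw [this]
        unfold covers
        push_cast
        simp [Nat.choose]
        ring
      · rw [finrank_MotN_empty_four hMC hspM (by omega), if_neg hm3]
        have : rk (Qp p F) M = rk p S - rk p F := by omega
        rw [this]; push_cast; ring
  zify at h1 h2 h3
  linarith

end PartG7

section PartG8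
set_option linter.unusedSectionVars false
variable {ι : Type*} [DecidableEq ι] {W : Type*} [AddCommGroup W] [Module ℝ W]

/-- The configuration seen in its own span. -/
def spc (p : ι → W) (S : Finset ι) : ι → sp p S := fun i => if h : i ∈ S then ⟨p i, mem_sp h⟩ else 0

lemma spc_coe {p : ι → W} {S : Finset ι} {i : ι} (h : i ∈ S) : (sp p S).subtype (spc p S i) = p i := by
  simp [spc, h]

lemma sp_congr {p q : ι → W} {T : Finset ι} (h : ∀ i ∈ T, q i = p i) : sp q T = sp p T := by
  unfold sp; rw [Set.image_congr (fun i hi => h i hi)]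

lemma spc_fc {p : ι → W} {S T U : Finset ι} (hT : T ⊆ S) : Fc (spc p S) T U ↔ Fc p T U := by
  rw [← fc_comp (sp p S).subtype (Submodule.injective_subtype _)]
  exact fc_congr fun i hi => spc_coe (hT hi)

lemma spc_rk {p : ι → W} {S T : Finset ι} (hT : T ⊆ S) : rk (spc p S) T = rk p T := by
  rw [← rk_comp (sp p S).subtype (Submodule.injective_subtype _)]
  unfold rk; rw [sp_congr fun i hi => spc_coe (hT hi)]

lemma spc_sp {p : ι → W} {S : Finset ι} : sp (spc p S) S = ⊤ := by
  apply Submodule.eq_top_of_finrank_eq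
  exact spc_rk (Finset.Subset.refl _)

lemma spc_cvx {p : ι → W} {S : Finset ι} (h : Cvx p S) : Cvx (spc p S) S := by
  refine ⟨?_, fun v hv => (spc_fc (Finset.Subset.refl _)).2 (h.2 v hv)⟩
  obtain ⟨f, hf⟩ := h.1
  refine ⟨f ∘ₗ (sp p S).subtype, fun i hi => ?_⟩
  rw [LinearMap.comp_apply, spc_coe hi]; exact hf i hi

lemma spc_faces (p : ι → W) (S : Finset ι) : faces (spc p S) S = faces p S := by
  ext T; rw [mem_faces, mem_faces, spc_fc (Finset.Subset.refl _)]

lemma spc_jn (p : ι → W) (S A : Finset ι) : jn (spc p S) S A = jn p S A := by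
  ext i; simp only [jn, spc_fc (Finset.Subset.refl _)]

lemma jn_sub_self (p : ι → W) (S A : Finset ι) : jn p S A ⊆ S := Finset.filter_subset _ _

lemma spc_zz (p : ι → W) (S F : Finset ι) (v : ι) : zz (spc p S) S F v = zz p S F v := by
  unfold zz
  rw [spc_jn, spc_rk (Finset.Subset.refl _), spc_rk (jn_sub_self _ _ _)]

lemma spc_kap {p : ι → W} {S F : Finset ι} (hF : F ⊆ S) : kap (spc p S) S F = kap p S F := by
  have : covers (spc p S) S F = covers p S F := by
    ext T
    simp only [mem_covers, spc_fc (Finset.Subset.refl _)]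
    constructor
    · rintro ⟨h1, h2, h3⟩; rw [spc_rk h1.1, spc_rk hF] at h3; exact ⟨h1, h2, h3⟩
    · rintro ⟨h1, h2, h3⟩; rw [← spc_rk h1.1, ← spc_rk hF] at h3; exact ⟨h1, h2, h3⟩
  unfold kap
  rw [spc_rk (Finset.Subset.refl _), spc_rk hF, this]

lemma spc_ker (p : ι → W) (S : Finset ι) (Ed : Finset (Finset ι)) :
    LinearMap.ker (TT (spc p S) S Ed) = LinearMap.ker (TT p S Ed) := by
  rw [← ker_TT_comp (spc p S) S Ed (sp p S).subtype (Submodule.injective_subtype _)]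
  ext x
  simp only [LinearMap.mem_ker, funext_iff, TT_apply, Pi.zero_apply]
  refine forall_congr' fun v => ?_
  rw [spc_coe v.2, Finset.sum_congr rfl (fun (w : ↥S) _ => by rw [spc_coe w.2])]

lemma spc_fk (p : ι → W) (S : Finset ι) (k : ℕ) : fk (spc p S) S k = fk p S k := by
  ext T
  rw [mem_fk, mem_fk, spc_fc (Finset.Subset.refl _)]
  constructor
  · rintro ⟨h1, h2⟩; exact ⟨h1, by rwa [spc_rk h1.1] at h2⟩
  · rintro ⟨h1, h2⟩; exact ⟨h1, by rwa [spc_rk h1.1]⟩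

lemma spc_fr {p : ι → W} {S : Finset ι} {Ed : Finset (Finset ι)} (h : Fr p S Ed) : Fr (spc p S) S Ed where
  pair := fun e he => by
    obtain ⟨h1, G, hG, hr, heG⟩ := h.pair e he
    exact ⟨h1, G, (spc_fc (Finset.Subset.refl _)).2 hG, by rwa [spc_rk hG.1], heG⟩
  edge := by rw [spc_fk]; exact h.edge
  cnt := by rw [spc_fk]; exact h.cnt
  rig := by
    rw [spc_fk]
    intro G hG u hu0 hu
    have hGS := (mem_fk.1 hG).1.1
    obtain ⟨π, hπ⟩ := LinearMap.exists_leftInverse_of_injective (sp p S).subtype (Submodule.ker_subtype _)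
    have hpi : ∀ i ∈ G, π (p i) = spc p S i := fun i hi => by
      have h1 : (sp p S).subtype (spc p S i) = p i := spc_coe (hGS hi)
      rw [← h1]; exact LinearMap.congr_fun hπ _
    obtain ⟨A, hA, hAu⟩ := h.rig G hG (fun v => u v ∘ₗ π)
      (fun v hv => by rw [LinearMap.comp_apply, hpi v hv]; exact hu0 v hv)
      (fun v hv w hw hvw => by
        rw [LinearMap.comp_apply, LinearMap.comp_apply, hpi v hv, hpi w hw]; exact hu v hv w hw hvw)
    refine ⟨pullB (sp p S).subtype A, fun x => hA _, fun v hv w hw => ?_⟩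
    have := hAu v hv w hw
    rw [LinearMap.comp_apply, hpi w hw] at this
    rw [pullB_apply, spc_coe (hGS hv), spc_coe (hGS hw), this]

lemma spc_EdN (p : ι → W) (S F : Finset ι) (Ed : Finset (Finset ι)) : EdN (spc p S) S F Ed = EdN p S F Ed := by
  unfold EdN; simp only [spc_jn]

theorem Fr.stress {p : ι → W} {S : Finset ι} {Ed : Finset (Finset ι)} (h : Fr p S Ed) (hC : Cvx p S) :
    Module.finrank ℝ (LinearMap.ker (TT p S Ed)) + S.card * rk p S = Ed.card + S.card + (rk p S).choose 2 := by
  have := (spc_fr h).stress_top (spc_cvx hC) spc_sp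
  rwa [spc_ker, spc_rk (Finset.Subset.refl _)] at this

/-- Vertices not in `F` carry no stress. -/
lemma ker_TT_face {p : ι → W} {S F : Finset ι} {Ed : Finset (Finset ι)} (hP : ∀ v ∈ S, p v ≠ 0) (hFS : F ⊆ S)
    (hEd : ∀ e ∈ Ed, e ⊆ F) :
    Module.finrank ℝ (LinearMap.ker (TT p S Ed)) = Module.finrank ℝ (LinearMap.ker (TT p F Ed)) := by
  let L : ((↥Ed → ℝ) × (↥F → ℝ)) →ₗ[ℝ] ((↥Ed → ℝ) × (↥S → ℝ)) :=
    { toFun := fun x => (x.1, fun v => exS F x.2 v)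
      map_add' := fun x y => by ext v <;> simp
      map_smul' := fun c x => by ext v <;> simp }
  have hL : Function.Injective L := by
    intro x y hxy
    have h1 : x.1 = y.1 := (Prod.ext_iff.1 hxy).1
    have h2 := (Prod.ext_iff.1 hxy).2
    refine Prod.ext h1 ?_
    funext v
    have := congrFun h2 ⟨v, hFS v.2⟩
    change exS F x.2 v = exS F y.2 v at this
    rwa [exS_coe, exS_coe] at this
  rw [← finrank_map_inj L hL]
  have hsum : ∀ (s : ↥Ed → ℝ) (v : ι), ∑ w : ↥S, exS Ed s {v, w.1} • p w = ∑ w : ↥F, exS Ed s {v, w.1} • p w := by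
    intro s v
    rw [Finset.sum_coe_sort S (fun w => exS Ed s {v, w} • p w), Finset.sum_coe_sort F (fun w => exS Ed s {v, w} • p w)]
    symm
    apply Finset.sum_subset hFS
    intro w _ hw
    rw [exS_not, zero_smul]
    intro he
    exact hw (hEd _ he (by simp))
  have hsum0 : ∀ (s : ↥Ed → ℝ) (v : ι), v ∉ F → ∑ w : ↥S, exS Ed s {v, w.1} • p w = 0 := by
    intro s v hv
    refine Finset.sum_eq_zero fun w _ => ?_
    rw [exS_not, zero_smul]
    intro he
    exact hv (hEd _ he (by simp))
  have : LinearMap.ker (TT p S Ed) = (LinearMap.ker (TT p F Ed)).map L := by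
    ext x
    constructor
    · intro hx
      rw [LinearMap.mem_ker] at hx
      have hx' : ∀ v : ↥S, x.2 v • p v + ∑ w : ↥S, exS Ed x.1 {v.1, w.1} • p w = 0 := fun v => congrFun hx v
      refine ⟨(x.1, fun v => x.2 ⟨v, hFS v.2⟩), ?_, ?_⟩
      · rw [SetLike.mem_coe, LinearMap.mem_ker]
        funext v
        rw [TT_apply]
        have := hx' ⟨v, hFS v.2⟩
        rw [hsum] at this
        exact this
      · refine Prod.ext rfl ?_
        funext v
        change exS F (fun v => x.2 ⟨v, hFS v.2⟩) v.1 = x.2 v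
        by_cases hv : v.1 ∈ F
        · rw [exS_mem _ hv]
        · rw [exS_not _ hv]
          have := hx' v
          rw [hsum0 _ _ hv, add_zero, smul_eq_zero] at this
          rcases this with h | h
          · exact h.symm
          · exact absurd h (hP v v.2)
    · rintro ⟨y, hy, rfl⟩
      rw [SetLike.mem_coe, LinearMap.mem_ker] at hy
      rw [LinearMap.mem_ker]
      funext v
      rw [TT_apply]
      change exS F y.2 v • p v + ∑ w : ↥S, exS Ed y.1 {v.1, w.1} • p w = 0
      by_cases hv : v.1 ∈ F
      · rw [exS_mem _ hv, hsum]; exact congrFun hy ⟨v, hv⟩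
      · rw [exS_not _ hv, hsum0 _ _ hv]; simp
  rw [this]

theorem stress_diff {p : ι → W} {S F : Finset ι} {Ed : Finset (Finset ι)} (h : Fr p S Ed) (hC : Cvx p S)
    (hF : Fc p S F) :
    (Module.finrank ℝ (LinearMap.ker (TT p S Ed)) : ℤ) - Module.finrank ℝ (LinearMap.ker (TT p S (EdN p S F Ed))) =
      (Ed.card : ℤ) - (EdN p S F Ed).card - ∑ v ∈ S, (zz p S F v : ℤ) + kap p S F := by
  have hle := rk_mono (p := p) hF.1
  by_cases hr : rk p F + 2 ≤ rk p S
  · have := stress_diff_top (spc_fr h) (spc_cvx hC) spc_sp ((spc_fc (Finset.Subset.refl _)).2 hF) (by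
      rwa [spc_rk (Finset.Subset.refl _), spc_rk hF.1])
    rw [spc_ker, spc_EdN, spc_ker, spc_kap hF.1] at this
    simp only [spc_zz] at this
    exact this
  have h1 := h.stress hC
  by_cases h0 : rk p S = rk p F
  · have hFS : F = S := hF.eq_of_rk (Finset.Subset.refl _) hF.1 h0.le
    subst hFS
    have hj : ∀ A ⊆ F, jn p F (F ∪ A) = F := fun A hA => by
      rw [Finset.union_eq_left.2 hA, jn_eq_self hF]
    have hN : EdN p F F Ed = ∅ := by
      rw [EdN, Finset.filter_eq_empty_iff]
      intro e he
      rw [hj e (h.edge_sub e he).2]; simp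
    have hz : ∀ v ∈ F, (zz p F F v : ℤ) = rk p F - 1 := by
      intro v hv
      have := rk_pos_of_mem hC.1 (Finset.Subset.refl _) ⟨v, hv⟩
      rw [zz, if_pos (hj {v} (by simpa using hv))]; omega
    have h2 : Module.finrank ℝ (LinearMap.ker (TT p F ∅)) = 0 := by
      rw [ker_TT_face (p := p) (S := F) (F := ∅) (Ed := ∅) (fun v hv => hC.1.ne_zero hv) (Finset.empty_subset _) (by simp)]
      exact Module.finrank_zero_of_subsingleton
    rw [hN, h2, Finset.sum_congr rfl hz, kap, if_pos rfl]
    simp only [Finset.sum_const, Finset.card_empty]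
    zify at h1
    rw [nsmul_eq_mul]; push_cast; linarith
  · have hr1 : rk p S = rk p F + 1 := by omega
    have hprop : ∀ G, Fc p S G → F ⊆ G → G ≠ S → G = F := by
      intro G hG hFG hne
      have := hG.rk_lt (Finset.Subset.refl _) hG.1 hne
      exact (hF.eq_of_rk hG.1 hFG (by omega)).symm
    have hFne : F ≠ S := by rintro rfl; omega
    have hN : EdN p S F Ed = Ed.filter (fun e => e ⊆ F) := by
      ext e
      rw [EdN, Finset.mem_filter, Finset.mem_filter]
      refine and_congr_right fun he => ?_
      rw [jn_ne_iff (Finset.union_subset hF.1 (h.edge_sub e he).2)]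
      constructor
      · rintro ⟨G, hG, hne, hs⟩
        rw [hprop G hG (Finset.subset_union_left.trans hs) hne] at hs
        exact Finset.subset_union_right.trans hs
      · intro he; exact ⟨F, hF, hFne, Finset.union_subset (Finset.Subset.refl _) he⟩
    have h2 := (h.sub hF).stress (hC.mono hF.1)
    rw [hN, ker_TT_face (F := F) (fun v hv => hC.1.ne_zero hv) hF.1 (fun e he => (Finset.mem_filter.1 he).2)]
    have hz : ∀ v ∈ S, (zz p S F v : ℤ) = if v ∈ F then 1 else (rk p F : ℤ) := by
      intro v hv
      have hsub : F ∪ {v} ⊆ S := Finset.union_subset hF.1 (by simpa using hv)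
      split_ifs with hvF
      · have hj : jn p S (F ∪ {v}) = F := by
          rw [Finset.union_eq_left.2 (by simpa using hvF), jn_eq_self hF]
        rw [zz, hj, if_neg hFne, if_pos hr1.symm]; rfl
      · have hj : jn p S (F ∪ {v}) = S := by
          by_contra hne
          have := hprop _ (jn_fc p S _ hsub) (Finset.subset_union_left.trans (sub_jn hsub)) hne
          apply hvF
          rw [← this]; exact sub_jn hsub (by simp)
        rw [zz, if_pos hj, hr1]; simp
    rw [Finset.sum_congr rfl hz, kap, if_neg (by omega), if_pos hr1]
    rw [Finset.sum_ite, Finset.sum_const, Finset.sum_const]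
    have hc1 : (S.filter (fun v => v ∈ F)).card = F.card := by
      congr 1; rw [Finset.filter_mem_eq_inter, Finset.inter_eq_right.2 hF.1]
    have hc2 : ((S.filter (fun v => ¬ v ∈ F)).card : ℤ) = S.card - F.card := by
      have := Finset.card_filter_add_card_filter_not (s := S) (fun v => v ∈ F)
      omega
    rw [nsmul_eq_mul, nsmul_eq_mul, hc1, hc2]
    have hch : ((rk p F + 1).choose 2 : ℤ) = (rk p F).choose 2 + rk p F := by
      rw [Nat.choose_succ_succ' (rk p F) 1, Nat.choose_one_right]; push_cast; ring
    rw [hr1] at h1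
    zify at h1 h2
    rw [hch] at h1
    linarith

end PartG8

section PartH1
set_option linter.unusedSectionVars false
variable {ι : Type*} [DecidableEq ι] {W : Type*} [AddCommGroup W] [Module ℝ W]

/-- Faces above `F`. -/
def up (p : ι → W) (S F : Finset ι) : Finset (Finset ι) := (faces p S).filter (fun E => F ⊆ E)

lemma mem_up {p : ι → W} {S F E : Finset ι} : E ∈ up p S F ↔ Fc p S E ∧ F ⊆ E := by
  simp [up, mem_faces]

lemma up_sub {p : ι → W} {S F T : Finset ι} (hT : Fc p S T) : up p T F = (up p S F).filter (fun E => E ⊆ T) := by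
  ext E
  simp only [Finset.mem_filter, mem_up]
  exact ⟨fun h => ⟨⟨hT.trans h.1, h.2⟩, h.1.1⟩, fun h => ⟨h.1.1.restrict' hT.1 h.2, h.1.2⟩⟩

lemma jn_face {p : ι → W} {S E A : Finset ι} (hE : Fc p S E) (hA : A ⊆ E) : jn p E A = jn p S A := by
  apply Finset.Subset.antisymm
  · exact jn_sub ((jn_fc p S A (hA.trans hE.1)).restrict' hE.1 (jn_sub hE hA)) (sub_jn (hA.trans hE.1))
  · exact jn_sub (hE.trans (jn_fc p E A hA)) (sub_jn hA)

lemma jn_mem_up {p : ι → W} {S F A : Finset ι} (hA : F ∪ A ⊆ S) : jn p S (F ∪ A) ∈ up p S F :=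
  mem_up.2 ⟨jn_fc p S _ hA, Finset.subset_union_left.trans (sub_jn hA)⟩

/-- Moebius uniqueness on the faces above `F`. -/
lemma up_unique {p : ι → W} {S F : Finset ι} (a b : Finset ι → ℤ)
    (h : ∀ T ∈ up p S F, ∑ E ∈ up p T F, a E = ∑ E ∈ up p T F, b E) : ∀ T ∈ up p S F, a T = b T := by
  suffices H : ∀ n, ∀ T ∈ up p S F, T.card = n → a T = b T from fun T hT => H _ T hT rfl
  intro n
  induction n using Nat.strong_induction_on with
  | _ n ih =>
    intro T hT hn
    have h1 := h T hT
    have hTT : T ∈ up p T F := mem_up.2 ⟨Fc.refl p T, (mem_up.1 hT).2⟩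
    rw [← Finset.add_sum_erase _ _ hTT, ← Finset.add_sum_erase _ _ hTT] at h1
    have h2 : ∑ E ∈ (up p T F).erase T, a E = ∑ E ∈ (up p T F).erase T, b E := by
      refine Finset.sum_congr rfl fun E hE => ?_
      rw [Finset.mem_erase, mem_up] at hE
      have hlt : E ⊂ T := hE.2.1.1.ssubset_of_ne hE.1
      exact ih E.card (hn ▸ Finset.card_lt_card hlt) E (mem_up.2 ⟨(mem_up.1 hT).1.trans hE.2.1, hE.2.2⟩) rfl
    rw [h2] at h1
    linarith

/-- The number of vertices joining `F` to `E`. -/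
def nu (p : ι → W) (S F E : Finset ι) : ℕ := (S.filter (fun v => jn p S (F ∪ {v}) = E)).card

lemma nu_sub {p : ι → W} {S F T E : Finset ι} (hT : Fc p S T) (hE : E ⊆ T) (hFT : F ⊆ T) (hF : F ⊆ S) :
    nu p T F E = nu p S F E := by
  unfold nu
  congr 1
  ext v
  simp only [Finset.mem_filter]
  constructor
  · rintro ⟨h1, h2⟩
    exact ⟨hT.1 h1, by rw [← jn_face hT (Finset.union_subset hFT (by simpa using h1))]; exact h2⟩
  · rintro ⟨h1, h2⟩
    have hv : v ∈ T := by
      apply hE; rw [← h2]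
      exact sub_jn (Finset.union_subset hF (by simpa using h1)) (by simp)
    exact ⟨hv, by rw [jn_face hT (Finset.union_subset hFT (by simpa using hv))]; exact h2⟩

lemma sum_nu {p : ι → W} {S F : Finset ι} (hF : F ⊆ S) (φ : Finset ι → ℤ) :
    ∑ E ∈ up p S F, (nu p S F E : ℤ) * φ E = ∑ v ∈ S, φ (jn p S (F ∪ {v})) := by
  rw [← Finset.sum_fiberwise_of_maps_to (s := S) (t := up p S F) (g := fun v => jn p S (F ∪ {v}))
    (fun v hv => jn_mem_up (Finset.union_subset hF (by simpa using hv)))]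
  refine Finset.sum_congr rfl fun E _ => ?_
  rw [Finset.sum_congr rfl (g := fun _ => φ E)]
  · rw [Finset.sum_const, nsmul_eq_mul, nu]
  · intro v hv; rw [(Finset.mem_filter.1 hv).2]

lemma ed_sum {p : ι → W} {S F : Finset ι} {Ed : Finset (Finset ι)} (h : Fr p S Ed) (hF : Fc p S F) :
    ∑ E ∈ up p S F, (((Ed.filter (fun e => e ⊆ E)).card : ℤ) - (EdN p E F (Ed.filter (fun e => e ⊆ E))).card) = Ed.card := by
  rw [Finset.card_eq_sum_card_fiberwise (s := Ed) (t := up p S F) (f := fun e => jn p S (F ∪ e))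
    (fun e he => jn_mem_up (Finset.union_subset hF.1 (h.edge_sub e he).2))]
  push_cast
  refine Finset.sum_congr rfl fun E hE => ?_
  obtain ⟨hE, hFE⟩ := mem_up.1 hE
  have h1 := Finset.card_filter_add_card_filter_not (s := Ed.filter (fun e => e ⊆ E)) (fun e => jn p E (F ∪ e) ≠ E)
  unfold EdN
  have h2 : (Ed.filter (fun e => e ⊆ E)).filter (fun e => ¬ jn p E (F ∪ e) ≠ E) = Ed.filter (fun e => jn p S (F ∪ e) = E) := by
    ext e
    simp only [Finset.mem_filter, not_not]
    constructor
    · rintro ⟨⟨h1, h2⟩, h3⟩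
      exact ⟨h1, by rw [← jn_face hE (Finset.union_subset hFE h2)]; exact h3⟩
    · rintro ⟨h1, h2⟩
      have : e ⊆ E := by
        conv_rhs => rw [← h2]
        exact Finset.subset_union_right.trans (sub_jn (Finset.union_subset hF.1 (h.edge_sub e h1).2))
      exact ⟨⟨h1, this⟩, by rw [jn_face hE (Finset.union_subset hFE this)]; exact h2⟩
  rw [← h2]
  omega

lemma zz_sum {p : ι → W} {S F : Finset ι} (hP : PosC p S) (hF : Fc p S F) :
    ∑ E ∈ up p S F, ∑ v ∈ E, (zz p E F v : ℤ) =
      ∑ v ∈ S, ((rk p (jn p S (F ∪ {v})) : ℤ) - 1 + (covers p S (jn p S (F ∪ {v}))).card) := by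
  have h1 : ∀ E ∈ up p S F, ∑ v ∈ E, (zz p E F v : ℤ) = ∑ v ∈ S, if v ∈ E then (zz p E F v : ℤ) else 0 := by
    intro E hE
    rw [← Finset.sum_filter]
    congr 1
    ext v; simp only [Finset.mem_filter]
    exact ⟨fun h => ⟨(mem_up.1 hE).1.1 h, h⟩, fun h => h.2⟩
  rw [Finset.sum_congr rfl h1, Finset.sum_comm]
  refine Finset.sum_congr rfl fun v hv => ?_
  have hsub : F ∪ {v} ⊆ S := Finset.union_subset hF.1 (by simpa using hv)
  set J := jn p S (F ∪ {v}) with hJ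
  have hJf : Fc p S J := jn_fc p S _ hsub
  have hsJ : F ∪ {v} ⊆ J := sub_jn hsub
  have hvJ : v ∈ J := hsJ (by simp)
  have hFJ : F ⊆ J := Finset.subset_union_left.trans hsJ
  have hpos : 0 < rk p J := rk_pos_of_mem hP hJf.1 ⟨v, hvJ⟩
  have h2 : ∀ E ∈ up p S F, (if v ∈ E then (zz p E F v : ℤ) else 0) =
      (if E = J then (rk p J : ℤ) - 1 else 0) + (if E ∈ covers p S J then 1 else 0) := by
    intro E hE
    obtain ⟨hE, hFE⟩ := mem_up.1 hE
    by_cases hvE : v ∈ E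
    · have hsE : F ∪ {v} ⊆ E := Finset.union_subset hFE (by simpa using hvE)
      have hJE : J ⊆ E := jn_sub hE hsE
      rw [if_pos hvE, zz, jn_face hE hsE, ← hJ]
      by_cases hEJ : J = E
      · subst hEJ
        rw [if_pos rfl, if_pos rfl, if_neg (by rw [mem_covers]; omega)]
        omega
      · have hEJ' : ¬ E = J := fun h => hEJ h.symm
        rw [if_neg hEJ, if_neg hEJ']
        by_cases hr : rk p J + 1 = rk p E
        · rw [if_pos hr, if_pos (mem_covers.2 ⟨hE, hJE, hr.symm⟩)]; simp
        · rw [if_neg hr, if_neg (fun h => hr (mem_covers.1 h).2.2.symm)]; simp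
    · rw [if_neg hvE, if_neg (by rintro rfl; exact hvE hvJ), if_neg (fun h => hvE ((mem_covers.1 h).2.1 hvJ))]
      simp
  rw [Finset.sum_congr rfl h2, Finset.sum_add_distrib]
  congr 1
  · rw [Finset.sum_ite_eq', if_pos (mem_up.2 ⟨hJf, hFJ⟩)]
  · rw [← Finset.sum_filter, Finset.card_eq_sum_ones]
    push_cast
    congr 1
    ext E; simp only [Finset.mem_filter, mem_up, mem_covers]
    exact ⟨fun h => h.2, fun h => ⟨⟨h.1, hFJ.trans h.2.1⟩, h⟩⟩

/-- Faces above `F` of relative rank `k`. -/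
def upk (p : ι → W) (S F : Finset ι) (k : ℕ) : Finset (Finset ι) := (up p S F).filter (fun E => rk p E = rk p F + k)

lemma mem_upk {p : ι → W} {S F E : Finset ι} {k : ℕ} : E ∈ upk p S F k ↔ Fc p S E ∧ F ⊆ E ∧ rk p E = rk p F + k := by
  rw [upk, Finset.mem_filter, mem_up, and_assoc]

lemma upk_one {p : ι → W} {S F : Finset ι} : upk p S F 1 = covers p S F := by
  ext E; rw [mem_upk, mem_covers]

lemma upk_card {p : ι → W} {S F : Finset ι} (hF : Fc p S F) (k : ℕ) : (upk p S F k).card = fcount (Qp p F) (S \ F) k := by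
  rw [← card_quot hF]
  congr 1
  ext E; rw [mem_upk, Finset.mem_filter, mem_faces]

lemma upk_zero {p : ι → W} {S F : Finset ι} (hF : Fc p S F) : upk p S F 0 = {F} := by
  ext E; rw [mem_upk, Finset.mem_singleton]
  constructor
  · rintro ⟨h1, h2, h3⟩; exact (hF.eq_of_rk h1.1 h2 (by omega)).symm
  · rintro rfl; exact ⟨hF, Finset.Subset.refl _, rfl⟩

lemma kap_sum {p : ι → W} {S F : Finset ι} (hF : Fc p S F) :
    ∑ E ∈ up p S F, kap p E F = ((rk p F).choose 2 : ℤ) + (covers p S F).card * rk p F + (upk p S F 2).card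
      + ∑ E ∈ upk p S F 3, (3 - ((covers p E F).card : ℤ)) := by
  have h1 : ∀ E ∈ up p S F, kap p E F = (if rk p E = rk p F + 0 then ((rk p F).choose 2 : ℤ) else 0)
      + (if rk p E = rk p F + 1 then (rk p F : ℤ) else 0) + (if rk p E = rk p F + 2 then 1 else 0)
      + (if rk p E = rk p F + 3 then (3 - ((covers p E F).card : ℤ)) else 0) := by
    intro E _
    unfold kap
    split_ifs <;> first | omega | simp_all
  rw [Finset.sum_congr rfl h1]
  simp only [Finset.sum_add_distrib, ← Finset.sum_filter]
  change ∑ E ∈ upk p S F 0, _ + ∑ E ∈ upk p S F 1, _ + ∑ E ∈ upk p S F 2, _ + ∑ E ∈ upk p S F 3, _ = _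
  rw [upk_zero hF, upk_one]
  simp

lemma cover_sum {p : ι → W} {S F : Finset ι} (hF : Fc p S F) :
    ∑ E ∈ covers p S F, ((covers p S E).card : ℤ) = 2 * (upk p S F 2).card := by
  have h1 : ∀ E ∈ covers p S F, ((covers p S E).card : ℤ) = ∑ X ∈ upk p S F 2, if E ⊆ X then 1 else 0 := by
    intro E hE
    rw [mem_covers] at hE
    rw [← Finset.sum_filter, Finset.card_eq_sum_ones]
    push_cast
    congr 1
    ext X; simp only [Finset.mem_filter, mem_upk, mem_covers]
    constructor
    · rintro ⟨a, b, c⟩; exact ⟨⟨a, hE.2.1.trans b, by omega⟩, b⟩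
    · rintro ⟨⟨a, b, c⟩, d⟩; exact ⟨a, d, by omega⟩
  rw [Finset.sum_congr rfl h1, Finset.sum_comm, Finset.sum_congr rfl (g := fun _ => (2 : ℤ))]
  · rw [Finset.sum_const, nsmul_eq_mul]; ring
  · intro X hX
    rw [mem_upk] at hX
    rw [← Finset.sum_filter]
    have := diamond (hF.restrict' hX.1.1 hX.2.1) hX.2.2
    rw [← Nat.cast_inj (R := ℤ)] at this
    rw [Finset.sum_const, nsmul_eq_mul, mul_one]
    refine Eq.trans ?_ this
    congr 2
    ext E; simp only [Finset.mem_filter, mem_covers]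
    exact ⟨fun h => ⟨h.1.1.restrict' hX.1.1 h.2, h.1.2⟩, fun h => ⟨⟨hX.1.trans h.1, h.2⟩, h.1.1⟩⟩

lemma Fr.card {p : ι → W} {S : Finset ι} {Ed : Finset (Finset ι)} (h : Fr p S Ed) (hC : Cvx p S) :
    (Ed.card : ℤ) = fcount p S 2 + ∑ G ∈ fk p S 3, ((G.card : ℤ) - 3) := by
  have h1 : (Ed \ fk p S 2).card + fcount p S 2 = Ed.card := Finset.card_sdiff_add_card_eq_card h.edge
  have h2 : ∀ e ∈ Ed \ fk p S 2, ∑ G ∈ fk p S 3, (if e ⊆ G then (1 : ℤ) else 0) = 1 := by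
    intro e he
    rw [Finset.mem_sdiff] at he
    obtain ⟨hc, G, hG, hr, heG⟩ := h.pair e he.1
    have hre : ∀ H, Fc p S H → e ⊆ H → 3 ≤ rk p H := by
      intro H hH heH
      obtain ⟨v, w, hvw, rfl⟩ := Finset.card_eq_two.1 hc
      have hr2 := hC.rk_pair (hH.1 (heH (by simp : v ∈ _))) (hH.1 (heH (by simp : w ∈ _))) hvw
      have := rk_mono (p := p) heH
      by_contra hlt
      have h3 : H ∈ fk p S 2 := mem_fk.2 ⟨hH, by omega⟩
      have := hC.edge_pair h3 hvw (heH (by simp)) (heH (by simp))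
      exact he.2 (this ▸ h3)
    have hG3 := hre G hG heG
    rw [← Finset.sum_filter, Finset.sum_const, nsmul_eq_mul, mul_one]
    have : (fk p S 3).filter (fun G => e ⊆ G) = {G} := by
      ext H
      rw [Finset.mem_filter, mem_fk, Finset.mem_singleton]
      constructor
      · rintro ⟨⟨a, b⟩, c⟩
        have hGH := hre _ (hG.inter a) (Finset.subset_inter heG c)
        have e1 := (hG.inter a).eq_of_rk hG.1 Finset.inter_subset_left (by omega)
        have e2 := (hG.inter a).eq_of_rk a.1 Finset.inter_subset_right (by omega)
        exact e2.symm.trans e1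
      · rintro rfl; exact ⟨⟨hG, by omega⟩, heG⟩
    rw [this]; simp
  have h3 : ((Ed \ fk p S 2).card : ℤ) = ∑ G ∈ fk p S 3, ((G.card : ℤ) - 3) := by
    rw [Finset.card_eq_sum_ones]
    push_cast
    rw [← Finset.sum_congr rfl h2, Finset.sum_comm]
    refine Finset.sum_congr rfl fun G hG => ?_
    rw [← Finset.sum_filter, Finset.sum_const, nsmul_eq_mul, mul_one]
    have h4 := h.cnt G hG
    obtain ⟨hGf, hG3⟩ := mem_fk.1 hG
    have h5 : fcount p G 2 = G.card := by
      rw [fcount_rank3 (hC.mono hGf.1).1 hG3, (hC.mono hGf.1).fcount_one]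
    rw [← fk_card, fk_sub hGf] at h5
    have h6 : (Ed \ fk p S 2).filter (fun e => e ⊆ G) = Ed.filter (fun e => e ⊆ G) \ (fk p S 2).filter (fun e => e ⊆ G) := by
      ext e; simp only [Finset.mem_filter, Finset.mem_sdiff]; tauto
    have h7 := Finset.card_sdiff_add_card_eq_card (Finset.filter_subset_filter (fun e => e ⊆ G) h.edge)
    rw [h6]
    omega
  rw [← h3]; omega

end PartH1

section PartH2
set_option linter.unusedSectionVars false
variable {ι : Type*} [DecidableEq ι] {W : Type*} [AddCommGroup W] [Module ℝ W]

/-- The stress number of a face. -/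
def sE (p : ι → W) (F : Finset ι) (Ed : Finset (Finset ι)) (E : Finset ι) : ℤ :=
  ((Ed.filter (fun e => e ⊆ E)).card : ℤ) - (EdN p E F (Ed.filter (fun e => e ⊆ E))).card
    - ∑ v ∈ E, (zz p E F v : ℤ) + kap p E F

lemma sE_sum {p : ι → W} {S F : Finset ι} {Ed : Finset (Finset ι)} (h : Fr p S Ed) (hC : Cvx p S) (hF : Fc p S F) :
    ∑ E ∈ up p S F, sE p F Ed E = (Ed.card : ℤ)
      - ∑ v ∈ S, ((rk p (jn p S (F ∪ {v})) : ℤ) - 1 + (covers p S (jn p S (F ∪ {v}))).card)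
      + (((rk p F).choose 2 : ℤ) + (covers p S F).card * rk p F + (upk p S F 2).card
      + ∑ E ∈ upk p S F 3, (3 - ((covers p E F).card : ℤ))) := by
  unfold sE
  rw [Finset.sum_add_distrib, Finset.sum_sub_distrib, ed_sum h hF, zz_sum hC.1 hF, kap_sum hF]

/-- Data of the relative g polynomials on a configuration. -/
structure RelC (p : ι → W) (S F : Finset ι) (G r : Finset ι → ℤ[X]) (q : Finset ι → Finset ι → ℤ[X]) : Prop where
  gh : ∃ H, GHc p S G H
  quo : ∀ T ∈ up p S F, ∀ E ∈ up p T F, ∃ G' H', GHc (Qp p E) (T \ E) G' H' ∧ q T E = G' (T \ E)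
  rel : ∀ T ∈ up p S F, ∑ E ∈ up p T F, r E * q T E = G T

lemma RelC.q0 {p : ι → W} {S F : Finset ι} {G r : Finset ι → ℤ[X]} {q : Finset ι → Finset ι → ℤ[X]}
    (h : RelC p S F G r q) : ∀ T ∈ up p S F, ∀ E ∈ up p T F, (q T E).coeff 0 = 1 := by
  intro T hT E hE
  obtain ⟨G', H', hG, he⟩ := h.quo T hT E hE
  rw [he]; exact hG.coeff0 (pos_quot (mem_up.1 hE).1)

lemma RelC.q1 {p : ι → W} {S F : Finset ι} {G r : Finset ι → ℤ[X]} {q : Finset ι → Finset ι → ℤ[X]}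
    (h : RelC p S F G r q) : ∀ T ∈ up p S F, ∀ E ∈ up p T F,
      (q T E).coeff 1 = ((covers p T E).card : ℤ) - (rk p T - rk p E) := by
  intro T hT E hE
  obtain ⟨G', H', hG, he⟩ := h.quo T hT E hE
  have hE := (mem_up.1 hE).1
  rw [he, hG.coeff1 (pos_quot hE), ← upk_card hE, upk_one, ← rk_quot_all hE.1]
  push_cast; ring

lemma RelC.q2 {p : ι → W} {S F : Finset ι} {G r : Finset ι → ℤ[X]} {q : Finset ι → Finset ι → ℤ[X]}
    (h : RelC p S F G r q) : ∀ T ∈ up p S F, ∀ E ∈ up p T F,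
      (q T E).coeff 2 = ((rk p T - rk p E).choose 2 : ℤ) - (rk p T - rk p E - 1) * ((covers p T E).card : ℤ)
        + (upk p T E 2).card + ∑ X ∈ upk p T E 3, ((covers p X E).card - 3 : ℤ) := by
  intro T hT E hE
  obtain ⟨G', H', hG, he⟩ := h.quo T hT E hE
  have hE := (mem_up.1 hE).1
  have hr := rk_quot_all (p := p) hE.1
  rw [he, hG.coeff2 (pos_quot hE), ← upk_card hE, ← upk_card hE, upk_one, ← hr, Nat.add_sub_cancel]
  push_cast
  have h1 : ∑ X ∈ upk p T E 3, ((covers p X E).card - 3 : ℤ) = ∑ U ∈ faces (Qp p E) (T \ E),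
      if rk p (E ∪ U) = rk p E + 3 then ((covers p (E ∪ U) E).card - 3 : ℤ) else 0 := by
    rw [← sum_quot hE (fun X => if rk p X = rk p E + 3 then ((covers p X E).card - 3 : ℤ) else 0), ← Finset.sum_filter]
    rfl
  rw [h1, Finset.sum_filter]
  congr 1
  · ring
  · refine Finset.sum_congr rfl fun U hU => ?_
    rw [← rk_quot]
    have hUs := (mem_faces.1 hU).1
    have hEU := (fc_quot hE hUs).1 (mem_faces.1 hU)
    have hEf : Fc p (E ∪ U) E := hE.restrict' hEU.1 Finset.subset_union_left
    have : (covers p (E ∪ U) E).card = fcount (Qp p E) U 1 := by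
      rw [← upk_one, upk_card hEf]
      congr 1
      rw [Finset.union_sdiff_left]
      exact Finset.sdiff_eq_self_of_disjoint (Finset.disjoint_of_subset_left hUs Finset.sdiff_disjoint)
    rw [this]
    by_cases h3 : rk (Qp p E) U = 3
    · rw [if_pos h3, if_pos (by omega)]
    · rw [if_neg h3, if_neg (by omega)]

lemma RelC.r0 {p : ι → W} {S F : Finset ι} {G r : Finset ι → ℤ[X]} {q : Finset ι → Finset ι → ℤ[X]}
    (hC : Cvx p S) (hF : Fc p S F) (h : RelC p S F G r q) :
    ∀ T ∈ up p S F, (r T).coeff 0 = if T = F then 1 else 0 := by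
  apply up_unique
  intro T hT
  have hT' := mem_up.1 hT
  have h1 := congrArg (fun x => coeff x 0) (h.rel T hT)
  obtain ⟨H, hG⟩ := h.gh
  simp only [finsetSum_coeff, mul_coeff_zero] at h1
  rw [(hG.sub (mem_faces.2 hT'.1)).coeff0 (hC.mono hT'.1.1).1] at h1
  rw [Finset.sum_ite_eq', if_pos (mem_up.2 ⟨hF.restrict' hT'.1.1 hT'.2, Finset.Subset.refl _⟩), ← h1]
  refine Finset.sum_congr rfl fun E hE => ?_
  rw [h.q0 T hT E hE, mul_one]

lemma up_F {p : ι → W} {S F T : Finset ι} (hF : Fc p S F) (hT : T ∈ up p S F) : F ∈ up p T F :=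
  mem_up.2 ⟨hF.restrict' (mem_up.1 hT).1.1 (mem_up.1 hT).2, Finset.Subset.refl _⟩

lemma up_trans {p : ι → W} {S F T E : Finset ι} (hT : T ∈ up p S F) (hE : E ∈ up p T F) : E ∈ up p S F :=
  mem_up.2 ⟨(mem_up.1 hT).1.trans (mem_up.1 hE).1, (mem_up.1 hE).2⟩

lemma RelC.r1 {p : ι → W} {S F : Finset ι} {G r : Finset ι → ℤ[X]} {q : Finset ι → Finset ι → ℤ[X]}
    (hC : Cvx p S) (hF : Fc p S F) (h : RelC p S F G r q) :
    ∀ T ∈ up p S F, (r T).coeff 1 = (nu p S F T : ℤ) - (if T = F then (rk p F : ℤ) else 0) - (if T ∈ covers p S F then 1 else 0) := by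
  apply up_unique
  intro T hT
  have hT' := mem_up.1 hT
  have hCT := hC.mono hT'.1.1
  have h1 := congrArg (fun x => coeff x 1) (h.rel T hT)
  obtain ⟨H, hG⟩ := h.gh
  simp only [finsetSum_coeff, coeff_one_mul', Finset.sum_add_distrib] at h1
  rw [(hG.sub (mem_faces.2 hT'.1)).coeff1 hCT.1, hCT.fcount_one] at h1
  have h2 : ∑ E ∈ up p T F, (r E).coeff 0 * (q T E).coeff 1 = (q T F).coeff 1 := by
    rw [Finset.sum_congr rfl (g := fun E => if E = F then (q T E).coeff 1 else 0)]
    · rw [Finset.sum_ite_eq', if_pos (up_F hF hT)]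
    · intro E hE
      rw [h.r0 hC hF E (up_trans hT hE)]; split_ifs <;> simp
  have h3 : ∑ E ∈ up p T F, (r E).coeff 1 * (q T E).coeff 0 = ∑ E ∈ up p T F, (r E).coeff 1 :=
    Finset.sum_congr rfl fun E hE => by rw [h.q0 T hT E hE, mul_one]
  rw [h2, h3, h.q1 T hT F (up_F hF hT)] at h1
  rw [Finset.sum_sub_distrib, Finset.sum_sub_distrib, Finset.sum_ite_eq', if_pos (up_F hF hT)]
  have h4 : ∑ E ∈ up p T F, (nu p S F E : ℤ) = T.card := by
    have := sum_nu (p := p) hT'.2 (fun _ => 1)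
    simp only [mul_one, Finset.sum_const, nsmul_eq_mul] at this
    rw [← this]
    refine Finset.sum_congr rfl fun E hE => ?_
    rw [nu_sub hT'.1 (mem_up.1 hE).1.1 hT'.2 hF.1]
  have h5 : ∑ E ∈ up p T F, (if E ∈ covers p S F then (1 : ℤ) else 0) = (covers p T F).card := by
    rw [← Finset.sum_filter, Finset.sum_const, nsmul_eq_mul, mul_one]
    congr 2
    ext E; simp only [Finset.mem_filter, mem_up, mem_covers]
    exact ⟨fun hh => ⟨hh.1.1, hh.2.2⟩, fun hh => ⟨⟨hh.1, hh.2.1⟩, hT'.1.trans hh.1, hh.2⟩⟩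
  rw [h4, h5]
  linarith

lemma RelC.sub {p : ι → W} {S F T : Finset ι} {G r : Finset ι → ℤ[X]} {q : Finset ι → Finset ι → ℤ[X]}
    (h : RelC p S F G r q) (hT : T ∈ up p S F) : RelC p T F G r q where
  gh := by obtain ⟨H, hH⟩ := h.gh; exact ⟨H, hH.sub (mem_faces.2 (mem_up.1 hT).1)⟩
  quo := fun U hU => h.quo U (up_trans hT hU)
  rel := fun U hU => h.rel U (up_trans hT hU)

lemma choose_two_add (a b : ℕ) : (((a + b).choose 2 : ℕ) : ℤ) = (a.choose 2 : ℤ) + (b.choose 2 : ℤ) + a * b := by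
  induction b with
  | zero => simp
  | succ b ih =>
    have h1 : (a + (b + 1)).choose 2 = (a + b).choose 2 + (a + b) := by
      rw [← add_assoc, Nat.choose_succ_succ' (a + b) 1, Nat.choose_one_right]; ring
    have h2 : (b + 1).choose 2 = b.choose 2 + b := by
      rw [Nat.choose_succ_succ' b 1, Nat.choose_one_right]; ring
    rw [h1, h2]; push_cast; rw [ih]; ring

lemma RelC.sum2 {p : ι → W} {S F : Finset ι} {Ed : Finset (Finset ι)} {G r : Finset ι → ℤ[X]} {q : Finset ι → Finset ι → ℤ[X]}
    (hFr : Fr p S Ed) (hC : Cvx p S) (hF : Fc p S F) (h : RelC p S F G r q) :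
    ∑ E ∈ up p S F, (r E).coeff 2 = ∑ E ∈ up p S F, sE p F Ed E := by
  have hS : S ∈ up p S F := mem_up.2 ⟨Fc.refl p S, hF.1⟩
  have hFu := up_F hF hS
  have h1 := congrArg (fun x => coeff x 2) (h.rel S hS)
  obtain ⟨H, hG⟩ := id h.gh
  simp only [finsetSum_coeff, coeff_two_mul, Finset.sum_add_distrib] at h1
  have h2 : ∑ E ∈ up p S F, (r E).coeff 0 * (q S E).coeff 2 = (q S F).coeff 2 := by
    rw [Finset.sum_congr rfl (g := fun E => if E = F then (q S E).coeff 2 else 0)]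
    · rw [Finset.sum_ite_eq', if_pos hFu]
    · intro E hE
      rw [h.r0 hC hF E hE]; split_ifs <;> simp
  have h3 : ∑ E ∈ up p S F, (r E).coeff 2 * (q S E).coeff 0 = ∑ E ∈ up p S F, (r E).coeff 2 :=
    Finset.sum_congr rfl fun E hE => by rw [h.q0 S hS E hE, mul_one]
  have h4 : ∑ E ∈ up p S F, (r E).coeff 1 * (q S E).coeff 1 =
      ∑ v ∈ S, (((covers p S (jn p S (F ∪ {v}))).card : ℤ) - (rk p S - rk p (jn p S (F ∪ {v}))))
      - rk p F * (((covers p S F).card : ℤ) - (rk p S - rk p F))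
      - ∑ E ∈ covers p S F, (((covers p S E).card : ℤ) - (rk p S - rk p E)) := by
    have e1 : ∀ E ∈ up p S F, (r E).coeff 1 * (q S E).coeff 1 =
        (nu p S F E : ℤ) * (((covers p S E).card : ℤ) - (rk p S - rk p E))
        - (if E = F then (rk p F : ℤ) * (((covers p S E).card : ℤ) - (rk p S - rk p E)) else 0)
        - (if E ∈ covers p S F then (((covers p S E).card : ℤ) - (rk p S - rk p E)) else 0) := by
      intro E hE
      rw [h.r1 hC hF E hE, h.q1 S hS E hE]
      split_ifs <;> ring
    rw [Finset.sum_congr rfl e1, Finset.sum_sub_distrib, Finset.sum_sub_distrib,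
      sum_nu hF.1 (fun E => ((covers p S E).card : ℤ) - (rk p S - rk p E)), Finset.sum_ite_eq', if_pos hFu]
    congr 1
    rw [← Finset.sum_filter]
    congr 1
    ext E; simp only [Finset.mem_filter, mem_up, mem_covers]
    exact ⟨fun hh => hh.2, fun hh => ⟨⟨hh.1, hh.2.1⟩, hh⟩⟩
  have h5 : ∑ E ∈ covers p S F, (((covers p S E).card : ℤ) - (rk p S - rk p E)) =
      2 * (upk p S F 2).card - (covers p S F).card * ((rk p S : ℤ) - rk p F - 1) := by
    rw [Finset.sum_sub_distrib, cover_sum hF, Finset.sum_congr rfl (g := fun _ => ((rk p S : ℤ) - rk p F - 1))]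
    · rw [Finset.sum_const, nsmul_eq_mul]
    · intro E hE; rw [(mem_covers.1 hE).2.2]; push_cast; ring
  have h6 : ∑ U ∈ (faces p S).filter (fun U => rk p U = 3), ((fcount p U 1 : ℤ) - 3) = ∑ G ∈ fk p S 3, ((G.card : ℤ) - 3) := by
    refine Finset.sum_congr rfl fun U hU => ?_
    rw [(hC.mono (mem_fk.1 hU).1.1).fcount_one]
  have h7 := hFr.card hC
  have hle := rk_mono (p := p) hF.1
  obtain ⟨m, hm⟩ := Nat.exists_eq_add_of_le hle
  have h8 := choose_two_add (rk p F) m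
  rw [h2, h3, h4, h5, h.q2 S hS F hFu, hG.coeff2 hC.1, h6, hC.fcount_one] at h1
  rw [sE_sum hFr hC hF]
  simp only [Finset.sum_add_distrib, Finset.sum_sub_distrib, Finset.sum_const, nsmul_eq_mul] at h1 h7 ⊢
  rw [hm, Nat.add_sub_cancel_left, h8] at h1
  push_cast at h1 h7 ⊢
  linarith

/-- The second coefficient of the relative g polynomial. -/
theorem RelC.coeff2 {p : ι → W} {S F : Finset ι} {Ed : Finset (Finset ι)} {G r : Finset ι → ℤ[X]} {q : Finset ι → Finset ι → ℤ[X]}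
    (hFr : Fr p S Ed) (hC : Cvx p S) (hF : Fc p S F) (h : RelC p S F G r q) :
    (r S).coeff 2 = (Module.finrank ℝ (LinearMap.ker (TT p S Ed)) : ℤ)
      - Module.finrank ℝ (LinearMap.ker (TT p S (EdN p S F Ed))) := by
  have hS : S ∈ up p S F := mem_up.2 ⟨Fc.refl p S, hF.1⟩
  have key := up_unique (p := p) (S := S) (F := F) (fun E => (r E).coeff 2) (sE p F Ed) (fun T hT => by
    have hT' := mem_up.1 hT
    rw [(h.sub hT).sum2 (hFr.sub hT'.1) (hC.mono hT'.1.1) (hF.restrict' hT'.1.1 hT'.2)]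
    refine Finset.sum_congr rfl fun E hE => ?_
    have : (Ed.filter (fun e => e ⊆ T)).filter (fun e => e ⊆ E) = Ed.filter (fun e => e ⊆ E) := by
      ext e; simp only [Finset.mem_filter]
      exact ⟨fun hh => ⟨hh.1.1, hh.2⟩, fun hh => ⟨⟨hh.1, hh.2.trans (mem_up.1 hE).1.1⟩, hh.2⟩⟩
    unfold sE; rw [this]) S hS
  rw [stress_diff hFr hC hF]
  refine key.trans ?_
  have : Ed.filter (fun e => e ⊆ S) = Ed := Finset.filter_true_of_mem fun e he => (hFr.edge_sub e he).2
  unfold sE; rw [this]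

end PartH2

section PartF
set_option linter.unusedSectionVars false
variable {ι : Type*} [DecidableEq ι] {W : Type*} [AddCommGroup W] [Module ℝ W]

/-- The segments `a b` and `c d` cross in their relative interiors. -/
def Cross (p : ι → W) (a b c d : ι) : Prop :=
  ∃ α β γ δ : ℝ, 0 < α ∧ 0 < β ∧ 0 < γ ∧ 0 < δ ∧ α • p a + β • p b = γ • p c + δ • p d

/-- A maximal noncrossing set of pairs in the polygon `G`. -/
structure Tri (p : ι → W) (G : Finset ι) (E : Finset (Finset ι)) : Prop where
  pair : ∀ e ∈ E, e.card = 2 ∧ e ⊆ G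
  nc : ∀ a b c d, ({a, b} : Finset ι) ∈ E → ({c, d} : Finset ι) ∈ E → a ≠ c → a ≠ d → b ≠ c → b ≠ d →
    ¬ Cross p a b c d
  max : ∀ a ∈ G, ∀ b ∈ G, a ≠ b → ({a, b} : Finset ι) ∉ E →
    ∃ c d, ({c, d} : Finset ι) ∈ E ∧ a ≠ c ∧ a ≠ d ∧ b ≠ c ∧ b ≠ d ∧ Cross p a b c d

lemma Tri.base {p : ι → W} {G : Finset ι} {E : Finset (Finset ι)} (hC : Cvx p G) (h3 : rk p G = 3)
    (h : Tri p G E) (hc : G.card = 3) :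
    E.card + 3 = 2 * G.card ∧
    ∀ u : ι → W →ₗ[ℝ] ℝ, (∀ v ∈ G, u v (p v) = 0) →
      (∀ v ∈ G, ∀ w ∈ G, ({v, w} : Finset ι) ∈ E → u v (p w) + u w (p v) = 0) → AltOn p u G := by
  have hall : ∀ a ∈ G, ∀ b ∈ G, a ≠ b → ({a, b} : Finset ι) ∈ E := by
    intro a ha b hb hab
    by_contra hn
    obtain ⟨c, d, hcd, h1, h2, h4, h5, -⟩ := h.max a ha b hb hab hn
    have hp := h.pair _ hcd
    have hne : c ≠ d := by
      rintro rfl; simp at hp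
    have hsub : ({a, b, c, d} : Finset ι) ⊆ G := by
      intro x hx
      simp only [Finset.mem_insert, Finset.mem_singleton] at hx
      rcases hx with rfl | rfl | rfl | rfl
      · exact ha
      · exact hb
      · exact hp.2 (by simp)
      · exact hp.2 (by simp)
    have := Finset.card_le_card hsub
    have h6 : ({a, b, c, d} : Finset ι).card = 4 := by
      rw [Finset.card_insert_of_notMem (by simp [hab, h1, h2]),
        Finset.card_insert_of_notMem (by simp [h4, h5]), Finset.card_pair hne]
    omega
  have hE : E = G.powersetCard 2 := by
    ext e
    rw [Finset.mem_powersetCard]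
    constructor
    · intro he; exact ⟨(h.pair e he).2, (h.pair e he).1⟩
    · rintro ⟨he, h2⟩
      obtain ⟨a, b, hab, rfl⟩ := Finset.card_eq_two.1 h2
      exact hall a (he (by simp)) b (he (by simp)) hab
  constructor
  · rw [hE, Finset.card_powersetCard, hc]; rfl
  · intro u h0 h1
    refine altOn_indep (by rw [h3, hc]) fun v hv w hw => ?_
    by_cases hvw : v = w
    · subst hvw; rw [h0 v hv]; simp
    · have := h1 v hv w hw (hall v hv w hw hvw)
      linarith

lemma Cross.symm {p : ι → W} {a b c d : ι} (h : Cross p a b c d) : Cross p c d a b := by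
  obtain ⟨α, β, γ, δ, h1, h2, h3, h4, h5⟩ := h
  exact ⟨γ, δ, α, β, h3, h4, h1, h2, h5.symm⟩

lemma Cvx.exists_expose {p : ι → W} {G : Finset ι} (hC : Cvx p G) {a : ι} (ha : a ∈ G) :
    ∃ f : W →ₗ[ℝ] ℝ, f (p a) = 0 ∧ ∀ i ∈ G, i ≠ a → 0 < f (p i) := by
  obtain ⟨_, f, hf, hf'⟩ := hC.2 a ha
  refine ⟨f, (hf' a ha).2 (by simp), fun i hi hia => ?_⟩
  rcases (hf i hi).lt_or_eq with h | h
  · exact h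
  · exact absurd ((hf' i hi).1 h.symm) (by simp [hia])

/-- If a pair is crossed by another pair, it is not a face. -/
lemma Cross.not_face {p : ι → W} {G : Finset ι} {a b c d : ι} (hc : c ∈ G) (hd : d ∈ G)
    (h : Cross p a b c d) (h1 : a ≠ c) (h2 : b ≠ c) : ¬ Fc p G {a, b} := by
  rintro ⟨hs, f, hf, hf'⟩
  obtain ⟨α, β, γ, δ, ha, hb, hγ, hδ, he⟩ := h
  have := congrArg f he
  simp only [map_add, map_smul, smul_eq_mul] at this
  rw [(hf' a (hs (by simp))).2 (by simp), (hf' b (hs (by simp))).2 (by simp)] at this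
  have h3 := hf c hc
  have h4 := hf d hd
  have h5 : 0 < f (p c) := by
    rcases h3.lt_or_eq with h | h
    · exact h
    · exact absurd ((hf' c hc).1 h.symm) (by simp [h1.symm, h2.symm])
  nlinarith [mul_pos hγ h5, mul_nonneg hδ.le h4]

lemma Tri.exists_diag {p : ι → W} {G : Finset ι} {E : Finset (Finset ι)} (hC : Cvx p G) (h3 : rk p G = 3)
    (h : Tri p G E) (hc : 4 ≤ G.card) :
    ∃ a ∈ G, ∃ b ∈ G, a ≠ b ∧ ({a, b} : Finset ι) ∈ E ∧ ¬ Fc p G {a, b} := by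
  obtain ⟨a, ha⟩ : G.Nonempty := Finset.card_pos.1 (by omega)
  have hN := hC.polygon_Nb h3 ha
  obtain ⟨b, hb, hbn⟩ : ∃ b ∈ G, b ∉ insert a (Nb p G a) := by
    by_contra hcon
    push Not at hcon
    have := Finset.card_le_card (show G ⊆ insert a (Nb p G a) from hcon)
    have := Finset.card_insert_le a (Nb p G a)
    omega
  simp only [Finset.mem_insert, mem_Nb, not_or, not_and] at hbn
  by_cases hE : ({a, b} : Finset ι) ∈ E
  · exact ⟨a, ha, b, hb, Ne.symm hbn.1, hE, hbn.2 hbn.1⟩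
  · obtain ⟨c, d, hcd, h1, h2, h4, h5, hX⟩ := h.max a ha b hb (Ne.symm hbn.1) hE
    have hp := h.pair _ hcd
    refine ⟨c, hp.2 (by simp), d, hp.2 (by simp), ?_, hcd, hX.symm.not_face ha hb h1.symm h2.symm⟩
    rintro rfl; simp at hp

/-- Gluing of the infinitesimal rigidity statement. -/
lemma altOn_glue {p : ι → W} {u : ι → W →ₗ[ℝ] ℝ} {G G1 G2 : Finset ι} {a b c : ι}
    (hG : G = G1 ∪ G2) (h1 : sp p G1 = sp p G) (h2 : sp p G2 = sp p G)
    (ha1 : a ∈ G1) (ha2 : a ∈ G2) (hb1 : b ∈ G1) (hb2 : b ∈ G2) (hc : sp p {a, b, c} = sp p G)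
    (hA1 : AltOn p u G1) (hA2 : AltOn p u G2) : AltOn p u G := by
  obtain ⟨A, hA, hAu⟩ := hA1
  obtain ⟨B, hB, hBu⟩ := hA2
  have e1 : ∀ v ∈ G1, ∀ x ∈ sp p G, u v x = A (p v) x := by
    intro v hv x hx
    rw [← h1] at hx
    exact eq_on_sp (fun i hi => hAu v hv i hi) hx
  have e2 : ∀ v ∈ G2, ∀ x ∈ sp p G, u v x = B (p v) x := by
    intro v hv x hx
    rw [← h2] at hx
    exact eq_on_sp (fun i hi => hBu v hv i hi) hx
  have ka : ∀ x ∈ sp p G, A (p a) x = B (p a) x := fun x hx => by rw [← e1 a ha1 x hx, e2 a ha2 x hx]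
  have kb : ∀ x ∈ sp p G, A (p b) x = B (p b) x := fun x hx => by rw [← e1 b hb1 x hx, e2 b hb2 x hx]
  have hcG : p c ∈ sp p G := by rw [← hc]; exact mem_sp (by simp)
  have kc : ∀ x ∈ sp p G, A (p c) x = B (p c) x := by
    intro x hx
    rw [← hc] at hx
    refine eq_on_sp (fun i hi => ?_) hx
    simp only [Finset.mem_insert, Finset.mem_singleton] at hi
    rcases hi with rfl | rfl | rfl
    · rw [← hA.neg, ← hB.neg, ka _ hcG]
    · rw [← hA.neg, ← hB.neg, kb _ hcG]
    · rw [hA.self_eq_zero, hB.self_eq_zero]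
  have kk : ∀ y ∈ sp p G, ∀ x ∈ sp p G, A y x = B y x := by
    intro y hy x hx
    rw [← hc] at hy
    have := eq_on_sp (f := A.flip x) (g := B.flip x) (fun i hi => ?_) hy
    · simpa using this
    · simp only [Finset.mem_insert, Finset.mem_singleton] at hi
      simp only [LinearMap.flip_apply]
      rcases hi with rfl | rfl | rfl
      · exact ka x hx
      · exact kb x hx
      · exact kc x hx
  refine ⟨A, hA, fun v hv w hw => ?_⟩
  have hw' : p w ∈ sp p G := mem_sp hw
  have hv' := hv
  rw [hG, Finset.mem_union] at hv
  rcases hv with hv | hv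
  · exact e1 v hv _ hw'
  · rw [e2 v hv _ hw', kk _ (mem_sp hv') _ hw']

lemma sp_eq_of_rk {p : ι → W} {T S : Finset ι} (h : T ⊆ S) (hr : rk p S ≤ rk p T) : sp p T = sp p S :=
  Submodule.eq_of_le_of_finrank_le (sp_mono h) hr

/-- The half of a polygon. -/
lemma Tri.half {p : ι → W} {G : Finset ι} {E : Finset (Finset ι)} (h : Tri p G E) {a b : ι} {f : W →ₗ[ℝ] ℝ}
    (hab : ({a, b} : Finset ι) ∈ E)
    (hz : ∀ i ∈ G, f (p i) = 0 → i = a ∨ i = b)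
    (hE : ∀ e ∈ E, (∀ i ∈ e, 0 ≤ f (p i)) ∨ (∀ i ∈ e, f (p i) ≤ 0)) :
    Tri p (G.filter (fun i => 0 ≤ f (p i))) (E.filter (fun e => ∀ i ∈ e, 0 ≤ f (p i))) := by
  refine ⟨fun e he => ?_, fun x y c d h1 h2 => ?_, fun x hx y hy hxy hn => ?_⟩
  · rw [Finset.mem_filter] at he
    refine ⟨(h.pair e he.1).1, fun i hi => Finset.mem_filter.2 ⟨(h.pair e he.1).2 hi, he.2 i hi⟩⟩
  · exact h.nc x y c d (Finset.mem_filter.1 h1).1 (Finset.mem_filter.1 h2).1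
  · rw [Finset.mem_filter] at hx hy
    have hn' : ({x, y} : Finset ι) ∉ E := fun hc => hn (Finset.mem_filter.2 ⟨hc, by
      intro i hi; simp only [Finset.mem_insert, Finset.mem_singleton] at hi
      rcases hi with rfl | rfl
      exacts [hx.2, hy.2]⟩)
    obtain ⟨c, d, hcd, k1, k2, k3, k4, hX⟩ := h.max x hx.1 y hy.1 hxy hn'
    refine ⟨c, d, Finset.mem_filter.2 ⟨hcd, ?_⟩, k1, k2, k3, k4, hX⟩
    rcases hE _ hcd with h' | h'
    · exact h'
    · exfalso
      have hc := h' c (by simp)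
      have hd := h' d (by simp)
      obtain ⟨α, β, γ, δ, q1, q2, q3, q4, he⟩ := hX
      have := congrArg f he
      simp only [map_add, map_smul, smul_eq_mul] at this
      have t1 := mul_nonneg q1.le hx.2
      have t2 := mul_nonneg q2.le hy.2
      have t3 := mul_nonpos_of_nonneg_of_nonpos q3.le hc
      have t4 := mul_nonpos_of_nonneg_of_nonpos q4.le hd
      have r1 : α * f (p x) = 0 := by linarith
      have r2 : β * f (p y) = 0 := by linarith
      have z1 := hz x hx.1 ((mul_eq_zero.1 r1).resolve_left q1.ne')
      have z2 := hz y hy.1 ((mul_eq_zero.1 r2).resolve_left q2.ne')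
      rcases z1 with rfl | rfl <;> rcases z2 with rfl | rfl
      · exact hxy rfl
      · exact hn' hab
      · exact hn' (by rw [Finset.pair_comm]; exact hab)
      · exact hxy rfl

lemma Tri.main {p : ι → W} : ∀ (n : ℕ) {G : Finset ι} {E : Finset (Finset ι)}, G.card = n → Cvx p G → rk p G = 3 →
    Tri p G E →
    E.card + 3 = 2 * G.card ∧
    ∀ u : ι → W →ₗ[ℝ] ℝ, (∀ v ∈ G, u v (p v) = 0) →
      (∀ v ∈ G, ∀ w ∈ G, ({v, w} : Finset ι) ∈ E → u v (p w) + u w (p v) = 0) → AltOn p u G := by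
  intro n
  induction n using Nat.strong_induction_on with
  | _ n IH =>
  intro G E hn hC h3 h
  have hge : 3 ≤ G.card := h3 ▸ rk_le_card p G
  by_cases hc3 : G.card = 3
  · exact h.base hC h3 hc3
  obtain ⟨a, ha, b, hb, hab, habE, hnf⟩ := h.exists_diag hC h3 (by omega)
  have hr2 : rk p {a, b} = 2 := hC.rk_pair ha hb hab
  have habG : ({a, b} : Finset ι) ⊆ G := by
    intro x hx; simp only [Finset.mem_insert, Finset.mem_singleton] at hx
    rcases hx with rfl | rfl <;> assumption
  -- a functional
  obtain ⟨v, hv, hvn⟩ : ∃ v ∈ G, p v ∉ sp p {a, b} := by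
    by_contra hcon
    push Not at hcon
    have : sp p G ≤ sp p {a, b} := sp_le.2 hcon
    have := Submodule.finrank_mono this
    unfold rk at h3 hr2; omega
  obtain ⟨f, hfv, hf0⟩ : ∃ f : W →ₗ[ℝ] ℝ, f (p v) ≠ 0 ∧ ∀ x ∈ sp p {a, b}, f x = 0 := by
    by_contra hcon
    push Not at hcon
    refine hvn (mem_of_functionals fun g hg => ?_)
    by_contra hne
    obtain ⟨x, hx, hx0⟩ := hcon g hne
    exact hx0 (hg x hx)
  have hfa : f (p a) = 0 := hf0 _ (mem_sp (by simp))
  have hfb : f (p b) = 0 := hf0 _ (mem_sp (by simp))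
  -- rank three of triples
  have htri : ∀ c ∈ G, c ≠ a → c ≠ b → sp p {a, b, c} = sp p G := by
    intro c hc h1 h2
    have hs : ({a, b, c} : Finset ι) ⊆ G := by
      intro x hx; simp only [Finset.mem_insert, Finset.mem_singleton] at hx
      rcases hx with rfl | rfl | rfl <;> assumption
    refine sp_eq_of_rk hs ?_
    rw [h3]
    refine hC.three_le hs ?_
    rw [Finset.card_insert_of_notMem (by simp [hab, h1.symm]), Finset.card_pair h2.symm]
  have hz : ∀ i ∈ G, f (p i) = 0 → i = a ∨ i = b := by
    intro i hi h0
    by_contra hcon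
    push Not at hcon
    have := htri i hi hcon.1 hcon.2
    apply hfv
    have hm : p v ∈ sp p {a, b, i} := by rw [this]; exact mem_sp hv
    refine zero_on_sp (fun j hj => ?_) hm
    simp only [Finset.mem_insert, Finset.mem_singleton] at hj
    rcases hj with rfl | rfl | rfl <;> assumption
  have hpos : ∃ c ∈ G, 0 < f (p c) := by
    by_contra hcon
    push Not at hcon
    refine hnf ⟨habG, -f, fun i hi => by simpa using hcon i hi, fun i hi => ?_⟩
    simp only [LinearMap.neg_apply, neg_eq_zero, Finset.mem_insert, Finset.mem_singleton]
    exact ⟨hz i hi, by rintro (rfl | rfl) <;> assumption⟩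
  have hneg : ∃ c ∈ G, f (p c) < 0 := by
    by_contra hcon
    push Not at hcon
    refine hnf ⟨habG, f, fun i hi => hcon i hi, fun i hi => ?_⟩
    simp only [Finset.mem_insert, Finset.mem_singleton]
    exact ⟨hz i hi, by rintro (rfl | rfl) <;> assumption⟩
  obtain ⟨c, hc, hfc⟩ := hpos
  obtain ⟨c', hc', hfc'⟩ := hneg
  obtain ⟨fa, hfa0, hfap⟩ := hC.exists_expose ha
  obtain ⟨fb, hfb0, hfbp⟩ := hC.exists_expose hb
  -- no pair crosses
  have hmix : ∀ x y, ({x, y} : Finset ι) ∈ E → ¬ (f (p x) < 0 ∧ 0 < f (p y)) := by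
    rintro x y hxy ⟨hx, hy⟩
    have hG := (h.pair _ hxy).2
    have hxG : x ∈ G := hG (by simp)
    have hyG : y ∈ G := hG (by simp)
    have hxa : x ≠ a := by rintro rfl; linarith
    have hxb : x ≠ b := by rintro rfl; linarith
    have hya : y ≠ a := by rintro rfl; linarith
    have hyb : y ≠ b := by rintro rfl; linarith
    have hm : f (p y) • p x + (- f (p x)) • p y ∈ sp p {a, b, c} := by
      rw [htri c hc (by rintro rfl; linarith) (by rintro rfl; linarith)]
      exact add_mem (Submodule.smul_mem _ _ (mem_sp hxG)) (Submodule.smul_mem _ _ (mem_sp hyG))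
    unfold sp at hm
    rw [Finset.coe_insert, Finset.coe_pair, Set.image_insert_eq, Set.image_pair, Submodule.mem_span_insert] at hm
    obtain ⟨α, z, hz', he⟩ := hm
    obtain ⟨β, γ, rfl⟩ := Submodule.mem_span_pair.1 hz'
    have k := congrArg f he
    have ka := congrArg fa he
    have kb := congrArg fb he
    simp only [map_add, map_smul, smul_eq_mul, hfa, hfb] at k
    have hγ : γ = 0 := by
      have : γ * f (p c) = 0 := by linarith
      exact (mul_eq_zero.1 this).resolve_right hfc.ne'
    subst hγ
    simp only [map_add, map_smul, smul_eq_mul, hfa0, hfb0] at ka kb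
    have hβ : 0 < β := by
      have h1 := hfap x hxG hxa
      have h2 := hfap y hyG hya
      have h4 := hfap b hb hab.symm
      have : 0 < β * fa (p b) := by nlinarith [mul_pos hy h1, mul_pos (neg_pos.2 hx) h2]
      exact pos_of_mul_pos_left this h4.le
    have hα : 0 < α := by
      have h1 := hfbp x hxG hxb
      have h2 := hfbp y hyG hyb
      have h4 := hfbp a ha hab
      have : 0 < α * fb (p a) := by nlinarith [mul_pos hy h1, mul_pos (neg_pos.2 hx) h2]
      exact pos_of_mul_pos_left this h4.le
    refine h.nc x y a b hxy habE hxa hxb hya hyb ⟨f (p y), - f (p x), α, β, hy, by linarith, hα, hβ, ?_⟩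
    rw [he]; simp
  have hE : ∀ e ∈ E, (∀ i ∈ e, 0 ≤ f (p i)) ∨ (∀ i ∈ e, f (p i) ≤ 0) := by
    intro e he
    obtain ⟨x, y, hxy, rfl⟩ := Finset.card_eq_two.1 (h.pair e he).1
    have m1 := hmix x y he
    have m2 := hmix y x (by rw [Finset.pair_comm]; exact he)
    simp only [Finset.mem_insert, Finset.mem_singleton, forall_eq_or_imp, forall_eq]
    rcases lt_trichotomy (f (p x)) 0 with h1 | h1 | h1 <;> rcases lt_trichotomy (f (p y)) 0 with h2 | h2 | h2
    · right; constructor <;> linarith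
    · right; constructor <;> linarith
    · exact absurd ⟨h1, h2⟩ m1
    · right; constructor <;> linarith
    · right; constructor <;> linarith
    · left; constructor <;> linarith
    · exact absurd ⟨h2, h1⟩ m2
    · left; constructor <;> linarith
    · left; constructor <;> linarith
  have T1 := h.half habE hz hE
  have T2 := h.half (f := -f) habE (fun i hi h0 => hz i hi (by simpa using h0)) (fun e he => by
    rcases hE e he with h' | h'
    · right; intro i hi; simpa using h' i hi
    · left; intro i hi; simpa using h' i hi)
  set G1 := G.filter (fun i => 0 ≤ f (p i)) with hG1
  set G2 := G.filter (fun i => 0 ≤ (-f) (p i)) with hG2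
  set E1 := E.filter (fun e => ∀ i ∈ e, 0 ≤ f (p i)) with hE1
  set E2 := E.filter (fun e => ∀ i ∈ e, 0 ≤ (-f) (p i)) with hE2
  have m1 : ∀ i, i ∈ G1 ↔ i ∈ G ∧ 0 ≤ f (p i) := fun i => Finset.mem_filter
  have m2 : ∀ i, i ∈ G2 ↔ i ∈ G ∧ f (p i) ≤ 0 := fun i => by rw [hG2, Finset.mem_filter]; simp
  have hU : G = G1 ∪ G2 := by
    ext i; rw [Finset.mem_union, m1, m2, ← and_or_left]
    exact ⟨fun h => ⟨h, le_total _ _⟩, fun h => h.1⟩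
  have hI : G1 ∩ G2 = {a, b} := by
    ext i; rw [Finset.mem_inter, m1, m2]; simp only [Finset.mem_insert, Finset.mem_singleton]
    constructor
    · rintro ⟨⟨h1, h2⟩, -, h3⟩; exact hz i h1 (le_antisymm h3 h2)
    · rintro (rfl | rfl)
      · exact ⟨⟨ha, hfa.ge⟩, ha, hfa.le⟩
      · exact ⟨⟨hb, hfb.ge⟩, hb, hfb.le⟩
  have hUE : E = E1 ∪ E2 := by
    ext e; rw [Finset.mem_union, hE1, hE2, Finset.mem_filter, Finset.mem_filter, ← and_or_left]
    refine ⟨fun h => ⟨h, ?_⟩, fun h => h.1⟩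
    simpa using hE e h
  have hIE : E1 ∩ E2 = {{a, b}} := by
    ext e; rw [Finset.mem_inter, hE1, hE2, Finset.mem_filter, Finset.mem_filter, Finset.mem_singleton]
    constructor
    · rintro ⟨⟨h1, h2⟩, -, h4⟩
      refine Finset.eq_of_subset_of_card_le (fun i hi => ?_) ?_
      · rw [Finset.mem_insert, Finset.mem_singleton]
        refine hz i ((h.pair e h1).2 hi) (le_antisymm ?_ (h2 i hi))
        simpa using h4 i hi
      · rw [(h.pair e h1).1, Finset.card_pair hab]
    · rintro rfl
      refine ⟨⟨habE, ?_⟩, habE, ?_⟩ <;> simp [hfa, hfb]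
  have s1 : G1 ⊆ G := Finset.filter_subset _ _
  have s2 : G2 ⊆ G := Finset.filter_subset _ _
  have ha1 : a ∈ G1 := (m1 a).2 ⟨ha, hfa.ge⟩
  have hb1 : b ∈ G1 := (m1 b).2 ⟨hb, hfb.ge⟩
  have ha2 : a ∈ G2 := (m2 a).2 ⟨ha, hfa.le⟩
  have hb2 : b ∈ G2 := (m2 b).2 ⟨hb, hfb.le⟩
  have hc1 : c ∈ G1 := (m1 c).2 ⟨hc, hfc.le⟩
  have hc2 : c' ∈ G2 := (m2 c').2 ⟨hc', hfc'.le⟩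
  have hsp : sp p {a, b, c} = sp p G := htri c hc (by rintro rfl; linarith) (by rintro rfl; linarith)
  have hsp' : sp p {a, b, c'} = sp p G := htri c' hc' (by rintro rfl; linarith) (by rintro rfl; linarith)
  have hs1 : sp p G1 = sp p G := by
    refine le_antisymm (sp_mono s1) ?_
    rw [← hsp]; refine sp_mono ?_
    intro x hx; simp only [Finset.mem_insert, Finset.mem_singleton] at hx
    rcases hx with rfl | rfl | rfl <;> assumption
  have hs2 : sp p G2 = sp p G := by
    refine le_antisymm (sp_mono s2) ?_
    rw [← hsp']; refine sp_mono ?_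
    intro x hx; simp only [Finset.mem_insert, Finset.mem_singleton] at hx
    rcases hx with rfl | rfl | rfl <;> assumption
  have hr1 : rk p G1 = 3 := by unfold rk at h3 ⊢; rw [hs1, h3]
  have hr2' : rk p G2 = 3 := by unfold rk at h3 ⊢; rw [hs2, h3]
  have l1 : G1.card < n := by
    rw [← hn]; refine Finset.card_lt_card ⟨s1, fun hcon => ?_⟩
    have := ((m1 c').1 (hcon hc')).2; linarith
  have l2 : G2.card < n := by
    rw [← hn]; refine Finset.card_lt_card ⟨s2, fun hcon => ?_⟩
    have := ((m2 c).1 (hcon hc)).2; linarith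
  obtain ⟨n1, R1⟩ := IH _ l1 rfl (hC.mono s1) hr1 T1
  obtain ⟨n2, R2⟩ := IH _ l2 rfl (hC.mono s2) hr2' T2
  constructor
  · have q1 := Finset.card_union_add_card_inter G1 G2
    have q2 := Finset.card_union_add_card_inter E1 E2
    rw [← hU, hI, Finset.card_pair hab] at q1
    rw [← hUE, hIE, Finset.card_singleton] at q2
    omega
  · intro u h0 h1
    refine altOn_glue hU hs1 hs2 ha1 ha2 hb1 hb2 hsp (R1 u (fun v hv => h0 v (s1 hv)) ?_)
      (R2 u (fun v hv => h0 v (s2 hv)) ?_)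
    · intro v hv w hw he
      exact h1 v (s1 hv) w (s1 hw) (Finset.mem_filter.1 he).1
    · intro v hv w hw he
      exact h1 v (s2 hv) w (s2 hw) (Finset.mem_filter.1 he).1

end PartF

section PartK
set_option linter.unusedSectionVars false
variable {ι : Type*} [DecidableEq ι] {d : ℕ}

/-- Homogenisation of a point configuration. -/
def hp (y : ι → (Fin d → ℝ)) : ι → (Fin d → ℝ) × ℝ := fun i => (y i, 1)

/-- The polytope spanned by a subconfiguration. -/
def cv (y : ι → (Fin d → ℝ)) (T : Finset ι) : Set (Fin d → ℝ) := convexHull ℝ (y '' (T : Set ι))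

lemma hp_pos (y : ι → (Fin d → ℝ)) (S : Finset ι) : PosC (hp y) S :=
  ⟨LinearMap.snd ℝ _ _, fun i _ => by simp [hp]⟩

lemma mem_cv {y : ι → (Fin d → ℝ)} {T : Finset ι} {x : Fin d → ℝ} :
    x ∈ cv y T ↔ ∃ w : ι → ℝ, (∀ i ∈ T, 0 ≤ w i) ∧ ∑ i ∈ T, w i = 1 ∧ ∑ i ∈ T, w i • y i = x := by
  constructor
  · intro hx
    have hconv : Convex ℝ {x | ∃ w : ι → ℝ, (∀ i ∈ T, 0 ≤ w i) ∧ ∑ i ∈ T, w i = 1 ∧ ∑ i ∈ T, w i • y i = x} := by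
      rintro x ⟨w, h1, h2, rfl⟩ x' ⟨w', h1', h2', rfl⟩ a b ha hb hab
      refine ⟨fun i => a * w i + b * w' i, fun i hi => ?_, ?_, ?_⟩
      · exact add_nonneg (mul_nonneg ha (h1 i hi)) (mul_nonneg hb (h1' i hi))
      · rw [Finset.sum_add_distrib, ← Finset.mul_sum, ← Finset.mul_sum, h2, h2']; linarith
      · simp only [add_smul, mul_smul]
        rw [Finset.sum_add_distrib, Finset.smul_sum, Finset.smul_sum]
    refine convexHull_min ?_ hconv hx
    rintro _ ⟨i, hi, rfl⟩
    refine ⟨fun j => if j = i then 1 else 0, fun j _ => by positivity, ?_, ?_⟩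
    · rw [Finset.sum_ite_eq' T i]; simp [Finset.mem_coe.1 hi]
    · simp only [ite_smul, one_smul, zero_smul]; rw [Finset.sum_ite_eq' T i]; simp [Finset.mem_coe.1 hi]
  · rintro ⟨w, h1, h2, rfl⟩
    exact (convex_convexHull ℝ _).sum_mem h1 h2 fun i hi => subset_convexHull ℝ _ ⟨i, hi, rfl⟩

lemma mem_cv_hp {y : ι → (Fin d → ℝ)} {T : Finset ι} {x : Fin d → ℝ} :
    x ∈ cv y T ↔ ∃ w : ι → ℝ, (∀ i ∈ T, 0 ≤ w i) ∧ ∑ i ∈ T, w i • hp y i = (x, 1) := by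
  rw [mem_cv]
  refine exists_congr fun w => and_congr_right fun _ => ?_
  rw [Prod.ext_iff, Prod.fst_sum, Prod.snd_sum]
  simp [hp, and_comm]

lemma cv_mono {y : ι → (Fin d → ℝ)} {T U : Finset ι} (h : T ⊆ U) : cv y T ⊆ cv y U :=
  convexHull_mono (Set.image_mono (by exact_mod_cast h))

lemma mem_cv_self {y : ι → (Fin d → ℝ)} {T : Finset ι} {i : ι} (h : i ∈ T) : y i ∈ cv y T :=
  subset_convexHull ℝ _ ⟨i, h, rfl⟩

lemma cv_empty (y : ι → (Fin d → ℝ)) : cv y ∅ = ∅ := by simp [cv]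

lemma cv_nonempty {y : ι → (Fin d → ℝ)} {T : Finset ι} : (cv y T).Nonempty ↔ T.Nonempty := by
  simp [cv]

lemma cv_eq_empty {y : ι → (Fin d → ℝ)} {T : Finset ι} : cv y T = ∅ ↔ T = ∅ := by
  rw [← Set.not_nonempty_iff_eq_empty, cv_nonempty, Finset.not_nonempty_iff_eq_empty]

lemma cv_nonneg {y : ι → (Fin d → ℝ)} {S : Finset ι} {φ : (Fin d → ℝ) × ℝ →ₗ[ℝ] ℝ}
    (h : ∀ i ∈ S, 0 ≤ φ (hp y i)) {x : Fin d → ℝ} (hx : x ∈ cv y S) : 0 ≤ φ (x, 1) := by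
  obtain ⟨w, h1, h2⟩ := mem_cv_hp.1 hx
  rw [← h2, map_sum]
  refine Finset.sum_nonneg fun i hi => ?_
  rw [map_smul, smul_eq_mul]
  exact mul_nonneg (h1 i hi) (h i hi)

lemma cv_zero {y : ι → (Fin d → ℝ)} {S T : Finset ι} (hT : T ⊆ S) {φ : (Fin d → ℝ) × ℝ →ₗ[ℝ] ℝ}
    (h : ∀ i ∈ S, 0 ≤ φ (hp y i)) (h0 : ∀ i ∈ S, φ (hp y i) = 0 ↔ i ∈ T) {x : Fin d → ℝ} (hx : x ∈ cv y S) :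
    φ (x, 1) = 0 ↔ x ∈ cv y T := by
  constructor
  · intro hz
    obtain ⟨w, h1, h2⟩ := mem_cv_hp.1 hx
    rw [← h2, map_sum] at hz
    have hz' := (Finset.sum_eq_zero_iff_of_nonneg (fun i hi => by
      rw [map_smul, smul_eq_mul]; exact mul_nonneg (h1 i hi) (h i hi))).1 hz
    refine mem_cv_hp.2 ⟨w, fun i hi => h1 i (hT hi), ?_⟩
    rw [← h2]
    refine Finset.sum_subset hT fun i hi hn => ?_
    have := hz' i hi
    rw [map_smul, smul_eq_mul] at this
    have : w i = 0 := (mul_eq_zero.1 this).resolve_right fun hc => hn ((h0 i hi).1 hc)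
    rw [this, zero_smul]
  · intro hx
    obtain ⟨w, h1, h2⟩ := mem_cv_hp.1 hx
    rw [← h2, map_sum]
    refine Finset.sum_eq_zero fun i hi => ?_
    rw [map_smul, (h0 i (hT hi)).2 hi, smul_zero]

lemma Fc.isFace {y : ι → (Fin d → ℝ)} {S T : Finset ι} (h : Fc (hp y) S T) : IsFace (cv y S) (cv y T) := by
  obtain ⟨hT, φ, h1, h2⟩ := h
  have key : ∀ x, φ (x, 1) = φ (x, 0) + φ (0, 1) := fun x => by rw [← map_add]; simp
  refine Or.inr (Or.inr ⟨-(φ ∘ₗ LinearMap.inl ℝ _ _), φ (0, 1), fun x hx => ?_, ?_⟩)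
  · have := cv_nonneg h1 hx
    rw [key] at this
    simp only [LinearMap.neg_apply, LinearMap.comp_apply, LinearMap.inl_apply]; linarith
  · ext x
    simp only [Set.mem_ofPred_eq, LinearMap.neg_apply, LinearMap.comp_apply, LinearMap.inl_apply]
    constructor
    · intro hx
      have hx' := cv_mono hT hx
      refine ⟨hx', ?_⟩
      have := (cv_zero hT h1 h2 hx').2 hx
      rw [key] at this; linarith
    · rintro ⟨hx, h0⟩
      refine (cv_zero hT h1 h2 hx).1 ?_
      rw [key]; linarith

lemma IsFace.exists_fc {y : ι → (Fin d → ℝ)} {S : Finset ι} {F : Set (Fin d → ℝ)} (h : IsFace (cv y S) F) :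
    ∃ T, Fc (hp y) S T ∧ F = cv y T := by
  rcases h with rfl | rfl | ⟨f, c, h1, rfl⟩
  · exact ⟨∅, Fc.empty (hp_pos y S), (cv_empty y).symm⟩
  · exact ⟨S, Fc.refl _ _, rfl⟩
  · set φ : (Fin d → ℝ) × ℝ →ₗ[ℝ] ℝ := c • LinearMap.snd ℝ _ _ - f ∘ₗ LinearMap.fst ℝ _ _ with hφ
    have e : ∀ x, φ (x, 1) = c - f x := fun x => by simp [hφ]
    have k1 : ∀ i ∈ S, 0 ≤ φ (hp y i) := fun i hi => by
      have := h1 _ (mem_cv_self (y := y) hi); rw [hp, e]; linarith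
    have k2 : ∀ i ∈ S, φ (hp y i) = 0 ↔ i ∈ S.filter (fun i => f (y i) = c) := fun i hi => by
      rw [hp, e, Finset.mem_filter, sub_eq_zero]
      exact ⟨fun h => ⟨hi, h.symm⟩, fun h => h.2.symm⟩
    refine ⟨S.filter (fun i => f (y i) = c), ⟨Finset.filter_subset _ _, φ, k1, k2⟩, ?_⟩
    ext x
    rw [Set.mem_ofPred_eq]
    constructor
    · rintro ⟨hx, hc⟩
      refine (cv_zero (Finset.filter_subset _ _) k1 k2 hx).1 ?_
      rw [e, hc, sub_self]
    · intro hx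
      have hx' := cv_mono (Finset.filter_subset _ _) hx
      refine ⟨hx', ?_⟩
      have := (cv_zero (Finset.filter_subset _ _) k1 k2 hx').2 hx
      rw [e] at this; linarith

lemma Fc.mem_iff {y : ι → (Fin d → ℝ)} {S T : Finset ι} (h : Fc (hp y) S T) {i : ι} (hi : i ∈ S) :
    y i ∈ cv y T ↔ i ∈ T := by
  obtain ⟨hT, φ, h1, h2⟩ := h
  rw [← cv_zero hT h1 h2 (mem_cv_self hi), ← h2 i hi]; rfl

lemma Fc.cv_subset {y : ι → (Fin d → ℝ)} {S T U : Finset ι} (hU : Fc (hp y) S U) (hT : T ⊆ S) :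
    cv y T ⊆ cv y U ↔ T ⊆ U :=
  ⟨fun h i hi => (hU.mem_iff (hT hi)).1 (h (mem_cv_self hi)), cv_mono⟩

lemma Fc.cv_inj {y : ι → (Fin d → ℝ)} {S T U : Finset ι} (hT : Fc (hp y) S T) (hU : Fc (hp y) S U)
    (h : cv y T = cv y U) : T = U :=
  Finset.Subset.antisymm ((hU.cv_subset hT.1).1 h.le) ((hT.cv_subset hU.1).1 h.ge)

lemma cv_polytope (y : ι → (Fin d → ℝ)) (T : Finset ι) : IsPolytope (cv y T) :=
  ⟨T.image y, by rw [Finset.coe_image]; rfl⟩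

lemma rk_hp (y : ι → (Fin d → ℝ)) {T : Finset ι} (hT : T.Nonempty) :
    rk (hp y) T = Module.finrank ℝ (vectorSpan ℝ (y '' (T : Set ι))) + 1 := by
  obtain ⟨i0, hi0⟩ := hT
  set L : sp (hp y) T →ₗ[ℝ] ℝ := (LinearMap.snd ℝ (Fin d → ℝ) ℝ).domRestrict (sp (hp y) T) with hL
  have h1 := L.finrank_range_add_finrank_ker
  have hr : LinearMap.range L = ⊤ := by
    rw [LinearMap.range_eq_top]
    intro t
    refine ⟨t • ⟨hp y i0, mem_sp hi0⟩, ?_⟩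
    simp [hL, hp]
  rw [hr, finrank_top, Module.finrank_self] at h1
  have hk : (LinearMap.ker L).map (sp (hp y) T).subtype
      = (vectorSpan ℝ (y '' (T : Set ι))).map (LinearMap.inl ℝ (Fin d → ℝ) ℝ) := by
    apply le_antisymm
    · rintro _ ⟨⟨x, hx⟩, hx0, rfl⟩
      have hx0 : x.2 = 0 := hx0
      have hx1 : ∀ z ∈ sp (hp y) T, z.1 - z.2 • y i0 ∈ vectorSpan ℝ (y '' (T : Set ι)) := by
        intro z hz
        have : sp (hp y) T ≤ (vectorSpan ℝ (y '' (T : Set ι))).comap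
            (LinearMap.fst ℝ (Fin d → ℝ) ℝ - (LinearMap.snd ℝ (Fin d → ℝ) ℝ).smulRight (y i0)) := by
          refine sp_le.2 fun i hi => ?_
          simp only [Submodule.mem_comap, hp]
          simpa using vsub_mem_vectorSpan ℝ (s := y '' (T : Set ι)) ⟨i, hi, rfl⟩ ⟨i0, hi0, rfl⟩
        simpa using this hz
      have := hx1 x hx
      rw [hx0, zero_smul, sub_zero] at this
      refine ⟨x.1, this, ?_⟩
      simp only [LinearMap.inl_apply, Submodule.subtype_apply]
      exact Prod.ext rfl hx0.symm
    · rw [Submodule.map_le_iff_le_comap, vectorSpan, Submodule.span_le]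
      rintro _ ⟨_, ⟨i, hi, rfl⟩, _, ⟨j, hj, rfl⟩, rfl⟩
      refine ⟨⟨hp y i - hp y j, sub_mem (mem_sp hi) (mem_sp hj)⟩, ?_, ?_⟩
      · simp [hL, hp]
      · simp [hp]
  have e1 := (Submodule.equivMapOfInjective (sp (hp y) T).subtype (Submodule.subtype_injective _) (LinearMap.ker L)).finrank_eq
  have e2 := (Submodule.equivMapOfInjective (LinearMap.inl ℝ (Fin d → ℝ) ℝ) LinearMap.inl_injective
    (vectorSpan ℝ (y '' (T : Set ι)))).finrank_eq
  unfold rk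
  rw [hk] at e1
  omega

lemma pdim_cv (y : ι → (Fin d → ℝ)) (T : Finset ι) : pdim (cv y T) = (rk (hp y) T : ℤ) - 1 := by
  unfold pdim
  by_cases h : T = ∅
  · subst h; rw [if_pos (cv_empty y), rk_empty]; rfl
  · rw [if_neg (fun hc => h (cv_eq_empty.1 hc)), rk_hp y (Finset.nonempty_iff_ne_empty.2 h), cv,
      affineSpan_convexHull, direction_affineSpan]
    push_cast; ring

lemma setOf_faces (y : ι → (Fin d → ℝ)) (T : Finset ι) :
    {F | IsFace (cv y T) F ∧ F ≠ cv y T} = cv y '' (((faces (hp y) T).filter (fun U => U ≠ T) : Finset (Finset ι)) : Set (Finset ι)) := by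
  ext F
  simp only [Set.mem_ofPred_eq, Set.mem_image, Finset.coe_filter, mem_faces]
  constructor
  · rintro ⟨h1, h2⟩
    obtain ⟨U, hU, rfl⟩ := h1.exists_fc
    exact ⟨U, ⟨hU, fun h => h2 (by rw [h])⟩, rfl⟩
  · rintro ⟨U, ⟨hU, hne⟩, rfl⟩
    exact ⟨hU.isFace, fun h => hne (hU.cv_inj (Fc.refl _ _) h)⟩

lemma IsGH.ghc {g h : Set (Fin d → ℝ) → ℤ[X]} (H : IsGH g h) (y : ι → (Fin d → ℝ)) (S : Finset ι) :
    GHc (hp y) S (fun T => g (cv y T)) (fun T => h (cv y T)) := by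
  obtain ⟨H1, H2, H3⟩ := H
  have hne : ∀ T : Finset ι, T.Nonempty → cv y T ≠ ∅ := fun T hT hc =>
    hT.ne_empty (cv_eq_empty.1 hc)
  refine ⟨by simp [cv_empty, H1], fun T hT => ?_, fun T hT hn => ?_, fun T hT hn i hi hr => ?_, fun T hT hn i hi hr => ?_⟩
  · beta_reduce
    rw [H2 _ (cv_polytope y T), setOf_faces, finsum_mem_image, finsum_mem_coe_finset]
    · refine Finset.sum_congr rfl fun U _ => ?_
      rw [pdim_cv, pdim_cv]
      congr 2
      omega
    · intro U hU U' hU' he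
      simp only [Finset.coe_filter, Set.mem_ofPred_eq, mem_faces] at hU hU'
      exact hU.1.cv_inj hU'.1 he
  · exact (H3 _ (cv_polytope y T) (hne T hn)).1
  · refine (H3 _ (cv_polytope y T) (hne T hn)).2.1 i hi ?_
    rw [pdim_cv]; omega
  · refine (H3 _ (cv_polytope y T) (hne T hn)).2.2 i hi ?_
    rw [pdim_cv]; omega

/-- A polytope is spanned by its vertices. -/
lemma exists_vertices {P : Set (Fin d → ℝ)} (hP : IsPolytope P) :
    ∃ V : Finset (Fin d → ℝ), P = cv id V ∧ Cvx (hp id) V := by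
  have hex : ∃ n : ℕ, ∃ V : Finset (Fin d → ℝ), V.card = n ∧ P = cv id V := by
    obtain ⟨V, hV⟩ := hP
    exact ⟨_, V, rfl, by rw [cv, Set.image_id]; exact hV⟩
  obtain ⟨V, hVc, hV⟩ := Nat.find_spec hex
  refine ⟨V, hV, hp_pos _ _, fun v hv => ?_⟩
  have hnot : v ∉ cv id (V.erase v) := by
    intro hmem
    have : P = cv id (V.erase v) := by
      rw [hV]
      refine Set.Subset.antisymm (convexHull_min ?_ (convex_convexHull ℝ _)) (cv_mono (Finset.erase_subset _ _))
      rintro _ ⟨w, hw, rfl⟩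
      by_cases hwv : w = v
      · subst hwv; exact hmem
      · exact mem_cv_self (Finset.mem_erase.2 ⟨hwv, hw⟩)
    have h2 := Nat.find_min' hex ⟨V.erase v, rfl, this⟩
    have h3 := Finset.card_erase_lt_of_mem hv
    omega
  have hcl : IsClosed (cv id (V.erase v)) := by
    unfold cv
    exact (((V.erase v).finite_toSet.image _).isCompact_convexHull ℝ).isClosed
  obtain ⟨f, u, h1, h2⟩ := geometric_hahn_banach_point_closed (convex_convexHull ℝ _) hcl hnot
  have key : ∀ w ∈ V, w ≠ v → f v < f w := fun w hw hne =>
    h1.trans (h2 w (mem_cv_self (Finset.mem_erase.2 ⟨hne, hw⟩)))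
  refine ⟨by simpa using hv, (f : (Fin d → ℝ) →ₗ[ℝ] ℝ) ∘ₗ LinearMap.fst ℝ _ _ - f v • LinearMap.snd ℝ _ _, ?_, ?_⟩
  · intro w hw
    simp only [hp, LinearMap.sub_apply, LinearMap.comp_apply, LinearMap.fst_apply, LinearMap.smul_apply, LinearMap.snd_apply, id]
    by_cases hwv : w = v
    · subst hwv; simp
    · have := key w hw hwv; simp; linarith
  · intro w hw
    simp only [hp, LinearMap.sub_apply, LinearMap.comp_apply, LinearMap.fst_apply, LinearMap.smul_apply, LinearMap.snd_apply, id,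
      Finset.mem_singleton]
    constructor
    · intro h0
      by_contra hwv
      have := key w hw hwv
      simp at h0; linarith
    · rintro rfl; simp

end PartK

section PartK2
set_option linter.unusedSectionVars false
variable {ι : Type*} [DecidableEq ι] {d : ℕ} {W : Type*} [AddCommGroup W] [Module ℝ W]

/-- Every pointed configuration of small dimension is realized by a point configuration. -/
lemma realize [FiniteDimensional ℝ W] (hd : Module.finrank ℝ W ≤ d + 1) (q : ι → W) (S : Finset ι) (hP : PosC q S) :
    ∃ y : ι → (Fin d → ℝ), (∀ T ⊆ S, ∀ U, Fc (hp y) T U ↔ Fc q T U) ∧ ∀ T ⊆ S, rk (hp y) T = rk q T := by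
  by_cases hS : S = ∅
  · subst hS
    refine ⟨fun _ => 0, fun T hT U => ?_, fun T hT => ?_⟩
    · rw [Finset.subset_empty] at hT; subst hT
      constructor
      · intro h
        have := Finset.subset_empty.1 h.1; subst this; exact Fc.refl _ _
      · intro h
        have := Finset.subset_empty.1 h.1; subst this; exact Fc.refl _ _
    · rw [Finset.subset_empty] at hT; subst hT; rw [rk_empty, rk_empty]
  obtain ⟨i0, hi0⟩ := Finset.nonempty_iff_ne_empty.2 hS
  obtain ⟨θ, hθ⟩ := hP
  set w0 : W := (θ (q i0))⁻¹ • q i0 with hw0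
  have hθ0 : θ w0 = 1 := by
    rw [hw0, map_smul, smul_eq_mul, inv_mul_cancel₀ (hθ i0 hi0).ne']
  have hk : Module.finrank ℝ (LinearMap.ker θ) ≤ d := by
    have h1 := θ.finrank_range_add_finrank_ker
    have hr : LinearMap.range θ = ⊤ := by
      rw [LinearMap.range_eq_top]
      intro t; exact ⟨t • w0, by simp [hθ0]⟩
    rw [hr, finrank_top, Module.finrank_self] at h1
    omega
  obtain ⟨N, hN⟩ : ∃ N : LinearMap.ker θ →ₗ[ℝ] (Fin d → ℝ), Function.Injective N := by
    rw [← lift_rank_le_iff_exists_linearMap, ← Module.finrank_eq_rank, ← Module.finrank_eq_rank,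
      Cardinal.lift_natCast, Cardinal.lift_natCast, Nat.cast_le, Module.finrank_fin_fun]
    exact hk
  set π : W →ₗ[ℝ] LinearMap.ker θ := LinearMap.codRestrict (LinearMap.ker θ) (LinearMap.id - θ.smulRight w0) (by
    intro x; simp [hθ0]) with hπ
  set L : W →ₗ[ℝ] (Fin d → ℝ) × ℝ := (N ∘ₗ π).prod θ with hL
  have hLi : Function.Injective L := by
    rw [← LinearMap.ker_eq_bot, LinearMap.ker_eq_bot']
    intro x hx
    have h1 : N (π x) = 0 := congrArg Prod.fst hx
    have h2 : θ x = 0 := congrArg Prod.snd hx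
    have h3 : π x = 0 := hN (by rw [h1, map_zero])
    have h4 : x - θ x • w0 = 0 := congrArg Subtype.val h3
    simpa [h2] using h4
  refine ⟨fun i => (θ (q i))⁻¹ • N (π (q i)), ?_, ?_⟩
  · intro T hT U
    rw [← fc_comp L hLi]
    refine fc_scale (fun i => (θ (q i))⁻¹) (fun i hi => inv_pos.2 (hθ i (hT hi))) (fun i hi => ?_)
    simp only [hp, hL]
    ext <;> simp [(hθ i (hT hi)).ne']
  · intro T hT
    rw [← rk_comp (p := q) L hLi]
    refine rk_scale (fun i => (θ (q i))⁻¹) (fun i hi => inv_pos.2 (hθ i (hT hi))) (fun i hi => ?_)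
    simp only [hp, hL]
    ext <;> simp [(hθ i (hT hi)).ne']

lemma GHc.congr {W' : Type*} [AddCommGroup W'] [Module ℝ W'] {p : ι → W} {q : ι → W'} {S : Finset ι} {G H : Finset ι → ℤ[X]} (h : GHc p S G H)
    (h1 : ∀ T ⊆ S, ∀ U, Fc p T U ↔ Fc q T U) (h2 : ∀ T ⊆ S, rk p T = rk q T) : GHc q S G H := by
  have hf : ∀ T ⊆ S, faces q T = faces p T := fun T hT => by
    ext U; rw [mem_faces, mem_faces, h1 T hT]
  have hs : ∀ T ∈ faces q S, T ⊆ S := fun T hT => (mem_faces.1 hT).1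
  have hm : ∀ T ∈ faces q S, T ∈ faces p S := fun T hT => by rwa [← hf S subset_rfl]
  refine ⟨h.empty, fun T hT => ?_, fun T hT => h.g0 T (hm T hT), fun T hT hn i hi hr => ?_, fun T hT hn i hi hr => ?_⟩
  · rw [h.hh T (hm T hT), hf T (hs T hT)]
    refine Finset.sum_congr rfl fun U hU => ?_
    have hU' := (mem_faces.1 (Finset.mem_filter.1 hU).1).1
    rw [h2 T (hs T hT), h2 U (hU'.trans (hs T hT))]
  · exact h.g1 T (hm T hT) hn i hi (by rwa [h2 T (hs T hT)])
  · exact h.g2 T (hm T hT) hn i hi (by rwa [h2 T (hs T hT)])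

/-- Existence of the quotient polytope. -/
lemma exists_quotient {T E : Finset (Fin d → ℝ)} (hE : Fc (hp id) T E) :
    ∃ (y : (Fin d → ℝ) → (Fin d → ℝ)) (ψ : Set (Fin d → ℝ) → Set (Fin d → ℝ)),
      IsQuotientPair (cv id T) (cv id E) (cv y (T \ E)) ψ ∧
      (∀ T' ⊆ T \ E, ∀ U, Fc (hp y) T' U ↔ Fc (Qp (hp id) E) T' U) ∧
      ∀ T' ⊆ T \ E, rk (hp y) T' = rk (Qp (hp id) E) T' := by
  have hfr : Module.finrank ℝ (((Fin d → ℝ) × ℝ) ⧸ sp (hp id) E) ≤ d + 1 := by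
    refine (Submodule.finrank_quotient_le _).trans ?_
    simp
  obtain ⟨y, hy1, hy2⟩ := realize hfr (Qp (hp id) E) (T \ E) (pos_quot hE)
  set vs : Set (Fin d → ℝ) → Finset (Fin d → ℝ) := fun G => T.filter (fun i => i ∈ G) with hvs
  have hvs' : ∀ U, Fc (hp id) T U → vs (cv id U) = U := by
    intro U hU
    ext i
    rw [hvs, Finset.mem_filter]
    constructor
    · rintro ⟨h1, h2⟩; exact (hU.mem_iff h1).1 h2
    · intro h; exact ⟨hU.1 h, (hU.mem_iff (hU.1 h)).2 h⟩
  have key : ∀ G, IsFace (cv id T) G ∧ cv id E ⊆ G → ∃ U, Fc (hp id) T U ∧ E ⊆ U ∧ G = cv id U ∧ vs G = U ∧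
      Fc (hp y) (T \ E) (U \ E) := by
    rintro G ⟨h1, h2⟩
    obtain ⟨U, hU, rfl⟩ := h1.exists_fc
    have hEU := (hU.cv_subset hE.1).1 h2
    refine ⟨U, hU, hEU, rfl, hvs' U hU, ?_⟩
    rw [hy1 _ subset_rfl, fc_quot hE (Finset.sdiff_subset_sdiff hU.1 subset_rfl), Finset.union_sdiff_of_subset hEU]
    exact hU
  refine ⟨y, fun G => cv y (vs G \ E), ⟨cv_polytope _ _, ⟨?_, ?_, ?_⟩, ?_⟩, hy1, hy2⟩
  · intro G hG
    obtain ⟨U, hU, hEU, rfl, hv, hF⟩ := key G hG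
    simp only [hv]
    exact hF.isFace
  · intro G hG G' hG' he
    obtain ⟨U, hU, hEU, rfl, hv, hF⟩ := key G hG
    obtain ⟨U', hU', hEU', rfl, hv', hF'⟩ := key G' hG'
    simp only [hv, hv'] at he
    have := hF.cv_inj hF' he
    have : U = U' := by
      rw [← Finset.union_sdiff_of_subset hEU, ← Finset.union_sdiff_of_subset hEU', this]
    rw [this]
  · intro G hG
    obtain ⟨U, hU, rfl⟩ := IsFace.exists_fc hG
    have hUs := hU.1
    rw [hy1 _ subset_rfl, fc_quot hE hU.1] at hU
    refine ⟨cv id (E ∪ U), ⟨hU.isFace, cv_mono Finset.subset_union_left⟩, ?_⟩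
    simp only [hvs' _ hU]
    congr 1
    rw [Finset.union_sdiff_left, Finset.sdiff_eq_self_iff_disjoint]
    exact (Finset.subset_sdiff.1 hUs).2
  · intro G hG G' hG'
    obtain ⟨U, hU, hEU, rfl, hv, hF⟩ := key G hG
    obtain ⟨U', hU', hEU', rfl, hv', hF'⟩ := key G' hG'
    simp only [hv, hv']
    rw [hU'.cv_subset hU.1, hF'.cv_subset hF.1]
    constructor
    · intro h; exact Finset.sdiff_subset_sdiff h subset_rfl
    · intro h i hi
      by_cases hiE : i ∈ E
      · exact hEU' hiE
      · exact (Finset.mem_sdiff.1 (h (Finset.mem_sdiff.2 ⟨hi, hiE⟩))).1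

lemma setOf_up {T F : Finset (Fin d → ℝ)} (hF : F ⊆ T) :
    {E | IsFace (cv id T) E ∧ cv id F ⊆ E} = cv id '' ((up (hp id) T F : Finset (Finset (Fin d → ℝ))) : Set (Finset (Fin d → ℝ))) := by
  ext G
  simp only [Set.mem_ofPred_eq, Set.mem_image, Finset.mem_coe, mem_up]
  constructor
  · rintro ⟨h1, h2⟩
    obtain ⟨U, hU, rfl⟩ := h1.exists_fc
    exact ⟨U, ⟨hU, (hU.cv_subset hF).1 h2⟩, rfl⟩
  · rintro ⟨U, ⟨hU, hFU⟩, rfl⟩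
    exact ⟨hU.isFace, cv_mono hFU⟩

lemma exists_relC {g h : Set (Fin d → ℝ) → ℤ[X]} {gr : Set (Fin d → ℝ) → Set (Fin d → ℝ) → ℤ[X]}
    (hGH : IsGH g h) (hgr : IsRelG g gr) {V F : Finset (Fin d → ℝ)} (hF : Fc (hp id) V F) :
    ∃ q, RelC (hp id) V F (fun T => g (cv id T)) (fun E => gr (cv id E) (cv id F)) q := by
  have hex : ∀ T E : Finset (Fin d → ℝ), ∃ (y : (Fin d → ℝ) → (Fin d → ℝ)) (ψ : Set (Fin d → ℝ) → Set (Fin d → ℝ)),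
      Fc (hp id) T E → IsQuotientPair (cv id T) (cv id E) (cv y (T \ E)) ψ ∧
      (∀ T' ⊆ T \ E, ∀ U, Fc (hp y) T' U ↔ Fc (Qp (hp id) E) T' U) ∧
      ∀ T' ⊆ T \ E, rk (hp y) T' = rk (Qp (hp id) E) T' := by
    intro T E
    by_cases hE : Fc (hp id) T E
    · obtain ⟨y, ψ, h⟩ := exists_quotient hE
      exact ⟨y, ψ, fun _ => h⟩
    · exact ⟨id, id, fun h => absurd h hE⟩
  choose y ψ hyψ using hex
  refine ⟨fun T E => g (cv (y T E) (T \ E)), ⟨_, hGH.ghc id V⟩, ?_, ?_⟩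
  · intro T hT E hE
    have hE' := (mem_up.1 hE).1
    obtain ⟨-, h1, h2⟩ := hyψ T E hE'
    exact ⟨fun U => g (cv (y T E) U), _, (hGH.ghc (y T E) (T \ E)).congr h1 h2, rfl⟩
  · intro T hT
    obtain ⟨hTf, hFT⟩ := mem_up.1 hT
    have hF' : Fc (hp id) T F := Fc.restrict' hF hTf.1 hFT
    have hvs : ∀ U, Fc (hp id) T U → T.filter (fun i => i ∈ cv id U) = U := by
      intro U hU
      ext i
      rw [Finset.mem_filter]
      constructor
      · rintro ⟨h1, h2⟩; exact (hU.mem_iff h1).1 h2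
      · intro h; exact ⟨hU.1 h, (hU.mem_iff (hU.1 h)).2 h⟩
    have := hgr (cv id T) (cv id F)
      (fun G => cv (y T (T.filter (fun i => i ∈ G))) (T \ T.filter (fun i => i ∈ G)))
      (fun G => ψ T (T.filter (fun i => i ∈ G))) (cv_polytope _ _) hF'.isFace (by
        intro G hG hFG
        obtain ⟨U, hU, rfl⟩ := hG.exists_fc
        simp only [hvs U hU]
        exact (hyψ T U hU).1)
    rw [setOf_up hFT, finsum_mem_image, finsum_mem_coe_finset] at this
    · rw [← this]
      refine Finset.sum_congr rfl fun E hE => ?_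
      rw [hvs E (mem_up.1 hE).1]
    · intro U hU U' hU' he
      exact (mem_up.1 hU).1.cv_inj (mem_up.1 hU').1 he

end PartK2

section PartK3
set_option linter.unusedSectionVars false
variable {d : ℕ}

/-- Edge set of a framework as a finset of finsets. -/
def edF (V : Finset (Fin d → ℝ)) (Ed : Set (Set (Fin d → ℝ))) : Finset (Finset (Fin d → ℝ)) :=
  V.powerset.filter (fun e => (e : Set (Fin d → ℝ)) ∈ Ed)

lemma mem_edF {V : Finset (Fin d → ℝ)} {Ed : Set (Set (Fin d → ℝ))} {e : Finset (Fin d → ℝ)} :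
    e ∈ edF V Ed ↔ e ⊆ V ∧ (e : Set (Fin d → ℝ)) ∈ Ed := by
  rw [edF, Finset.mem_filter, Finset.mem_powerset]

lemma cv_singleton (v : Fin d → ℝ) : cv id {v} = {v} := by simp [cv]

lemma isFace_singleton {V : Finset (Fin d → ℝ)} {v : Fin d → ℝ} (h : IsFace (cv id V) {v}) : v ∈ V := by
  obtain ⟨T, hT, he⟩ := h.exists_fc
  have hn : T.Nonempty := cv_nonempty (y := id).1 (by rw [← he]; exact Set.singleton_nonempty v)
  obtain ⟨w, hw⟩ := hn
  have : w ∈ cv id T := mem_cv_self (y := id) hw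
  rw [← he, Set.mem_singleton_iff] at this
  rw [← this]; exact hT.1 hw

/-- Uniqueness of barycentric coordinates in a triangle. -/
lemma tri_support {ι W : Type*} [DecidableEq ι] [AddCommGroup W] [Module ℝ W] {p : ι → W} {G t U : Finset ι}
    (hC : Cvx p G) (ht : t ⊆ G) (h3 : t.card = 3) (hU : U ⊆ t) {w : ι → ℝ} {a b : ι} {α β : ℝ}
    (ha : a ∈ t) (hb : b ∈ t) (hab : a ≠ b) (hα : 0 < α)
    (he : ∑ i ∈ U, w i • p i = α • p a + β • p b) : a ∈ U := by
  by_contra hn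
  have hr : rk p t = t.card := le_antisymm (rk_le_card p t) (by rw [h3]; exact hC.three_le ht h3.ge)
  have := indep_of_rk hr (fun i => (if i ∈ U then w i else 0) - (if i = a then α else 0) - (if i = b then β else 0)) (by
    simp only [sub_smul, Finset.sum_sub_distrib, ite_smul, zero_smul]
    rw [Finset.sum_ite_mem, Finset.inter_eq_right.2 hU, he, Finset.sum_ite_eq', if_pos ha, Finset.sum_ite_eq', if_pos hb]
    abel) a ha
  simp [hn, hab] at this
  exact hα.ne' this

lemma sum_hp_id {t : Finset (Fin d → ℝ)} {x : Fin d → ℝ} (hx : x ∈ convexHull ℝ (t : Set (Fin d → ℝ))) :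
    ∃ w : (Fin d → ℝ) → ℝ, (∀ i ∈ t, 0 ≤ w i) ∧ ∑ i ∈ t, w i • hp id i = (x, (1 : ℝ)) := by
  have : x ∈ cv id t := by rw [cv, Set.image_id]; exact hx
  exact mem_cv_hp.1 this

lemma tri_of_triangulates {V G : Finset (Fin d → ℝ)} {Ed : Set (Set (Fin d → ℝ))} (hC : Cvx (hp id) V)
    (hG : Fc (hp id) V G) (hEV : ∀ e ∈ Ed, ∃ v w, v ≠ w ∧ e = {v, w} ∧ v ∈ V ∧ w ∈ V)
    (hT : Triangulates Ed (cv id G)) : Tri (hp id) G ((edF V Ed).filter (fun e => e ⊆ G)) := by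
  obtain ⟨T, h1, h2, h4, h5⟩ := hT
  have hCG := hC.mono hG.1
  have hmem : ∀ a b : Fin d → ℝ, a ∈ G → b ∈ G → ({a, b} : Set (Fin d → ℝ)) ∈ Ed →
      ({a, b} : Finset (Fin d → ℝ)) ∈ (edF V Ed).filter (fun e => e ⊆ G) := by
    intro a b ha hb he
    have hs : ({a, b} : Finset (Fin d → ℝ)) ⊆ G := by
      intro x hx; simp only [Finset.mem_insert, Finset.mem_singleton] at hx
      rcases hx with rfl | rfl <;> assumption
    rw [Finset.mem_filter, mem_edF]
    exact ⟨⟨hs.trans hG.1, by rwa [Finset.coe_pair]⟩, hs⟩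
  have hmem' : ∀ a b : Fin d → ℝ, ({a, b} : Finset (Fin d → ℝ)) ∈ (edF V Ed).filter (fun e => e ⊆ G) →
      a ∈ G ∧ b ∈ G ∧ ({a, b} : Set (Fin d → ℝ)) ∈ Ed := by
    intro a b he
    rw [Finset.mem_filter, mem_edF, Finset.coe_pair] at he
    exact ⟨he.2 (by simp), he.2 (by simp), he.1.2⟩
  have hcard : ∀ e ∈ (edF V Ed).filter (fun e => e ⊆ G), e.card = 2 := by
    intro e he
    rw [Finset.mem_filter, mem_edF] at he
    obtain ⟨v, w, hvw, he', -, -⟩ := hEV _ he.1.2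
    have : e = {v, w} := by
      apply Finset.coe_injective; rw [he', Finset.coe_pair]
    rw [this, Finset.card_pair hvw]
  have htG : ∀ t ∈ T, t ⊆ G := by
    intro t ht v hv
    obtain ⟨k1, -, k2, k3⟩ := h1 t ht
    obtain ⟨w, hw, hwv⟩ := Finset.exists_mem_ne (by omega : 1 < t.card) v
    have hvE := k3 v hv w hw hwv.symm
    obtain ⟨v', w', -, he, hv', hw'⟩ := hEV _ hvE
    have hvV : v ∈ V := by
      have : v ∈ ({v', w'} : Set (Fin d → ℝ)) := by rw [← he]; simp
      rcases this with rfl | hh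
      · exact hv'
      · rw [Set.mem_singleton_iff] at hh; rw [hh]; exact hw'
    have : id v ∈ cv id G := k2 (subset_convexHull ℝ _ hv)
    exact (hG.mem_iff hvV).1 this
  have hin : ∀ a b : Fin d → ℝ, a ∈ G → b ∈ G → ({a, b} : Set (Fin d → ℝ)) ∈ Ed → ∃ t ∈ T, a ∈ t ∧ b ∈ t := by
    intro a b ha hb he
    obtain ⟨t, ht, hs⟩ := h5 _ he (by
      rintro x (rfl | hx)
      · exact mem_cv_self (y := id) ha
      · rw [Set.mem_singleton_iff] at hx; rw [hx]; exact mem_cv_self (y := id) hb)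
    exact ⟨t, ht, hs (by simp), hs (by simp)⟩
  refine ⟨fun e he => ⟨hcard e he, (Finset.mem_filter.1 he).2⟩, ?_, ?_⟩
  · rintro a b c e hab hce n1 n2 n3 n4 ⟨α, β, γ, δ, q1, q2, q3, q4, hX⟩
    have hab2 : a ≠ b := by rintro rfl; have := hcard _ hab; simp at this
    have hce2 : c ≠ e := by rintro rfl; have := hcard _ hce; simp at this
    obtain ⟨ha, hb, habE⟩ := hmem' _ _ hab
    obtain ⟨hc, he, hceE⟩ := hmem' _ _ hce
    obtain ⟨t1, ht1, ha1, hb1⟩ := hin a b ha hb habE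
    obtain ⟨t2, ht2, hc2, he2⟩ := hin c e hc he hceE
    have hs := congrArg Prod.snd hX
    have hf := congrArg Prod.fst hX
    simp only [hp, Prod.snd_add, Prod.smul_snd, smul_eq_mul, mul_one, Prod.fst_add, Prod.smul_fst, id] at hs hf
    set s := α + β with hsdef
    have hs0 : 0 < s := by positivity
    set x := (α / s) • a + (β / s) • b with hx
    have hx1 : x ∈ convexHull ℝ (t1 : Set (Fin d → ℝ)) := by
      refine (convex_convexHull ℝ _) (subset_convexHull ℝ _ ha1) (subset_convexHull ℝ _ hb1) (by positivity) (by positivity) ?_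
      rw [← add_div, div_self hs0.ne']
    have hx2 : x ∈ convexHull ℝ (t2 : Set (Fin d → ℝ)) := by
      have : x = (γ / s) • c + (δ / s) • e := by
        rw [hx, div_eq_inv_mul, div_eq_inv_mul, div_eq_inv_mul, div_eq_inv_mul, mul_smul, mul_smul, mul_smul, mul_smul,
          ← smul_add, ← smul_add, hf]
      rw [this]
      refine (convex_convexHull ℝ _) (subset_convexHull ℝ _ hc2) (subset_convexHull ℝ _ he2) (by positivity) (by positivity) ?_
      rw [← add_div, ← hs, div_self hs0.ne']
    have hx3 : x ∈ convexHull ℝ (((t1 ∩ t2 : Finset (Fin d → ℝ))) : Set (Fin d → ℝ)) := by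
      rw [Finset.coe_inter, ← h4 t1 ht1 t2 ht2]; exact ⟨hx1, hx2⟩
    obtain ⟨w, hw0, hw⟩ := sum_hp_id hx3
    have hxx : (x, (1 : ℝ)) = (α / s) • hp id a + (β / s) • hp id b := by
      ext1
      · simp [hp, hx]
      · simp only [hp, Prod.snd_add, Prod.smul_snd, smul_eq_mul, mul_one]
        rw [← add_div, div_self hs0.ne']
    rw [hxx] at hw
    have ka := tri_support hCG (htG t1 ht1) (h1 t1 ht1).1 Finset.inter_subset_left ha1 hb1 hab2 (by positivity) hw
    rw [add_comm] at hw
    have kb := tri_support hCG (htG t1 ht1) (h1 t1 ht1).1 Finset.inter_subset_left hb1 ha1 hab2.symm (by positivity) hw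
    have hsub : ({a, b, c, e} : Finset (Fin d → ℝ)) ⊆ t2 := by
      intro z hz
      simp only [Finset.mem_insert, Finset.mem_singleton] at hz
      rcases hz with rfl | rfl | rfl | rfl
      · exact (Finset.mem_inter.1 ka).2
      · exact (Finset.mem_inter.1 kb).2
      · exact hc2
      · exact he2
    have := Finset.card_le_card hsub
    have h6 : ({a, b, c, e} : Finset (Fin d → ℝ)).card = 4 := by
      rw [Finset.card_insert_of_notMem (by simp [hab2, n1, n2]),
        Finset.card_insert_of_notMem (by simp [n3, n4]), Finset.card_pair hce2]
    have := (h1 t2 ht2).1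
    omega
  · intro a ha b hb hab hn
    have hn' : ({a, b} : Set (Fin d → ℝ)) ∉ Ed := fun h => hn (hmem a b ha hb h)
    obtain ⟨fa, hfa0, hfa⟩ := hCG.exists_expose ha
    obtain ⟨fb, hfb0, hfb⟩ := hCG.exists_expose hb
    obtain ⟨m, hm, hmin⟩ := Finset.exists_min_image (G.erase a) (fun i => fa (hp id i)) ⟨b, Finset.mem_erase.2 ⟨hab.symm, hb⟩⟩
    have hδ := hfa m (Finset.mem_of_mem_erase hm) (Finset.ne_of_mem_erase hm)
    have hfab := hfa b hb hab.symm
    set δ := fa (hp id m) with hδdef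
    have hδb : δ ≤ fa (hp id b) := hmin b (Finset.mem_erase.2 ⟨hab.symm, hb⟩)
    set ε := δ / (2 * fa (hp id b)) with hε
    have hε0 : 0 < ε := by positivity
    have hε1 : ε < 1 := by rw [hε, div_lt_one (by positivity)]; linarith
    have hεb : ε * fa (hp id b) < δ := by
      have : ε * fa (hp id b) = δ / 2 := by rw [hε]; field_simp
      rw [this]; linarith
    set x := (1 - ε) • a + ε • b with hx
    have hxG : x ∈ cv id G :=
      (convex_convexHull ℝ _) (mem_cv_self (y := id) ha) (mem_cv_self (y := id) hb) (by linarith) hε0.le (by ring)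
    rw [← h2] at hxG
    simp only [Set.mem_iUnion, exists_prop] at hxG
    obtain ⟨t, ht, hxt⟩ := hxG
    obtain ⟨w, hw0, hw⟩ := sum_hp_id hxt
    have hxx : (x, (1 : ℝ)) = (1 - ε) • hp id a + ε • hp id b := by
      ext1
      · simp [hp, hx]
      · simp only [hp, Prod.snd_add, Prod.smul_snd, smul_eq_mul, mul_one]; ring
    rw [hxx] at hw
    have hw1 : ∑ i ∈ t, w i = 1 := by
      have := congrArg Prod.snd hw
      rw [Prod.snd_sum] at this
      simp [hp] at this
      exact this
    have hat : a ∈ t := by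
      by_contra hat
      have := congrArg fa hw
      rw [map_sum, map_add, map_smul, map_smul, hfa0, smul_zero, zero_add, smul_eq_mul] at this
      have hge : δ ≤ ∑ i ∈ t, fa (w i • hp id i) := by
        calc δ = ∑ i ∈ t, w i * δ := by rw [← Finset.sum_mul, hw1, one_mul]
          _ ≤ _ := Finset.sum_le_sum fun i hi => by
            rw [map_smul, smul_eq_mul]
            refine mul_le_mul_of_nonneg_left (hmin i (Finset.mem_erase.2 ⟨?_, htG t ht hi⟩)) (hw0 i hi)
            rintro rfl; exact hat hi
      linarith
    obtain ⟨k1, -, -, k3⟩ := h1 t ht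
    have hbt : b ∉ t := fun hbt => hn' (k3 a hat b hbt hab)
    obtain ⟨c, e, hce, hte⟩ := Finset.card_eq_two.1 (show (t.erase a).card = 2 by
      rw [Finset.card_erase_of_mem hat, k1])
    have hc : c ∈ t.erase a := by rw [hte]; simp
    have he : e ∈ t.erase a := by rw [hte]; simp
    rw [Finset.mem_erase] at hc he
    have hbc : b ≠ c := by rintro rfl; exact hbt hc.2
    have hbe : b ≠ e := by rintro rfl; exact hbt he.2
    have hcG := htG t ht hc.2
    have heG := htG t ht he.2
    rw [← Finset.add_sum_erase t _ hat, hte, Finset.sum_pair hce] at hw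
    have hrel : (1 - ε - w a) • hp id a + ε • hp id b = w c • hp id c + w e • hp id e := by
      rw [sub_smul, sub_add_eq_add_sub, ← hw]; abel
    obtain ⟨fc, hfc0, hfc⟩ := hCG.exists_expose hcG
    obtain ⟨fe, hfe0, hfe⟩ := hCG.exists_expose heG
    have rb := congrArg fb hrel
    have rc := congrArg fc hrel
    have re := congrArg fe hrel
    simp only [map_add, map_smul, smul_eq_mul, hfb0, hfc0, hfe0] at rb rc re
    have wc := hw0 c hc.2
    have we := hw0 e he.2
    have hκ : 0 ≤ 1 - ε - w a := by
      by_contra hcon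
      push Not at hcon
      have t1 := hfb a ha hab
      have t2 := mul_neg_of_neg_of_pos hcon t1
      have t3 := mul_nonneg wc (hfb c hcG hbc.symm).le
      have t4 := mul_nonneg we (hfb e heG hbe.symm).le
      linarith
    have hwe : 0 < w e := by
      have t1 := mul_nonneg hκ (hfc a ha hc.1.symm).le
      have t2 := mul_pos hε0 (hfc b hb hbc)
      have t3 : 0 < w e * fc (hp id e) := by linarith
      exact pos_of_mul_pos_left t3 (hfc e heG hce.symm).le
    have hwc : 0 < w c := by
      have t1 := mul_nonneg hκ (hfe a ha he.1.symm).le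
      have t2 := mul_pos hε0 (hfe b hb hbe)
      have t3 : 0 < w c * fe (hp id c) := by linarith
      exact pos_of_mul_pos_left t3 (hfe c hcG hce).le
    have hκ' : 0 < 1 - ε - w a := by
      have t1 := mul_pos hwc (hfb c hcG hbc.symm)
      have t2 := mul_pos hwe (hfb e heG hbe.symm)
      have t3 : 0 < (1 - ε - w a) * fb (hp id a) := by linarith
      exact pos_of_mul_pos_left t3 (hfb a ha hab).le
    exact ⟨c, e, hmem c e hcG heG (k3 c hc.2 e he.2 hce), hc.1.symm, he.1.symm, hbc, hbe,
      _, _, _, _, hκ', hε0, hwc, hwe, hrel⟩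

end PartK3

section PartK4
set_option linter.unusedSectionVars false
variable {d : ℕ}

lemma cv_pair (v w : Fin d → ℝ) : cv id {v, w} = segment ℝ v w := by
  rw [cv, Set.image_id, Finset.coe_pair, convexHull_pair]

lemma framework_edges {V : Finset (Fin d → ℝ)} {Ed : Set (Set (Fin d → ℝ))} (h : IsFrameworkFor (cv id V) Ed) :
    ∀ e ∈ Ed, ∃ v w, v ≠ w ∧ e = {v, w} ∧ v ∈ V ∧ w ∈ V := by
  intro e he
  obtain ⟨v, w, h1, h2, h3, h4, -⟩ := h.2.1 e he
  exact ⟨v, w, h1, h2, isFace_singleton h3, isFace_singleton h4⟩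

lemma framework_fr {V : Finset (Fin d → ℝ)} {Ed : Set (Set (Fin d → ℝ))} (hC : Cvx (hp id) V)
    (h : IsFrameworkFor (cv id V) Ed) : Fr (hp id) V (edF V Ed) := by
  have hEV := framework_edges h
  have hTri : ∀ G ∈ fk (hp id) V 3, Tri (hp id) G ((edF V Ed).filter (fun e => e ⊆ G)) := by
    intro G hG
    obtain ⟨hG1, hG2⟩ := mem_fk.1 hG
    refine tri_of_triangulates hC hG1 hEV (h.2.2.2 _ hG1.isFace ?_)
    rw [pdim_cv, hG2]; rfl
  refine ⟨?_, ?_, ?_, ?_⟩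
  · intro e he
    rw [mem_edF] at he
    obtain ⟨v, w, h1, h2, h3, h4, h5⟩ := h.2.1 _ he.2
    have he' : e = {v, w} := by
      apply Finset.coe_injective; rw [h2, Finset.coe_pair]
    have hv := isFace_singleton h3
    have hw := isFace_singleton h4
    refine ⟨by rw [he', Finset.card_pair h1], ?_⟩
    rcases h5 with h5 | ⟨G, hG, hG2, hs⟩
    · obtain ⟨G, hG, hs⟩ := h5.exists_fc
      refine ⟨G, hG, ?_, ?_⟩
      · have e1 := pdim_cv id G
        have e2 := pdim_cv id ({v, w} : Finset (Fin d → ℝ))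
        rw [← hs] at e1
        rw [cv_pair] at e2
        have := rk_le_card (hp id) ({v, w} : Finset (Fin d → ℝ))
        rw [Finset.card_pair h1] at this
        omega
      · intro x hx
        have : id x ∈ cv id G := by
          rw [← hs, ← cv_pair]
          rw [he'] at hx
          exact mem_cv_self hx
        exact (hG.mem_iff (he.1 hx)).1 this
    · obtain ⟨K, hK, rfl⟩ := hG.exists_fc
      refine ⟨K, hK, ?_, ?_⟩
      · rw [pdim_cv] at hG2; omega
      · intro x hx
        have : id x ∈ cv id K := by
          refine hs ?_
          rw [← cv_pair]
          rw [he'] at hx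
          exact mem_cv_self hx
        exact (hK.mem_iff (he.1 hx)).1 this
  · intro G hG
    obtain ⟨hG1, hG2⟩ := mem_fk.1 hG
    obtain ⟨v, w, hs, he⟩ := h.2.2.1 _ hG1.isFace (by rw [pdim_cv, hG2]; rfl)
    obtain ⟨v', w', hne, heq, hv', hw'⟩ := hEV _ he
    have hpair : ({v, w} : Finset (Fin d → ℝ)) = {v', w'} := by
      apply Finset.coe_injective; rw [Finset.coe_pair, Finset.coe_pair, heq]
    have hin : ∀ x ∈ ({v', w'} : Finset (Fin d → ℝ)), x ∈ G := by
      intro x hx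
      have hxV : x ∈ V := by
        simp only [Finset.mem_insert, Finset.mem_singleton] at hx
        rcases hx with rfl | rfl <;> assumption
      rw [← hpair] at hx
      have : id x ∈ cv id G := by
        rw [hs, ← cv_pair]; exact mem_cv_self hx
      exact (hG1.mem_iff hxV).1 this
    have hGe : G = {v', w'} := hC.edge_pair hG hne (hin v' (by simp)) (hin w' (by simp))
    rw [mem_edF]
    refine ⟨hG1.1, ?_⟩
    rw [hGe, Finset.coe_pair, ← heq]; exact he
  · intro G hG
    obtain ⟨hG1, hG2⟩ := mem_fk.1 hG
    exact (Tri.main _ rfl (hC.mono hG1.1) hG2 (hTri G hG)).1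
  · intro G hG u h0 h1
    obtain ⟨hG1, hG2⟩ := mem_fk.1 hG
    exact (Tri.main _ rfl (hC.mono hG1.1) hG2 (hTri G hG)).2 u h0 fun v hv w hw he =>
      h1 v hv w hw (Finset.mem_filter.1 he).1

/-- Geometric edges of the subframework. -/
lemma edN_iff {V F : Finset (Fin d → ℝ)} {Ed : Set (Set (Fin d → ℝ))} (hF : Fc (hp id) V F)
    (hEV : ∀ e ∈ Ed, ∃ v w, v ≠ w ∧ e = {v, w} ∧ v ∈ V ∧ w ∈ V) {e : Finset (Fin d → ℝ)} :
    e ∈ EdN (hp id) V F (edF V Ed) ↔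
      e ⊆ V ∧ (e : Set (Fin d → ℝ)) ∈ {e ∈ Ed | convexHull ℝ e ⊆ NPF (cv id V) (cv id F)} := by
  rw [EdN, Finset.mem_filter, mem_edF, Set.mem_ofPred_eq, and_assoc]
  refine and_congr_right fun heV => and_congr_right fun heE => ?_
  rw [jn_ne_iff (Finset.union_subset hF.1 heV)]
  constructor
  · rintro ⟨G, hG, hne, hs⟩ x hx
    have hlt := hG.rk_lt subset_rfl hG.1 hne
    obtain ⟨R, hR, hGR, hRr⟩ := exists_face_rank (r := rk (hp id) V - 1) hG (by omega) (by omega)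
    refine ⟨cv id R, ⟨hR.isFace, ?_, cv_mono ((Finset.subset_union_left.trans hs).trans hGR)⟩, ?_⟩
    · rw [pdim_cv, pdim_cv, hRr]; omega
    · have : x ∈ cv id e := by rw [cv, Set.image_id]; exact hx
      exact cv_mono ((Finset.subset_union_right.trans hs).trans hGR) this
  · intro hs
    obtain ⟨v, w, hne, he, hv, hw⟩ := hEV _ heE
    have hm : (1 / 2 : ℝ) • v + (1 / 2 : ℝ) • w ∈ convexHull ℝ (e : Set (Fin d → ℝ)) := by
      rw [he]
      exact (convex_convexHull ℝ _) (subset_convexHull ℝ _ (by simp)) (subset_convexHull ℝ _ (by simp))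
        (by norm_num) (by norm_num) (by norm_num)
    obtain ⟨G, ⟨hG, hGd, hFG⟩, hmG⟩ := hs hm
    obtain ⟨R, hR, rfl⟩ := hG.exists_fc
    refine ⟨R, hR, ?_, Finset.union_subset ((hR.cv_subset hF.1).1 hFG) ?_⟩
    · rintro rfl; omega
    · obtain ⟨hRV, φ, k1, k2⟩ := hR
      have hmV : (1 / 2 : ℝ) • v + (1 / 2 : ℝ) • w ∈ cv id V := cv_mono hRV hmG
      have hz := (cv_zero hRV k1 k2 hmV).2 hmG
      have hsum : (((1 / 2 : ℝ) • v + (1 / 2 : ℝ) • w, 1) : (Fin d → ℝ) × ℝ)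
          = (1 / 2 : ℝ) • hp id v + (1 / 2 : ℝ) • hp id w := by
        ext1
        · simp [hp]
        · simp only [hp, Prod.snd_add, Prod.smul_snd, smul_eq_mul]; norm_num
      rw [hsum, map_add, map_smul, map_smul, smul_eq_mul, smul_eq_mul] at hz
      have z1 := k1 v hv
      have z2 := k1 w hw
      intro x hx
      have hx' : x ∈ ({v, w} : Set (Fin d → ℝ)) := by rw [← he]; exact hx
      rcases hx' with rfl | hx'
      · exact (k2 _ hv).1 (by linarith)
      · rw [Set.mem_singleton_iff] at hx'; subst hx'; exact (k2 _ hw).1 (by linarith)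

/-- Comparison of the stress space with the kernel of the homogenised stress map. -/
def RR (V : Finset (Fin d → ℝ)) (E : Finset (Finset (Fin d → ℝ))) :
    (Set (Fin d → ℝ) → ℝ) →ₗ[ℝ] (↥E → ℝ) × (↥V → ℝ) where
  toFun s := (fun e => s (e.1 : Set (Fin d → ℝ)), fun v => - ∑ w ∈ V, s {v.1, w})
  map_add' s t := by
    ext1
    · ext e; simp
    · ext v; simp [Finset.sum_add_distrib]; ring
  map_smul' c s := by
    ext1
    · ext e; simp
    · ext v; simp [Finset.mul_sum]

lemma stress_finrank {V : Finset (Fin d → ℝ)} {Ed : Set (Set (Fin d → ℝ))} {E : Finset (Finset (Fin d → ℝ))}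
    (hE : ∀ e, e ∈ E ↔ e ⊆ V ∧ (e : Set (Fin d → ℝ)) ∈ Ed)
    (hEV : ∀ e ∈ Ed, ∃ v w, v ≠ w ∧ e = {v, w} ∧ v ∈ V ∧ w ∈ V) :
    Module.Finite ℝ (Stress Ed) ∧
    Module.finrank ℝ (Stress Ed) = Module.finrank ℝ (LinearMap.ker (TT (hp id) V E)) := by
  have hfin : ∀ e ∈ Ed, ∃ e' ∈ E, (e' : Set (Fin d → ℝ)) = e := by
    intro e he
    obtain ⟨v, w, hne, rfl, hv, hw⟩ := hEV e he
    refine ⟨{v, w}, (hE _).2 ⟨?_, by rwa [Finset.coe_pair]⟩, Finset.coe_pair⟩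
    intro x hx; simp only [Finset.mem_insert, Finset.mem_singleton] at hx
    rcases hx with rfl | rfl <;> assumption
  have hEdmem : ∀ v w : Fin d → ℝ, ({v, w} : Set (Fin d → ℝ)) ∈ Ed → v ∈ V ∧ w ∈ V := by
    intro v w h
    obtain ⟨e', he', heq⟩ := hfin _ h
    have := ((hE e').1 he').1
    constructor
    · refine this ?_
      rw [← Finset.mem_coe, heq]; simp
    · refine this ?_
      rw [← Finset.mem_coe, heq]; simp
  have hEdfin : Ed.Finite := by
    refine (E.finite_toSet.image (fun e : Finset (Fin d → ℝ) => (e : Set (Fin d → ℝ)))).subset ?_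
    intro e he
    obtain ⟨e', h1, h2⟩ := hfin e he
    exact ⟨e', h1, h2⟩
  -- for functions supported on the edges, the force sum is a finite sum
  have hsum : ∀ s : Set (Fin d → ℝ) → ℝ, Function.support s ⊆ Ed → ∀ v,
      (∑ᶠ w : Fin d → ℝ, s {v, w} • (v - w)) = ∑ w ∈ V, s {v, w} • (v - w) := by
    intro s hs v
    refine finsum_eq_sum_of_support_subset _ ?_
    intro w hw
    have : s {v, w} ≠ 0 := by
      intro h0; apply hw; simp only [h0, zero_smul]
    exact (hEdmem v w (hs this)).2
  have hex : ∀ s : Set (Fin d → ℝ) → ℝ, Function.support s ⊆ Ed → ∀ v w : Fin d → ℝ,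
      exS E (RR V E s).1 {v, w} = s {v, w} := by
    intro s hs v w
    by_cases h : ({v, w} : Finset (Fin d → ℝ)) ∈ E
    · rw [exS_mem _ h]
      show s ((({v, w} : Finset (Fin d → ℝ))) : Set (Fin d → ℝ)) = _
      rw [Finset.coe_pair]
    · rw [exS_not _ h]
      by_contra hne
      have h1 : ({v, w} : Set (Fin d → ℝ)) ∈ Ed := hs (Ne.symm hne)
      have h2 := hEdmem v w h1
      refine h ((hE _).2 ⟨?_, by rwa [Finset.coe_pair]⟩)
      intro x hx; simp only [Finset.mem_insert, Finset.mem_singleton] at hx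
      rcases hx with rfl | rfl
      exacts [h2.1, h2.2]
  have hinj : Function.Injective ((RR V E).domRestrict (Stress Ed)) := by
    rw [← LinearMap.ker_eq_bot, LinearMap.ker_eq_bot']
    rintro ⟨s, hs⟩ h0
    have hs' : Function.support s ⊆ Ed := hs.2.1
    ext e
    show s e = 0
    by_contra hne
    obtain ⟨e', he', rfl⟩ := hfin e (hs' hne)
    have := congrFun (congrArg Prod.fst h0) ⟨e', he'⟩
    exact hne this
  have hmap : (Stress Ed).map (RR V E) = LinearMap.ker (TT (hp id) V E) := by
    apply le_antisymm
    · rintro _ ⟨s, hs, rfl⟩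
      have hs' : Function.support s ⊆ Ed := hs.2.1
      rw [LinearMap.mem_ker]
      funext v
      rw [TT_apply]
      simp only [hex s hs']
      have h3 := hs.2.2 v.1
      rw [hsum s hs'] at h3
      rw [Finset.sum_coe_sort V (fun w => s {v.1, w} • hp id w)]
      simp only [smul_sub, Finset.sum_sub_distrib, ← Finset.sum_smul] at h3
      ext1
      · rw [Prod.fst_add, Prod.fst_sum]
        simp only [hp, RR, LinearMap.coe_mk, AddHom.coe_mk, Prod.smul_fst, id]
        rw [neg_smul]
        change _ = (0 : Fin d → ℝ)
        rw [neg_add_eq_zero]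
        exact sub_eq_zero.1 h3
      · rw [Prod.snd_add, Prod.snd_sum]
        simp [hp, RR]
    · intro x hx
      rw [LinearMap.mem_ker] at hx
      set s : Set (Fin d → ℝ) → ℝ := fun e => if h : ∃ e' : ↥E, (e'.1 : Set (Fin d → ℝ)) = e then x.1 h.choose else 0 with hsdef
      have hse : ∀ e' : ↥E, s (e'.1 : Set (Fin d → ℝ)) = x.1 e' := by
        intro e'
        have h : ∃ e'' : ↥E, (e''.1 : Set (Fin d → ℝ)) = (e'.1 : Set (Fin d → ℝ)) := ⟨e', rfl⟩
        have : h.choose = e' := Subtype.ext (Finset.coe_injective h.choose_spec)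
        rw [hsdef]; simp only []
        rw [dif_pos h, this]
      have hs' : Function.support s ⊆ Ed := by
        intro e he
        rw [Function.mem_support, hsdef] at he
        by_cases h : ∃ e' : ↥E, (e'.1 : Set (Fin d → ℝ)) = e
        · obtain ⟨e', rfl⟩ := h
          exact ((hE _).1 e'.2).2
        · simp only [] at he
          rw [dif_neg h] at he; exact absurd rfl he
      have h1 : (RR V E s).1 = x.1 := by
        ext e; exact hse e
      have hforce : ∀ v : ↥V, x.2 v • hp id v.1 + ∑ w ∈ V, s {v.1, w} • hp id w = 0 := by
        intro v
        have := congrFun hx v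
        rw [TT_apply, ← h1] at this
        simp only [hex s hs'] at this
        rw [Finset.sum_coe_sort V (fun w => s {v.1, w} • hp id w)] at this
        exact this
      have hx2 : ∀ v : ↥V, x.2 v = - ∑ w ∈ V, s {v.1, w} := by
        intro v
        have := congrArg Prod.snd (hforce v)
        rw [Prod.snd_add, Prod.snd_sum] at this
        simp [hp] at this
        linarith
      refine ⟨s, ⟨hEdfin.subset hs', hs', fun v => ?_⟩, ?_⟩
      · rw [hsum s hs']
        by_cases hv : v ∈ V
        · have := congrArg Prod.fst (hforce ⟨v, hv⟩)
          rw [Prod.fst_add, Prod.fst_sum, hx2] at this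
          simp only [hp, Prod.smul_fst, id, neg_smul, Prod.fst_zero, Prod.fst_neg] at this
          simp only [smul_sub, Finset.sum_sub_distrib, ← Finset.sum_smul]
          rw [neg_add_eq_zero] at this
          exact sub_eq_zero.2 this
        · refine Finset.sum_eq_zero fun w _ => ?_
          have : s {v, w} = 0 := by
            by_contra hne
            exact hv (hEdmem v w (hs' hne)).1
          rw [this, zero_smul]
      · refine Prod.ext h1 ?_
        funext v
        rw [hx2]; rfl
  refine ⟨Module.Finite.of_injective _ hinj, ?_⟩
  rw [← hmap, ← LinearMap.range_domRestrict, LinearMap.finrank_range_of_inj hinj]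

lemma Stress_mono {Ed Ed' : Set (Set (Fin d → ℝ))} (h : Ed' ⊆ Ed) : Stress Ed' ≤ Stress Ed := by
  rintro s ⟨h1, h2, h3⟩
  exact ⟨h1, h2.trans h, h3⟩

theorem relative_g_two' {d : ℕ} (g h : Set (Fin d → ℝ) → Polynomial ℤ)
    (gr : Set (Fin d → ℝ) → Set (Fin d → ℝ) → Polynomial ℤ)
    (hGH : IsGH g h) (hgr : IsRelG g gr)
    (P F : Set (Fin d → ℝ)) (hP : IsPolytope P) (hF : IsFace P F)
    (Ed : Set (Set (Fin d → ℝ))) (hEd : IsFrameworkFor P Ed) :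
    (gr P F).coeff 2 =
      Module.finrank ℝ
        (↥(Stress Ed) ⧸
          Submodule.comap (Stress Ed).subtype
            (Stress {e ∈ Ed | convexHull ℝ e ⊆ NPF P F})) := by
  obtain ⟨V, rfl, hC⟩ := exists_vertices hP
  obtain ⟨F', hF', rfl⟩ := hF.exists_fc
  obtain ⟨q, hq⟩ := exists_relC hGH hgr hF'
  have hEV := framework_edges hEd
  have hmain := hq.coeff2 (framework_fr hC hEd) hC hF'
  obtain ⟨hf, h1⟩ := stress_finrank (V := V) (E := edF V Ed) (Ed := Ed) (fun e => mem_edF) hEV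
  obtain ⟨-, h2⟩ := stress_finrank (V := V) (E := EdN (hp id) V F' (edF V Ed))
    (Ed := {e ∈ Ed | convexHull ℝ e ⊆ NPF (cv id V) (cv id F')}) (fun e => edN_iff hF' hEV)
    (fun e he => hEV e he.1)
  have hle : Stress {e ∈ Ed | convexHull ℝ e ⊆ NPF (cv id V) (cv id F')} ≤ Stress Ed := Stress_mono fun e he => he.1
  have h3 := Submodule.finrank_quotient_add_finrank (Submodule.comap (Stress Ed).subtype
    (Stress {e ∈ Ed | convexHull ℝ e ⊆ NPF (cv id V) (cv id F')}))
  rw [(Submodule.comapSubtypeEquivOfLe hle).finrank_eq] at h3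
  rw [hmain, ← h1, ← h2]
  omega

end PartK4

/-- For any convex polytope `P ⊆ ℝ^d`, any face `F` of `P`, and any
framework `Φ_P` for `P`, `g₂(P,F) = dim_ℝ (S(Φ_P)/S(Φ_N))`, where `Φ_N` is the
subframework of all vertices and edges of `Φ_P` contained in `N(P,F)` (with
`S(Φ_N) ⊆ S(Φ_P)` by extension by zero). -/
theorem relative_g_two {d : ℕ} (g h : Set (Fin d → ℝ) → Polynomial ℤ)
    (gr : Set (Fin d → ℝ) → Set (Fin d → ℝ) → Polynomial ℤ)
    (hGH : IsGH g h) (hgr : IsRelG g gr)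
    (P F : Set (Fin d → ℝ)) (hP : IsPolytope P) (hF : IsFace P F)
    (Ed : Set (Set (Fin d → ℝ))) (hEd : IsFrameworkFor P Ed) :
    (gr P F).coeff 2 =
      Module.finrank ℝ
        (↥(Stress Ed) ⧸
          Submodule.comap (Stress Ed).subtype
            (Stress {e ∈ Ed | convexHull ℝ e ⊆ NPF P F})) := by
  exact relative_g_two' g h gr hGH hgr P F hP hF Ed hEd

end
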